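/- Let 0 < a < 1 and 0 < σ < 1/2. Then, as T → ∞, ∫_1^T |ζ_H(σ+it, a)|² dt = ((2π)^{2σ−1}/(2−2σ)) · ζ(2−2σ) · T^{2−2σ} + ζ_H(2σ, a) · T + O(T^{1−σ} log T), where ζ denotes the Riemann zeta function and ζ_H(2σ, a) is the value of the analytically continued Hurwitz zeta function. -/

import Mathlib

open Complex Filter Finset MeasureTheory

/-- The Hurwitz zeta function `ζ_H(s,a)` (meromorphic continuation of
`∑ m, (m+a)^{-s}`). -/
noncomputable def hzeta (a : ℝ) (s : ℂ) : ℂ := HurwitzZeta.hurwitzZeta (a : UnitAddCircle) s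

/-- `B` is continuous on `[p, q]` and its partial integrals from `p` are bounded by `M`. -/
def OscBound (B : ℝ → ℂ) (p q M : ℝ) : Prop :=
  ContinuousOn B (Set.Icc p q) ∧ ∀ v ∈ Set.Icc p q, ‖∫ x in p..v, B x‖ ≤ M

lemma OscBound.nonneg {B : ℝ → ℂ} {p q M : ℝ} (h : OscBound B p q M) (hpq : p ≤ q) : 0 ≤ M :=
  (norm_nonneg _).trans (h.2 p ⟨le_rfl, hpq⟩)

/-- Multiplying by a bounded monotone function with continuous derivative of constant sign keeps
partial integrals bounded. -/
lemma OscBound.mul {B : ℝ → ℂ} {P P' : ℝ → ℝ} {p q M C : ℝ} (hB : OscBound B p q M)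
    (hP : ∀ v ∈ Set.Icc p q, HasDerivAt P (P' v) v) (hP' : ContinuousOn P' (Set.Icc p q))
    (hsgn : (∀ v ∈ Set.Icc p q, 0 ≤ P' v) ∨ (∀ v ∈ Set.Icc p q, P' v ≤ 0))
    (hC : ∀ v ∈ Set.Icc p q, |P v| ≤ C) :
    OscBound (fun v => (P v : ℂ) * B v) p q (3 * C * M) := by
  obtain ⟨hBc, hBM⟩ := hB
  have hPc : ContinuousOn P (Set.Icc p q) := fun v hv => (hP v hv).continuousAt.continuousWithinAt
  refine ⟨(continuous_ofReal.comp_continuousOn hPc).mul hBc, fun w hw => ?_⟩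
  have hpw : p ≤ w := hw.1
  have hsub : Set.Icc p w ⊆ Set.Icc p q := Set.Icc_subset_Icc_right hw.2
  have hpI : p ∈ Set.Icc p q := ⟨le_rfl, hpw.trans hw.2⟩
  have hM : 0 ≤ M := (norm_nonneg _).trans (hBM p hpI)
  have hii : IntervalIntegrable B volume p w :=
    (hBc.mono (by rw [Set.uIcc_of_le hpw]; exact hsub)).intervalIntegrable
  have hP'ii : IntervalIntegrable P' volume p w :=
    (hP'.mono (by rw [Set.uIcc_of_le hpw]; exact hsub)).intervalIntegrable
  have hP'iic : IntervalIntegrable (fun v => (P' v : ℂ)) volume p w :=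
    ((continuous_ofReal.comp_continuousOn hP').mono
      (by rw [Set.uIcc_of_le hpw]; exact hsub)).intervalIntegrable
  set β : ℝ → ℂ := fun v => ∫ x in p..v, B x with hβ
  have hβc : ContinuousOn β (Set.uIcc p w) :=
    intervalIntegral.continuousOn_primitive_interval' hii Set.left_mem_uIcc
  have hβd : ∀ v ∈ Set.Ioo (min p w) (max p w), HasDerivAt β (B v) v := by
    intro v hv
    rw [min_eq_left hpw, max_eq_right hpw] at hv
    have hvI : Set.Icc p q ∈ nhds v := Icc_mem_nhds hv.1 (hv.2.trans_le hw.2)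
    refine intervalIntegral.integral_hasDerivAt_right ?_ ?_ (hBc.continuousAt hvI)
    · exact hii.mono_set (by
        rw [Set.uIcc_of_le hpw, Set.uIcc_of_le hv.1.le]; exact Set.Icc_subset_Icc_right hv.2.le)
    · exact ContinuousOn.stronglyMeasurableAtFilter_nhdsWithin hBc measurableSet_Icc v
          |>.filter_mono
        (by rw [nhdsWithin_eq_nhds.2 hvI])
  have hPd : ∀ v ∈ Set.Ioo (min p w) (max p w), HasDerivAt (fun v => (P v : ℂ)) (P' v) v := by
    intro v hv
    rw [min_eq_left hpw, max_eq_right hpw] at hv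
    exact (hP v (hsub ⟨hv.1.le, hv.2.le⟩)).ofReal_comp
  have key := intervalIntegral.integral_mul_deriv_eq_deriv_mul_of_hasDerivAt
    (u := fun v => (P v : ℂ)) (v := β) (u' := fun v => (P' v : ℂ)) (v' := B) (a := p) (b := w)
    ((continuous_ofReal.comp_continuousOn hPc).mono (by rw [Set.uIcc_of_le hpw]; exact hsub))
    hβc hPd hβd hP'iic hii
  rw [key]
  have hβp : β p = 0 := by simp [hβ]
  rw [hβp, mul_zero, sub_zero]
  have h1 : ‖(P w : ℂ) * β w‖ ≤ C * M := by
    rw [norm_mul, norm_real, Real.norm_eq_abs]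
    exact mul_le_mul (hC w hw) (hBM w hw) (norm_nonneg _) ((abs_nonneg _).trans (hC w hw))
  have h2 : ‖∫ x in p..w, (P' x : ℂ) * β x‖ ≤ 2 * C * M := by
    have hle : ‖∫ x in p..w, (P' x : ℂ) * β x‖ ≤ ∫ x in p..w, |P' x| * M := by
      refine intervalIntegral.norm_integral_le_of_norm_le hpw (ae_of_all _ fun x hx => ?_)
        (hP'ii.abs.mul_const M)
      rw [norm_mul, norm_real, Real.norm_eq_abs]
      exact mul_le_mul_of_nonneg_left (hBM x (hsub ⟨hx.1.le, hx.2⟩)) (abs_nonneg _)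
    refine hle.trans ?_
    rw [intervalIntegral.integral_mul_const]
    refine mul_le_mul_of_nonneg_right ?_ hM
    have hftc : ∫ x in p..w, P' x = P w - P p :=
      intervalIntegral.integral_eq_sub_of_hasDerivAt
        (fun x hx => hP x (hsub (by rwa [Set.uIcc_of_le hpw] at hx))) hP'ii
    have hw' := hC w hw
    have hp' := hC p hpI
    rcases hsgn with h | h
    · have : ∫ x in p..w, |P' x| = ∫ x in p..w, P' x :=
        intervalIntegral.integral_congr fun x hx => abs_of_nonneg
          (h x (hsub (by rwa [Set.uIcc_of_le hpw] at hx)))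
      rw [this, hftc]
      linarith [abs_le.1 hw', abs_le.1 hp']
    · have : ∫ x in p..w, |P' x| = ∫ x in p..w, -P' x :=
        intervalIntegral.integral_congr fun x hx => abs_of_nonpos
          (h x (hsub (by rwa [Set.uIcc_of_le hpw] at hx)))
      rw [this, intervalIntegral.integral_neg, hftc]
      linarith [abs_le.1 hw', abs_le.1 hp']
  calc _ ≤ C * M + 2 * C * M := (norm_sub_le _ _).trans (add_le_add h1 h2)
    _ = 3 * C * M := by ring

/-- The derivative of a unimodular function has bounded partial integrals. -/
lemma OscBound.of_hasDerivAt {u u' : ℝ → ℂ} {p q M : ℝ}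
    (hu : ∀ v ∈ Set.Icc p q, HasDerivAt u (u' v) v) (hc : ContinuousOn u' (Set.Icc p q))
    (hM : ∀ v ∈ Set.Icc p q, ‖u v‖ ≤ M) : OscBound u' p q (2 * M) := by
  refine ⟨hc, fun v hv => ?_⟩
  have hsub : Set.uIcc p v ⊆ Set.Icc p q := by
    rw [Set.uIcc_of_le hv.1]; exact Set.Icc_subset_Icc_right hv.2
  rw [intervalIntegral.integral_eq_sub_of_hasDerivAt (fun x hx => hu x (hsub hx))
    (hc.mono hsub).intervalIntegrable]
  have := hM p ⟨le_rfl, hv.1.trans hv.2⟩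
  linarith [norm_sub_le (u v) (u p), hM v hv]

lemma OscBound.mono {B : ℝ → ℂ} {p q M M' : ℝ} (h : OscBound B p q M) (hM : M ≤ M') :
    OscBound B p q M' := ⟨h.1, fun v hv => (h.2 v hv).trans hM⟩

lemma OscBound.norm_integral_le {B : ℝ → ℂ} {p q M : ℝ} (h : OscBound B p q M) (hpq : p ≤ q) :
    ‖∫ x in p..q, B x‖ ≤ M := h.2 q ⟨hpq, le_rfl⟩

lemma OscBound.congr {B B' : ℝ → ℂ} {p q M : ℝ} (h : OscBound B p q M)
    (hB : ∀ v ∈ Set.Icc p q, B' v = B v) : OscBound B' p q M := by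
  refine ⟨h.1.congr hB, fun v hv => ?_⟩
  rw [intervalIntegral.integral_congr (g := B)]
  · exact h.2 v hv
  · intro x hx
    rw [Set.uIcc_of_le hv.1] at hx
    exact hB x ⟨hx.1, hx.2.trans hv.2⟩

/-- The increment of `(z - 1/2) log z - z` minus `log z`. -/
noncomputable def stirlingStep (z : ℂ) : ℂ := (z + 1 / 2) * (log (z + 1) - log z) - 1

lemma log_add_one_sub_log {z : ℂ} (hz : 0 < z.re) : log (z + 1) - log z = log (1 + z⁻¹) := by
  have hz0 : z ≠ 0 := by rintro rfl; simp at hz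
  have hre : 0 < (1 + z⁻¹).re := by
    have : 0 < (z⁻¹).re := by
      rw [inv_re]; exact div_pos hz (normSq_pos.2 hz0)
    simp only [add_re, one_re]; linarith
  have h10 : (1 + z⁻¹) ≠ 0 := by intro h; rw [h] at hre; simp at hre
  have ha1 := abs_lt.1 (abs_arg_lt_pi_div_two_iff.2 (Or.inl hz))
  have ha2 := abs_lt.1 (abs_arg_lt_pi_div_two_iff.2 (Or.inl hre))
  have : z + 1 = z * (1 + z⁻¹) := by field_simp
  rw [this, (log_mul_eq_add_log_iff hz0 h10).2 ⟨by linarith [ha1.1, ha2.1], by linarith [ha1.2,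
      ha2.2]⟩]
  ring

lemma norm_stirlingStep_le {z : ℂ} (hz : 0 < z.re) (h2 : 2 ≤ ‖z‖) :
    ‖stirlingStep z‖ ≤ 2 * (‖z‖ ^ 2)⁻¹ := by
  have hz0 : z ≠ 0 := by rintro rfl; simp at hz
  have hw : ‖z⁻¹‖ ≤ 1 / 2 := by
    rw [norm_inv, one_div]; exact inv_anti₀ (by norm_num) h2
  have hE := norm_log_sub_logTaylor_le 2 (z := z⁻¹) (by linarith)
  set w := z⁻¹ with hwdef
  have hw0 : w ≠ 0 := inv_ne_zero hz0
  have hT : logTaylor (2 + 1) w = w - w ^ 2 / 2 := by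
    simp [logTaylor_succ, logTaylor_zero]; ring
  rw [hT] at hE
  set e := log (1 + w) - (w - w ^ 2 / 2) with he
  have hEle : ‖e‖ ≤ ‖w‖ ^ 3 * (2 / 3) := by
    refine hE.trans ?_
    have : (1 - ‖w‖)⁻¹ ≤ 2 := by
      rw [inv_le_comm₀ (by linarith) (by norm_num)]; linarith
    have h3 : 0 ≤ ‖w‖ ^ 3 := by positivity
    norm_num
    nlinarith
  have hz' : z = w⁻¹ := by rw [hwdef, inv_inv]
  have hs : stirlingStep z = -(w ^ 2) / 4 + (w⁻¹ * e + e / 2) := by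
    rw [stirlingStep, log_add_one_sub_log hz, ← hwdef, hz']
    have : log (1 + w) = e + (w - w ^ 2 / 2) := by rw [he]; ring
    rw [this]; field_simp; ring
  have hn : (‖z‖ ^ 2)⁻¹ = ‖w‖ ^ 2 := by rw [hwdef, norm_inv, inv_pow]
  rw [hs, hn]
  have hwp : 0 < ‖w‖ := norm_pos_iff.2 hw0
  have h1 : ‖w⁻¹ * e‖ ≤ ‖w‖ ^ 2 * (2 / 3) := by
    rw [norm_mul, norm_inv]
    calc ‖w‖⁻¹ * ‖e‖ ≤ ‖w‖⁻¹ * (‖w‖ ^ 3 * (2 / 3)) := by gcongr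
      _ = _ := by field_simp
  have h2' : ‖e / 2‖ ≤ ‖w‖ ^ 2 * (1 / 6) := by
    rw [norm_div, norm_ofNat]
    nlinarith [sq_nonneg ‖w‖]
  have h3 : ‖-(w ^ 2) / 4‖ = ‖w‖ ^ 2 / 4 := by simp
  calc _ ≤ ‖w‖ ^ 2 / 4 + (‖w‖ ^ 2 * (2 / 3) + ‖w‖ ^ 2 * (1 / 6)) := by
        refine (norm_add_le _ _).trans ?_
        rw [h3]
        exact add_le_add le_rfl ((norm_add_le _ _).trans (add_le_add h1 h2'))
    _ ≤ _ := by nlinarith [sq_nonneg ‖w‖]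

lemma sum_norm_stirlingStep_le {z : ℂ} (hz : 0 < z.re) (h2 : 2 ≤ |z.im|) (n : ℕ) :
    ∑ k ∈ range n, ‖stirlingStep (z + k)‖ ≤ 8 / |z.im| := by
  have key : ∀ n : ℕ, ∑ k ∈ range n, ‖stirlingStep (z + k)‖ ≤
      4 * (1 / (|z.im| - 1) - 1 / (|z.im| + n - 1)) := by
    intro n
    induction n with
    | zero => simp
    | succ n ih =>
      rw [sum_range_succ]
      have hn : (0 : ℝ) ≤ n := n.cast_nonneg
      have hre : 0 < (z + n).re := by simp; linarith
      have hnorm : (n + |z.im|) ^ 2 / 2 ≤ ‖z + n‖ ^ 2 := by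
        rw [← normSq_eq_norm_sq, normSq_apply]
        simp only [add_re, natCast_re, add_im, natCast_im, add_zero]
        nlinarith [sq_nonneg ((n : ℝ) - |z.im|), sq_abs z.im]
      have h2n : 2 ≤ ‖z + n‖ := by
        have := abs_im_le_norm (z + n)
        simp only [add_im, natCast_im, add_zero] at this
        linarith
      have hs := norm_stirlingStep_le hre h2n
      have h3 : 2 * (‖z + n‖ ^ 2)⁻¹ ≤ 4 * (1 / (|z.im| + n - 1) - 1 / (|z.im| + (n + 1) - 1)) := by
        have ha : 0 < |z.im| + n - 1 := by linarith
        have hb : 0 < |z.im| + (n + 1) - 1 := by linarith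
        calc 2 * (‖z + n‖ ^ 2)⁻¹ ≤ 2 * ((n + |z.im|) ^ 2 / 2)⁻¹ := by
              gcongr
          _ ≤ 4 * (1 / (|z.im| + n - 1) - 1 / (|z.im| + (n + 1) - 1)) := by
              rw [div_sub_div _ _ ha.ne' hb.ne']
              have : 2 * ((n + |z.im|) ^ 2 / 2)⁻¹ = 4 * (1 / (n + |z.im|) ^ 2) := by
                field_simp; norm_num
              rw [this]
              gcongr ?_ * ?_
              rw [div_le_div_iff₀ (by positivity) (by positivity)]
              nlinarith
      push_cast
      linarith
  refine (key n).trans ?_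
  have hn : (0 : ℝ) ≤ n := n.cast_nonneg
  have : 0 ≤ 1 / (|z.im| + n - 1) := by
    apply div_nonneg zero_le_one; linarith
  have h3 : 1 / (|z.im| - 1) ≤ 2 / |z.im| := by
    rw [div_le_div_iff₀ (by linarith) (by linarith)]; linarith
  calc 4 * (1 / (|z.im| - 1) - 1 / (|z.im| + n - 1)) ≤ 4 * (2 / |z.im|) := by linarith
    _ = _ := by ring

/-- The function `exp ((z - 1/2) log z - z)`. -/
noncomputable def stirlingMain (z : ℂ) : ℂ := exp ((z - 1 / 2) * log z - z)

lemma stirlingMain_add_one {z : ℂ} (hz : z ≠ 0) :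
    stirlingMain (z + 1) = z * stirlingMain z * exp (stirlingStep z) := by
  rw [stirlingMain, stirlingMain, stirlingStep]
  have : z * exp ((z - 1 / 2) * log z - z) = exp (log z + ((z - 1 / 2) * log z - z)) := by
    rw [exp_add, exp_log hz]
  rw [this, ← exp_add]
  congr 1; ring

lemma stirlingMain_add_nat {z : ℂ} (hz : 0 < z.re) (n : ℕ) :
    stirlingMain (z + n) = (∏ k ∈ range n, (z + k)) * stirlingMain z *
      exp (∑ k ∈ range n, stirlingStep (z + k)) := by
  induction n with
  | zero => simp
  | succ n ih =>
    have h0 : z + n ≠ 0 := by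
      intro h
      have := congrArg re h
      simp at this
      have hn : (0 : ℝ) ≤ n := n.cast_nonneg
      linarith
    rw [Nat.cast_succ, ← add_assoc, stirlingMain_add_one h0, ih, prod_range_succ, sum_range_succ,
      exp_add]
    ring

lemma tendsto_stirlingMain_ratio (z : ℂ) :
    Tendsto (fun n : ℕ => (n : ℂ) ^ z * (n.factorial : ℂ) / stirlingMain (z + (n + 1 : ℕ)))
      atTop (nhds (Real.sqrt (2 * Real.pi))) := by
  have hst : Tendsto (fun n : ℕ => ((Stirling.stirlingSeq n : ℝ) : ℂ)) atTop
      (nhds ((Real.sqrt Real.pi : ℝ) : ℂ)) :=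
    (continuous_ofReal.tendsto _).comp Stirling.tendsto_stirlingSeq_sqrt_pi
  have hg : Tendsto (fun x : ℝ => (x : ℂ) * ((z + 1) / (x : ℂ))) atTop (nhds (z + 1)) := by
    refine tendsto_const_nhds.congr' ?_
    filter_upwards [eventually_gt_atTop 0] with x hx
    have : (x : ℂ) ≠ 0 := ofReal_ne_zero.2 hx.ne'
    field_simp
  have hlog := (tendsto_mul_log_one_add_of_tendsto hg).comp (tendsto_natCast_atTop_atTop (R := ℝ))
  have hlog0 : Tendsto (fun n : ℕ => log (1 + (z + 1) / (n : ℂ))) atTop (nhds 0) := by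
    have h1 : Tendsto (fun n : ℕ => ((n : ℂ))⁻¹) atTop (nhds 0) := by
      have := tendsto_inv_atTop_nhds_zero_nat (𝕜 := ℂ)
      simpa using this
    have := hlog.mul h1
    rw [mul_zero] at this
    refine this.congr' ?_
    filter_upwards [eventually_gt_atTop 0] with n hn
    have : (n : ℂ) ≠ 0 := Nat.cast_ne_zero.2 hn.ne'
    simp only [Function.comp_apply, ofReal_natCast]
    field_simp
  have hexp : Tendsto (fun n : ℕ => exp (-((n : ℂ) * log (1 + (z + 1) / (n : ℂ)) +
      (z + 1 / 2) * log (1 + (z + 1) / (n : ℂ))) + (z + 1))) atTop (nhds 1) := by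
    have h := (hlog.add (hlog0.const_mul (z + 1 / 2))).neg.add_const (z + 1)
    have h2 : -((z + 1) + (z + 1 / 2) * 0) + (z + 1) = 0 := by ring
    rw [h2] at h
    have := (continuous_exp.tendsto 0).comp h
    rw [exp_zero] at this
    exact this
  have hprod := (hst.mul_const ((Real.sqrt 2 : ℝ) : ℂ)).mul hexp
  have hc : ((Real.sqrt Real.pi : ℝ) : ℂ) * ((Real.sqrt 2 : ℝ) : ℂ) * 1 =
      ((Real.sqrt (2 * Real.pi) : ℝ) : ℂ) := by
    rw [mul_one, ← ofReal_mul, Real.sqrt_mul (by norm_num), mul_comm]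
  rw [hc] at hprod
  refine hprod.congr' ?_
  have hsmall : ∀ᶠ n : ℕ in atTop, ‖(z + 1) / (n : ℂ)‖ < 1 := by
    have : Tendsto (fun n : ℕ => (z + 1) / (n : ℂ)) atTop (nhds 0) := by
      have := (tendsto_inv_atTop_nhds_zero_nat (𝕜 := ℂ)).const_mul (z + 1)
      simpa [div_eq_mul_inv] using this
    have := this.norm
    rw [norm_zero] at this
    exact this.eventually_lt_const one_pos
  filter_upwards [eventually_gt_atTop 0, hsmall] with n hn hsm
  have hnR : (0 : ℝ) < n := Nat.cast_pos.2 hn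
  have hn0 : (n : ℂ) ≠ 0 := Nat.cast_ne_zero.2 hn.ne'
  have h1 : (1 + (z + 1) / (n : ℂ)) ≠ 0 := by
    intro h
    have : (z + 1) / (n : ℂ) = -1 := by linear_combination h
    rw [this] at hsm; simp at hsm
  have hl : log (z + (n + 1 : ℕ)) = Real.log n + log (1 + (z + 1) / (n : ℂ)) := by
    rw [← log_ofReal_mul hnR h1]
    congr 1
    push_cast; field_simp; ring
  have hfac : (n.factorial : ℂ) = ((Stirling.stirlingSeq n : ℝ) : ℂ) * ((Real.sqrt 2 : ℝ) : ℂ) *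
      exp (1 / 2 * Real.log n + n * Real.log n - n) := by
    have : (n.factorial : ℝ) = Stirling.stirlingSeq n * Real.sqrt 2 *
        Real.exp (1 / 2 * Real.log n + n * Real.log n - n) := by
      have e1 : Real.exp (1 / 2 * Real.log n) = Real.sqrt n := by
        rw [mul_comm, ← Real.rpow_def_of_pos hnR, ← Real.sqrt_eq_rpow]
      have e2 : Real.exp (n * Real.log n) = (n : ℝ) ^ n := by
        rw [mul_comm, ← Real.rpow_def_of_pos hnR, Real.rpow_natCast]
      rw [Stirling.stirlingSeq, Real.exp_sub, Real.exp_add, e1, e2, Real.sqrt_mul (by norm_num),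
        div_pow, ← Real.exp_nat_mul, mul_one]
      have := Real.sqrt_pos.2 hnR
      have h2 : 0 < Real.sqrt 2 := by positivity
      field_simp
    rw [← ofReal_natCast, this]
    push_cast
    rfl
  rw [hfac, stirlingMain, hl, cpow_def_of_ne_zero hn0, natCast_log]
  set L := log (1 + (z + 1) / (n : ℂ))
  rw [eq_div_iff (exp_ne_zero _)]
  have : ∀ p q A B E : ℂ, exp A * exp B = exp E → p * q * exp A * exp B = exp (log n * z) *
      (p * q * exp (E - log n * z)) := by
    intro p q A B E h
    rw [mul_assoc, h, mul_left_comm, ← exp_add]; congr 2; ring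
  rw [this _ _ _ _ (log n * z + (1 / 2 * log n + n * log n - n))]
  · congr 3; ring
  · rw [← exp_add]; congr 1
    push_cast
    ring

/-- Stirling's formula off the real axis. -/
theorem exists_Gamma_eq_stirlingMain {z : ℂ} (hz : 0 < z.re) (h2 : 2 ≤ |z.im|) :
    ∃ H : ℂ, ‖H‖ ≤ 8 / |z.im| ∧
      Gamma z = Real.sqrt (2 * Real.pi) * stirlingMain z * exp H := by
  have hsum : Summable fun k : ℕ => ‖stirlingStep (z + k)‖ :=
    summable_of_sum_range_le (fun _ => norm_nonneg _) (sum_norm_stirlingStep_le hz h2)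
  refine ⟨∑' k : ℕ, stirlingStep (z + k), (norm_tsum_le_tsum_norm hsum).trans
    (Real.tsum_le_of_sum_range_le (fun _ => norm_nonneg _) (sum_norm_stirlingStep_le hz h2)), ?_⟩
  have h1 := (hsum.of_norm.hasSum.tendsto_sum_nat).comp (tendsto_add_atTop_nat 1)
  have h3 := ((tendsto_stirlingMain_ratio z).mul_const (stirlingMain z)).mul
    ((continuous_exp.tendsto _).comp h1)
  refine tendsto_nhds_unique (GammaSeq_tendsto_Gamma z) (h3.congr fun n => ?_)
  have hp : ∏ k ∈ range (n + 1), (z + k) ≠ 0 := by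
    refine prod_ne_zero_iff.2 fun k _ h => ?_
    have := congrArg re h
    simp at this
    have hn : (0 : ℝ) ≤ k := k.cast_nonneg
    linarith
  simp only [Function.comp_apply]
  rw [stirlingMain_add_nat hz, GammaSeq]
  have e1 := exp_ne_zero (∑ k ∈ range (n + 1), stirlingStep (z + k))
  have e2 : stirlingMain z ≠ 0 := exp_ne_zero _
  field_simp

lemma log_sub_mul_I {x t : ℝ} (ht : 0 < t) :
    log (x - t * I) = Real.log t - Real.pi / 2 * I + log (1 + x / t * I) := by
  have ht0 : (t : ℂ) ≠ 0 := ofReal_ne_zero.2 ht.ne'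
  have hre : 0 < (1 + (x : ℂ) / t * I).re := by
    rw [← ofReal_div]; simp
  have h10 : (1 + (x : ℂ) / t * I) ≠ 0 := by intro h; rw [h] at hre; simp at hre
  have ha2 := abs_lt.1 (abs_arg_lt_pi_div_two_iff.2 (Or.inl hre))
  have hI : -I ≠ 0 := neg_ne_zero.2 I_ne_zero
  have : (x - t * I : ℂ) = t * (-I * (1 + x / t * I)) := by
    field_simp; ring_nf; simp [I_sq]
  rw [this, log_ofReal_mul ht (mul_ne_zero hI h10),
    (log_mul_eq_add_log_iff hI h10).2 ⟨by rw [arg_neg_I]; linarith [ha2.1],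
      by rw [arg_neg_I]; linarith [ha2.2, Real.pi_pos]⟩, log_neg_I]
  ring

/-- Stirling's formula along vertical lines. -/
theorem exists_Gamma_sub_mul_I {x t : ℝ} (hx : 0 < x) (hx2 : x ≤ 2) (ht : 4 ≤ t) :
    ∃ E : ℂ, ‖E‖ ≤ 20 / t ∧ Gamma (x - t * I) = Real.sqrt (2 * Real.pi) *
      exp ((x - 1 / 2 - t * I) * (Real.log t - Real.pi / 2 * I) + t * I + E) := by
  have ht0 : 0 < t := by linarith
  have ht0' : (t : ℂ) ≠ 0 := ofReal_ne_zero.2 ht0.ne'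
  have him : |(x - t * I : ℂ).im| = t := by simp [abs_of_pos ht0]
  obtain ⟨H, hH, hG⟩ := exists_Gamma_eq_stirlingMain (z := x - t * I) (by simpa using hx)
    (by rw [him]; linarith)
  rw [him] at hH
  set w : ℂ := x / t * I with hw
  have hwn : ‖w‖ = x / t := by
    rw [hw, norm_mul, norm_I, mul_one, ← ofReal_div, norm_real, Real.norm_eq_abs,
      abs_of_nonneg (by positivity)]
  have hw2 : ‖w‖ ≤ 1 / 2 := by rw [hwn, div_le_iff₀ ht0]; linarith
  have hwt : ‖w‖ ≤ 2 / t := by rw [hwn]; gcongr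
  have hl1 := norm_log_one_add_half_le_self hw2
  have hl2 := norm_log_one_add_sub_self_le (z := w) (by linarith)
  have hl3 : ‖log (1 + w) - w‖ ≤ ‖w‖ ^ 2 := by
    refine hl2.trans ?_
    have : (1 - ‖w‖)⁻¹ ≤ 2 := by
      rw [inv_le_comm₀ (by linarith) (by norm_num)]; linarith
    nlinarith [sq_nonneg ‖w‖]
  refine ⟨(x - 1 / 2 : ℝ) * log (1 + w) - t * I * (log (1 + w) - w) + H, ?_, ?_⟩
  · have e1 : ‖((x - 1 / 2 : ℝ) : ℂ) * log (1 + w)‖ ≤ 6 / t := by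
      rw [norm_mul, norm_real, Real.norm_eq_abs]
      have : |x - 1 / 2| ≤ 2 := abs_le.2 ⟨by linarith, by linarith⟩
      calc |x - 1 / 2| * ‖log (1 + w)‖ ≤ 2 * (3 / 2 * (2 / t)) := by
            gcongr; exact hl1.trans (by gcongr)
        _ = 6 / t := by ring
    have e2 : ‖t * I * (log (1 + w) - w)‖ ≤ 4 / t := by
      rw [norm_mul, norm_mul, norm_I, norm_real, Real.norm_eq_abs, abs_of_pos ht0, mul_one]
      calc t * ‖log (1 + w) - w‖ ≤ t * (2 / t) ^ 2 := by
            gcongr; exact hl3.trans (by gcongr)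
        _ = 4 / t := by field_simp; norm_num
    calc _ ≤ 6 / t + 4 / t + 8 / t := (norm_add_le _ _).trans
          (add_le_add ((norm_sub_le _ _).trans (add_le_add e1 e2)) hH)
      _ = 18 / t := by ring
      _ ≤ 20 / t := by gcongr; norm_num
  · rw [hG, stirlingMain, mul_assoc, ← exp_add, log_sub_mul_I ht0, ← hw]
    congr 2
    have htw : t * I * w = -x := by
      rw [hw]; field_simp; rw [I_sq]; ring
    push_cast
    linear_combination -htw

/-- Uniform bound for the Gamma function in the strip `1 ≤ re s ≤ 2`. -/
theorem exists_norm_Gamma_mul_exp_le : ∃ C : ℝ, 0 < C ∧ ∀ x : ℝ, 1 ≤ x → x ≤ 2 → ∀ y : ℝ,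
    ‖Gamma (x + y * I)‖ * Real.exp (Real.pi * |y| / 2) ≤ C * (1 + |y|) ^ (x - 1 / 2) := by
  have hcont : ContinuousOn (fun p : ℝ × ℝ =>
      ‖Gamma (p.1 + p.2 * I)‖ * Real.exp (Real.pi * |p.2| / 2))
      (Set.Icc 1 2 ×ˢ Set.Icc (-4) 4) := by
    refine ContinuousOn.mul (ContinuousOn.norm fun p hp => ?_) (by fun_prop)
    have hre : 0 < ((p.1 : ℂ) + p.2 * I).re := by
      have := hp.1.1; simp; linarith
    have h1 : ContinuousAt Gamma ((p.1 : ℂ) + p.2 * I) :=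
      (differentiableAt_Gamma _ fun m h => by
        rw [h] at hre; simp at hre
        linarith [(m.cast_nonneg : (0 : ℝ) ≤ m)]).continuousAt
    exact (ContinuousAt.comp (f := fun p : ℝ × ℝ => (p.1 : ℂ) + p.2 * I) h1
      (by fun_prop)).continuousWithinAt
  obtain ⟨C₁, hC₁⟩ := (isCompact_Icc.prod isCompact_Icc).exists_bound_of_continuousOn hcont
  set C₂ : ℝ := Real.sqrt (2 * Real.pi) * Real.exp 5 with hC₂
  have hC₂p : 0 < C₂ := by positivity
  refine ⟨|C₁| + C₂, by positivity, fun x hx1 hx2 y => ?_⟩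
  have hone : 1 ≤ (1 + |y|) ^ (x - 1 / 2) :=
    Real.one_le_rpow (by linarith [abs_nonneg y]) (by linarith)
  rcases le_or_gt |y| 4 with hy | hy
  · have h := hC₁ (x, y) ⟨⟨hx1, hx2⟩, abs_le.1 hy⟩
    rw [Real.norm_eq_abs, abs_of_nonneg (by positivity)] at h
    calc _ ≤ C₁ := h
      _ ≤ (|C₁| + C₂) * 1 := by linarith [le_abs_self C₁]
      _ ≤ _ := by gcongr
  · have hnorm : ‖Gamma (x + y * I)‖ = ‖Gamma (x - |y| * I)‖ := by
      rcases abs_cases y with ⟨h, -⟩ | ⟨h, -⟩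
      · rw [h, ← norm_conj, ← Gamma_conj]; simp [sub_eq_add_neg]
      · rw [h]; simp
    have ht0 : 0 < |y| := by linarith
    obtain ⟨E, hE, hG⟩ := exists_Gamma_sub_mul_I (x := x) (by linarith) hx2 hy.le
    have hE5 : E.re ≤ 5 := by
      refine (re_le_norm E).trans (hE.trans ?_)
      rw [div_le_iff₀ ht0]; linarith
    rw [hnorm, hG, norm_mul, norm_real, Real.norm_eq_abs, abs_of_nonneg (Real.sqrt_nonneg _),
      norm_exp]
    have hre : ((x - 1 / 2 - |y| * I) * (Real.log |y| - Real.pi / 2 * I) + |y| * I + E : ℂ).re =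
        (x - 1 / 2) * Real.log |y| - Real.pi * |y| / 2 + E.re := by
      have : (x - 1 / 2 - |y| * I : ℂ) = ((x - 1 / 2 : ℝ) : ℂ) - |y| * I := by push_cast; ring
      rw [this]
      have : (Real.log |y| - Real.pi / 2 * I : ℂ) = Real.log |y| - ((Real.pi / 2 : ℝ) : ℂ) * I := by
        push_cast; ring
      rw [this]
      simp only [add_re, mul_re, sub_re, sub_im, ofReal_re, ofReal_im, mul_im, I_re, I_im]
      ring
    rw [hre, mul_assoc, ← Real.exp_add]
    have hpow : Real.exp ((x - 1 / 2) * Real.log |y|) = |y| ^ (x - 1 / 2) := by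
      rw [mul_comm, ← Real.rpow_def_of_pos ht0]
    calc _ = Real.sqrt (2 * Real.pi) * (Real.exp E.re * |y| ^ (x - 1 / 2)) := by
          rw [← hpow, ← Real.exp_add]; congr 2; ring
      _ ≤ Real.sqrt (2 * Real.pi) * (Real.exp 5 * (1 + |y|) ^ (x - 1 / 2)) := by
          gcongr
          · linarith
          · linarith
      _ = C₂ * (1 + |y|) ^ (x - 1 / 2) := by rw [hC₂]; ring
      _ ≤ _ := by gcongr; linarith [abs_nonneg C₁]

/-- `e(x) = exp (2πix)`. -/
noncomputable def unitExp (x : ℝ) : ℂ := exp (((2 * Real.pi * x : ℝ) : ℂ) * I)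

lemma norm_unitExp (x : ℝ) : ‖unitExp x‖ = 1 := norm_exp_ofReal_mul_I _

lemma continuous_unitExp : Continuous unitExp := by unfold unitExp; fun_prop

lemma unitExp_add (x y : ℝ) : unitExp (x + y) = unitExp x * unitExp y := by
  rw [unitExp, unitExp, unitExp, ← exp_add]; congr 1; push_cast; ring

/-- First derivative of the smooth transition function. -/
noncomputable def transDeriv (x : ℝ) : ℝ := deriv Real.smoothTransition x

/-- Second derivative of the smooth transition function. -/
noncomputable def transDeriv2 (x : ℝ) : ℝ := deriv transDeriv x

lemma contDiff_transDeriv : ContDiff ℝ 1 transDeriv := by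
  have h : ContDiff ℝ (1 + 1 : ℕ) Real.smoothTransition := Real.smoothTransition.contDiff (n :=
      ((1 + 1 : ℕ) : ℕ∞))
  exact (contDiff_succ_iff_deriv.1 (by exact_mod_cast h)).2.2

lemma continuous_transDeriv : Continuous transDeriv := contDiff_transDeriv.continuous

lemma continuous_transDeriv2 : Continuous transDeriv2 :=
  contDiff_transDeriv.continuous_deriv le_rfl

lemma hasDerivAt_smoothTransition (x : ℝ) :
    HasDerivAt Real.smoothTransition (transDeriv x) x :=
  ((Real.smoothTransition.contDiff (n := 1)).differentiable (by norm_num) x).hasDerivAt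

lemma hasDerivAt_transDeriv (x : ℝ) : HasDerivAt transDeriv (transDeriv2 x) x :=
  (contDiff_transDeriv.differentiable (by norm_num) x).hasDerivAt

lemma transDeriv_of_lt {x : ℝ} (hx : x < 0) : transDeriv x = 0 := by
  have : Real.smoothTransition =ᶠ[nhds x] fun _ => 0 := by
    filter_upwards [Iio_mem_nhds hx] with y hy
    exact Real.smoothTransition.zero_of_nonpos (le_of_lt hy)
  rw [transDeriv, this.deriv_eq]; simp

lemma transDeriv_of_gt {x : ℝ} (hx : 1 < x) : transDeriv x = 0 := by
  have : Real.smoothTransition =ᶠ[nhds x] fun _ => 1 := by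
    filter_upwards [Ioi_mem_nhds hx] with y hy
    exact Real.smoothTransition.one_of_one_le (le_of_lt hy)
  rw [transDeriv, this.deriv_eq]; simp

lemma transDeriv2_of_lt {x : ℝ} (hx : x < 0) : transDeriv2 x = 0 := by
  have : transDeriv =ᶠ[nhds x] fun _ => 0 := by
    filter_upwards [Iio_mem_nhds hx] with y hy using transDeriv_of_lt hy
  rw [transDeriv2, this.deriv_eq]; simp

lemma transDeriv2_of_gt {x : ℝ} (hx : 1 < x) : transDeriv2 x = 0 := by
  have : transDeriv =ᶠ[nhds x] fun _ => 0 := by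
    filter_upwards [Ioi_mem_nhds hx] with y hy using transDeriv_of_gt hy
  rw [transDeriv2, this.deriv_eq]; simp

lemma eq_zero_of_nonpos_of_continuous {f : ℝ → ℝ} (hf : Continuous f)
    (h : ∀ x < 0, f x = 0) {x : ℝ} (hx : x ≤ 0) : f x = 0 := by
  have hc : IsClosed {y | f y = 0} := isClosed_eq hf continuous_const
  have : closure (Set.Iio (0 : ℝ)) ⊆ {y | f y = 0} := hc.closure_subset_iff.2 fun y hy => h y hy
  rw [closure_Iio] at this
  exact this hx

lemma eq_zero_of_one_le_of_continuous {f : ℝ → ℝ} (hf : Continuous f)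
    (h : ∀ x > 1, f x = 0) {x : ℝ} (hx : 1 ≤ x) : f x = 0 := by
  have hc : IsClosed {y | f y = 0} := isClosed_eq hf continuous_const
  have : closure (Set.Ioi (1 : ℝ)) ⊆ {y | f y = 0} := hc.closure_subset_iff.2 fun y hy => h y hy
  rw [closure_Ioi] at this
  exact this hx

lemma transDeriv_of_nonpos {x : ℝ} (hx : x ≤ 0) : transDeriv x = 0 :=
  eq_zero_of_nonpos_of_continuous continuous_transDeriv (fun _ => transDeriv_of_lt) hx

lemma transDeriv_of_one_le {x : ℝ} (hx : 1 ≤ x) : transDeriv x = 0 :=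
  eq_zero_of_one_le_of_continuous continuous_transDeriv (fun _ => transDeriv_of_gt) hx

lemma transDeriv2_of_nonpos {x : ℝ} (hx : x ≤ 0) : transDeriv2 x = 0 :=
  eq_zero_of_nonpos_of_continuous continuous_transDeriv2 (fun _ => transDeriv2_of_lt) hx

lemma transDeriv2_of_one_le {x : ℝ} (hx : 1 ≤ x) : transDeriv2 x = 0 :=
  eq_zero_of_one_le_of_continuous continuous_transDeriv2 (fun _ => transDeriv2_of_gt) hx

lemma exists_bound_transDeriv : ∃ K : ℝ, 1 ≤ K ∧ (∀ x, |transDeriv x| ≤ K) ∧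
    ∀ x, |transDeriv2 x| ≤ K := by
  obtain ⟨K₁, h₁⟩ := isCompact_Icc.exists_bound_of_continuousOn
    (continuous_transDeriv.continuousOn (s := Set.Icc 0 1))
  obtain ⟨K₂, h₂⟩ := isCompact_Icc.exists_bound_of_continuousOn
    (continuous_transDeriv2.continuousOn (s := Set.Icc 0 1))
  refine ⟨1 + |K₁| + |K₂|, by linarith [abs_nonneg K₁, abs_nonneg K₂], fun x => ?_, fun x => ?_⟩
  · rcases lt_or_ge x 0 with h | h
    · rw [transDeriv_of_lt h]; simp; positivity
    rcases lt_or_ge 1 x with h' | h'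
    · rw [transDeriv_of_gt h']; simp; positivity
    have := h₁ x ⟨h, h'⟩
    rw [Real.norm_eq_abs] at this
    linarith [le_abs_self K₁, abs_nonneg K₂]
  · rcases lt_or_ge x 0 with h | h
    · rw [transDeriv2_of_lt h]; simp; positivity
    rcases lt_or_ge 1 x with h' | h'
    · rw [transDeriv2_of_gt h']; simp; positivity
    have := h₂ x ⟨h, h'⟩
    rw [Real.norm_eq_abs] at this
    linarith [le_abs_self K₂, abs_nonneg K₁]

/-- The smoothly truncated power `W(v - N) v^{-s}`. -/
noncomputable def cutPow (N : ℝ) (s : ℂ) (v : ℝ) : ℂ :=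
  (Real.smoothTransition (v - N) : ℂ) * (v : ℂ) ^ (-s)

/-- The derivative of `cutPow`. -/
noncomputable def cutPow1 (N : ℝ) (s : ℂ) (v : ℝ) : ℂ :=
  (transDeriv (v - N) : ℂ) * (v : ℂ) ^ (-s) -
    s * (Real.smoothTransition (v - N) : ℂ) * (v : ℂ) ^ (-s - 1)

/-- The second derivative of `cutPow`. -/
noncomputable def cutPow2 (N : ℝ) (s : ℂ) (v : ℝ) : ℂ :=
  (transDeriv2 (v - N) : ℂ) * (v : ℂ) ^ (-s) -
    2 * s * (transDeriv (v - N) : ℂ) * (v : ℂ) ^ (-s - 1) +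
    s * (s + 1) * (Real.smoothTransition (v - N) : ℂ) * (v : ℂ) ^ (-s - 2)

lemma cutPow_of_le {N v : ℝ} (s : ℂ) (h : v ≤ N) : cutPow N s v = 0 := by
  simp [cutPow, Real.smoothTransition.zero_of_nonpos (sub_nonpos.2 h)]

lemma cutPow1_of_le {N v : ℝ} (s : ℂ) (h : v ≤ N) : cutPow1 N s v = 0 := by
  simp [cutPow1, Real.smoothTransition.zero_of_nonpos (sub_nonpos.2 h),
    transDeriv_of_nonpos (sub_nonpos.2 h)]

lemma cutPow2_of_le {N v : ℝ} (s : ℂ) (h : v ≤ N) : cutPow2 N s v = 0 := by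
  simp [cutPow2, Real.smoothTransition.zero_of_nonpos (sub_nonpos.2 h),
    transDeriv_of_nonpos (sub_nonpos.2 h), transDeriv2_of_nonpos (sub_nonpos.2 h)]

lemma cutPow_of_ge {N v : ℝ} (s : ℂ) (h : N + 1 ≤ v) : cutPow N s v = (v : ℂ) ^ (-s) := by
  simp [cutPow, Real.smoothTransition.one_of_one_le (show 1 ≤ v - N by linarith)]

lemma hasDerivAt_ofReal_cpow_pos {v : ℝ} (hv : 0 < v) (r : ℂ) :
    HasDerivAt (fun x : ℝ => (x : ℂ) ^ r) (r * (v : ℂ) ^ (r - 1)) v := by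
  have h := (hasDerivAt_id (v : ℂ)).cpow_const (c := r) (Or.inl (by simpa using hv))
  simpa using h.comp_ofReal

lemma hasDerivAt_cutPow {N : ℝ} (hN : 0 < N) (s : ℂ) (v : ℝ) :
    HasDerivAt (cutPow N s) (cutPow1 N s v) v := by
  rcases lt_or_ge v N with h | h
  · rw [cutPow1_of_le s h.le]
    refine (hasDerivAt_const v (0 : ℂ)).congr_of_eventuallyEq ?_
    filter_upwards [Iio_mem_nhds h] with y hy using cutPow_of_le s (le_of_lt hy)
  · have hv : 0 < v := hN.trans_le h
    have h1 : HasDerivAt (fun v => (Real.smoothTransition (v - N) : ℂ)) (transDeriv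
        (v - N) : ℂ) v :=
      ((hasDerivAt_smoothTransition (v - N)).comp_sub_const v N).ofReal_comp
    have := h1.mul (hasDerivAt_ofReal_cpow_pos hv (-s))
    refine this.congr_deriv ?_
    rw [cutPow1]; ring

lemma hasDerivAt_cutPow1 {N : ℝ} (hN : 0 < N) (s : ℂ) (v : ℝ) :
    HasDerivAt (cutPow1 N s) (cutPow2 N s v) v := by
  rcases lt_or_ge v N with h | h
  · rw [cutPow2_of_le s h.le]
    refine (hasDerivAt_const v (0 : ℂ)).congr_of_eventuallyEq ?_
    filter_upwards [Iio_mem_nhds h] with y hy using cutPow1_of_le s (le_of_lt hy)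
  · have hv : 0 < v := hN.trans_le h
    have h1 : HasDerivAt (fun v => (Real.smoothTransition (v - N) : ℂ)) (transDeriv
        (v - N) : ℂ) v :=
      ((hasDerivAt_smoothTransition (v - N)).comp_sub_const v N).ofReal_comp
    have h2 : HasDerivAt (fun v => (transDeriv (v - N) : ℂ)) (transDeriv2 (v - N) : ℂ) v :=
      ((hasDerivAt_transDeriv (v - N)).comp_sub_const v N).ofReal_comp
    have := (h2.mul (hasDerivAt_ofReal_cpow_pos hv (-s))).sub
      ((h1.const_mul s).mul (hasDerivAt_ofReal_cpow_pos hv (-s - 1)))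
    refine this.congr_deriv ?_
    rw [cutPow2, show -s - 1 - 1 = -s - 2 by ring]; ring

lemma continuous_cutPow {N : ℝ} (hN : 0 < N) (s : ℂ) : Continuous (cutPow N s) :=
  continuous_iff_continuousAt.2 fun v => (hasDerivAt_cutPow hN s v).continuousAt

lemma continuous_cutPow1 {N : ℝ} (hN : 0 < N) (s : ℂ) : Continuous (cutPow1 N s) :=
  continuous_iff_continuousAt.2 fun v => (hasDerivAt_cutPow1 hN s v).continuousAt

lemma continuous_cutPow2 {N : ℝ} (hN : 0 < N) (s : ℂ) : Continuous (cutPow2 N s) := by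
  refine continuous_iff_continuousAt.2 fun v => ?_
  rcases lt_or_ge v N with h | h
  · refine (continuousAt_const (y := (0 : ℂ))).congr ?_
    filter_upwards [Iio_mem_nhds h] with y hy using (cutPow2_of_le s (le_of_lt hy)).symm
  · have hv : 0 < v := hN.trans_le h
    have hc : ∀ r : ℂ, ContinuousAt (fun x : ℝ => (x : ℂ) ^ r) v := fun r =>
      (hasDerivAt_ofReal_cpow_pos hv r).continuousAt
    have c0 : ContinuousAt (fun v => (Real.smoothTransition (v - N) : ℂ)) v :=
      (continuous_ofReal.comp (Real.smoothTransition.continuous.comp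
        (continuous_sub_right N))).continuousAt
    have c1 : ContinuousAt (fun v => (transDeriv (v - N) : ℂ)) v :=
      (continuous_ofReal.comp (continuous_transDeriv.comp (continuous_sub_right N))).continuousAt
    have c2 : ContinuousAt (fun v => (transDeriv2 (v - N) : ℂ)) v :=
      (continuous_ofReal.comp (continuous_transDeriv2.comp (continuous_sub_right N))).continuousAt
    exact ((c2.mul (hc _)).sub ((continuousAt_const.mul c1).mul (hc _))).add
      ((continuousAt_const.mul c0).mul (hc _))

lemma abs_smoothTransition_le_one (x : ℝ) : |Real.smoothTransition x| ≤ 1 := by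
  rw [abs_of_nonneg (Real.smoothTransition.nonneg x)]
  exact Real.smoothTransition.le_one x

lemma norm_cutPow_le (N : ℝ) (s : ℂ) (v : ℝ) (hv : 0 < v) :
    ‖cutPow N s v‖ ≤ v ^ (-s.re) := by
  rw [cutPow, norm_mul, norm_real, norm_cpow_eq_rpow_re_of_pos hv, neg_re, Real.norm_eq_abs]
  exact mul_le_of_le_one_left (by positivity) (abs_smoothTransition_le_one _)

lemma abs_transDeriv_mul_le {K N v : ℝ} (hK : ∀ x, |transDeriv x| ≤ K) (hv : 0 < v) :
    |transDeriv (v - N)| * v ≤ K * (|N| + 1) := by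
  have hK0 : 0 ≤ K := (abs_nonneg _).trans (hK 0)
  rcases lt_or_ge (N + 1) v with h | h
  · rw [transDeriv_of_gt (by linarith)]; simp; positivity
  · exact mul_le_mul (hK _) (h.trans (by linarith [le_abs_self N])) hv.le hK0

lemma abs_transDeriv2_mul_le {K N v : ℝ} (hK : ∀ x, |transDeriv2 x| ≤ K) (hv : 0 < v) :
    |transDeriv2 (v - N)| * v ^ 2 ≤ K * (|N| + 1) ^ 2 := by
  have hK0 : 0 ≤ K := (abs_nonneg _).trans (hK 0)
  rcases lt_or_ge (N + 1) v with h | h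
  · rw [transDeriv2_of_gt (by linarith)]; simp; positivity
  · exact mul_le_mul (hK _) (pow_le_pow_left₀ hv.le (h.trans (by linarith [le_abs_self N])) 2)
      (by positivity) hK0

lemma exists_norm_cutPow1_le (N : ℝ) (s : ℂ) : ∃ C, ∀ v : ℝ, 0 < v →
    ‖cutPow1 N s v‖ ≤ C * v ^ (-s.re - 1) := by
  obtain ⟨K, hK1, hK, -⟩ := exists_bound_transDeriv
  refine ⟨K * (|N| + 1) + ‖s‖, fun v hv => ?_⟩
  rw [cutPow1]
  refine (norm_sub_le _ _).trans ?_
  simp only [norm_mul, norm_real, norm_cpow_eq_rpow_re_of_pos hv, neg_re, sub_re, one_re,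
    Real.norm_eq_abs]
  have hv1 : v ^ (-s.re) = v * v ^ (-s.re - 1) := by
    nth_rw 2 [← Real.rpow_one v]
    rw [← Real.rpow_add hv]; ring_nf
  rw [add_mul, hv1]
  refine add_le_add ?_ ?_
  · rw [← mul_assoc]
    exact mul_le_mul_of_nonneg_right (abs_transDeriv_mul_le hK hv) (by positivity)
  · refine mul_le_mul_of_nonneg_right ?_ (by positivity)
    exact mul_le_of_le_one_right (norm_nonneg _) (abs_smoothTransition_le_one _)

lemma exists_norm_cutPow2_le (N : ℝ) : ∃ C, 0 < C ∧ ∀ s : ℂ, ∀ v : ℝ, 0 < v →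
    ‖cutPow2 N s v‖ ≤ C * (1 + ‖s‖) ^ 2 * v ^ (-s.re - 2) := by
  obtain ⟨K, hK1, hK, hK'⟩ := exists_bound_transDeriv
  refine ⟨K * (|N| + 1) ^ 2 + 2 * (K * (|N| + 1)) + 1, by positivity, fun s v hv => ?_⟩
  rw [cutPow2]
  refine (norm_add_le _ _).trans ((add_le_add (norm_sub_le _ _) le_rfl).trans ?_)
  simp only [norm_mul, norm_real, norm_cpow_eq_rpow_re_of_pos hv, neg_re, sub_re, one_re,
    Real.norm_eq_abs, norm_ofNat, re_ofNat]
  have hv1 : v ^ (-s.re - 1) = v * v ^ (-s.re - 2) := by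
    nth_rw 2 [← Real.rpow_one v]
    rw [← Real.rpow_add hv]; ring_nf
  have hv2 : v ^ (-s.re) = v ^ 2 * v ^ (-s.re - 2) := by
    rw [← Real.rpow_natCast, ← Real.rpow_add hv]; push_cast; ring_nf
  have hs1 : ‖s + 1‖ ≤ 1 + ‖s‖ := (norm_add_le _ _).trans (by rw [norm_one, add_comm])
  have hs0 := norm_nonneg s
  rw [hv1, hv2]
  have e1 := abs_transDeriv2_mul_le hK' (N := N) hv
  have e2 := abs_transDeriv_mul_le hK (N := N) hv
  have e3 := abs_smoothTransition_le_one (v - N)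
  have hp : 0 ≤ v ^ (-s.re - 2) := by positivity
  have hone : 1 ≤ (1 + ‖s‖) ^ 2 := by nlinarith
  have hsle : ‖s‖ ≤ (1 + ‖s‖) ^ 2 := by nlinarith
  have f1 : |transDeriv2 (v - N)| * v ^ 2 ≤ K * (|N| + 1) ^ 2 * (1 + ‖s‖) ^ 2 :=
    e1.trans (le_mul_of_one_le_right (by positivity) hone)
  have f2 : 2 * ‖s‖ * (|transDeriv (v - N)| * v) ≤ 2 * (K * (|N| + 1)) * (1 + ‖s‖) ^ 2 := by
    calc _ ≤ 2 * (1 + ‖s‖) ^ 2 * (K * (|N| + 1)) := by gcongr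
      _ = _ := by ring
  have f3 : ‖s‖ * ‖s + 1‖ * |Real.smoothTransition (v - N)| ≤ 1 * (1 + ‖s‖) ^ 2 := by
    calc _ ≤ (1 + ‖s‖) * (1 + ‖s‖) * 1 := by gcongr; linarith
      _ = _ := by ring
  calc _ = (|transDeriv2 (v - N)| * v ^ 2 + 2 * ‖s‖ * (|transDeriv (v - N)| * v) +
        ‖s‖ * ‖s + 1‖ * |Real.smoothTransition (v - N)|) * v ^ (-s.re - 2) := by ring
    _ ≤ _ := by
        refine mul_le_mul_of_nonneg_right ?_ hp
        linarith

lemma integrable_of_le_rpow {g : ℝ → ℂ} (hg : Continuous g) {N b C : ℝ} (hN : 0 < N) (hb : b < -1)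
    (h0 : ∀ v ≤ N, g v = 0) (h1 : ∀ v, 0 < v → ‖g v‖ ≤ C * v ^ b) : Integrable g := by
  have hs : Function.support g ⊆ Set.Ioi N := fun v hv => by
    by_contra h; exact hv (h0 v (not_lt.1 h))
  rw [← integrableOn_iff_integrable_of_support_subset hs]
  refine Integrable.mono' ((integrableOn_Ioi_rpow_of_lt hb hN).const_mul C)
    hg.aestronglyMeasurable ?_
  exact (ae_restrict_iff' measurableSet_Ioi).2 (ae_of_all _ fun v hv => h1 v (hN.trans hv))

/-- Fourier coefficient of the periodic kernel in Euler-Maclaurin summation. -/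
noncomputable def emCoeff (n : ℤ) : ℝ := 1 / (4 * Real.pi ^ 2 * (n : ℝ) ^ 2)

lemma emCoeff_nonneg (n : ℤ) : 0 ≤ emCoeff n := by unfold emCoeff; positivity

lemma summable_emCoeff : Summable emCoeff := by
  have h : Summable fun n : ℤ => 1 / (n : ℝ) ^ 2 := Real.summable_one_div_int_pow.2 one_lt_two
  refine (h.mul_left (1 / (4 * Real.pi ^ 2))).congr fun n => ?_
  rw [emCoeff, div_mul_div_comm, one_mul]

/-- The periodic kernel `∑ e(n(v-a)) / (4π²n²)`. -/
noncomputable def emKernel (a v : ℝ) : ℂ := ∑' n : ℤ, (emCoeff n : ℂ) * unitExp (n * (v - a))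

lemma norm_emCoeff_mul_unitExp (n : ℤ) (x : ℝ) : ‖(emCoeff n : ℂ) * unitExp x‖ = emCoeff n := by
  rw [norm_mul, norm_unitExp, mul_one, norm_real, Real.norm_eq_abs,
      abs_of_nonneg (emCoeff_nonneg n)]

lemma continuous_emKernel (a : ℝ) : Continuous (emKernel a) :=
  continuous_tsum (fun n => continuous_const.mul (continuous_unitExp.comp (by fun_prop)))
    summable_emCoeff fun n v => (norm_emCoeff_mul_unitExp n _).le

lemma norm_emKernel_le (a v : ℝ) : ‖emKernel a v‖ ≤ ∑' n, emCoeff n :=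
  tsum_of_norm_bounded summable_emCoeff.hasSum fun n => (norm_emCoeff_mul_unitExp n _).le

lemma hasSum_integral_emKernel {g : ℝ → ℂ} (hg : Integrable g) (a : ℝ) :
    HasSum (fun n : ℤ => (emCoeff n : ℂ) * ∫ v, g v * unitExp (n * (v - a)))
      (∫ v, g v * emKernel a v) := by
  have hint : ∀ n : ℤ, Integrable fun v => g v * ((emCoeff n : ℂ) * unitExp (n * (v - a))) := by
    intro n
    refine (hg.norm.mul_const (emCoeff n)).mono' (hg.aestronglyMeasurable.mul
      (continuous_const.mul (continuous_unitExp.comp (by fun_prop))).aestronglyMeasurable)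
      (ae_of_all _ fun v => ?_)
    rw [norm_mul, norm_emCoeff_mul_unitExp]
  have hnorm : ∀ n : ℤ, ∫ v, ‖g v * ((emCoeff n : ℂ) * unitExp (n * (v - a)))‖ =
      (∫ v, ‖g v‖) * emCoeff n := by
    intro n
    simp_rw [norm_mul (g _), norm_emCoeff_mul_unitExp]
    rw [integral_mul_const]
  have := hasSum_integral_of_summable_integral_norm hint
    (by simp_rw [hnorm]; exact summable_emCoeff.mul_left _)
  simp_rw [tsum_mul_left] at this
  refine this.congr_fun fun n => ?_
  rw [← integral_const_mul]
  congr 1 with v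
  ring

lemma integrable_cutPow {N : ℝ} (hN : 0 < N) {s : ℂ} (hs : 1 < s.re) : Integrable (cutPow N s) :=
  integrable_of_le_rpow (continuous_cutPow hN s) hN (by linarith : -s.re < -1)
    (fun _ => cutPow_of_le s) (C := 1) fun v hv => by simpa using norm_cutPow_le N s v hv

lemma integrable_cutPow1 {N : ℝ} (hN : 0 < N) {s : ℂ} (hs : 0 < s.re) :
    Integrable (cutPow1 N s) := by
  obtain ⟨C, hC⟩ := exists_norm_cutPow1_le N s
  exact integrable_of_le_rpow (continuous_cutPow1 hN s) hN (by linarith : -s.re - 1 < -1)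
    (fun _ => cutPow1_of_le s) hC

lemma integrable_cutPow2 {N : ℝ} (hN : 0 < N) {s : ℂ} (hs : -1 < s.re) :
    Integrable (cutPow2 N s) := by
  obtain ⟨C, -, hC⟩ := exists_norm_cutPow2_le N
  exact integrable_of_le_rpow (continuous_cutPow2 hN s) hN (by linarith : -s.re - 2 < -1)
    (fun _ => cutPow2_of_le s) (hC s)

open FourierTransform in
lemma fourier_cutPow {N : ℝ} (hN : 0 < N) {s : ℂ} (hs : 1 < s.re) {n : ℤ} (hn : n ≠ 0) :
    𝓕 (cutPow N s) n = -(emCoeff n : ℂ) * 𝓕 (cutPow2 N s) n := by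
  have d1 : deriv (cutPow N s) = cutPow1 N s := funext fun v => (hasDerivAt_cutPow hN s v).deriv
  have d2 : deriv (cutPow1 N s) = cutPow2 N s := funext fun v => (hasDerivAt_cutPow1 hN s v).deriv
  have e1 := Real.fourier_deriv (integrable_cutPow hN hs)
    (fun v => (hasDerivAt_cutPow hN s v).differentiableAt)
    (by rw [d1]; exact integrable_cutPow1 hN (by linarith))
  have e2 := Real.fourier_deriv (integrable_cutPow1 hN (by linarith))
    (fun v => (hasDerivAt_cutPow1 hN s v).differentiableAt)
    (by rw [d2]; exact integrable_cutPow2 hN (by linarith))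
  rw [d1] at e1
  rw [d2, e1] at e2
  have h := congrFun e2 (n : ℝ)
  simp only [smul_eq_mul] at h
  rw [h, emCoeff]
  have hnC : (n : ℂ) ≠ 0 := Int.cast_ne_zero.2 hn
  have hpi : (Real.pi : ℂ) ≠ 0 := ofReal_ne_zero.2 Real.pi_ne_zero
  push_cast
  field_simp
  rw [I_sq]; ring

open FourierTransform in
lemma fourier_cutPow2_mul (N : ℝ) (s : ℂ) (n : ℤ) (a : ℝ) :
    𝓕 (cutPow2 N s) n * fourier n (a : UnitAddCircle) =
      ∫ v, cutPow2 N s v * unitExp ((-n : ℤ) * (v - a)) := by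
  rw [Real.fourier_real_eq_integral_exp_smul, ← integral_mul_const]
  congr 1 with v
  rw [fourier_coe_apply, unitExp, smul_eq_mul, mul_right_comm, ← exp_add, mul_comm]
  congr 2
  push_cast
  ring

open FourierTransform in
lemma hasSum_fourier_cutPow {N : ℝ} (hN : 0 < N) {s : ℂ} (hs : 1 < s.re) (a : ℝ) :
    HasSum (fun n : ℤ => 𝓕 (cutPow N s) n * fourier n (a : UnitAddCircle))
      ((∫ v, cutPow N s v) - ∫ v, cutPow2 N s v * emKernel a v) := by
  have h1 := hasSum_integral_emKernel (integrable_cutPow2 hN (s := s) (by linarith)) a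
  have h2 : HasSum (fun n : ℤ => (emCoeff (-n) : ℂ) * ∫ v, cutPow2 N s v *
      unitExp ((-n : ℤ) * (v - a))) (∫ v, cutPow2 N s v * emKernel a v) :=
    (Equiv.neg ℤ).hasSum_iff.2 h1
  have h3 := (hasSum_ite_eq (0 : ℤ) (∫ v, cutPow N s v)).sub h2
  refine h3.congr_fun fun n => ?_
  have hneg : emCoeff (-n) = emCoeff n := by simp [emCoeff]
  rw [hneg]
  split_ifs with hn
  · subst hn
    have : emCoeff 0 = 0 := by simp [emCoeff]
    rw [this, Real.fourier_real_eq_integral_exp_smul]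
    simp
  · rw [fourier_cutPow hN hs hn, mul_assoc, fourier_cutPow2_mul]
    ring

lemma cutPow_isBigO {N : ℝ} (hN : 0 < N) (s : ℂ) :
    cutPow N s =O[cocompact ℝ] fun x : ℝ => |x| ^ (-s.re) := by
  refine Asymptotics.IsBigO.of_bound 1 (Eventually.of_forall fun v => ?_)
  rcases le_or_gt v 0 with hv | hv
  · rw [cutPow_of_le s (hv.trans hN.le)]; simp
  · rw [one_mul, abs_of_pos hv, Real.norm_eq_abs, abs_of_nonneg (by positivity)]
    exact norm_cutPow_le N s v hv

lemma tsum_cutPow {N : ℕ} (hN : 0 < N) {s : ℂ} (hs : 1 < s.re) (a : ℝ) :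
    ∑' n : ℤ, cutPow N s (a + n) =
      (∫ v, cutPow N s v) - ∫ v, cutPow2 N s v * emKernel a v := by
  have hNR : (0 : ℝ) < N := Nat.cast_pos.2 hN
  have h := hasSum_fourier_cutPow hNR hs a
  rw [Real.tsum_eq_tsum_fourier_of_rpow_decay_of_summable (continuous_cutPow hNR s) hs
    (cutPow_isBigO hNR s) ?_ a, h.tsum_eq]
  rw [← summable_norm_iff]
  refine (summable_norm_iff.2 h.summable).congr fun n => ?_
  rw [norm_mul, fourier_apply, Circle.norm_coe, mul_one]

lemma hurwitzZeta_eq_of_one_lt_re {a : ℝ} (ha : 0 < a) (ha1 : a ≤ 1) {N : ℕ} (hN : 0 < N) {s : ℂ}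
    (hs : 1 < s.re) : HurwitzZeta.hurwitzZeta (a : UnitAddCircle) s =
      ∑ k ∈ range N, ((k + a : ℝ) : ℂ) ^ (-s) +
      (1 - Real.smoothTransition a) * ((N + a : ℝ) : ℂ) ^ (-s) +
      (∫ v, cutPow N s v) - ∫ v, cutPow2 N s v * emKernel a v := by
  have h0 := HurwitzZeta.hasSum_hurwitzZeta_of_one_lt_re (a := a) ⟨ha.le, ha1⟩ hs
  have h1 : HasSum (fun n : ℕ => ((n + a : ℝ) : ℂ) ^ (-s))
      (HurwitzZeta.hurwitzZeta (a : UnitAddCircle) s) := by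
    refine h0.congr_fun fun n => ?_
    rw [cpow_neg, one_div]; push_cast; rfl
  have h2 := (hasSum_nat_add_iff' N).2 h1
  set Z := HurwitzZeta.hurwitzZeta (a : UnitAddCircle) s
  have h3 := h2.sub (hasSum_ite_eq (0 : ℕ)
    ((1 - Real.smoothTransition a : ℂ) * ((N + a : ℝ) : ℂ) ^ (-s)))
  have h4 : HasSum (fun m : ℕ => cutPow N s (a + ((N + m : ℤ) : ℝ)))
      (Z - ∑ k ∈ range N, ((k + a : ℝ) : ℂ) ^ (-s) -
        (1 - Real.smoothTransition a) * ((N + a : ℝ) : ℂ) ^ (-s)) := by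
    refine h3.congr_fun fun m => ?_
    split_ifs with hm
    · subst hm
      rw [cutPow]
      push_cast
      have : a + (N + 0) - (N : ℝ) = a := by ring
      simp only [zero_add, add_zero, add_sub_cancel_right]
      rw [add_comm (a : ℂ)]; ring
    · have hm1 : (1 : ℝ) ≤ m := by exact_mod_cast Nat.one_le_iff_ne_zero.2 hm
      rw [cutPow_of_ge _ (by push_cast; linarith)]
      push_cast
      rw [sub_zero]; congr 1; ring
  have hinj : Function.Injective fun m : ℕ => (N + m : ℤ) := fun x y h => by simpa using h
  have h5 : HasSum (fun n : ℤ => cutPow N s (a + (n : ℝ))) _ :=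
    (hinj.hasSum_iff (f := fun n : ℤ => cutPow N s (a + (n : ℝ))) (fun n hn => by
      refine cutPow_of_le s ?_
      have : n < N := by
        by_contra h
        push Not at h
        exact hn ⟨(n - N).toNat, by
          show (N : ℤ) + ((n - N).toNat : ℤ) = n
          omega⟩
      have : (n : ℝ) + 1 ≤ N := by exact_mod_cast this
      linarith)).1 h4
  have h6 := tsum_cutPow hN hs a
  rw [h5.tsum_eq] at h6
  linear_combination h6

/-- The integral `∫ W'(v - N) v^{1-s} dv`. -/
noncomputable def cutMass (N : ℝ) (s : ℂ) : ℂ :=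
  mellin (fun v : ℝ => (transDeriv (v - N) : ℂ)) (2 - s)

lemma mellin_differentiable_of_eventually_zero {f : ℝ → ℂ} (hf : Continuous f) {N M : ℝ}
    (hN : 0 < N) (h0 : ∀ v ≤ N, f v = 0) (h1 : ∀ v ≥ M, f v = 0) (s : ℂ) :
    DifferentiableAt ℂ (mellin f) s := by
  refine mellin_differentiableAt_of_isBigO_rpow (a := s.re + 1) (b := s.re - 1)
    (hf.locallyIntegrable.locallyIntegrableOn _) ?_ (by linarith) ?_ (by linarith)
  · refine Asymptotics.IsBigO.of_bound 1 ?_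
    filter_upwards [eventually_ge_atTop M] with v hv
    rw [h1 v hv]; simp
  · refine Asymptotics.IsBigO.of_bound 1 ?_
    filter_upwards [nhdsWithin_le_nhds (Iio_mem_nhds hN)] with v hv
    rw [h0 v (le_of_lt hv)]; simp

lemma mellin_differentiable_of_bounded {f : ℝ → ℂ} (hf : Continuous f) {N C : ℝ}
    (hN : 0 < N) (h0 : ∀ v ≤ N, f v = 0) (h1 : ∀ v, ‖f v‖ ≤ C) {s : ℂ} (hs : s.re < 0) :
    DifferentiableAt ℂ (mellin f) s := by
  refine mellin_differentiableAt_of_isBigO_rpow (a := 0) (b := s.re - 1)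
    (hf.locallyIntegrable.locallyIntegrableOn _) ?_ hs ?_ (by linarith)
  · refine Asymptotics.IsBigO.of_bound C (Eventually.of_forall fun v => ?_)
    simpa using h1 v
  · refine Asymptotics.IsBigO.of_bound 1 ?_
    filter_upwards [nhdsWithin_le_nhds (Iio_mem_nhds hN)] with v hv
    rw [h0 v (le_of_lt hv)]; simp

lemma differentiable_cutMass {N : ℝ} (hN : 0 < N) : Differentiable ℂ (cutMass N) := by
  intro s
  refine (mellin_differentiable_of_eventually_zero (N := N) (M := N + 1)
    (continuous_ofReal.comp (continuous_transDeriv.comp (continuous_sub_right N))) hN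
    (fun v hv => ?_) (fun v hv => ?_) (2 - s)).comp s (by fun_prop)
  · simp [transDeriv_of_nonpos (sub_nonpos.2 hv)]
  · simp [transDeriv_of_one_le (show 1 ≤ v - N by linarith)]

lemma cutMass_eq {N : ℝ} (hN : 0 < N) (s : ℂ) :
    cutMass N s = ∫ v in N..(N + 1), (transDeriv (v - N) : ℂ) * (v : ℂ) ^ (1 - s) := by
  have e : cutMass N s = ∫ v in Set.Ioi (0 : ℝ), (transDeriv (v - N) : ℂ) * (v : ℂ) ^ (1 - s) := by
    rw [cutMass, mellin]
    refine setIntegral_congr_fun measurableSet_Ioi fun v _ => ?_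
    simp only [smul_eq_mul]
    rw [mul_comm]; congr 2; ring
  rw [e, intervalIntegral.integral_of_le (by linarith)]
  refine (setIntegral_eq_of_subset_of_forall_sdiff_eq_zero measurableSet_Ioi
    (fun v hv => hN.trans hv.1) fun v hv => ?_)
  have : v ≤ N ∨ N + 1 < v := by
    by_contra h
    push Not at h
    exact hv.2 ⟨h.1, h.2⟩
  rcases this with h | h
  · simp [transDeriv_of_nonpos (sub_nonpos.2 h)]
  · simp [transDeriv_of_one_le (show 1 ≤ v - N by linarith)]

lemma integral_cutPow {N : ℝ} (hN : 0 < N) {s : ℂ} (hs : 1 < s.re) :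
    ∫ v, cutPow N s v = (s - 1)⁻¹ * cutMass N s := by
  have hs1 : s - 1 ≠ 0 := by
    intro h
    have := congrArg re h
    simp at this; linarith
  have hcut : ∀ v, cutPow1 N (s - 1) v =
      (transDeriv (v - N) : ℂ) * (v : ℂ) ^ (1 - s) - (s - 1) * cutPow N s v := by
    intro v
    rw [cutPow1, cutPow]
    rw [show -(s - 1) = 1 - s by ring, show 1 - s - 1 = -s by ring]; ring
  have hint1 := integrable_cutPow1 hN (s := s - 1) (by simp; linarith)
  have hint0 := integrable_cutPow hN hs
  have hlim0 : Tendsto (cutPow N (s - 1)) atBot (nhds 0) := by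
    refine tendsto_const_nhds.congr' ?_
    filter_upwards [eventually_le_atBot N] with v hv using (cutPow_of_le _ hv).symm
  have hlim1 : Tendsto (cutPow N (s - 1)) atTop (nhds 0) := by
    have h := tendsto_rpow_neg_atTop (y := s.re - 1) (by linarith)
    refine squeeze_zero_norm' ?_ h
    filter_upwards [eventually_gt_atTop 0] with v hv
    simpa using norm_cutPow_le N (s - 1) v hv
  have h := integral_of_hasDerivAt_of_tendsto (fun v => hasDerivAt_cutPow hN (s - 1) v) hint1
    hlim0 hlim1
  have hintD : Integrable fun v : ℝ => (transDeriv (v - N) : ℂ) * (v : ℂ) ^ (1 - s) := by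
    refine (hint1.add (hint0.const_mul (s - 1))).congr (ae_of_all _ fun v => ?_)
    simp only [Pi.add_apply]
    rw [hcut]; ring
  simp_rw [hcut] at h
  rw [integral_sub hintD (hint0.const_mul _), integral_const_mul, sub_zero] at h
  have hD : ∫ v : ℝ, (transDeriv (v - N) : ℂ) * (v : ℂ) ^ (1 - s) = cutMass N s := by
    rw [cutMass_eq hN, intervalIntegral.integral_of_le (by linarith)]
    symm
    refine setIntegral_eq_integral_of_forall_compl_eq_zero fun v hv => ?_
    have : v ≤ N ∨ N + 1 < v := by
      by_contra h
      push Not at h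
      exact hv ⟨h.1, h.2⟩
    rcases this with h | h
    · simp [transDeriv_of_nonpos (sub_nonpos.2 h)]
    · simp [transDeriv_of_one_le (show 1 ≤ v - N by linarith)]
  rw [hD] at h
  rw [eq_inv_mul_iff_mul_eq₀ hs1]
  linear_combination -h

/-- The remainder integral in Euler-Maclaurin summation. -/
noncomputable def emRemainder (a N : ℝ) (s : ℂ) : ℂ := ∫ v, cutPow2 N s v * emKernel a v

lemma differentiableAt_emRemainder {N : ℝ} (hN : 0 < N) (a : ℝ) {s : ℂ} (hs : -1 < s.re) :
    DifferentiableAt ℂ (emRemainder a N) s := by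
  obtain ⟨K, hK1, hK, hK'⟩ := exists_bound_transDeriv
  set f2 : ℝ → ℂ := fun v => (transDeriv2 (v - N) : ℂ) * emKernel a v
  set f1 : ℝ → ℂ := fun v => (transDeriv (v - N) : ℂ) * emKernel a v
  set f0 : ℝ → ℂ := fun v => (Real.smoothTransition (v - N) : ℂ) * emKernel a v
  have c2 : Continuous f2 := (continuous_ofReal.comp (continuous_transDeriv2.comp
    (continuous_sub_right N))).mul (continuous_emKernel a)
  have c1 : Continuous f1 := (continuous_ofReal.comp (continuous_transDeriv.comp
    (continuous_sub_right N))).mul (continuous_emKernel a)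
  have c0 : Continuous f0 := (continuous_ofReal.comp (Real.smoothTransition.continuous.comp
    (continuous_sub_right N))).mul (continuous_emKernel a)
  have z2 : ∀ v ≤ N, f2 v = 0 := fun v hv => by simp [f2, transDeriv2_of_nonpos (sub_nonpos.2 hv)]
  have z1 : ∀ v ≤ N, f1 v = 0 := fun v hv => by simp [f1, transDeriv_of_nonpos (sub_nonpos.2 hv)]
  have z0 : ∀ v ≤ N, f0 v = 0 := fun v hv => by
    simp [f0, Real.smoothTransition.zero_of_nonpos (sub_nonpos.2 hv)]
  have z2' : ∀ v ≥ N + 1, f2 v = 0 := fun v hv => by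
    simp [f2, transDeriv2_of_one_le (show 1 ≤ v - N by linarith)]
  have z1' : ∀ v ≥ N + 1, f1 v = 0 := fun v hv => by
    simp [f1, transDeriv_of_one_le (show 1 ≤ v - N by linarith)]
  have b0 : ∀ v, ‖f0 v‖ ≤ 1 * ∑' n, emCoeff n := fun v => by
    rw [norm_mul, norm_real, Real.norm_eq_abs]
    exact mul_le_mul (abs_smoothTransition_le_one _) (norm_emKernel_le a v) (norm_nonneg _)
      zero_le_one
  have m2 : ∀ s, MellinConvergent f2 s := fun s => by
    refine mellinConvergent_of_isBigO_rpow (a := s.re + 1) (b := s.re - 1)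
      (c2.locallyIntegrable.locallyIntegrableOn _) ?_ (by linarith) ?_ (by linarith)
    · refine Asymptotics.IsBigO.of_bound 1 ?_
      filter_upwards [eventually_ge_atTop (N + 1)] with v hv
      rw [z2' v hv]; simp
    · refine Asymptotics.IsBigO.of_bound 1 ?_
      filter_upwards [nhdsWithin_le_nhds (Iio_mem_nhds hN)] with v hv
      rw [z2 v (le_of_lt hv)]; simp
  have m1 : ∀ s, MellinConvergent f1 s := fun s => by
    refine mellinConvergent_of_isBigO_rpow (a := s.re + 1) (b := s.re - 1)
      (c1.locallyIntegrable.locallyIntegrableOn _) ?_ (by linarith) ?_ (by linarith)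
    · refine Asymptotics.IsBigO.of_bound 1 ?_
      filter_upwards [eventually_ge_atTop (N + 1)] with v hv
      rw [z1' v hv]; simp
    · refine Asymptotics.IsBigO.of_bound 1 ?_
      filter_upwards [nhdsWithin_le_nhds (Iio_mem_nhds hN)] with v hv
      rw [z1 v (le_of_lt hv)]; simp
  have m0 : ∀ s : ℂ, s.re < 0 → MellinConvergent f0 s := fun s hs => by
    refine mellinConvergent_of_isBigO_rpow (a := 0) (b := s.re - 1)
      (c0.locallyIntegrable.locallyIntegrableOn _) ?_ hs ?_ (by linarith)
    · refine Asymptotics.IsBigO.of_bound (1 * ∑' n, emCoeff n) (Eventually.of_forall fun v => ?_)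
      simpa using b0 v
    · refine Asymptotics.IsBigO.of_bound 1 ?_
      filter_upwards [nhdsWithin_le_nhds (Iio_mem_nhds hN)] with v hv
      rw [z0 v (le_of_lt hv)]; simp
  have key : ∀ w : ℂ, -1 < w.re → emRemainder a N w =
      mellin f2 (1 - w) - 2 * w * mellin f1 (-w) + w * (w + 1) * mellin f0 (-1 - w) := by
    intro w hw
    have hr : emRemainder a N w = ∫ v in Set.Ioi (0 : ℝ), cutPow2 N w v * emKernel a v := by
      refine (setIntegral_eq_integral_of_forall_compl_eq_zero fun v hv => ?_).symm
      rw [cutPow2_of_le w ((not_lt.1 hv).trans hN.le), zero_mul]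
    have i2 := m2 (1 - w)
    have i1 := m1 (-w)
    have i0 := m0 (-1 - w) (by simp; linarith)
    rw [MellinConvergent, IntegrableOn] at i2 i1 i0
    have i1' := i1.const_mul (2 * w)
    have i0' := i0.const_mul (w * (w + 1))
    have e1 := integral_add (i2.sub i1') i0'
    have e2 := integral_sub i2 i1'
    simp only [Pi.sub_apply] at e1
    rw [hr, mellin, mellin, mellin, ← integral_const_mul, ← integral_const_mul, ← e2, ← e1]
    refine setIntegral_congr_fun measurableSet_Ioi fun v hv => ?_
    simp only [smul_eq_mul, f2, f1, f0, cutPow2]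
    rw [show 1 - w - 1 = -w by ring, show -1 - w - 1 = -w - 2 by ring]
    ring
  have hopen : IsOpen {w : ℂ | -1 < w.re} := isOpen_lt continuous_const continuous_re
  have hev : emRemainder a N =ᶠ[nhds s] fun w =>
      mellin f2 (1 - w) - 2 * w * mellin f1 (-w) + w * (w + 1) * mellin f0 (-1 - w) := by
    filter_upwards [hopen.mem_nhds hs] with w hw using key w hw
  refine DifferentiableAt.congr_of_eventuallyEq ?_ hev
  have d2 := (mellin_differentiable_of_eventually_zero c2 hN z2 z2' (1 - s)).comp s
    (f := fun w => 1 - w) (by fun_prop)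
  have d1 := (mellin_differentiable_of_eventually_zero c1 hN z1 z1' (-s)).comp s
    (f := fun w => -w) (by fun_prop)
  have d0 := (mellin_differentiable_of_bounded c0 hN z0 b0 (s := -1 - s)
    (by simp; linarith)).comp s (f := fun w => -1 - w) (by fun_prop)
  simp only [Function.comp_def] at d2 d1 d0
  fun_prop

/-- Propagation of an identity of holomorphic functions to a larger convex set. -/
lemma eqOn_of_convex_of_eqOn {f g : ℂ → ℂ} {U V : Set ℂ} (hU : IsOpen U) (hUc : Convex ℝ U)
    (hV : IsOpen V) (hf : DifferentiableOn ℂ f U) (hg : DifferentiableOn ℂ g U)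
    (hfg : Set.EqOn f g V) {z : ℂ} (hzU : z ∈ U) (hzV : z ∈ V) : Set.EqOn f g U :=
  (hf.analyticOnNhd hU).eqOn_of_preconnected_of_eventuallyEq (hg.analyticOnNhd hU)
    hUc.isPreconnected hzU (by filter_upwards [hV.mem_nhds hzV] with w hw using hfg hw)

/-- Smoothed Euler-Maclaurin formula for the Hurwitz zeta function in `re s > -1`. -/
theorem hurwitzZeta_eq {a : ℝ} (ha : 0 < a) (ha1 : a ≤ 1) {N : ℕ} (hN : 0 < N) {s : ℂ}
    (hs : -1 < s.re) (hs1 : s ≠ 1) : HurwitzZeta.hurwitzZeta (a : UnitAddCircle) s =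
      ∑ k ∈ range N, ((k + a : ℝ) : ℂ) ^ (-s) +
      (1 - Real.smoothTransition a) * ((N + a : ℝ) : ℂ) ^ (-s) +
      (s - 1)⁻¹ * cutMass N s - emRemainder a N s := by
  have hNR : (0 : ℝ) < N := Nat.cast_pos.2 hN
  set f : ℂ → ℂ := HurwitzZeta.hurwitzZeta (a : UnitAddCircle) with hf
  set g : ℂ → ℂ := fun s => ∑ k ∈ range N, ((k + a : ℝ) : ℂ) ^ (-s) +
      (1 - Real.smoothTransition a) * ((N + a : ℝ) : ℂ) ^ (-s) +
      (s - 1)⁻¹ * cutMass N s - emRemainder a N s with hg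
  have hpow : ∀ x : ℝ, 0 < x → Differentiable ℂ fun s : ℂ => (x : ℂ) ^ (-s) := fun x hx s =>
    (differentiableAt_id.neg).const_cpow (Or.inl (ofReal_ne_zero.2 hx.ne'))
  have hfd : ∀ w : ℂ, w ≠ 1 → DifferentiableAt ℂ f w := fun w hw =>
    HurwitzZeta.differentiableAt_hurwitzZeta _ hw
  have hgd : ∀ w : ℂ, -1 < w.re → w ≠ 1 → DifferentiableAt ℂ g w := by
    intro w hw hw1
    have e1 : DifferentiableAt ℂ (fun s : ℂ => ∑ k ∈ range N, ((k + a : ℝ) : ℂ) ^ (-s)) w :=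
      DifferentiableAt.fun_sum fun k _ => hpow _ (by positivity) w
    have e2 := (hpow (N + a) (by positivity) w).const_mul (1 - Real.smoothTransition a : ℂ)
    have e3 : DifferentiableAt ℂ (fun s : ℂ => (s - 1)⁻¹ * cutMass N s) w := by
      have hsub : DifferentiableAt ℂ (fun s : ℂ => s - 1) w := by fun_prop
      exact (hsub.fun_inv (sub_ne_zero.2 hw1)).fun_mul (differentiable_cutMass hNR w)
    exact ((e1.add e2).add e3).sub (differentiableAt_emRemainder hNR a hw)
  have h0 : Set.EqOn f g {w | 1 < w.re} := fun w hw => by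
    rw [hf, hg, hurwitzZeta_eq_of_one_lt_re ha ha1 hN hw, integral_cutPow hNR hw]; rfl
  have o0 : IsOpen {w : ℂ | 1 < w.re} := isOpen_lt continuous_const continuous_re
  have cre : ∀ r : ℝ, Convex ℝ {w : ℂ | r < w.re} := fun r => convex_halfSpace_re_gt r
  have step : ∀ {U V : Set ℂ} {z : ℂ}, IsOpen U → Convex ℝ U → IsOpen V → Set.EqOn f g V →
      z ∈ U → z ∈ V → (∀ w ∈ U, -1 < w.re ∧ w ≠ 1) → Set.EqOn f g U :=
    fun hU hUc hV hfg hzU hzV hUs => eqOn_of_convex_of_eqOn hU hUc hV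
      (fun w hw => (hfd w (hUs w hw).2).differentiableWithinAt)
      (fun w hw => (hgd w (hUs w hw).1 (hUs w hw).2).differentiableWithinAt) hfg hzU hzV
  have o1 : IsOpen ({w : ℂ | -1 < w.re} ∩ {w | 0 < w.im}) :=
    (isOpen_lt continuous_const continuous_re).inter (isOpen_lt continuous_const continuous_im)
  have h1 := step (z := 2 + I) o1 ((cre _).inter (convex_halfSpace_im_gt 0)) o0 h0
    (by simp; norm_num) (by simp) fun w hw => ⟨hw.1, by rintro rfl; simpa using hw.2⟩
  have o2 : IsOpen ({w : ℂ | -1 < w.re} ∩ {w | w.im < 0}) :=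
    (isOpen_lt continuous_const continuous_re).inter (isOpen_lt continuous_im continuous_const)
  have h2 := step (z := 2 - I) o2 ((cre _).inter (convex_halfSpace_im_lt 0)) o0 h0
    (by simp; norm_num) (by simp) fun w hw => ⟨hw.1, by rintro rfl; simpa using hw.2⟩
  have o3 : IsOpen ({w : ℂ | -1 < w.re} ∩ {w | w.re < 1}) :=
    (isOpen_lt continuous_const continuous_re).inter (isOpen_lt continuous_re continuous_const)
  have h3 := step (z := I) o3 ((cre _).inter (convex_halfSpace_re_lt 1)) o1 h1
    (by simp) (by simp) fun w hw => ⟨hw.1, by rintro rfl; simpa using hw.2⟩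
  rcases lt_trichotomy s.im 0 with h | h | h
  · exact h2 ⟨hs, h⟩
  · rcases lt_trichotomy s.re 1 with h' | h' | h'
    · exact h3 ⟨hs, h'⟩
    · exact absurd (Complex.ext h' h) hs1
    · exact h0 h'
  · exact h1 ⟨hs, h⟩

lemma rpow_neg_sub_rpow_neg_ge {δ x : ℝ} (hδ : 0 ≤ δ) (hx : 0 < x) :
    δ * (x + 1) ^ (-1 - δ) ≤ x ^ (-δ) - (x + 1) ^ (-δ) := by
  have h1 : x ^ (-δ) = (x + 1) ^ (-δ) * (x / (x + 1)) ^ (-δ) := by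
    rw [← Real.mul_rpow (by positivity) (by positivity)]
    congr 1; field_simp
  have h2 : 1 + δ / (x + 1) ≤ (x / (x + 1)) ^ (-δ) := by
    rw [Real.rpow_def_of_pos (by positivity)]
    have h3 : Real.log (x / (x + 1)) ≤ -(1 / (x + 1)) := by
      have := Real.log_le_sub_one_of_pos (show 0 < x / (x + 1) by positivity)
      have e : x / (x + 1) - 1 = -(1 / (x + 1)) := by field_simp; ring
      linarith
    have h4 := Real.add_one_le_exp (Real.log (x / (x + 1)) * -δ)
    have h5 : δ / (x + 1) = δ * (1 / (x + 1)) := by ring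
    nlinarith
  have h6 : (x + 1) ^ (-1 - δ) = (x + 1) ^ (-δ) * (1 / (x + 1)) := by
    rw [show -1 - δ = -δ + -1 by ring, Real.rpow_add (by positivity), Real.rpow_neg_one,
      one_div]
  have h7 := mul_le_mul_of_nonneg_left h2 (show 0 ≤ (x + 1) ^ (-δ) by positivity)
  rw [h1, h6]
  have h8 : δ / (x + 1) = δ * (1 / (x + 1)) := by ring
  rw [h8] at h7
  linarith

/-- Bound for the partial sums of the Dirichlet series of zeta to the right of the pole. -/
lemma sum_rpow_neg_one_sub_le {δ : ℝ} (hδ : 0 < δ) (n : ℕ) :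
    ∑ i ∈ range n, ((i : ℝ) + 1) ^ (-1 - δ) ≤ 1 + 1 / δ := by
  have key : ∀ n : ℕ, ∑ i ∈ range (n + 1), ((i : ℝ) + 1) ^ (-1 - δ) ≤
      1 + 1 / δ - 1 / δ * ((n : ℝ) + 1) ^ (-δ) := by
    intro n
    induction n with
    | zero => simp
    | succ n ih =>
      rw [sum_range_succ]
      have := rpow_neg_sub_rpow_neg_ge hδ.le (x := (n : ℝ) + 1) (by positivity)
      push_cast
      have h2 : 1 / δ * (δ * ((n : ℝ) + 1 + 1) ^ (-1 - δ)) ≤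
        1 / δ * (((n : ℝ) + 1) ^ (-δ) - ((n : ℝ) + 1 + 1) ^ (-δ)) := by gcongr
      rw [← mul_assoc, one_div_mul_cancel hδ.ne', one_mul, mul_sub] at h2
      linarith
  cases n with
  | zero => simp; positivity
  | succ n =>
    refine (key n).trans (sub_le_self _ (by positivity))

lemma one_add_pow_three_mul_exp_le {x : ℝ} (hx : 0 ≤ x) :
    (1 + x) ^ 3 * Real.exp (-x ^ 2) ≤ Real.exp 3 := by
  have h1 : (1 + x) ^ 3 ≤ Real.exp (3 * x) := by
    rw [mul_comm, Real.exp_mul, Real.rpow_ofNat]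
    gcongr
    linarith [Real.add_one_le_exp x]
  calc _ ≤ Real.exp (3 * x) * Real.exp (-x ^ 2) := by gcongr
    _ = Real.exp (3 * x - x ^ 2) := by rw [← Real.exp_add]; ring_nf
    _ ≤ _ := by gcongr; nlinarith [sq_nonneg (x - 3 / 2)]

/-- A convexity bound in the critical strip for a function with the growth of a degree one
zeta function multiplied by `s - 1`. -/
theorem exists_convexity_bound {g : ℂ → ℂ} {A C : ℝ} (hC : 0 ≤ C)
    (hg : ∀ s : ℂ, -1 < s.re → DifferentiableAt ℂ g s)
    (hA : ∀ s : ℂ, -(3 / 4) ≤ s.re → s.re ≤ 7 / 4 → ‖g s‖ ≤ A * Real.exp (A * |s.im|))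
    (hr : ∀ δ y : ℝ, 0 < δ → δ ≤ 3 / 4 → ‖g ((1 + δ : ℝ) + y * I)‖ ≤ C / δ * (1 + |y|))
    (hl : ∀ δ y : ℝ, 0 < δ → δ ≤ 3 / 4 →
      ‖g ((-δ : ℝ) + y * I)‖ ≤ C / δ * (1 + |y|) ^ (3 / 2 + δ)) :
    ∃ K : ℝ, 0 < K ∧ ∀ t u : ℝ, 2 * Real.pi ≤ t → 0 ≤ u → u ≤ 1 + 1 / Real.log t →
      ‖g (u + t * I)‖ ≤ K * t ^ (1 + (1 - u) / 2) * Real.log t := by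
  have hA0 : 0 ≤ A := by
    have := (norm_nonneg _).trans (hA 0 (by simp; norm_num) (by simp; norm_num))
    simpa using this
  refine ⟨8 * Real.exp 8 * C + 1, by positivity, fun t u ht hu hu1 => ?_⟩
  have ht6 : 6 ≤ t := by linarith [Real.pi_gt_three]
  have ht0 : 0 < t := by linarith
  have hlog : 4 / 3 ≤ Real.log t := by
    rw [Real.le_log_iff_exp_le ht0]
    refine le_trans ?_ ht6
    have h1 : Real.exp (4 / 3) ^ 3 = Real.exp 1 ^ 4 := by
      rw [← Real.exp_nat_mul, ← Real.exp_nat_mul]; norm_num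
    have h2 : Real.exp 1 ^ 4 ≤ 2.72 ^ 4 :=
      pow_le_pow_left₀ (Real.exp_pos 1).le (by linarith [Real.exp_one_lt_d9]) 4
    refine le_of_pow_le_pow_left₀ (n := 3) (by norm_num) (by norm_num) ?_
    rw [h1]; exact h2.trans (by norm_num)
  have hlog0 : 0 < Real.log t := by linarith
  obtain ⟨δ, hδ⟩ : ∃ δ, δ = 1 / Real.log t := ⟨_, rfl⟩
  have hδ0 : 0 < δ := by rw [hδ]; positivity
  have hδ1 : δ ≤ 3 / 4 := by
    rw [hδ, div_le_iff₀ hlog0]; linarith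
  have htδ : t ^ (δ / 2) ≤ Real.exp 1 := by
    rw [Real.rpow_def_of_pos ht0, hδ]
    gcongr
    field_simp; norm_num
  set f : ℂ → ℂ := fun z => g z * exp ((z - t * I) ^ 2) * (t : ℂ) ^ ((z - 1) / 2) with hf
  have hexp : ∀ z : ℂ, ‖exp ((z - t * I) ^ 2)‖ = Real.exp (z.re ^ 2 - (z.im - t) ^ 2) := by
    intro z
    rw [norm_exp]; congr 1
    simp [pow_two]
  have hpow : ∀ z : ℂ, ‖(t : ℂ) ^ ((z - 1) / 2)‖ = t ^ ((z.re - 1) / 2) := by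
    intro z
    rw [norm_cpow_eq_rpow_re_of_pos ht0]; simp
  have hnf : ∀ z, ‖f z‖ = ‖g z‖ * Real.exp (z.re ^ 2 - (z.im - t) ^ 2) * t ^ ((z.re - 1) / 2) := by
    intro z
    rw [hf, norm_mul, norm_mul, hexp, hpow]
  have hfd : ∀ s : ℂ, -1 < s.re → DifferentiableAt ℂ f s := fun s hs => by
    have h1 : DifferentiableAt ℂ (fun z : ℂ => (t : ℂ) ^ ((z - 1) / 2)) s :=
      (by fun_prop : DifferentiableAt ℂ (fun z : ℂ => (z - 1) / 2) s).const_cpow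
        (Or.inl (ofReal_ne_zero.2 ht0.ne'))
    have h2 : DifferentiableAt ℂ (fun z : ℂ => exp ((z - t * I) ^ 2)) s := by fun_prop
    exact ((hg s hs).mul h2).mul h1
  have hy : ∀ y : ℝ, 1 + |y| ≤ 2 * t * (1 + |y - t|) := fun y => by
    have h1 : |y| ≤ |y - t| + t := by
      have := abs_add_le (y - t) t
      rwa [sub_add_cancel, abs_of_pos ht0] at this
    nlinarith [abs_nonneg (y - t)]
  have hsq : ∀ y v : ℝ, v ^ 2 ≤ 4 →
      (1 + |y - t|) ^ 3 * Real.exp (v ^ 2 - (y - t) ^ 2) ≤ Real.exp 7 := fun y v hv => by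
    have h1 := one_add_pow_three_mul_exp_le (abs_nonneg (y - t))
    rw [sq_abs] at h1
    calc _ = (1 + |y - t|) ^ 3 * Real.exp (-(y - t) ^ 2) * Real.exp (v ^ 2) := by
          rw [mul_assoc, ← Real.exp_add]; ring_nf
      _ ≤ Real.exp 3 * Real.exp 4 := by gcongr
      _ = _ := by rw [← Real.exp_add]; norm_num
  have hM : ‖f (u + t * I)‖ ≤ C / δ * (8 * t * Real.exp 8) := by
    have e8 : Real.exp 8 = Real.exp 7 * Real.exp 1 := by rw [← Real.exp_add]; norm_num
    refine PhragmenLindelof.vertical_strip (a := -δ) (b := 1 + δ) ?_ ?_ ?_ ?_ ?_ ?_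
    · refine DifferentiableOn.diffContOnCl fun s hs => (hfd s ?_).differentiableWithinAt
      have h1 : closure (re ⁻¹' Set.Ioo (-δ) (1 + δ)) ⊆ re ⁻¹' Set.Icc (-δ) (1 + δ) :=
        closure_minimal (Set.preimage_mono Set.Ioo_subset_Icc_self)
          (isClosed_Icc.preimage continuous_re)
      have := (h1 hs).1
      linarith
    · refine ⟨1, ?_, A, ?_⟩
      · rw [lt_div_iff₀ (by linarith)]; linarith [Real.pi_gt_three]
      · refine Asymptotics.IsBigO.of_bound (A * Real.exp 4 * t) ?_
        refine (Filter.eventually_principal.2 fun z hz => ?_).filter_mono inf_le_right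
        have hz1 : -δ < z.re := hz.1
        have hz2 : z.re < 1 + δ := hz.2
        have h1 := hA z (by linarith) (by linarith)
        have h2 : Real.exp (z.re ^ 2 - (z.im - t) ^ 2) ≤ Real.exp 4 := by
          gcongr; nlinarith [sq_nonneg (z.im - t)]
        have h3 : t ^ ((z.re - 1) / 2) ≤ t := by
          conv_rhs => rw [← Real.rpow_one t]
          exact Real.rpow_le_rpow_of_exponent_le (by linarith) (by linarith)
        have h4 : Real.exp (A * |z.im|) ≤ ‖Real.exp (A * Real.exp (1 * |z.im|))‖ := by
          rw [Real.norm_eq_abs, Real.abs_exp, one_mul]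
          gcongr
          linarith [Real.add_one_le_exp |z.im|]
        rw [hnf]
        calc _ ≤ A * Real.exp (A * |z.im|) * Real.exp 4 * t := by gcongr
          _ = A * Real.exp 4 * t * Real.exp (A * |z.im|) := by ring
          _ ≤ _ := by gcongr
    · intro z hz
      have h1 := hl δ z.im hδ0 hδ1
      rw [← hz, re_add_im] at h1
      rw [hnf]
      have h2 : (1 + |z.im|) ^ (3 / 2 + δ) ≤ 8 * t ^ (3 / 2 + δ) * (1 + |z.im - t|) ^ 3 := by
        calc (1 + |z.im|) ^ (3 / 2 + δ) ≤ (2 * t * (1 + |z.im - t|)) ^ (3 / 2 + δ) :=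
              Real.rpow_le_rpow (by positivity) (hy _) (by positivity)
          _ = 2 ^ (3 / 2 + δ) * t ^ (3 / 2 + δ) * (1 + |z.im - t|) ^ (3 / 2 + δ) := by
              rw [Real.mul_rpow (by positivity) (by positivity),
                Real.mul_rpow (by positivity) (by positivity)]
          _ ≤ 2 ^ (3 : ℝ) * t ^ (3 / 2 + δ) * (1 + |z.im - t|) ^ (3 : ℝ) := by
              gcongr
              · norm_num
              · linarith
              · linarith [abs_nonneg (z.im - t)]
              · linarith
          _ = _ := by norm_num
      have h3 : t ^ (3 / 2 + δ) * t ^ ((z.re - 1) / 2) ≤ t * Real.exp 1 := by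
        rw [hz, ← Real.rpow_add ht0, show 3 / 2 + δ + (-δ - 1) / 2 = 1 + δ / 2 by ring,
          Real.rpow_add ht0, Real.rpow_one]
        gcongr
      calc _ ≤ C / δ * (8 * t ^ (3 / 2 + δ) * (1 + |z.im - t|) ^ 3) *
            Real.exp (z.re ^ 2 - (z.im - t) ^ 2) * t ^ ((z.re - 1) / 2) := by
            gcongr; exact h1.trans (by gcongr)
        _ = C / δ * (8 * (t ^ (3 / 2 + δ) * t ^ ((z.re - 1) / 2)) * ((1 + |z.im - t|) ^ 3 *
            Real.exp (z.re ^ 2 - (z.im - t) ^ 2))) := by ring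
        _ ≤ C / δ * (8 * (t * Real.exp 1) * Real.exp 7) := by
            gcongr
            exact hsq _ _ (by rw [hz]; nlinarith)
        _ = _ := by rw [e8]; ring
    · intro z hz
      have h1 := hr δ z.im hδ0 hδ1
      rw [← hz, re_add_im] at h1
      rw [hnf]
      have h2 : 1 + |z.im| ≤ 8 * t * (1 + |z.im - t|) ^ 3 := by
        refine (hy _).trans ?_
        have h4 : 1 + |z.im - t| ≤ (1 + |z.im - t|) ^ 3 :=
          le_self_pow₀ (by linarith [abs_nonneg (z.im - t)]) (by norm_num)
        calc 2 * t * (1 + |z.im - t|) ≤ 8 * t * (1 + |z.im - t|) := by gcongr; norm_num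
          _ ≤ _ := by gcongr
      have h3 : t ^ ((z.re - 1) / 2) ≤ Real.exp 1 := by
        rw [hz, show (1 + δ - 1) / 2 = δ / 2 by ring]; exact htδ
      calc _ ≤ C / δ * (8 * t * (1 + |z.im - t|) ^ 3) *
            Real.exp (z.re ^ 2 - (z.im - t) ^ 2) * Real.exp 1 := by
            gcongr; exact h1.trans (by gcongr)
        _ = C / δ * (8 * t * ((1 + |z.im - t|) ^ 3 *
            Real.exp (z.re ^ 2 - (z.im - t) ^ 2)) * Real.exp 1) := by ring
        _ ≤ C / δ * (8 * t * Real.exp 7 * Real.exp 1) := by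
            gcongr
            exact hsq _ _ (by rw [hz]; nlinarith)
        _ = _ := by rw [e8]; ring
    · simp; linarith
    · simp; linarith
  rw [hnf] at hM
  simp only [add_re, ofReal_re, mul_re, I_re, mul_zero, ofReal_im, I_im, mul_one, sub_self,
    add_zero, add_im, mul_im, zero_add, zero_pow two_ne_zero, sub_zero] at hM
  have h1 : ‖g (u + t * I)‖ * t ^ ((u - 1) / 2) ≤ C / δ * (8 * t * Real.exp 8) := by
    refine le_trans ?_ hM
    gcongr
    exact le_mul_of_one_le_right (norm_nonneg _) (Real.one_le_exp (by positivity))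
  have h2 : t ^ ((u - 1) / 2) * t ^ ((1 - u) / 2) = 1 := by
    rw [← Real.rpow_add ht0, show (u - 1) / 2 + (1 - u) / 2 = 0 by ring, Real.rpow_zero]
  calc ‖g (u + t * I)‖ = ‖g (u + t * I)‖ * t ^ ((u - 1) / 2) * t ^ ((1 - u) / 2) := by
        rw [mul_assoc, h2, mul_one]
    _ ≤ C / δ * (8 * t * Real.exp 8) * t ^ ((1 - u) / 2) := by gcongr
    _ = 8 * Real.exp 8 * C * t ^ (1 + (1 - u) / 2) * Real.log t := by
        rw [Real.rpow_add ht0, Real.rpow_one, hδ]; field_simp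
    _ ≤ _ := by gcongr; linarith

/-- A series of the shape `∑ β_k (k + b)^{-s}` with unimodular coefficients is bounded by
`O(1 / δ)` on the line `re s = 1 + δ`. -/
lemma norm_le_of_hasSum_dirichlet {b δ : ℝ} (hb : 0 < b) (hδ : 0 < δ) (hδ1 : δ ≤ 1)
    {β : ℕ → ℂ} (hβ : ∀ k, ‖β k‖ = 1) {s D : ℂ} (hs : s.re = 1 + δ)
    (h : HasSum (fun k : ℕ => β k * ((k + b : ℝ) : ℂ) ^ (-s)) D) :
    ‖D‖ ≤ (b ^ (-2 : ℝ) + 3) / δ := by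
  refine le_of_tendsto h.tendsto_sum_nat.norm (Eventually.of_forall fun n => ?_)
  have hterm : ∀ k : ℕ, ‖β k * ((k + b : ℝ) : ℂ) ^ (-s)‖ = (k + b) ^ (-1 - δ) := fun k => by
    rw [norm_mul, hβ, one_mul, norm_cpow_eq_rpow_re_of_pos (by positivity)]
    congr 1; simp [hs]; ring
  have hb2 : b ^ (-1 - δ) ≤ b ^ (-2 : ℝ) + 1 := by
    rcases le_or_gt b 1 with hb1 | hb1
    · have := Real.rpow_le_rpow_of_exponent_ge hb hb1 (show -2 ≤ -1 - δ by linarith)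
      linarith
    · have := Real.rpow_le_one_of_one_le_of_nonpos hb1.le (show -1 - δ ≤ 0 by linarith)
      have : 0 < b ^ (-2 : ℝ) := by positivity
      linarith
  refine (norm_sum_le _ _).trans ?_
  simp only [hterm]
  have h1 : ∑ k ∈ range n, ((k : ℝ) + b) ^ (-1 - δ) ≤
      b ^ (-1 - δ) + ∑ k ∈ range n, ((k : ℝ) + 1) ^ (-1 - δ) := by
    cases n with
    | zero => simp; positivity
    | succ n =>
      rw [sum_range_succ', add_comm]
      simp only [Nat.cast_zero, zero_add]
      gcongr
      refine (sum_le_sum fun k _ => ?_).trans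
        (sum_le_sum_of_subset_of_nonneg (range_subset_range.2 n.le_succ)
          fun _ _ _ => by positivity)
      push_cast
      exact Real.rpow_le_rpow_of_nonpos (by positivity) (by linarith) (by linarith)
  have h2 := sum_rpow_neg_one_sub_le hδ n
  have h3 : 1 ≤ 1 / δ := by rw [le_div_iff₀ hδ]; linarith
  have h4 : 0 < b ^ (-2 : ℝ) := by positivity
  calc _ ≤ b ^ (-2 : ℝ) + 1 + (1 + 1 / δ) := by linarith
    _ ≤ (b ^ (-2 : ℝ) + 3) * (1 / δ) := by nlinarith
    _ = _ := by ring

lemma hasSum_hurwitzZeta {b : ℝ} (hb : 0 < b) (hb1 : b ≤ 1) {s : ℂ} (hs : 1 < s.re) :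
    HasSum (fun k : ℕ => (1 : ℂ) * ((k + b : ℝ) : ℂ) ^ (-s))
      (HurwitzZeta.hurwitzZeta (b : UnitAddCircle) s) := by
  refine (HurwitzZeta.hasSum_hurwitzZeta_of_one_lt_re ⟨hb.le, hb1⟩ hs).congr_fun fun k => ?_
  rw [cpow_neg, one_mul, one_div]; push_cast; rfl

lemma hasSum_expZeta (a : ℝ) {s : ℂ} (hs : 1 < s.re) :
    HasSum (fun k : ℕ => unitExp (a * (k + 1)) * ((k + (1 : ℝ) : ℝ) : ℂ) ^ (-s))
      (HurwitzZeta.expZeta (a : UnitAddCircle) s) := by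
  have h := HurwitzZeta.hasSum_expZeta_of_one_lt_re a hs
  rw [← hasSum_nat_add_iff' 1] at h
  have h0 : s ≠ 0 := by rintro rfl; simp at hs; linarith
  simp only [range_one, sum_singleton, Nat.cast_zero, zero_cpow h0, div_zero, sub_zero] at h
  refine h.congr_fun fun k => ?_
  rw [cpow_neg, unitExp, div_eq_mul_inv]
  push_cast
  ring_nf

lemma exists_norm_hurwitzZeta_le {b : ℝ} (hb : 0 < b) (hb1 : b ≤ 1) : ∃ C : ℝ, 0 < C ∧
    ∀ (δ : ℝ) (s : ℂ), 0 < δ → δ ≤ 1 → s.re = 1 + δ →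
      ‖HurwitzZeta.hurwitzZeta (b : UnitAddCircle) s‖ ≤ C / δ :=
  ⟨b ^ (-2 : ℝ) + 3, by positivity, fun _ s hδ hδ1 hs => norm_le_of_hasSum_dirichlet hb hδ hδ1
    (β := fun _ => 1) (fun _ => norm_one) hs (hasSum_hurwitzZeta hb hb1 (by linarith))⟩

lemma norm_expZeta_le (a : ℝ) {δ : ℝ} {s : ℂ} (hδ : 0 < δ) (hδ1 : δ ≤ 1) (hs : s.re = 1 + δ) :
    ‖HurwitzZeta.expZeta (a : UnitAddCircle) s‖ ≤ 4 / δ := by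
  have := norm_le_of_hasSum_dirichlet one_pos hδ hδ1 (fun _ => norm_unitExp _) hs
    (hasSum_expZeta a (by linarith))
  norm_num at this
  exact this

lemma norm_exp_pi_mul_I_le (s : ℂ) : ‖exp (Real.pi * I * s / 2)‖ ≤ Real.exp (Real.pi * |s.im| / 2) ∧
    ‖exp (-Real.pi * I * s / 2)‖ ≤ Real.exp (Real.pi * |s.im| / 2) := by
  rw [norm_exp, norm_exp]
  have h1 : (Real.pi * I * s / 2).re = -(Real.pi * s.im / 2) := by simp; ring
  have h2 : (-Real.pi * I * s / 2).re = Real.pi * s.im / 2 := by simp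
  rw [h1, h2]
  constructor
  · gcongr
    nlinarith [neg_abs_le s.im, Real.pi_pos]
  · gcongr
    exact le_abs_self _

/-- The Gamma factor in the functional equations, to the right of `re s = 1`. -/
lemma exists_norm_functional_le : ∃ C : ℝ, 0 < C ∧ ∀ (s A B : ℂ) (M : ℝ), 1 ≤ s.re → s.re ≤ 2 →
    ‖A‖ ≤ M → ‖B‖ ≤ M →
    ‖(2 * Real.pi : ℂ) ^ (-s) * Gamma s *
      (exp (Real.pi * I * s / 2) * A + exp (-Real.pi * I * s / 2) * B)‖ ≤
      C * M * (1 + |s.im|) ^ (s.re - 1 / 2) := by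
  obtain ⟨C, hC, h⟩ := exists_norm_Gamma_mul_exp_le
  refine ⟨2 * C, by positivity, fun s A B M h1 h2 hA hB => ?_⟩
  have hM : 0 ≤ M := (norm_nonneg _).trans hA
  have h3 := h s.re h1 h2 s.im
  rw [re_add_im] at h3
  have h4 : ‖(2 * Real.pi : ℂ) ^ (-s)‖ ≤ 1 := by
    rw [show (2 * Real.pi : ℂ) = ((2 * Real.pi : ℝ) : ℂ) by push_cast; rfl,
      norm_cpow_eq_rpow_re_of_pos (by positivity)]
    exact Real.rpow_le_one_of_one_le_of_nonpos (by linarith [Real.pi_gt_three])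
      (by simp; linarith)
  obtain ⟨e1, e2⟩ := norm_exp_pi_mul_I_le s
  calc _ ≤ 1 * ‖Gamma s‖ * (Real.exp (Real.pi * |s.im| / 2) * M +
        Real.exp (Real.pi * |s.im| / 2) * M) := by
        rw [norm_mul, norm_mul]
        gcongr
        refine (norm_add_le _ _).trans ?_
        rw [norm_mul, norm_mul]
        gcongr
    _ = 2 * M * (‖Gamma s‖ * Real.exp (Real.pi * |s.im| / 2)) := by ring
    _ ≤ 2 * M * (C * (1 + |s.im|) ^ (s.re - 1 / 2)) := by gcongr
    _ = _ := by ring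

/-- The entire (in `re s > -1`) function `(s - 1) ζ(s, b)`. -/
noncomputable def subOneMulHurwitz (b : ℝ) (s : ℂ) : ℂ :=
  (s - 1) * (∑ k ∈ range 1, ((k + b : ℝ) : ℂ) ^ (-s) +
    (1 - Real.smoothTransition b) * (((1 : ℕ) + b : ℝ) : ℂ) ^ (-s) -
      emRemainder b (1 : ℕ) s) + cutMass (1 : ℕ) s

lemma subOneMulHurwitz_eq {b : ℝ} (hb : 0 < b) (hb1 : b ≤ 1) {s : ℂ} (hs : -1 < s.re)
    (hs1 : s ≠ 1) :
    subOneMulHurwitz b s = (s - 1) * HurwitzZeta.hurwitzZeta (b : UnitAddCircle) s := by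
  rw [hurwitzZeta_eq hb hb1 one_pos hs hs1, subOneMulHurwitz]
  have : s - 1 ≠ 0 := sub_ne_zero.2 hs1
  field_simp
  ring

lemma differentiableAt_subOneMulHurwitz {b : ℝ} (hb : 0 < b) {s : ℂ} (hs : -1 < s.re) :
    DifferentiableAt ℂ (subOneMulHurwitz b) s := by
  have hpow : ∀ x : ℝ, 0 < x → DifferentiableAt ℂ (fun s : ℂ => (x : ℂ) ^ (-s)) s := fun x hx =>
    (differentiableAt_id.neg).const_cpow (Or.inl (ofReal_ne_zero.2 hx.ne'))
  have e1 : DifferentiableAt ℂ (fun s : ℂ => ∑ k ∈ range 1, ((k + b : ℝ) : ℂ) ^ (-s)) s :=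
    DifferentiableAt.fun_sum fun k _ => hpow _ (by positivity)
  have e2 := (hpow ((1 : ℕ) + b) (by positivity)).const_mul (1 - Real.smoothTransition b : ℂ)
  have e3 := differentiableAt_emRemainder (N := (1 : ℕ)) (by norm_num) b hs
  have e4 := differentiable_cutMass (N := (1 : ℕ)) (by norm_num) s
  have e0 : DifferentiableAt ℂ (fun s : ℂ => s - 1) s := by fun_prop
  exact (e0.mul ((e1.add e2).sub e3)).add e4

lemma four_add_pow_three_le {x : ℝ} (hx : 0 ≤ x) : (4 + x) ^ 3 ≤ 64 * Real.exp (3 * x) := by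
  have h1 : (1 + x) ^ 3 ≤ Real.exp (3 * x) := by
    rw [mul_comm, Real.exp_mul, Real.rpow_ofNat]
    gcongr
    linarith [Real.add_one_le_exp x]
  calc (4 + x) ^ 3 ≤ (4 * (1 + x)) ^ 3 := by gcongr; linarith
    _ = 64 * (1 + x) ^ 3 := by ring
    _ ≤ _ := by gcongr

lemma exists_norm_subOneMulHurwitz_le {b : ℝ} (hb : 0 < b) (hb1 : b ≤ 1) : ∃ A : ℝ, 3 ≤ A ∧
    ∀ s : ℂ, -(3 / 4) ≤ s.re → s.re ≤ 7 / 4 →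
      ‖subOneMulHurwitz b s‖ ≤ A * Real.exp (A * |s.im|) := by
  obtain ⟨C, hC, hcut⟩ := exists_norm_cutPow2_le (1 : ℕ)
  obtain ⟨K, hK1, hK, -⟩ := exists_bound_transDeriv
  set E := ∑' n, emCoeff n
  have hE : 0 ≤ E := tsum_nonneg emCoeff_nonneg
  refine ⟨64 * (b ^ (-2 : ℝ) + 4 + 4 * C * E + 4 * K) + 3, by
    have : 0 < b ^ (-2 : ℝ) := by positivity
    nlinarith [mul_nonneg hC.le hE], fun s h1 h2 => ?_⟩
  have hs : ‖s‖ ≤ 2 + |s.im| := by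
    refine (norm_le_abs_re_add_abs_im s).trans ?_
    gcongr
    rw [abs_le]; constructor <;> linarith
  have n1 : ‖((((0 : ℕ) : ℝ) + b : ℝ) : ℂ) ^ (-s)‖ ≤ b ^ (-2 : ℝ) + 2 := by
    rw [norm_cpow_eq_rpow_re_of_pos (by positivity)]
    simp only [Nat.cast_zero, zero_add, neg_re]
    have := Real.rpow_le_rpow_of_exponent_ge hb hb1 (show -2 ≤ -s.re by linarith)
    linarith
  have n2 : ‖(1 - Real.smoothTransition b : ℂ) * (((1 : ℕ) + b : ℝ) : ℂ) ^ (-s)‖ ≤ 2 := by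
    rw [norm_mul, norm_cpow_eq_rpow_re_of_pos (by positivity), ← ofReal_one, ← ofReal_sub,
      norm_real, Real.norm_eq_abs, abs_of_nonneg (by linarith [Real.smoothTransition.le_one b])]
    calc _ ≤ 1 * (2 : ℝ) ^ (1 : ℝ) := by
          gcongr
          · linarith [Real.smoothTransition.nonneg b]
          · calc (((1 : ℕ) + b : ℝ)) ^ (-s).re ≤ ((1 : ℕ) + b : ℝ) ^ (1 : ℝ) := by
                  apply Real.rpow_le_rpow_of_exponent_le
                  · push_cast; linarith
                  · simp; linarith
              _ ≤ _ := by gcongr; push_cast; linarith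
      _ = 2 := by norm_num
  have n3 : ‖emRemainder b (1 : ℕ) s‖ ≤ 4 * C * E * (4 + |s.im|) ^ 2 := by
    have hsub : emRemainder b (1 : ℕ) s =
        ∫ v in Set.Ioi (1 : ℝ), cutPow2 (1 : ℕ) s v * emKernel b v := by
      refine (setIntegral_eq_integral_of_forall_compl_eq_zero fun v hv => ?_).symm
      rw [cutPow2_of_le s (by simpa using hv), zero_mul]
    rw [hsub]
    have hi := integrableOn_Ioi_rpow_of_lt (show -s.re - 2 < -1 by linarith) one_pos
    refine (norm_integral_le_of_norm_le
      (hi.const_mul (C * (1 + ‖s‖) ^ 2 * E)) ?_).trans ?_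
    · refine (ae_restrict_iff' measurableSet_Ioi).2 (Eventually.of_forall fun v hv => ?_)
      have hv0 : (0 : ℝ) < v := lt_trans one_pos hv
      rw [norm_mul]
      calc _ ≤ C * (1 + ‖s‖) ^ 2 * v ^ (-s.re - 2) * E := by
            gcongr
            · exact hcut s v hv0
            · exact norm_emKernel_le b v
        _ = _ := by ring
    · rw [integral_const_mul, integral_Ioi_rpow_of_lt (by linarith) one_pos, Real.one_rpow]
      have h5 : -1 / (-s.re - 2 + 1) ≤ 4 := by
        rw [div_le_iff_of_neg (by linarith)]; linarith
      have h6 : 1 + ‖s‖ ≤ 4 + |s.im| := by linarith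
      have h7 : 0 ≤ -1 / (-s.re - 2 + 1) :=
        div_nonneg_of_nonpos (by norm_num) (by linarith)
      calc _ ≤ C * (4 + |s.im|) ^ 2 * E * 4 := by gcongr
        _ = _ := by ring
  have n4 : ‖cutMass (1 : ℕ) s‖ ≤ 4 * K := by
    rw [cutMass_eq (by norm_num)]
    have := intervalIntegral.norm_integral_le_of_norm_le_const (a := ((1 : ℕ) : ℝ))
      (b := (1 : ℕ) + 1) (C := 4 * K)
      (f := fun v : ℝ => (transDeriv (v - (1 : ℕ)) : ℂ) * (v : ℂ) ^ (1 - s)) ?_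
    · simpa using this
    · intro v hv
      rw [Set.uIoc_of_le (by linarith)] at hv
      have hv1 : (1 : ℝ) ≤ v := by have := hv.1; push_cast at this; linarith
      have hv2 : v ≤ 2 := by have := hv.2; push_cast at this; linarith
      rw [norm_mul, norm_cpow_eq_rpow_re_of_pos (by linarith), norm_real, Real.norm_eq_abs,
        mul_comm]
      gcongr
      · calc v ^ (1 - s).re ≤ v ^ (2 : ℝ) :=
              Real.rpow_le_rpow_of_exponent_le hv1 (by simp; linarith)
          _ ≤ 2 ^ (2 : ℝ) := by gcongr
          _ = 4 := by norm_num
      · exact hK _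
  have n5 : ‖s - 1‖ ≤ 4 + |s.im| := by
    have := norm_sub_le s 1
    rw [norm_one] at this; linarith
  have hx := abs_nonneg s.im
  have q1 : 1 ≤ 4 + |s.im| := by linarith
  have q2 : 1 ≤ (4 + |s.im|) ^ 2 := one_le_pow₀ q1
  have q3 : 1 ≤ (4 + |s.im|) ^ 3 := one_le_pow₀ q1
  have hbp : 0 < b ^ (-2 : ℝ) := by positivity
  calc ‖subOneMulHurwitz b s‖ ≤ (4 + |s.im|) * (b ^ (-2 : ℝ) + 2 + 2 +
        4 * C * E * (4 + |s.im|) ^ 2) + 4 * K := by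
        rw [subOneMulHurwitz, sum_range_one]
        refine (norm_add_le _ _).trans ?_
        rw [norm_mul]
        gcongr
        refine (norm_sub_le _ _).trans ?_
        gcongr
        exact (norm_add_le _ _).trans (add_le_add n1 n2)
    _ ≤ (4 + |s.im|) * ((b ^ (-2 : ℝ) + 4) * (4 + |s.im|) ^ 2 +
        4 * C * E * (4 + |s.im|) ^ 2) + 4 * K * (4 + |s.im|) ^ 3 := by
        refine add_le_add ?_ (le_mul_of_one_le_right (by positivity) q3)
        gcongr
        nlinarith
    _ = (b ^ (-2 : ℝ) + 4 + 4 * C * E + 4 * K) * (4 + |s.im|) ^ 3 := by ring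
    _ ≤ (b ^ (-2 : ℝ) + 4 + 4 * C * E + 4 * K) * (64 * Real.exp (3 * |s.im|)) := by
        gcongr
        exact four_add_pow_three_le hx
    _ = 64 * (b ^ (-2 : ℝ) + 4 + 4 * C * E + 4 * K) * Real.exp (3 * |s.im|) := by ring
    _ ≤ _ := by
        gcongr
        · linarith
        · have : 0 ≤ C * E := by positivity
          nlinarith

lemma exists_convexity_hurwitz {b : ℝ} (hb : 0 < b) (hb1 : b ≤ 1) :
    ∃ K : ℝ, 0 < K ∧ ∀ t u : ℝ, 2 * Real.pi ≤ t → 0 ≤ u → u ≤ 1 + 1 / Real.log t →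
      ‖HurwitzZeta.hurwitzZeta (b : UnitAddCircle) (u + t * I)‖ ≤
        K * t ^ ((1 - u) / 2) * Real.log t := by
  obtain ⟨A, hA3, hA⟩ := exists_norm_subOneMulHurwitz_le hb hb1
  obtain ⟨C, hC, hright⟩ := exists_norm_hurwitzZeta_le hb hb1
  obtain ⟨F, hF, hfun⟩ := exists_norm_functional_le
  have hr : ∀ δ y : ℝ, 0 < δ → δ ≤ 3 / 4 →
      ‖subOneMulHurwitz b ((1 + δ : ℝ) + y * I)‖ ≤ (C + 2 * F * 4) / δ * (1 + |y|) := by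
    intro δ y hδ hδ1
    have hre : (((1 + δ : ℝ) : ℂ) + y * I).re = 1 + δ := by simp
    have hn : (((1 + δ : ℝ) : ℂ) + y * I) ≠ 1 := fun h0 => by
      rw [h0] at hre; simp at hre; linarith
    rw [subOneMulHurwitz_eq hb hb1 (by rw [hre]; linarith) hn, norm_mul]
    have h1 := hright δ _ hδ (by linarith) hre
    have h2 : ‖((1 + δ : ℝ) : ℂ) + y * I - 1‖ ≤ 1 + |y| := by
      refine (norm_le_abs_re_add_abs_im _).trans ?_
      simp [abs_of_pos hδ]; linarith
    calc _ ≤ (1 + |y|) * (C / δ) := by gcongr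
      _ = C / δ * (1 + |y|) := by ring
      _ ≤ _ := by gcongr; linarith
  have hl : ∀ δ y : ℝ, 0 < δ → δ ≤ 3 / 4 →
      ‖subOneMulHurwitz b ((-δ : ℝ) + y * I)‖ ≤
        (C + 2 * F * 4) / δ * (1 + |y|) ^ (3 / 2 + δ) := by
    intro δ y hδ hδ1
    have hre : (((-δ : ℝ) : ℂ) + y * I).re = -δ := by simp
    have hn : (((-δ : ℝ) : ℂ) + y * I) ≠ 1 := fun h0 => by
      rw [h0] at hre; simp at hre; linarith
    rw [subOneMulHurwitz_eq hb hb1 (by rw [hre]; linarith) hn, norm_mul]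
    have h2 : ‖((-δ : ℝ) : ℂ) + y * I - 1‖ ≤ 2 * (1 + |y|) := by
      refine (norm_le_abs_re_add_abs_im _).trans ?_
      have : |-δ - 1| ≤ 2 := by rw [abs_le]; constructor <;> linarith
      simp; linarith [abs_nonneg y]
    set s : ℂ := (1 + δ : ℝ) - y * I with hs
    have hsre : s.re = 1 + δ := by simp [hs]
    have hsim : |s.im| = |y| := by simp [hs]
    have e : ((-δ : ℝ) : ℂ) + y * I = 1 - s := by rw [hs]; push_cast; ring
    have h3 : ‖HurwitzZeta.hurwitzZeta (b : UnitAddCircle) (1 - s)‖ ≤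
        F * (4 / δ) * (1 + |y|) ^ (1 / 2 + δ) := by
      rw [HurwitzZeta.hurwitzZeta_one_sub _ (fun n h0 => by
        have := congrArg Complex.re h0
        simp [hsre] at this; linarith [(n.cast_nonneg : (0 : ℝ) ≤ n)]) (Or.inr fun h0 => by
        rw [h0] at hsre; simp at hsre; linarith), add_comm]
      have := hfun s (HurwitzZeta.expZeta (-(b : UnitAddCircle)) s)
        (HurwitzZeta.expZeta (b : UnitAddCircle) s) (4 / δ) (by linarith) (by linarith)
        (by have := norm_expZeta_le (-b) hδ (by linarith) hsre; simpa using this)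
        (norm_expZeta_le b hδ (by linarith) hsre)
      rw [hsim, hsre] at this
      refine this.trans_eq ?_
      congr 2; ring
    rw [e] at h2 ⊢
    calc _ ≤ 2 * (1 + |y|) * (F * (4 / δ) * (1 + |y|) ^ (1 / 2 + δ)) := by gcongr
      _ = 2 * F * 4 / δ * (1 + |y|) ^ (3 / 2 + δ) := by
        have h4 : (1 + |y|) ^ (3 / 2 + δ) = (1 + |y|) * (1 + |y|) ^ (1 / 2 + δ) := by
          rw [show 3 / 2 + δ = 1 + (1 / 2 + δ) by ring, Real.rpow_add (by positivity) 1,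
            Real.rpow_one]
        rw [h4]; ring
      _ ≤ _ := by gcongr; linarith
  obtain ⟨K, hK, h⟩ := exists_convexity_bound (by positivity)
    (fun s hs => differentiableAt_subOneMulHurwitz hb hs) hA hr hl
  refine ⟨K, hK, fun t u ht hu hu1 => ?_⟩
  have ht0 : 0 < t := by linarith [Real.pi_pos]
  have hn : ((u : ℂ) + t * I) ≠ 1 := fun h0 => by
    have := congrArg Complex.im h0; simp at this; linarith
  have h1 := h t u ht hu hu1
  rw [subOneMulHurwitz_eq hb hb1 (by simp; linarith) hn, norm_mul] at h1
  have h2 : t ≤ ‖(u : ℂ) + t * I - 1‖ := by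
    refine le_trans ?_ (abs_im_le_norm _)
    simp [abs_of_pos ht0]
  rw [Real.rpow_add ht0, Real.rpow_one] at h1
  refine le_of_mul_le_mul_left ?_ ht0
  calc _ ≤ _ := mul_le_mul_of_nonneg_right h2 (norm_nonneg _)
    _ ≤ _ := h1
    _ = _ := by ring

lemma norm_Gamma_le_of_one_le_im {s : ℂ} (hs : 1 ≤ |s.im|) : ‖Gamma s‖ ≤ ‖Gamma (s + 1)‖ := by
  have h0 : s ≠ 0 := by rintro rfl; simp at hs; linarith
  rw [Gamma_add_one s h0, norm_mul]
  exact le_mul_of_one_le_left (norm_nonneg _) (hs.trans (abs_im_le_norm s))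

lemma exists_norm_Gamma_le : ∃ C : ℝ, 0 < C ∧ ∀ s : ℂ, -(3 / 4) ≤ s.re → s.re ≤ 7 / 4 →
    1 ≤ |s.im| → ‖Gamma s‖ ≤ C * (4 + |s.im|) ^ 3 := by
  obtain ⟨C, hC, h⟩ := exists_norm_Gamma_mul_exp_le
  have key : ∀ s : ℂ, 1 ≤ s.re → s.re ≤ 2 → ‖Gamma s‖ ≤ C * (4 + |s.im|) ^ 3 := by
    intro s h1 h2
    have h3 := h s.re h1 h2 s.im
    rw [re_add_im] at h3
    calc ‖Gamma s‖ ≤ ‖Gamma s‖ * Real.exp (Real.pi * |s.im| / 2) :=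
          le_mul_of_one_le_right (norm_nonneg _) (Real.one_le_exp (by positivity))
      _ ≤ _ := h3
      _ ≤ C * (4 + |s.im|) ^ (3 : ℝ) := by
          gcongr
          calc (1 + |s.im|) ^ (s.re - 1 / 2) ≤ (1 + |s.im|) ^ (3 : ℝ) :=
                Real.rpow_le_rpow_of_exponent_le (by linarith [abs_nonneg s.im]) (by linarith)
            _ ≤ _ := by gcongr; norm_num
      _ = _ := by norm_num
  refine ⟨C, hC, fun s h1 h2 h3 => ?_⟩
  rcases le_or_gt 1 s.re with h4 | h4
  · exact key s h4 (by linarith)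
  · have h5 := norm_Gamma_le_of_one_le_im h3
    rcases le_or_gt 0 s.re with h6 | h6
    · have := key (s + 1) (by simp; linarith) (by simp; linarith)
      simp only [add_im, one_im, add_zero] at this
      exact h5.trans this
    · have h7 := norm_Gamma_le_of_one_le_im (s := s + 1) (by simpa using h3)
      have := key (s + 1 + 1) (by simp; linarith) (by simp; linarith)
      simp only [add_im, one_im, add_zero] at this
      exact h5.trans (h7.trans this)

lemma coe_one_sub_unitAddCircle (a : ℝ) : ((1 - a : ℝ) : UnitAddCircle) = -(a : UnitAddCircle) := by
  have h : ((1 : ℝ) : UnitAddCircle) = 0 := AddCircle.coe_period 1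
  rw [AddCircle.coe_sub, h, zero_sub]

lemma coe_ne_zero_unitAddCircle {a : ℝ} (ha : 0 < a) (ha1 : a < 1) : (a : UnitAddCircle) ≠ 0 := by
  intro h
  obtain ⟨n, hn⟩ := (AddCircle.coe_eq_zero_iff (1 : ℝ)).1 h
  simp at hn
  have h1 : (0 : ℤ) < n := by rw [← hn] at ha; exact_mod_cast ha
  have h2 : n < (1 : ℤ) := by rw [← hn] at ha1; exact_mod_cast ha1
  omega

lemma exists_norm_expZeta_growth {a : ℝ} (ha : 0 < a) (ha1 : a < 1) : ∃ A : ℝ, ∀ s : ℂ,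
    -(3 / 4) ≤ s.re → s.re ≤ 7 / 4 →
      ‖(s - 1) * HurwitzZeta.expZeta (a : UnitAddCircle) s‖ ≤ A * Real.exp (A * |s.im|) := by
  obtain ⟨A1, hA1, h1⟩ := exists_norm_subOneMulHurwitz_le ha ha1.le
  obtain ⟨A2, hA2, h2⟩ := exists_norm_subOneMulHurwitz_le (b := 1 - a) (by linarith) (by linarith)
  obtain ⟨G, hG, hGam⟩ := exists_norm_Gamma_le
  have hd := HurwitzZeta.differentiable_expZeta_of_ne_zero (coe_ne_zero_unitAddCircle ha ha1)
  have hcont : Continuous fun s : ℂ => (s - 1) * HurwitzZeta.expZeta (a : UnitAddCircle) s :=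
    (continuous_id.sub continuous_const).mul hd.continuous
  have hcomp : IsCompact (Set.Icc (-(3 / 4) : ℝ) (7 / 4) ×ℂ Set.Icc (-1 : ℝ) 1) :=
    isCompact_Icc.reProdIm isCompact_Icc
  obtain ⟨B, hB⟩ := hcomp.exists_bound_of_continuousOn hcont.continuousOn
  have hH : ∀ (b A0 : ℝ) (s : ℂ), 0 < b → b ≤ 1 →
      (∀ s : ℂ, -(3 / 4) ≤ s.re → s.re ≤ 7 / 4 →
        ‖subOneMulHurwitz b s‖ ≤ A0 * Real.exp (A0 * |s.im|)) →
      -(3 / 4) ≤ s.re → s.re ≤ 7 / 4 → 1 ≤ |s.im| →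
      ‖HurwitzZeta.hurwitzZeta (b : UnitAddCircle) s‖ ≤ A0 * Real.exp (A0 * |s.im|) := by
    intro b A0 s hb hb1 h0 hs hs' him
    have hn : s ≠ 1 := by rintro rfl; simp at him; linarith
    refine le_trans ?_ (h0 s hs hs')
    rw [subOneMulHurwitz_eq hb hb1 (by linarith) hn, norm_mul]
    refine le_mul_of_one_le_left (norm_nonneg _) (him.trans ?_)
    simpa using abs_im_le_norm (s - 1)
  set M := A1 + A2 + 6 with hM
  refine ⟨|B| + 4 * 7 * (G * 64) * (A1 + A2) + M, fun s hs hs' => ?_⟩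
  have hB0 := abs_nonneg B
  have hX : 0 ≤ 4 * 7 * (G * 64) * (A1 + A2) := by positivity
  have hM0 : 0 ≤ M := by linarith
  set A := |B| + 4 * 7 * (G * 64) * (A1 + A2) + M with hA
  have hA0 : 0 ≤ A := by linarith
  rcases le_or_gt 1 |s.im| with him | him
  · set w := 1 - s with hw
    have hwre : w.re = 1 - s.re := by simp [hw]
    have hwim : |w.im| = |s.im| := by simp [hw]
    have e : s = 1 - w := by rw [hw]; ring
    have hfe := HurwitzZeta.expZeta_one_sub (a : UnitAddCircle) (s := w) (fun n h0 => by
      have := congrArg Complex.im h0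
      simp at this; rw [← hwim, this] at him; simp at him; linarith)
    rw [← e] at hfe
    have k1 := hH a A1 w ha ha1.le h1 (by linarith) (by linarith) (by rwa [hwim])
    have k2 := hH (1 - a) A2 w (by linarith) (by linarith) h2 (by linarith) (by linarith)
      (by rwa [hwim])
    rw [coe_one_sub_unitAddCircle] at k2
    have k3 := hGam w (by linarith) (by linarith) (by rwa [hwim])
    obtain ⟨k4, k5⟩ := norm_exp_pi_mul_I_le w
    rw [hwim] at k1 k2 k3 k4 k5
    have k6 : ‖(2 * Real.pi : ℂ) ^ (-w)‖ ≤ 7 := by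
      rw [show (2 * Real.pi : ℂ) = ((2 * Real.pi : ℝ) : ℂ) by push_cast; rfl,
        norm_cpow_eq_rpow_re_of_pos (by positivity)]
      calc _ ≤ (2 * Real.pi) ^ (1 : ℝ) := Real.rpow_le_rpow_of_exponent_le
              (by linarith [Real.pi_gt_three]) (by simp; linarith)
        _ ≤ 7 := by rw [Real.rpow_one]; linarith [Real.pi_lt_d2]
    have hy := abs_nonneg s.im
    have k7 : ‖s - 1‖ ≤ 4 * Real.exp |s.im| := by
      refine (norm_le_abs_re_add_abs_im _).trans ?_
      have q : |(s - 1).re| ≤ 2 := by simp; rw [abs_le]; constructor <;> linarith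
      have q2 : |(s - 1).im| = |s.im| := by simp
      rw [q2]
      nlinarith [Real.add_one_le_exp |s.im|]
    have k8 : Real.exp (Real.pi * |s.im| / 2) ≤ Real.exp (2 * |s.im|) := by
      gcongr; nlinarith [Real.pi_lt_d2]
    have k9 : ‖Gamma w‖ ≤ G * (64 * Real.exp (3 * |s.im|)) :=
      k3.trans (by gcongr; exact four_add_pow_three_le hy)
    have k10 : ∀ c, c = A1 ∨ c = A2 → Real.exp (c * |s.im|) ≤ Real.exp ((A1 + A2) * |s.im|) := by
      rintro c (rfl | rfl) <;> gcongr <;> linarith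
    have k11 : ‖exp (Real.pi * I * w / 2) * HurwitzZeta.hurwitzZeta (a : UnitAddCircle) w +
        exp (-Real.pi * I * w / 2) * HurwitzZeta.hurwitzZeta (-(a : UnitAddCircle)) w‖ ≤
        Real.exp (2 * |s.im|) * ((A1 + A2) * Real.exp ((A1 + A2) * |s.im|)) := by
      refine (norm_add_le _ _).trans ?_
      rw [norm_mul, norm_mul]
      calc _ ≤ Real.exp (2 * |s.im|) * (A1 * Real.exp ((A1 + A2) * |s.im|)) +
            Real.exp (2 * |s.im|) * (A2 * Real.exp ((A1 + A2) * |s.im|)) := by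
            gcongr
            · exact k4.trans k8
            · exact k1.trans (by gcongr; linarith)
            · exact k5.trans k8
            · exact k2.trans (by gcongr; linarith)
        _ = _ := by ring
    rw [norm_mul, hfe, norm_mul, norm_mul]
    calc _ ≤ 4 * Real.exp |s.im| * (7 * (G * (64 * Real.exp (3 * |s.im|))) *
          (Real.exp (2 * |s.im|) * ((A1 + A2) * Real.exp ((A1 + A2) * |s.im|)))) := by gcongr
      _ = 4 * 7 * (G * 64) * (A1 + A2) * (Real.exp |s.im| * Real.exp (3 * |s.im|) *
          Real.exp (2 * |s.im|) * Real.exp ((A1 + A2) * |s.im|)) := by ring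
      _ = 4 * 7 * (G * 64) * (A1 + A2) * Real.exp (M * |s.im|) := by
          rw [← Real.exp_add, ← Real.exp_add, ← Real.exp_add, hM]; ring_nf
      _ ≤ A * Real.exp (A * |s.im|) := by gcongr <;> linarith
  · refine (hB s ⟨⟨hs, hs'⟩, ?_⟩).trans ?_
    · exact abs_le.1 him.le
    · calc B ≤ |B| := le_abs_self B
        _ ≤ A := by linarith
        _ ≤ _ := le_mul_of_one_le_right hA0 (Real.one_le_exp (by positivity))

lemma exists_convexity_expZeta {a : ℝ} (ha : 0 < a) (ha1 : a < 1) :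
    ∃ K : ℝ, 0 < K ∧ ∀ t u : ℝ, 2 * Real.pi ≤ t → 0 ≤ u → u ≤ 1 + 1 / Real.log t →
      ‖HurwitzZeta.expZeta (a : UnitAddCircle) (u + t * I)‖ ≤
        K * t ^ ((1 - u) / 2) * Real.log t := by
  obtain ⟨A, hA⟩ := exists_norm_expZeta_growth ha ha1
  obtain ⟨C1, hC1, h1⟩ := exists_norm_hurwitzZeta_le ha ha1.le
  obtain ⟨C2, hC2, h2⟩ := exists_norm_hurwitzZeta_le (b := 1 - a) (by linarith) (by linarith)
  obtain ⟨F, hF, hfun⟩ := exists_norm_functional_le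
  have hd := HurwitzZeta.differentiable_expZeta_of_ne_zero (coe_ne_zero_unitAddCircle ha ha1)
  have hr : ∀ δ y : ℝ, 0 < δ → δ ≤ 3 / 4 →
      ‖((1 + δ : ℝ) + y * I - 1) * HurwitzZeta.expZeta (a : UnitAddCircle) ((1 + δ : ℝ) + y * I)‖ ≤
        (4 + 2 * F * (C1 + C2)) / δ * (1 + |y|) := by
    intro δ y hδ hδ1
    have hre : (((1 + δ : ℝ) : ℂ) + y * I).re = 1 + δ := by simp
    have h1 := norm_expZeta_le a hδ (by linarith) hre
    have h2 : ‖((1 + δ : ℝ) : ℂ) + y * I - 1‖ ≤ 1 + |y| := by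
      refine (norm_le_abs_re_add_abs_im _).trans ?_
      simp [abs_of_pos hδ]; linarith
    rw [norm_mul]
    calc _ ≤ (1 + |y|) * (4 / δ) := by gcongr
      _ = 4 / δ * (1 + |y|) := by ring
      _ ≤ _ := by
        gcongr
        have : 0 ≤ 2 * F * (C1 + C2) := by positivity
        linarith
  have hl : ∀ δ y : ℝ, 0 < δ → δ ≤ 3 / 4 →
      ‖((-δ : ℝ) + y * I - 1) * HurwitzZeta.expZeta (a : UnitAddCircle) ((-δ : ℝ) + y * I)‖ ≤
        (4 + 2 * F * (C1 + C2)) / δ * (1 + |y|) ^ (3 / 2 + δ) := by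
    intro δ y hδ hδ1
    have n2 : ‖((-δ : ℝ) : ℂ) + y * I - 1‖ ≤ 2 * (1 + |y|) := by
      refine (norm_le_abs_re_add_abs_im _).trans ?_
      have : |-δ - 1| ≤ 2 := by rw [abs_le]; constructor <;> linarith
      simp; linarith [abs_nonneg y]
    set s : ℂ := (1 + δ : ℝ) - y * I with hs
    have hsre : s.re = 1 + δ := by simp [hs]
    have hsim : |s.im| = |y| := by simp [hs]
    have e : ((-δ : ℝ) : ℂ) + y * I = 1 - s := by rw [hs]; push_cast; ring
    have h3 : ‖HurwitzZeta.expZeta (a : UnitAddCircle) (1 - s)‖ ≤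
        F * ((C1 + C2) / δ) * (1 + |y|) ^ (1 / 2 + δ) := by
      rw [HurwitzZeta.expZeta_one_sub _ (fun n h0 => by
        have := congrArg Complex.re h0
        simp [hsre] at this; linarith [(n.cast_nonneg : (0 : ℝ) ≤ n)])]
      have q1 := h1 δ s hδ (by linarith) hsre
      have q2 := h2 δ s hδ (by linarith) hsre
      rw [coe_one_sub_unitAddCircle] at q2
      have := hfun s _ _ ((C1 + C2) / δ) (by linarith) (by linarith)
        (q1.trans (by gcongr; linarith)) (q2.trans (by gcongr; linarith))
      rw [hsim, hsre] at this
      refine this.trans_eq ?_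
      congr 2; ring
    rw [e] at n2 ⊢
    rw [norm_mul]
    calc _ ≤ 2 * (1 + |y|) * (F * ((C1 + C2) / δ) * (1 + |y|) ^ (1 / 2 + δ)) := by gcongr
      _ = 2 * F * (C1 + C2) / δ * (1 + |y|) ^ (3 / 2 + δ) := by
        have h4 : (1 + |y|) ^ (3 / 2 + δ) = (1 + |y|) * (1 + |y|) ^ (1 / 2 + δ) := by
          rw [show 3 / 2 + δ = 1 + (1 / 2 + δ) by ring, Real.rpow_add (by positivity) 1,
            Real.rpow_one]
        rw [h4]; ring
      _ ≤ _ := by gcongr; linarith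
  obtain ⟨K, hK, h⟩ := exists_convexity_bound
    (g := fun s => (s - 1) * HurwitzZeta.expZeta (a : UnitAddCircle) s) (by positivity)
    (fun s _ => (differentiableAt_id.sub_const 1).mul (hd s)) hA hr hl
  refine ⟨K, hK, fun t u ht hu hu1 => ?_⟩
  have ht0 : 0 < t := by linarith [Real.pi_pos]
  have h1 := h t u ht hu hu1
  rw [norm_mul] at h1
  have h2 : t ≤ ‖(u : ℂ) + t * I - 1‖ := by
    refine le_trans ?_ (abs_im_le_norm _)
    simp [abs_of_pos ht0]
  rw [Real.rpow_add ht0, Real.rpow_one] at h1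
  refine le_of_mul_le_mul_left ?_ ht0
  calc _ ≤ _ := mul_le_mul_of_nonneg_right h2 (norm_nonneg _)
    _ ≤ _ := h1
    _ = _ := by ring

/-- The height from which the term of index `k` (counted from `0`) enters the truncated sums. -/
noncomputable def tau (k : ℕ) : ℝ := 2 * Real.pi * ((k : ℝ) + 1) ^ 2

/-- The length of the truncated sums at height `t`. -/
noncomputable def cutN (t : ℝ) : ℕ := ⌊Real.sqrt (t / (2 * Real.pi))⌋₊

lemma lt_cutN_iff {k : ℕ} {t : ℝ} : k < cutN t ↔ tau k ≤ t := by
  have hpi := Real.two_pi_pos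
  have hk : (0 : ℝ) < (k : ℝ) + 1 := by positivity
  unfold cutN tau
  rw [← Nat.succ_le_iff, Nat.le_floor_iff (Real.sqrt_nonneg _), Nat.succ_eq_add_one, Nat.cast_add,
    Nat.cast_one, Real.le_sqrt' hk, le_div_iff₀ hpi, mul_comm]

lemma two_pi_le_tau (k : ℕ) : 2 * Real.pi ≤ tau k := by
  unfold tau
  have hk : (0 : ℝ) ≤ (k : ℝ) := by positivity
  nlinarith [Real.two_pi_pos, mul_nonneg Real.two_pi_pos.le hk,
      mul_nonneg Real.two_pi_pos.le (mul_nonneg hk hk)]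

lemma six_lt_two_pi : (6 : ℝ) < 2 * Real.pi := by linarith [Real.pi_gt_three]

lemma one_le_log_of_two_pi_le {T : ℝ} (hT : 2 * Real.pi ≤ T) : 1 ≤ Real.log T := by
  have h6 := six_lt_two_pi
  rw [Real.le_log_iff_exp_le (by linarith)]
  linarith [Real.exp_one_lt_d9]

lemma succ_le_sqrt_of_tau_le {k : ℕ} {T : ℝ} (h : tau k ≤ T) : (k : ℝ) + 1 ≤ Real.sqrt T := by
  apply Real.le_sqrt_of_sq_le
  unfold tau at h
  nlinarith [six_lt_two_pi, sq_nonneg ((k : ℝ) + 1)]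

lemma sub_div_le_log_div {x y : ℝ} (hy : 0 < y) (hx : 0 < x) : (x - y) / x ≤ Real.log (x / y) := by
  have := Real.one_sub_inv_le_log_of_pos (div_pos hx hy)
  rwa [inv_div, ← div_self hx.ne', ← sub_div] at this

lemma norm_integral_cpow_le {r : ℝ} (hr : 0 < r) (hr1 : r ≠ 1) (c p q : ℝ) :
    ‖∫ t in p..q, (r : ℂ) ^ ((c : ℂ) + t * I)‖ ≤ 2 * r ^ c / |Real.log r| := by
  have hl : Real.log r ≠ 0 := Real.log_ne_zero_of_pos_of_ne_one hr hr1
  have hl' : (Real.log r : ℂ) * I ≠ 0 := mul_ne_zero (by exact_mod_cast hl) I_ne_zero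
  have hf : ∀ t : ℝ, (r : ℂ) ^ ((c : ℂ) + t * I) =
      (r : ℂ) ^ (c : ℂ) * exp ((Real.log r : ℂ) * I * t) := by
    intro t
    have hrc : (r : ℂ) ≠ 0 := by exact_mod_cast hr.ne'
    rw [cpow_add _ _ hrc, cpow_def_of_ne_zero hrc (t * I), ← ofReal_log hr.le]
    congr 2; ring
  simp_rw [hf]
  rw [intervalIntegral.integral_const_mul, integral_exp_mul_complex hl', norm_mul, norm_div,
    norm_mul, norm_I, mul_one, norm_real, Real.norm_eq_abs,
    norm_cpow_eq_rpow_re_of_pos hr, ofReal_re]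
  have he : ∀ x : ℝ, ‖exp ((Real.log r : ℂ) * I * x)‖ = 1 := by
    intro x
    rw [show (Real.log r : ℂ) * I * x = ((Real.log r * x : ℝ) : ℂ) * I by push_cast; ring]
    exact norm_exp_ofReal_mul_I _
  have h2 : ‖exp ((Real.log r : ℂ) * I * q) - exp ((Real.log r : ℂ) * I * p)‖ ≤ 2 := by
    refine (norm_sub_le _ _).trans ?_
    rw [he, he]; norm_num
  rw [mul_comm (2 : ℝ), mul_div_assoc]
  gcongr

lemma sum_one_div_succ_le (n : ℕ) :
    ∑ j ∈ range n, 1 / ((j : ℝ) + 1) ≤ 1 + Real.log n := by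
  have := harmonic_le_one_add_log n
  rw [harmonic] at this
  push_cast at this
  simpa [one_div] using this

lemma sum_one_div_sub_le (n : ℕ) :
    ∑ j ∈ range n, 1 / ((n : ℝ) - j) ≤ 1 + Real.log n := by
  refine le_trans (le_of_eq ?_) (sum_one_div_succ_le n)
  rw [← sum_range_reflect]
  refine sum_congr rfl fun j hj => ?_
  have hj' : j + 1 ≤ n := mem_range.mp hj
  congr 1
  rw [show n - 1 - j = n - (j + 1) by omega, Nat.cast_sub hj']
  push_cast; ring

lemma sum_one_div_add_le {b : ℝ} (hb : 0 < b) (n : ℕ) :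
    ∑ j ∈ range n, 1 / ((j : ℝ) + b) ≤ 1 / b + 1 + Real.log n := by
  rcases n with _ | n
  · simp; positivity
  · rw [sum_range_succ']
    have h1 : ∑ j ∈ range n, 1 / (((j + 1 : ℕ) : ℝ) + b) ≤ ∑ j ∈ range n, 1 / ((j : ℝ) + 1) := by
      refine sum_le_sum fun j _ => ?_
      push_cast
      exact one_div_le_one_div_of_le (by positivity) (by linarith)
    have h2 := sum_one_div_succ_le n
    have h3 : Real.log n ≤ Real.log (n + 1 : ℕ) := by
      rcases Nat.eq_zero_or_pos n with rfl | hn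
      · simp
      · apply Real.log_le_log (by exact_mod_cast hn); push_cast; linarith
    simp only [Nat.cast_zero, zero_add]
    linarith

lemma sum_offDiag_le {b T : ℝ} (hb : 0 < b) (hT : 2 * Real.pi ≤ T) {k : ℕ} (hk : (k : ℝ) ≤ T) :
    ∑ j ∈ range k, (1 / ((j : ℝ) + b) + 1 / ((k : ℝ) - j)) ≤ (1 / b + 4) * Real.log T := by
  have hl := one_le_log_of_two_pi_le hT
  have hkl : Real.log k ≤ Real.log T := by
    rcases Nat.eq_zero_or_pos k with rfl | hn
    · simp; linarith
    · exact Real.log_le_log (by exact_mod_cast hn) hk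
  rw [sum_add_distrib]
  have h1 := sum_one_div_add_le hb k
  have h2 := sum_one_div_sub_le k
  have hb' : 0 ≤ 1 / b := by positivity
  nlinarith

/-- Distinct frequencies: the integral of `(x / y) ^ (c + it)` is small. -/
lemma norm_integral_div_cpow_le {x y : ℝ} (hx : 0 < x) (hy : 0 < y) (hxy : x ≠ y) (c p q : ℝ) :
    ‖∫ t in p..q, ((x / y : ℝ) : ℂ) ^ ((c : ℂ) + t * I)‖ ≤
      2 * (x / y) ^ c * (max x y / |x - y|) := by
  have hr1 : x / y ≠ 1 := by rwa [Ne, div_eq_one_iff_eq hy.ne']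
  refine (norm_integral_cpow_le (div_pos hx hy) hr1 c p q).trans ?_
  rw [div_eq_mul_inv]
  have hm : 0 < max x y := lt_max_of_lt_left hx
  have hd : 0 < |x - y| := abs_pos.mpr (sub_ne_zero.mpr hxy)
  have hlog : |x - y| / max x y ≤ |Real.log (x / y)| := by
    rcases lt_or_gt_of_ne hxy with h | h
    · rw [max_eq_right h.le, abs_sub_comm, abs_of_pos (sub_pos.mpr h),
        ← abs_neg, ← Real.log_inv, inv_div]
      exact (sub_div_le_log_div hx hy).trans (le_abs_self _)
    · rw [max_eq_left h.le, abs_of_pos (sub_pos.mpr h)]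
      exact (sub_div_le_log_div hy hx).trans (le_abs_self _)
  have : |Real.log (x / y)|⁻¹ ≤ max x y / |x - y| := by
    rw [← inv_div |x - y|]
    exact inv_anti₀ (by positivity) hlog
  gcongr

/-- A function given by a generalized Dirichlet series `∑ β k (k + b) ^ (-s)` with unimodular
coefficients, holomorphic in the upper half-plane and satisfying a convexity bound. -/
structure DirichletData (b : ℝ) (β : ℕ → ℂ) (D : ℂ → ℂ) : Prop where
  pos : 0 < b
  le_one : b ≤ 1
  norm_coeff : ∀ k, ‖β k‖ = 1
  differentiableAt : ∀ s : ℂ, 0 < s.im → DifferentiableAt ℂ D s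
  hasSum : ∀ s : ℂ, 1 < s.re → HasSum (fun k : ℕ => β k * ((k + b : ℝ) : ℂ) ^ (-s)) (D s)
  convexity : ∃ K : ℝ, 0 < K ∧ ∀ t u : ℝ, 2 * Real.pi ≤ t → 0 ≤ u → u ≤ 1 + 1 / Real.log t →
      ‖D (u + t * I)‖ ≤ K * t ^ ((1 - u) / 2) * Real.log t

lemma rpow_one_div_log {T : ℝ} (hT : 2 * Real.pi ≤ T) : T ^ (1 / Real.log T) = Real.exp 1 := by
  have h6 := six_lt_two_pi
  have hl := one_le_log_of_two_pi_le hT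
  rw [Real.rpow_def_of_pos (by linarith), mul_one_div_cancel (by linarith)]

/-- The constant in the bound for off-diagonal terms on the line `Re s = 1 + 1 / log T`. -/
noncomputable def rightConst (b : ℝ) : ℝ :=
  4 * Real.exp 1 + 2 * (Real.exp 1 / b) * (1 / b + 4)

lemma norm_integral_right_upper_le {b T : ℝ} (hb : 0 < b) (hT : 2 * Real.pi ≤ T)
    {k : ℕ} (hk : (k : ℝ) + b ≤ T) (p q : ℝ) (i : ℕ) :
    ‖∫ t in p..q, ((((k + b) / ((k + 1 + i : ℕ) + b) : ℝ) : ℝ) : ℂ) ^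
      (((1 + 1 / Real.log T : ℝ) : ℂ) + t * I)‖ ≤
      2 * Real.exp 1 * (k + b) * ((i : ℝ) + 1) ^ (-1 - 1 / Real.log T) := by
  have hl := one_le_log_of_two_pi_le hT
  set δ := 1 / Real.log T with hδ
  have hδ0 : 0 < δ := by positivity
  have hx : (0 : ℝ) < k + b := by positivity
  have hy : (0 : ℝ) < (k + 1 + i : ℕ) + b := by positivity
  have hyx : (((k + 1 + i : ℕ) : ℝ) + b) - (k + b) = i + 1 := by push_cast; ring
  have hi : (0 : ℝ) < (i : ℝ) + 1 := by positivity
  have hlt : (k : ℝ) + b < (k + 1 + i : ℕ) + b := by linarith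
  refine (norm_integral_div_cpow_le hx hy hlt.ne _ p q).trans ?_
  rw [max_eq_right hlt.le, abs_sub_comm, hyx, abs_of_pos hi]
  set x : ℝ := k + b
  set y : ℝ := ((k + 1 + i : ℕ) : ℝ) + b
  have h1 : (x / y) ^ (1 + δ) * y = x * x ^ δ * y ^ (-δ) := by
    rw [Real.div_rpow hx.le hy.le, Real.rpow_add hx, Real.rpow_add hy, Real.rpow_neg hy.le,
      Real.rpow_one, Real.rpow_one]
    field_simp
  have h2 : x ^ δ ≤ Real.exp 1 := by
    rw [← rpow_one_div_log hT]
    exact Real.rpow_le_rpow hx.le hk hδ0.le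
  have h3 : y ^ (-δ) ≤ ((i : ℝ) + 1) ^ (-δ) :=
    Real.rpow_le_rpow_of_nonpos hi (by linarith) (by linarith)
  have h4 : ((i : ℝ) + 1) ^ (-1 - δ) = ((i : ℝ) + 1) ^ (-δ) / (i + 1) := by
    rw [show -1 - δ = -δ - 1 by ring, Real.rpow_sub hi, Real.rpow_one]
  rw [h4]
  calc 2 * (x / y) ^ (1 + δ) * (y / (i + 1)) = 2 * ((x / y) ^ (1 + δ) * y) / (i + 1) := by ring
    _ = 2 * (x * x ^ δ * y ^ (-δ)) / (i + 1) := by rw [h1]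
    _ ≤ 2 * (x * Real.exp 1 * ((i : ℝ) + 1) ^ (-δ)) / (i + 1) := by gcongr
    _ = _ := by ring

lemma norm_integral_right_lower_le {b T : ℝ} (hb : 0 < b) (hb1 : b ≤ 1) (hT : 2 * Real.pi ≤ T)
    {k : ℕ} (hk : (k : ℝ) + b ≤ T) (p q : ℝ) {j : ℕ} (hj : j < k) :
    ‖∫ t in p..q, ((((k + b) / (j + b) : ℝ) : ℝ) : ℂ) ^
      (((1 + 1 / Real.log T : ℝ) : ℂ) + t * I)‖ ≤
      2 * (Real.exp 1 / b) * (k + b) * (1 / (j + b) + 1 / (k - j)) := by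
  have hl := one_le_log_of_two_pi_le hT
  set δ := 1 / Real.log T with hδ
  have hδ0 : 0 < δ := by positivity
  have hδ1 : δ ≤ 1 := by rw [hδ, div_le_one (by linarith)]; exact hl
  have hx : (0 : ℝ) < k + b := by positivity
  have hy : (0 : ℝ) < j + b := by positivity
  have hkj : (0 : ℝ) < (k : ℝ) - j := by
    have : (j : ℝ) < k := by exact_mod_cast hj
    linarith
  have hlt : (j : ℝ) + b < k + b := by linarith
  refine (norm_integral_div_cpow_le hx hy hlt.ne' _ p q).trans ?_
  rw [max_eq_left hlt.le, show (k : ℝ) + b - (j + b) = k - j by ring, abs_of_pos hkj]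
  have h1 : ((k + b : ℝ) / (j + b)) ^ (1 + δ) =
      ((k + b) / (j + b)) * ((k + b : ℝ) / (j + b)) ^ δ := by
    rw [Real.rpow_add (by positivity), Real.rpow_one]
  have h2 : ((k + b : ℝ) / (j + b)) ^ δ ≤ Real.exp 1 / b := by
    calc ((k + b : ℝ) / (j + b)) ^ δ ≤ (T * (1 / b)) ^ δ := by
          refine Real.rpow_le_rpow (by positivity) ?_ hδ0.le
          rw [div_eq_mul_one_div]
          gcongr
          all_goals linarith [(Nat.cast_nonneg j : (0 : ℝ) ≤ j)]
      _ = T ^ δ * (1 / b) ^ δ := Real.mul_rpow (by linarith) (by positivity)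
      _ ≤ Real.exp 1 * (1 / b) ^ (1 : ℝ) := by
          rw [rpow_one_div_log hT]
          gcongr
          rw [le_div_iff₀ hb]; linarith
      _ = _ := by rw [Real.rpow_one]; ring
  have h3 : ((k + b : ℝ) / (j + b)) * (1 / (k - j)) = 1 / (j + b) + 1 / (k - j) := by
    field_simp; ring
  rw [h1]
  calc 2 * ((k + b) / (j + b) * ((k + b : ℝ) / (j + b)) ^ δ) * ((k + b) / (k - j))
      = 2 * ((k + b : ℝ) / (j + b)) ^ δ * (k + b) * (((k + b) / (j + b)) * (1 / (k - j))) := by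
        ring
    _ ≤ 2 * (Real.exp 1 / b) * (k + b) * (((k + b) / (j + b)) * (1 / (k - j))) := by gcongr
    _ = _ := by rw [h3]

lemma DirichletData.norm_integral_right_sub_le {b : ℝ} {β : ℕ → ℂ} {D : ℂ → ℂ}
    (h : DirichletData b β D) {T : ℝ} (hT : 2 * Real.pi ≤ T) {k : ℕ} (hk : (k : ℝ) + b ≤ T)
    (p q : ℝ) :
    ‖(∫ t in p..q, D (((1 + 1 / Real.log T : ℝ) : ℂ) + t * I) *
        ((k + b : ℝ) : ℂ) ^ (((1 + 1 / Real.log T : ℝ) : ℂ) + t * I)) - (q - p : ℝ) * β k‖ ≤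
      rightConst b * (k + b) * Real.log T := by
  have hl := one_le_log_of_two_pi_le hT
  have hb := h.pos
  have hlT : 0 < Real.log T := by linarith
  set c : ℝ := 1 + 1 / Real.log T with hc
  have hc1 : 1 < c := by rw [hc]; linarith [one_div_pos.mpr hlT]
  have hx : (0 : ℝ) < k + b := by positivity
  have hterm : ∀ (j : ℕ) (t : ℝ), β j * ((j + b : ℝ) : ℂ) ^ (-((c : ℂ) + t * I)) *
      ((k + b : ℝ) : ℂ) ^ ((c : ℂ) + t * I) =
      β j * (((k + b) / (j + b) : ℝ) : ℂ) ^ ((c : ℂ) + t * I) := by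
    intro j t
    have hy : (0 : ℝ) < j + b := by positivity
    rw [ofReal_div, div_cpow_ofReal_nonneg hx.le hy.le, cpow_neg]
    ring
  have hnorm : ∀ (j : ℕ) (t : ℝ),
      ‖β j * (((k + b) / (j + b) : ℝ) : ℂ) ^ ((c : ℂ) + t * I)‖ = ((k + b) / (j + b) : ℝ) ^ c := by
    intro j t
    rw [norm_mul, h.norm_coeff, one_mul, norm_cpow_eq_rpow_re_of_pos (by positivity)]
    simp
  have hsummable : Summable fun j : ℕ => ((k + b) / (j + b) : ℝ) ^ c := by
    have h1 := (((h.hasSum c (by simpa using hc1)).mul_right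
      (((k + b : ℝ) : ℂ) ^ (c : ℂ))).summable).norm
    refine h1.congr fun j => ?_
    have := hterm j 0
    simp only [ofReal_zero, zero_mul, add_zero] at this
    rw [this]
    simpa using hnorm j 0
  have hsum : HasSum (fun j : ℕ => ∫ t in p..q,
      β j * (((k + b) / (j + b) : ℝ) : ℂ) ^ ((c : ℂ) + t * I))
      (∫ t in p..q, D ((c : ℂ) + t * I) * ((k + b : ℝ) : ℂ) ^ ((c : ℂ) + t * I)) := by
    refine intervalIntegral.hasSum_integral_of_dominated_convergence
      (fun j _ => ((k + b) / (j + b) : ℝ) ^ c) ?_ ?_ ?_ ?_ ?_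
    · intro j
      refine (Continuous.aestronglyMeasurable ?_)
      refine continuous_const.mul (Continuous.const_cpow (by fun_prop) (Or.inl ?_))
      exact_mod_cast (by positivity : (0 : ℝ) < (k + b) / (j + b)).ne'
    · exact fun j => ae_of_all _ fun t _ => (hnorm j t).le
    · exact ae_of_all _ fun t _ => hsummable
    · exact intervalIntegrable_const
    · refine ae_of_all _ fun t _ => ?_
      have := (h.hasSum ((c : ℂ) + t * I) (by simpa using hc1)).mul_right
        (((k + b : ℝ) : ℂ) ^ ((c : ℂ) + t * I))
      simpa only [hterm] using this
  set f : ℕ → ℂ := fun j => ∫ t in p..q,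
      β j * (((k + b) / (j + b) : ℝ) : ℂ) ^ ((c : ℂ) + t * I) with hf
  have hfnorm : ∀ j, ‖f j‖ = ‖∫ t in p..q, (((k + b) / (j + b) : ℝ) : ℂ) ^ ((c : ℂ) + t * I)‖ := by
    intro j
    rw [hf]
    simp only [intervalIntegral.integral_const_mul, norm_mul, h.norm_coeff, one_mul]
  have hfk : f k = (q - p : ℝ) * β k := by
    rw [hf]
    simp only [div_self hx.ne', ofReal_one, one_cpow, mul_one, intervalIntegral.integral_const]
    rw [real_smul]
  have hpart : ∀ m : ℕ, ‖(∑ j ∈ range (k + 1 + m), f j) - (q - p : ℝ) * β k‖ ≤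
      rightConst b * (k + b) * Real.log T := by
    intro m
    rw [sum_range_add, sum_range_succ, hfk]
    have e1 : ‖∑ j ∈ range k, f j‖ ≤
        2 * (Real.exp 1 / b) * (k + b) * ((1 / b + 4) * Real.log T) := by
      refine (norm_sum_le _ _).trans ?_
      calc ∑ j ∈ range k, ‖f j‖ ≤ ∑ j ∈ range k,
            2 * (Real.exp 1 / b) * (k + b) * (1 / (j + b) + 1 / ((k : ℝ) - j)) := by
            refine sum_le_sum fun j hj => ?_
            rw [hfnorm]
            exact norm_integral_right_lower_le hb h.le_one hT hk p q (mem_range.mp hj)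
        _ = 2 * (Real.exp 1 / b) * (k + b) *
            ∑ j ∈ range k, (1 / ((j : ℝ) + b) + 1 / ((k : ℝ) - j)) := by rw [mul_sum]
        _ ≤ _ := by
            gcongr
            exact sum_offDiag_le hb hT (by linarith)
    have e2 : ‖∑ i ∈ range m, f (k + 1 + i)‖ ≤
        2 * Real.exp 1 * (k + b) * (2 * Real.log T) := by
      refine (norm_sum_le _ _).trans ?_
      calc ∑ i ∈ range m, ‖f (k + 1 + i)‖ ≤ ∑ i ∈ range m,
            2 * Real.exp 1 * (k + b) * ((i : ℝ) + 1) ^ (-1 - 1 / Real.log T) := by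
            refine sum_le_sum fun i _ => ?_
            rw [hfnorm]
            exact norm_integral_right_upper_le hb hT hk p q i
        _ = 2 * Real.exp 1 * (k + b) *
            ∑ i ∈ range m, ((i : ℝ) + 1) ^ (-1 - 1 / Real.log T) := by rw [mul_sum]
        _ ≤ _ := by
            gcongr
            refine (sum_rpow_neg_one_sub_le (by positivity) m).trans ?_
            rw [one_div_one_div]; linarith
    calc ‖∑ j ∈ range k, f j + (q - p : ℝ) * β k + ∑ i ∈ range m, f (k + 1 + i) -
          (q - p : ℝ) * β k‖ = ‖∑ j ∈ range k, f j + ∑ i ∈ range m, f (k + 1 + i)‖ := by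
          congr 1; ring
      _ ≤ _ := norm_add_le _ _
      _ ≤ _ := add_le_add e1 e2
      _ = _ := by unfold rightConst; ring
  have hlim : Tendsto (fun m : ℕ => ‖(∑ j ∈ range (k + 1 + m), f j) - (q - p : ℝ) * β k‖) atTop
      (nhds ‖(∫ t in p..q, D ((c : ℂ) + t * I) * ((k + b : ℝ) : ℂ) ^ ((c : ℂ) + t * I)) -
        (q - p : ℝ) * β k‖) := by
    refine ((hsum.tendsto_sum_nat.comp ?_).sub_const _).norm
    exact tendsto_atTop_mono (fun m => Nat.le_add_left m (k + 1)) tendsto_id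
  exact le_of_tendsto' hlim hpart

lemma DirichletData.exists_norm_integral_left_sub_le {b : ℝ} {β : ℕ → ℂ} {D : ℂ → ℂ}
    (h : DirichletData b β D) {α : ℝ} (hα0 : 0 < α) (hα1 : α < 1) :
    ∃ C : ℝ, 0 < C ∧ ∀ (T : ℝ) (k : ℕ), tau k ≤ T →
      ‖(∫ t in tau k..T, D ((α : ℂ) + t * I) * ((k + b : ℝ) : ℂ) ^ ((α : ℂ) + t * I)) -
        (T - tau k : ℝ) * β k‖ ≤
        C * Real.log T * (T ^ ((1 - α) / 2) * ((k : ℝ) + b) ^ α + (k + b)) := by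
  obtain ⟨K, hK, hconv⟩ := h.convexity
  have hb := h.pos
  have hrc : 0 ≤ rightConst b := by unfold rightConst; positivity
  refine ⟨4 * K + rightConst b, by positivity, fun T k hkT => ?_⟩
  have hτ := two_pi_le_tau k
  have h6 := six_lt_two_pi
  have hT : 2 * Real.pi ≤ T := hτ.trans hkT
  have hT0 : 0 < T := by linarith
  have hl := one_le_log_of_two_pi_le hT
  have hx : (0 : ℝ) < k + b := by positivity
  set x : ℝ := (k : ℝ) + b with hxdef
  have hxc : (x : ℂ) ≠ 0 := by exact_mod_cast hx.ne'
  set c : ℝ := 1 + 1 / Real.log T with hc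
  have hδ0 : 0 < 1 / Real.log T := by positivity
  have hδ1 : 1 / Real.log T ≤ 1 := by rw [div_le_one (by linarith)]; exact hl
  have hαc : α ≤ c := by linarith
  have hxT : x ≤ Real.sqrt T := by
    have := succ_le_sqrt_of_tau_le hkT
    linarith [h.le_one]
  have hsT : Real.sqrt T ≤ T := by
    rw [Real.sqrt_le_left hT0.le]; nlinarith
  have hhor : ∀ y : ℝ, tau k ≤ y → y ≤ T →
      ‖∫ u in α..c, D ((u : ℂ) + y * I) * (x : ℂ) ^ ((u : ℂ) + y * I)‖ ≤
        2 * K * Real.log T * (T ^ ((1 - α) / 2) * x ^ α) := by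
    intro y hy hyT
    have hy2 : 2 * Real.pi ≤ y := hτ.trans hy
    have hy0 : 0 < y := by linarith
    have hly := one_le_log_of_two_pi_le hy2
    have hlyT : Real.log y ≤ Real.log T := Real.log_le_log hy0 hyT
    have hxy : x ≤ Real.sqrt y := by
      have := succ_le_sqrt_of_tau_le hy
      linarith [h.le_one]
    have hbd : ∀ u ∈ Set.uIoc α c, ‖D ((u : ℂ) + y * I) * (x : ℂ) ^ ((u : ℂ) + y * I)‖ ≤
        K * Real.log T * (T ^ ((1 - α) / 2) * x ^ α) := by
      intro u hu
      rw [Set.uIoc_of_le hαc] at hu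
      have hu0 : 0 ≤ u := hα0.le.trans hu.1.le
      have hD := hconv y u hy2 hu0 (by
        refine hu.2.trans ?_
        rw [hc]
        gcongr)
      rw [norm_mul, norm_cpow_eq_rpow_re_of_pos hx]
      have hre : ((u : ℂ) + y * I).re = u := by simp
      rw [hre]
      have hsy : y ^ ((1 - u) / 2) = y ^ ((1 - α) / 2) * (Real.sqrt y) ^ (α - u) := by
        rw [Real.sqrt_eq_rpow, ← Real.rpow_mul hy0.le, ← Real.rpow_add hy0]
        congr 1; ring
      have hxu : (Real.sqrt y) ^ (α - u) * x ^ u ≤ x ^ α := by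
        have h1 : (Real.sqrt y) ^ (α - u) ≤ x ^ (α - u) :=
          Real.rpow_le_rpow_of_nonpos hx hxy (by linarith [hu.1])
        calc (Real.sqrt y) ^ (α - u) * x ^ u ≤ x ^ (α - u) * x ^ u := by gcongr
          _ = x ^ α := by rw [← Real.rpow_add hx]; congr 1; ring
      calc ‖D ((u : ℂ) + y * I)‖ * x ^ u ≤ (K * y ^ ((1 - u) / 2) * Real.log y) * x ^ u := by
            gcongr
        _ = K * Real.log y * (y ^ ((1 - α) / 2) * ((Real.sqrt y) ^ (α - u) * x ^ u)) := by
            rw [hsy]; ring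
        _ ≤ K * Real.log T * (T ^ ((1 - α) / 2) * x ^ α) := by
            have : 0 ≤ (1 - α) / 2 := by linarith
            gcongr
    refine (intervalIntegral.norm_integral_le_of_norm_le_const hbd).trans ?_
    rw [abs_of_nonneg (by linarith)]
    have : c - α ≤ 2 := by linarith
    calc K * Real.log T * (T ^ ((1 - α) / 2) * x ^ α) * (c - α) ≤
        K * Real.log T * (T ^ ((1 - α) / 2) * x ^ α) * 2 := by gcongr
      _ = _ := by ring
  have hrect := Complex.integral_boundary_rect_eq_zero_of_differentiableOn
    (fun s => D s * (x : ℂ) ^ s) ((α : ℂ) + (tau k : ℝ) * I) ((c : ℂ) + (T : ℝ) * I) (by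
      intro s hs
      rw [mem_reProdIm] at hs
      have him := hs.2
      simp only [add_im, ofReal_im, mul_im, ofReal_re, I_im, mul_one, I_re, mul_zero, add_zero,
        zero_add] at him
      rw [Set.uIcc_of_le hkT] at him
      have hs0 : 0 < s.im := by linarith [him.1]
      refine ((h.differentiableAt s hs0).mul ?_).differentiableWithinAt
      exact differentiableAt_id.const_cpow (Or.inl hxc))
  simp only [add_im, ofReal_im, mul_im, ofReal_re, I_im, mul_one, I_re, mul_zero, add_zero,
        zero_add, add_re, mul_re, sub_zero, smul_eq_mul] at hrect
  have hright := h.norm_integral_right_sub_le hT (k := k) (by linarith) (tau k) T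
  have hcc : ((1 + 1 / Real.log T : ℝ) : ℂ) = (c : ℂ) := by rw [hc]
  rw [hcc] at hright
  have h1 := hhor (tau k) le_rfl hkT
  have h2 := hhor T hkT le_rfl
  set H1 := ∫ u in α..c, D ((u : ℂ) + (tau k : ℝ) * I) * (x : ℂ) ^ ((u : ℂ) + (tau k : ℝ) * I)
  set H2 := ∫ u in α..c, D ((u : ℂ) + T * I) * (x : ℂ) ^ ((u : ℂ) + T * I)
  set V2 := ∫ t in tau k..T, D ((c : ℂ) + t * I) * (x : ℂ) ^ ((c : ℂ) + t * I)
  set V1 := ∫ t in tau k..T, D ((α : ℂ) + t * I) * (x : ℂ) ^ ((α : ℂ) + t * I)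
  have hV : V1 - (T - tau k : ℝ) * β k = (V2 - (T - tau k : ℝ) * β k) - I * H1 + I * H2 := by
    have hI : I * (H1 - H2 + I * V2 - I * V1) = 0 := by rw [hrect, mul_zero]
    linear_combination hI + (V1 - V2) * I_mul_I
  rw [hV]
  calc ‖(V2 - (T - tau k : ℝ) * β k) - I * H1 + I * H2‖
      ≤ ‖V2 - (T - tau k : ℝ) * β k‖ + ‖I * H1‖ + ‖I * H2‖ := by
        refine (norm_add_le _ _).trans ?_
        gcongr
        exact norm_sub_le _ _
    _ ≤ rightConst b * x * Real.log T + 2 * K * Real.log T * (T ^ ((1 - α) / 2) * x ^ α) +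
        2 * K * Real.log T * (T ^ ((1 - α) / 2) * x ^ α) := by
        rw [norm_mul, norm_mul, norm_I, one_mul, one_mul]
        gcongr
    _ ≤ (4 * K + rightConst b) * Real.log T * (T ^ ((1 - α) / 2) * x ^ α + x) := by
        have e1 : 0 ≤ rightConst b * Real.log T * (T ^ ((1 - α) / 2) * x ^ α) := by positivity
        have e2 : 0 ≤ 4 * K * Real.log T * x := by positivity
        nlinarith

lemma sqrt_le_self_of_two_pi_le {T : ℝ} (hT : 2 * Real.pi ≤ T) : Real.sqrt T ≤ T := by
  have h6 := six_lt_two_pi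
  rw [Real.sqrt_le_left (by linarith)]; nlinarith

lemma cutN_le_sqrt {T : ℝ} : (cutN T : ℝ) ≤ Real.sqrt T := by
  rcases Nat.eq_zero_or_pos (cutN T) with h | h
  · rw [h]; simp
  · have h1 : cutN T - 1 < cutN T := by omega
    have := succ_le_sqrt_of_tau_le (lt_cutN_iff.mp h1)
    rwa [Nat.cast_sub h, Nat.cast_one, sub_add_cancel] at this

lemma sum_range_rpow_le {b r : ℝ} (hb : 0 < b) (hb1 : b ≤ 1) (hr : -1 < r) :
    ∃ C : ℝ, 0 < C ∧ ∀ N : ℕ, ∑ k ∈ range N, ((k : ℝ) + b) ^ r ≤ C * (N : ℝ) ^ (r + 1) := by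
  rcases le_or_gt 0 r with h0 | h0
  · refine ⟨1, one_pos, fun N => ?_⟩
    have : ∀ k ∈ range N, ((k : ℝ) + b) ^ r ≤ (N : ℝ) ^ r := by
      intro k hk
      have hk' : (k : ℝ) + 1 ≤ N := by exact_mod_cast mem_range.mp hk
      exact Real.rpow_le_rpow (by positivity) (by linarith) h0
    refine (sum_le_card_nsmul _ _ _ this).trans ?_
    rw [card_range, nsmul_eq_mul, one_mul, Real.rpow_add_one' (by positivity) (by linarith)]
    linarith
  · have hr1 : 0 < r + 1 := by linarith
    refine ⟨b ^ r / (r + 1), by positivity, fun N => ?_⟩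
    have hstep : ∀ k : ℕ, ((k : ℝ) + 1) ^ r ≤
        (((k + 1 : ℕ) : ℝ) ^ (r + 1) - (k : ℝ) ^ (r + 1)) / (r + 1) := by
      intro k
      have hk : (0 : ℝ) < (k : ℝ) + 1 := by positivity
      have h1 := rpow_one_add_le_one_add_mul_self (s := -1 / ((k : ℝ) + 1)) (p := r + 1)
        (by rw [neg_div, neg_le_neg_iff, div_le_one hk]; linarith [(Nat.cast_nonneg k : (0:ℝ) ≤ k)])
        hr1.le (by linarith)
      have h2 : 1 + -1 / ((k : ℝ) + 1) = k / (k + 1) := by field_simp; ring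
      rw [h2, Real.div_rpow (by positivity) hk.le, div_le_iff₀ (by positivity)] at h1
      have h3 : ((k : ℝ) + 1) ^ (r + 1) = (k + 1) ^ r * (k + 1) := by
        rw [Real.rpow_add hk, Real.rpow_one]
      rw [le_div_iff₀ hr1]
      push_cast
      have h4 : (1 + (r + 1) * (-1 / ((k : ℝ) + 1))) * ((k : ℝ) + 1) ^ (r + 1) =
          ((k : ℝ) + 1) ^ (r + 1) - (r + 1) * ((k : ℝ) + 1) ^ r := by
        rw [h3]; field_simp; ring
      linarith
    have hterm : ∀ k : ℕ, ((k : ℝ) + b) ^ r ≤ b ^ r * ((k : ℝ) + 1) ^ r := by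
      intro k
      rw [← Real.mul_rpow hb.le (by positivity)]
      refine Real.rpow_le_rpow_of_nonpos (by positivity) ?_ h0.le
      nlinarith [(Nat.cast_nonneg k : (0 : ℝ) ≤ k)]
    calc ∑ k ∈ range N, ((k : ℝ) + b) ^ r ≤ ∑ k ∈ range N,
          b ^ r * ((((k + 1 : ℕ) : ℝ) ^ (r + 1) - (k : ℝ) ^ (r + 1)) / (r + 1)) := by
          refine sum_le_sum fun k _ => (hterm k).trans ?_
          gcongr
          exact hstep k
      _ = b ^ r / (r + 1) * ∑ k ∈ range N, (((k + 1 : ℕ) : ℝ) ^ (r + 1) - (k : ℝ) ^ (r + 1)) := by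
          rw [mul_sum]; refine sum_congr rfl fun k _ => by ring
      _ = b ^ r / (r + 1) * (N : ℝ) ^ (r + 1) := by
          rw [sum_range_sub (fun k : ℕ => (k : ℝ) ^ (r + 1))]
          simp [Real.zero_rpow hr1.ne']

lemma sum_cutN_rpow_le {b r : ℝ} (hb : 0 < b) (hb1 : b ≤ 1) (hr : -1 < r) :
    ∃ C : ℝ, 0 < C ∧ ∀ T : ℝ, 0 ≤ T →
      ∑ k ∈ range (cutN T), ((k : ℝ) + b) ^ r ≤ C * T ^ ((r + 1) / 2) := by
  obtain ⟨C, hC, h⟩ := sum_range_rpow_le hb hb1 hr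
  refine ⟨C, hC, fun T hT => (h _).trans ?_⟩
  have : T ^ ((r + 1) / 2) = (Real.sqrt T) ^ (r + 1) := by
    rw [Real.sqrt_eq_rpow, ← Real.rpow_mul hT]; congr 1; ring
  rw [this]
  have := cutN_le_sqrt (T := T)
  have hr1 : 0 ≤ r + 1 := by linarith
  gcongr

lemma intervalIntegrable_indicator_Ici {f : ℝ → ℂ} {T : ℝ} (hT : 1 ≤ T)
    (hf : ContinuousOn f (Set.Icc 1 T)) (θ : ℝ) :
    IntervalIntegrable ((Set.Ici θ).indicator f) volume 1 T := by
  have h1 : IntervalIntegrable f volume 1 T := by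
    refine ContinuousOn.intervalIntegrable ?_
    rwa [Set.uIcc_of_le hT]
  rw [intervalIntegrable_iff_integrableOn_Ioc_of_le hT] at h1 ⊢
  exact Integrable.indicator h1 measurableSet_Ici

lemma integral_indicator_Ici {f : ℝ → ℂ} {θ T : ℝ} (hθ : 1 < θ) (hT : θ ≤ T) :
    ∫ t in (1 : ℝ)..T, (Set.Ici θ).indicator f t = ∫ t in θ..T, f t := by
  rw [intervalIntegral.integral_of_le (hθ.le.trans hT), intervalIntegral.integral_of_le hT,
    setIntegral_indicator measurableSet_Ici, ← integral_Icc_eq_integral_Ioc]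
  congr 2
  ext x
  simp only [Set.mem_inter_iff, Set.mem_Ioc, Set.mem_Ici, Set.mem_Icc]
  constructor
  · rintro ⟨⟨_, h2⟩, h3⟩; exact ⟨h3, h2⟩
  · rintro ⟨h1, h2⟩; exact ⟨⟨hθ.trans_le h1, h2⟩, h1⟩

lemma integral_sum_indicator {ι : Type*} (s : Finset ι) (θ : ι → ℝ) (f : ι → ℝ → ℂ) {T : ℝ}
    (hT : 1 ≤ T) (hθ : ∀ i ∈ s, 1 < θ i ∧ θ i ≤ T)
    (hf : ∀ i ∈ s, ContinuousOn (f i) (Set.Icc 1 T)) :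
    IntervalIntegrable (fun t => ∑ i ∈ s, (Set.Ici (θ i)).indicator (f i) t) volume 1 T ∧
    ∫ t in (1 : ℝ)..T, ∑ i ∈ s, (Set.Ici (θ i)).indicator (f i) t =
      ∑ i ∈ s, ∫ t in θ i..T, f i t := by
  have hi : ∀ i ∈ s, IntervalIntegrable ((Set.Ici (θ i)).indicator (f i)) volume 1 T :=
    fun i hi => intervalIntegrable_indicator_Ici hT (hf i hi) _
  refine ⟨?_, ?_⟩
  · have := IntervalIntegrable.sum s hi
    refine this.congr fun t _ => ?_
    simp
  · rw [intervalIntegral.integral_finsetSum hi]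
    exact sum_congr rfl fun i hi => integral_indicator_Ici (hθ i hi).1 (hθ i hi).2

/-- Truncating at `cutN t` is the same as truncating at `cutN T` with indicator weights. -/
lemma sum_cutN_eq {f : ℕ → ℝ → ℂ} {t T : ℝ} (hT : t ≤ T) :
    ∑ k ∈ range (cutN t), f k t =
      ∑ k ∈ range (cutN T), (Set.Ici (tau k)).indicator (f k) t := by
  have hsub : range (cutN t) ⊆ range (cutN T) := by
    intro k hk
    rw [mem_range, lt_cutN_iff] at hk ⊢
    exact hk.trans hT
  rw [← sum_subset hsub]
  · refine sum_congr rfl fun k hk => ?_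
    rw [mem_range, lt_cutN_iff] at hk
    rw [Set.indicator_of_mem (Set.mem_Ici.mpr hk)]
  · intro k _ hk
    rw [mem_range, lt_cutN_iff] at hk
    rw [Set.indicator_of_notMem]
    simpa using hk

lemma integral_sum_cutN {f : ℕ → ℝ → ℂ} {T : ℝ} (hT : 1 ≤ T)
    (hf : ∀ k, ContinuousOn (f k) (Set.Icc 1 T)) :
    IntervalIntegrable (fun t => ∑ k ∈ range (cutN t), f k t) volume 1 T ∧
    ∫ t in (1 : ℝ)..T, ∑ k ∈ range (cutN t), f k t =
      ∑ k ∈ range (cutN T), ∫ t in tau k..T, f k t := by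
  have h6 := six_lt_two_pi
  obtain ⟨h1, h2⟩ := integral_sum_indicator (range (cutN T)) tau f hT
    (fun k hk => ⟨by linarith [two_pi_le_tau k], lt_cutN_iff.mp (mem_range.mp hk)⟩)
    (fun k _ => hf k)
  refine ⟨h1.congr fun t ht => ?_, ?_⟩
  · rw [Set.uIoc_of_le hT] at ht
    exact (sum_cutN_eq ht.2).symm
  · rw [← h2]
    refine intervalIntegral.integral_congr fun t ht => ?_
    rw [Set.uIcc_of_le hT] at ht
    exact sum_cutN_eq ht.2

lemma sum_cutN_mul_sum_cutN_eq {f g : ℕ → ℝ → ℂ} {t T : ℝ} (hT : t ≤ T) :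
    (∑ k ∈ range (cutN t), f k t) * ∑ k ∈ range (cutN t), g k t =
      ∑ i ∈ range (cutN T) ×ˢ range (cutN T),
        (Set.Ici (max (tau i.1) (tau i.2))).indicator (fun t => f i.1 t * g i.2 t) t := by
  rw [sum_cutN_eq hT, sum_cutN_eq hT, sum_mul_sum, ← sum_product']
  refine sum_congr rfl fun i _ => ?_
  simp only [Set.indicator_apply, Set.mem_Ici, max_le_iff]
  split_ifs <;> simp_all

lemma integral_sum_cutN_mul_sum_cutN {f g : ℕ → ℝ → ℂ} {T : ℝ} (hT : 1 ≤ T)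
    (hf : ∀ k, ContinuousOn (f k) (Set.Icc 1 T)) (hg : ∀ k, ContinuousOn (g k) (Set.Icc 1 T)) :
    IntervalIntegrable (fun t => (∑ k ∈ range (cutN t), f k t) * ∑ k ∈ range (cutN t), g k t)
      volume 1 T ∧
    ∫ t in (1 : ℝ)..T, (∑ k ∈ range (cutN t), f k t) * ∑ k ∈ range (cutN t), g k t =
      ∑ j ∈ range (cutN T), ∑ k ∈ range (cutN T),
        ∫ t in (max (tau j) (tau k))..T, f j t * g k t := by
  have h6 := six_lt_two_pi
  obtain ⟨h1, h2⟩ := integral_sum_indicator (range (cutN T) ×ˢ range (cutN T))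
    (fun i => max (tau i.1) (tau i.2)) (fun i t => f i.1 t * g i.2 t) hT
    (fun i hi => by
      rw [mem_product, mem_range, mem_range, lt_cutN_iff, lt_cutN_iff] at hi
      exact ⟨lt_max_of_lt_left (by linarith [two_pi_le_tau i.1]), max_le hi.1 hi.2⟩)
    (fun i _ => (hf i.1).mul (hg i.2))
  refine ⟨h1.congr fun t ht => ?_, ?_⟩
  · rw [Set.uIoc_of_le hT] at ht
    exact (sum_cutN_mul_sum_cutN_eq ht.2).symm
  · rw [← sum_product', ← h2]
    refine intervalIntegral.integral_congr fun t ht => ?_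
    rw [Set.uIcc_of_le hT] at ht
    exact sum_cutN_mul_sum_cutN_eq ht.2

lemma norm_sum_sum_sub_diag_le (F : ℕ → ℕ → ℂ) (N : ℕ) :
    ‖(∑ j ∈ range N, ∑ k ∈ range N, F j k) - ∑ k ∈ range N, F k k‖ ≤
      ∑ k ∈ range N, ∑ j ∈ range k, (‖F j k‖ + ‖F k j‖) := by
  induction N with
  | zero => simp
  | succ n ih =>
    have h1 : (∑ j ∈ range (n + 1), ∑ k ∈ range (n + 1), F j k) - ∑ k ∈ range (n + 1), F k k =
        ((∑ j ∈ range n, ∑ k ∈ range n, F j k) - ∑ k ∈ range n, F k k) +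
          ∑ j ∈ range n, (F j n + F n j) := by
      simp only [sum_range_succ, sum_add_distrib]
      ring
    rw [h1, sum_range_succ]
    refine (norm_add_le _ _).trans (add_le_add ih ?_)
    exact (norm_sum_le _ _).trans (sum_le_sum fun j _ => norm_add_le _ _)

/-- The term of index `k` of a generalized Dirichlet series on the line `Re s = α`. -/
noncomputable def dTerm (b : ℝ) (β : ℕ → ℂ) (α : ℝ) (k : ℕ) (t : ℝ) : ℂ :=
  β k * ((k + b : ℝ) : ℂ) ^ (-((α : ℂ) + t * I))

/-- The partial sum of length `cutN t` of a generalized Dirichlet series. -/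
noncomputable def dSum (b : ℝ) (β : ℕ → ℂ) (α : ℝ) (t : ℝ) : ℂ :=
  ∑ k ∈ range (cutN t), dTerm b β α k t

section dTerm

variable {b : ℝ} {β : ℕ → ℂ} {α : ℝ}

lemma continuous_dTerm (hb : 0 < b) (k : ℕ) : Continuous (dTerm b β α k) := by
  unfold dTerm
  refine continuous_const.mul (Continuous.const_cpow (by fun_prop) (Or.inl ?_))
  exact_mod_cast (by positivity : (0 : ℝ) < k + b).ne'

lemma norm_dTerm (hb : 0 < b) (hβ : ∀ k, ‖β k‖ = 1) (k : ℕ) (t : ℝ) :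
    ‖dTerm b β α k t‖ = ((k : ℝ) + b) ^ (-α) := by
  rw [dTerm, norm_mul, hβ, one_mul, norm_cpow_eq_rpow_re_of_pos (by positivity)]
  simp

lemma conj_ofReal_cpow {x : ℝ} (hx : 0 < x) (z : ℂ) :
    (starRingEnd ℂ) ((x : ℂ) ^ z) = (x : ℂ) ^ ((starRingEnd ℂ) z) := by
  rw [cpow_conj, conj_ofReal]
  rw [arg_ofReal_of_nonneg hx.le]
  exact Real.pi_ne_zero.symm

lemma conj_dTerm (hb : 0 < b) (k : ℕ) (t : ℝ) :
    (starRingEnd ℂ) (dTerm b β α k t) = (starRingEnd ℂ) (β k) *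
      ((((k : ℝ) + b) ^ (-2 * α) : ℝ) : ℂ) * ((k + b : ℝ) : ℂ) ^ ((α : ℂ) + t * I) := by
  have hx : (0 : ℝ) < (k : ℝ) + b := by positivity
  have hxc : (((k : ℝ) + b : ℝ) : ℂ) ≠ 0 := by exact_mod_cast hx.ne'
  rw [dTerm, map_mul, conj_ofReal_cpow hx, ofReal_cpow hx.le, mul_assoc, ← cpow_add _ _ hxc]
  congr 2
  simp only [map_neg, map_add, conj_ofReal, map_mul, conj_I]
  push_cast; ring

lemma conj_mul_self_of_norm_eq_one {z : ℂ} (hz : ‖z‖ = 1) : (starRingEnd ℂ) z * z = 1 := by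
  rw [conj_mul', hz]; simp

lemma DirichletData.exists_norm_integral_mul_conj_sub_le {D : ℂ → ℂ}
    (h : DirichletData b β D) (hα0 : 0 < α) (hα1 : α < 1) :
    ∃ C : ℝ, 0 < C ∧ ∀ (T : ℝ) (k : ℕ), tau k ≤ T →
      ‖(∫ t in tau k..T, D ((α : ℂ) + t * I) * (starRingEnd ℂ) (dTerm b β α k t)) -
        (((T - tau k) * ((k : ℝ) + b) ^ (-2 * α) : ℝ) : ℂ)‖ ≤
        C * Real.log T * (T ^ ((1 - α) / 2) * ((k : ℝ) + b) ^ (-α) +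
          ((k : ℝ) + b) ^ (1 - 2 * α)) := by
  obtain ⟨C, hC, hmain⟩ := h.exists_norm_integral_left_sub_le hα0 hα1
  refine ⟨C, hC, fun T k hk => ?_⟩
  have hb := h.pos
  have hx : (0 : ℝ) < (k : ℝ) + b := by positivity
  have h1 := hmain T k hk
  have hβ := conj_mul_self_of_norm_eq_one (h.norm_coeff k)
  have e1 : (∫ t in tau k..T, D ((α : ℂ) + t * I) * (starRingEnd ℂ) (dTerm b β α k t)) -
        (((T - tau k) * ((k : ℝ) + b) ^ (-2 * α) : ℝ) : ℂ) =
      ((starRingEnd ℂ) (β k) * ((((k : ℝ) + b) ^ (-2 * α) : ℝ) : ℂ)) *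
      ((∫ t in tau k..T, D ((α : ℂ) + t * I) * ((k + b : ℝ) : ℂ) ^ ((α : ℂ) + t * I)) -
        (T - tau k : ℝ) * β k) := by
    rw [mul_sub, ← intervalIntegral.integral_const_mul]
    congr 1
    · refine intervalIntegral.integral_congr fun t _ => ?_
      simp only [conj_dTerm hb]
      ring
    · push_cast
      linear_combination (-((T : ℂ) - tau k) * ((((k : ℝ) + b) ^ (-2 * α) : ℝ) : ℂ)) * hβ
  rw [e1, norm_mul, norm_mul, RCLike.norm_conj, h.norm_coeff, one_mul, norm_real,
    Real.norm_of_nonneg (by positivity)]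
  calc ((k : ℝ) + b) ^ (-2 * α) * _ ≤ ((k : ℝ) + b) ^ (-2 * α) *
        (C * Real.log T * (T ^ ((1 - α) / 2) * ((k : ℝ) + b) ^ α + (k + b))) := by gcongr
    _ = C * Real.log T * (T ^ ((1 - α) / 2) * (((k : ℝ) + b) ^ (-2 * α) * ((k : ℝ) + b) ^ α) +
          ((k : ℝ) + b) ^ (-2 * α) * (k + b)) := by ring
    _ = _ := by
      rw [← Real.rpow_add hx, ← Real.rpow_add_one hx.ne', show -2 * α + α = -α by ring,
        show -2 * α + 1 = 1 - 2 * α by ring]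

lemma DirichletData.continuousOn {D : ℂ → ℂ} (h : DirichletData b β D) (α T : ℝ) :
    ContinuousOn (fun t : ℝ => D ((α : ℂ) + t * I)) (Set.Icc 1 T) := by
  intro t ht
  have h1 : ContinuousAt D ((α : ℂ) + t * I) :=
    (h.differentiableAt _ (by simpa using lt_of_lt_of_le one_pos ht.1)).continuousAt
  exact (ContinuousAt.comp (f := fun t : ℝ => (α : ℂ) + t * I) h1
    (by fun_prop)).continuousWithinAt

lemma DirichletData.exists_cross_le {D : ℂ → ℂ}
    (h : DirichletData b β D) (hα0 : 0 < α) (hα1 : α < 1) :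
    ∃ C : ℝ, 0 < C ∧ ∀ T : ℝ, 2 * Real.pi ≤ T →
      IntervalIntegrable (fun t : ℝ => D ((α : ℂ) + t * I) * (starRingEnd ℂ) (dSum b β α t))
        volume 1 T ∧
      ‖(∫ t in (1 : ℝ)..T, D ((α : ℂ) + t * I) * (starRingEnd ℂ) (dSum b β α t)) -
        ((∑ k ∈ range (cutN T), (T - tau k) * ((k : ℝ) + b) ^ (-2 * α) : ℝ) : ℂ)‖ ≤
        C * T ^ (1 - α) * Real.log T := by
  obtain ⟨C, hC, hmain⟩ := h.exists_norm_integral_mul_conj_sub_le hα0 hα1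
  obtain ⟨C1, hC1, hs1⟩ := sum_cutN_rpow_le h.pos h.le_one (r := -α) (by linarith)
  obtain ⟨C2, hC2, hs2⟩ := sum_cutN_rpow_le h.pos h.le_one (r := 1 - 2 * α) (by linarith)
  refine ⟨C * (C1 + C2), by positivity, fun T hT => ?_⟩
  have h6 := six_lt_two_pi
  have hl := one_le_log_of_two_pi_le hT
  have hT1 : 1 ≤ T := by linarith
  have hT0 : 0 < T := by linarith
  obtain ⟨i1, i2⟩ := integral_sum_cutN (T := T)
    (f := fun k t => D ((α : ℂ) + t * I) * (starRingEnd ℂ) (dTerm b β α k t)) hT1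
    (fun k => (h.continuousOn α T).mul
      (continuous_conj.comp (continuous_dTerm h.pos k)).continuousOn)
  have e1 : ∀ t : ℝ, ∑ k ∈ range (cutN t), D ((α : ℂ) + t * I) *
      (starRingEnd ℂ) (dTerm b β α k t) =
      D ((α : ℂ) + t * I) * (starRingEnd ℂ) (dSum b β α t) := by
    intro t
    rw [dSum, map_sum, mul_sum]
  simp only [e1] at i1 i2
  refine ⟨i1, ?_⟩
  rw [i2, ofReal_sum, ← sum_sub_distrib]
  calc _ ≤ ∑ k ∈ range (cutN T), C * Real.log T * (T ^ ((1 - α) / 2) * ((k : ℝ) + b) ^ (-α) +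
          ((k : ℝ) + b) ^ (1 - 2 * α)) :=
        norm_sum_le_of_le _ fun k hk => hmain T k (lt_cutN_iff.mp (mem_range.mp hk))
    _ = C * Real.log T * (T ^ ((1 - α) / 2) * ∑ k ∈ range (cutN T), ((k : ℝ) + b) ^ (-α) +
          ∑ k ∈ range (cutN T), ((k : ℝ) + b) ^ (1 - 2 * α)) := by
        rw [← mul_sum, sum_add_distrib, ← mul_sum]
    _ ≤ C * Real.log T * (T ^ ((1 - α) / 2) * (C1 * T ^ ((-α + 1) / 2)) +
          C2 * T ^ ((1 - 2 * α + 1) / 2)) := by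
        have := hs1 T hT0.le
        have := hs2 T hT0.le
        gcongr
    _ = C * (C1 + C2) * T ^ (1 - α) * Real.log T := by
        have e2 : T ^ ((1 - α) / 2) * (C1 * T ^ ((-α + 1) / 2)) = C1 * T ^ (1 - α) := by
          rw [mul_left_comm, ← Real.rpow_add hT0]; congr 2; ring
        rw [e2, show (1 - 2 * α + 1) / 2 = 1 - α by ring]
        ring

lemma tau_mono : Monotone tau := by
  intro j k hjk
  unfold tau
  have := Real.two_pi_pos
  gcongr

lemma norm_integral_dTerm_mul_conj_le (hb : 0 < b) (hβ : ∀ k, ‖β k‖ = 1) (j k : ℕ)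
    (hjk : j ≠ k) (p q : ℝ) :
    ‖∫ t in p..q, dTerm b β α j t * (starRingEnd ℂ) (dTerm b β α k t)‖ ≤
      2 * (((k : ℝ) + b) ^ (-α) * ((j : ℝ) + b) ^ (-α)) *
        (max ((k : ℝ) + b) (j + b) / |(k : ℝ) - j|) := by
  have hx : (0 : ℝ) < (k : ℝ) + b := by positivity
  have hy : (0 : ℝ) < (j : ℝ) + b := by positivity
  have hkj : (k : ℝ) ≠ j := by exact_mod_cast hjk.symm
  have e1 : ∀ t : ℝ, dTerm b β α j t * (starRingEnd ℂ) (dTerm b β α k t) =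
      (β j * (starRingEnd ℂ) (β k) * ((((k : ℝ) + b) ^ (-2 * α) : ℝ) : ℂ)) *
      ((((k + b) / (j + b) : ℝ) : ℝ) : ℂ) ^ ((α : ℂ) + t * I) := by
    intro t
    rw [conj_dTerm hb, dTerm, ofReal_div, div_cpow_ofReal_nonneg hx.le hy.le, cpow_neg]
    ring
  simp only [e1]
  rw [intervalIntegral.integral_const_mul, norm_mul, norm_mul, norm_mul, RCLike.norm_conj, hβ, hβ,
    one_mul, one_mul, norm_real, Real.norm_of_nonneg (by positivity)]
  have h1 := norm_integral_div_cpow_le hx hy (by simpa using hkj) α p q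
  rw [add_sub_add_right_eq_sub] at h1
  calc ((k : ℝ) + b) ^ (-2 * α) * _ ≤ ((k : ℝ) + b) ^ (-2 * α) *
        (2 * ((k + b : ℝ) / (j + b)) ^ α * (max ((k : ℝ) + b) (j + b) / |(k : ℝ) - j|)) := by
        gcongr
    _ = _ := by
        have : ((k : ℝ) + b) ^ (-2 * α) * ((k + b : ℝ) / (j + b)) ^ α =
            ((k : ℝ) + b) ^ (-α) * ((j : ℝ) + b) ^ (-α) := by
          rw [Real.div_rpow hx.le hy.le, Real.rpow_neg hy.le, div_eq_mul_inv, ← mul_assoc,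
            ← Real.rpow_add hx]
          congr 2; ring
        rw [← this]; ring

/-- Weighted pair estimate used for off-diagonal sums. -/
lemma pair_weight_le (hb : 0 < b) (hα1 : α ≤ 1) {j k : ℕ} (hjk : j < k) :
    (((k : ℝ) + b) ^ (-α) * ((j : ℝ) + b) ^ (-α)) * (((k : ℝ) + b) / ((k : ℝ) - j)) ≤
      ((k : ℝ) + b) ^ (1 - 2 * α) * (1 / ((j : ℝ) + b) + 1 / ((k : ℝ) - j)) := by
  have hx : (0 : ℝ) < (k : ℝ) + b := by positivity
  have hy : (0 : ℝ) < (j : ℝ) + b := by positivity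
  have hjk' : (j : ℝ) < k := by exact_mod_cast hjk
  have hd : (0 : ℝ) < (k : ℝ) - j := by linarith
  have h3 : ((k + b : ℝ) / (j + b)) * (1 / (k - j)) = 1 / (j + b) + 1 / (k - j) := by
    field_simp; ring
  have h1 : ((k + b : ℝ) / (j + b)) ^ α ≤ (k + b : ℝ) / (j + b) := by
    refine (Real.rpow_le_rpow_of_exponent_le ?_ hα1).trans (Real.rpow_one _).le
    rw [one_le_div hy]; linarith
  have h2 : ((k : ℝ) + b) ^ (-α) * ((j : ℝ) + b) ^ (-α) * (k + b) =
      ((k : ℝ) + b) ^ (1 - 2 * α) * ((k + b : ℝ) / (j + b)) ^ α := by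
    rw [Real.div_rpow hx.le hy.le, Real.rpow_neg hy.le, mul_div_assoc', ← Real.rpow_add hx,
      mul_right_comm, ← Real.rpow_add_one hx.ne', ← div_eq_mul_inv]
    congr 2; ring
  calc _ = (((k : ℝ) + b) ^ (-α) * ((j : ℝ) + b) ^ (-α) * (k + b)) * (1 / (k - j)) := by ring
    _ = ((k : ℝ) + b) ^ (1 - 2 * α) * (((k + b : ℝ) / (j + b)) ^ α * (1 / (k - j))) := by
        rw [h2]; ring
    _ ≤ ((k : ℝ) + b) ^ (1 - 2 * α) * (((k + b : ℝ) / (j + b)) * (1 / (k - j))) := by gcongr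
    _ = _ := by rw [h3]

end dTerm

section meanDefect

variable {b : ℝ} {β : ℕ → ℂ} {α : ℝ}

lemma exists_norm_integral_dSum_sq_sub_le (hb : 0 < b) (hb1 : b ≤ 1) (hβ : ∀ k, ‖β k‖ = 1)
    (hα1 : α < 1) :
    ∃ C : ℝ, 0 < C ∧ ∀ T : ℝ, 2 * Real.pi ≤ T →
      IntervalIntegrable (fun t : ℝ => dSum b β α t * (starRingEnd ℂ) (dSum b β α t))
        volume 1 T ∧
      ‖(∫ t in (1 : ℝ)..T, dSum b β α t * (starRingEnd ℂ) (dSum b β α t)) -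
        ((∑ k ∈ range (cutN T), (T - tau k) * ((k : ℝ) + b) ^ (-2 * α) : ℝ) : ℂ)‖ ≤
        C * T ^ (1 - α) * Real.log T := by
  obtain ⟨C2, hC2, hs2⟩ := sum_cutN_rpow_le hb hb1 (r := 1 - 2 * α) (by linarith)
  refine ⟨4 * (1 / b + 4) * C2, by positivity, fun T hT => ?_⟩
  have h6 := six_lt_two_pi
  have hl := one_le_log_of_two_pi_le hT
  have hT1 : 1 ≤ T := by linarith
  have hT0 : 0 < T := by linarith
  have hc : ∀ k, ContinuousOn (dTerm b β α k) (Set.Icc 1 T) :=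
    fun k => (continuous_dTerm hb k).continuousOn
  obtain ⟨i1, i2⟩ := integral_sum_cutN_mul_sum_cutN (T := T)
    (f := dTerm b β α) (g := fun k t => (starRingEnd ℂ) (dTerm b β α k t)) hT1 hc
    (fun k => (continuous_conj.comp (continuous_dTerm hb k)).continuousOn)
  have e1 : ∀ t : ℝ, (∑ k ∈ range (cutN t), dTerm b β α k t) *
      ∑ k ∈ range (cutN t), (starRingEnd ℂ) (dTerm b β α k t) =
      dSum b β α t * (starRingEnd ℂ) (dSum b β α t) := by
    intro t
    rw [dSum, map_sum]
  simp only [e1] at i1 i2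
  refine ⟨i1, ?_⟩
  set F : ℕ → ℕ → ℂ := fun j k => ∫ t in (max (tau j) (tau k))..T,
    dTerm b β α j t * (starRingEnd ℂ) (dTerm b β α k t) with hF
  have hdiag : ∀ k, F k k = (((T - tau k) * ((k : ℝ) + b) ^ (-2 * α) : ℝ) : ℂ) := by
    intro k
    have hx : (0 : ℝ) < (k : ℝ) + b := by positivity
    have e2 : ∀ t : ℝ, dTerm b β α k t * (starRingEnd ℂ) (dTerm b β α k t) =
        ((((k : ℝ) + b) ^ (-2 * α) : ℝ) : ℂ) := by
      intro t
      rw [mul_conj', norm_dTerm hb hβ, ← ofReal_pow, ← Real.rpow_mul_natCast hx.le]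
      congr 2; push_cast; ring
    rw [hF]
    simp only [e2, max_self, intervalIntegral.integral_const, real_smul]
    push_cast; ring
  have hoff : ∀ k ∈ range (cutN T), ∀ j ∈ range k, ‖F j k‖ + ‖F k j‖ ≤
      4 * (((k : ℝ) + b) ^ (1 - 2 * α) * (1 / ((j : ℝ) + b) + 1 / ((k : ℝ) - j))) := by
    intro k _ j hj
    have hjk : j < k := mem_range.mp hj
    have hjk' : (j : ℝ) < k := by exact_mod_cast hjk
    have hlt : (j : ℝ) + b ≤ k + b := by linarith
    have h1 := norm_integral_dTerm_mul_conj_le (α := α) hb hβ j k hjk.ne (max (tau j) (tau k)) T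
    have h2 := norm_integral_dTerm_mul_conj_le (α := α) hb hβ k j hjk.ne' (max (tau k) (tau j)) T
    have h3 := pair_weight_le hb hα1.le hjk
    rw [max_eq_left hlt, abs_of_pos (by linarith)] at h1
    rw [max_eq_right hlt, abs_sub_comm, abs_of_pos (by linarith),
      mul_comm (((j : ℝ) + b) ^ (-α))] at h2
    simp only [hF]
    linarith
  rw [i2, ofReal_sum]
  simp only [← hdiag]
  refine (norm_sum_sum_sub_diag_le F _).trans ?_
  calc _ ≤ ∑ k ∈ range (cutN T), ∑ j ∈ range k,
        4 * (((k : ℝ) + b) ^ (1 - 2 * α) * (1 / ((j : ℝ) + b) + 1 / ((k : ℝ) - j))) :=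
        sum_le_sum fun k hk => sum_le_sum fun j hj => hoff k hk j hj
    _ ≤ ∑ k ∈ range (cutN T), 4 * (((k : ℝ) + b) ^ (1 - 2 * α) *
          ((1 / b + 4) * Real.log T)) := by
        refine sum_le_sum fun k hk => ?_
        rw [← mul_sum, ← mul_sum]
        have hkT : (k : ℝ) ≤ T := by
          have h1 := succ_le_sqrt_of_tau_le (lt_cutN_iff.mp (mem_range.mp hk))
          have h2 := sqrt_le_self_of_two_pi_le hT
          linarith
        have := sum_offDiag_le hb hT hkT
        gcongr
    _ = 4 * (1 / b + 4) * Real.log T * ∑ k ∈ range (cutN T), ((k : ℝ) + b) ^ (1 - 2 * α) := by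
        rw [mul_sum]; refine sum_congr rfl fun k _ => by ring
    _ ≤ 4 * (1 / b + 4) * Real.log T * (C2 * T ^ ((1 - 2 * α + 1) / 2)) := by
        have := hs2 T hT0.le
        gcongr
    _ = _ := by
        rw [show (1 - 2 * α + 1) / 2 = 1 - α by ring]; ring

/-- The sum of the squared absolute values of the terms of `dSum`. -/
noncomputable def dDiag (b α t : ℝ) : ℝ := ∑ k ∈ range (cutN t), ((k : ℝ) + b) ^ (-2 * α)

lemma integral_dDiag {T : ℝ} (hT : 1 ≤ T) :
    IntervalIntegrable (dDiag b α) volume 1 T ∧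
    ∫ t in (1 : ℝ)..T, dDiag b α t =
      ∑ k ∈ range (cutN T), (T - tau k) * ((k : ℝ) + b) ^ (-2 * α) := by
  obtain ⟨i1, i2⟩ := integral_sum_cutN (T := T)
    (f := fun k _ => ((((k : ℝ) + b) ^ (-2 * α) : ℝ) : ℂ)) hT (fun k => continuousOn_const)
  have e1 : ∀ t : ℝ, ∑ k ∈ range (cutN t), ((((k : ℝ) + b) ^ (-2 * α) : ℝ) : ℂ) =
      (dDiag b α t : ℂ) := by
    intro t; rw [dDiag, ofReal_sum]
  simp only [e1, intervalIntegral.integral_const, real_smul, ← ofReal_mul, ← ofReal_sum] at i1 i2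
  rw [intervalIntegral.integral_ofReal, ofReal_inj] at i2
  refine ⟨?_, i2⟩
  rw [intervalIntegrable_iff] at i1 ⊢
  exact i1.re

/-- Twice the real part of `D · conj S` minus `|S|²` minus its diagonal. -/
noncomputable def meanDefect (b : ℝ) (β : ℕ → ℂ) (D : ℂ → ℂ) (α t : ℝ) : ℝ :=
  2 * (D ((α : ℂ) + t * I) * (starRingEnd ℂ) (dSum b β α t)).re - ‖dSum b β α t‖ ^ 2 - dDiag b α t

theorem DirichletData.exists_meanDefect_le {D : ℂ → ℂ} (h : DirichletData b β D)
    (hα0 : 0 < α) (hα1 : α < 1) :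
    ∃ C : ℝ, 0 < C ∧ ∀ T : ℝ, 2 * Real.pi ≤ T →
      IntervalIntegrable (meanDefect b β D α) volume 1 T ∧
      |∫ t in (1 : ℝ)..T, meanDefect b β D α t| ≤ C * T ^ (1 - α) * Real.log T := by
  obtain ⟨C1, hC1, h1⟩ := h.exists_cross_le hα0 hα1
  obtain ⟨C2, hC2, h2⟩ := exists_norm_integral_dSum_sq_sub_le h.pos h.le_one h.norm_coeff hα1
  refine ⟨2 * C1 + C2, by positivity, fun T hT => ?_⟩
  have h6 := six_lt_two_pi
  obtain ⟨i1, b1⟩ := h1 T hT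
  obtain ⟨i2, b2⟩ := h2 T hT
  obtain ⟨i3, b3⟩ := integral_dDiag (b := b) (α := α) (T := T) (by linarith)
  rw [← b3] at b1 b2
  have e2 : ∀ t : ℝ, ‖dSum b β α t‖ ^ 2 = (dSum b β α t * (starRingEnd ℂ) (dSum b β α t)).re := by
    intro t; rw [mul_conj', ← ofReal_pow, ofReal_re]
  have i1' : IntervalIntegrable (fun t : ℝ => (D ((α : ℂ) + t * I) *
      (starRingEnd ℂ) (dSum b β α t)).re) volume 1 T := by
    rw [intervalIntegrable_iff] at i1 ⊢; exact i1.re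
  have i2' : IntervalIntegrable (fun t : ℝ => ‖dSum b β α t‖ ^ 2) volume 1 T := by
    simp only [e2]
    rw [intervalIntegrable_iff] at i2 ⊢; exact i2.re
  have r1 := reCLM.intervalIntegral_comp_comm i1
  have r2 := reCLM.intervalIntegral_comp_comm i2
  simp only [reCLM_apply, ← e2] at r1 r2
  refine ⟨((i1'.const_mul 2).sub i2').sub i3, ?_⟩
  unfold meanDefect
  rw [intervalIntegral.integral_sub ((i1'.const_mul 2).sub i2') i3,
    intervalIntegral.integral_sub (i1'.const_mul 2) i2', intervalIntegral.integral_const_mul,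
    r1, r2]
  have c1 := (abs_re_le_norm _).trans b1
  have c2 := (abs_re_le_norm _).trans b2
  rw [sub_re, ofReal_re, abs_le] at c1 c2
  rw [abs_le]
  constructor <;> nlinarith [c1.1, c1.2, c2.1, c2.2]

end meanDefect

lemma conj_unitExp (x : ℝ) : (starRingEnd ℂ) (unitExp x) = unitExp (-x) := by
  unfold unitExp
  rw [← exp_conj]
  congr 1
  simp only [map_mul, conj_ofReal, conj_I]
  push_cast; ring

lemma expZeta_neg_conj {a : ℝ} (ha : 0 < a) (ha1 : a < 1) (z : ℂ) :
    HurwitzZeta.expZeta (-(a : UnitAddCircle)) ((starRingEnd ℂ) z) =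
      (starRingEnd ℂ) (HurwitzZeta.expZeta (a : UnitAddCircle) z) := by
  have hne := coe_ne_zero_unitAddCircle ha ha1
  have hd1 := HurwitzZeta.differentiable_expZeta_of_ne_zero hne
  have hd2 := HurwitzZeta.differentiable_expZeta_of_ne_zero (neg_ne_zero.mpr hne)
  have hkey : Set.EqOn (HurwitzZeta.expZeta (-(a : UnitAddCircle)))
      (fun w => (starRingEnd ℂ) (HurwitzZeta.expZeta (a : UnitAddCircle) ((starRingEnd ℂ) w)))
      Set.univ := by
    refine eqOn_of_convex_of_eqOn isOpen_univ convex_univ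
      (isOpen_lt continuous_const continuous_re) hd2.differentiableOn ?_ ?_
      (Set.mem_univ (2 : ℂ)) (V := {w : ℂ | 1 < w.re}) (by simp)
    · intro w _
      have h1 := (hd1 ((starRingEnd ℂ) w)).conj_conj
      rw [conj_conj] at h1
      exact h1.differentiableWithinAt
    · intro w hw
      have hw' : 1 < ((starRingEnd ℂ) w).re := by simpa using hw
      have h1 := (hasSum_expZeta a hw').map (starRingEnd ℂ) continuous_conj
      have h2 := hasSum_expZeta (-a) (s := w) hw
      rw [AddCircle.coe_neg] at h2
      refine h2.unique (h1.congr_fun fun k => ?_)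
      have hk : (0 : ℝ) < (k : ℝ) + 1 := by positivity
      simp only [Function.comp_apply, map_mul, conj_unitExp]
      rw [conj_ofReal_cpow hk, map_neg, conj_conj, neg_mul]
  have := hkey (Set.mem_univ ((starRingEnd ℂ) z))
  simpa using this

/-- The factor of the functional equation on the line `Re s = σ`. -/
noncomputable def chi (σ t : ℝ) : ℂ :=
  (2 * Real.pi : ℂ) ^ (-(1 - ((σ : ℂ) + t * I))) * Gamma (1 - ((σ : ℂ) + t * I)) *
    exp (Real.pi * I * (1 - ((σ : ℂ) + t * I)) / 2)

/-- The main term of `chi` for large `t`. -/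
noncomputable def chiMain (σ t : ℝ) : ℂ :=
  (((t / (2 * Real.pi)) ^ (1 / 2 - σ) : ℝ) : ℂ) *
    exp (((Real.pi / 4 + t - t * Real.log (t / (2 * Real.pi)) : ℝ) : ℂ) * I)

lemma norm_chiMain {σ t : ℝ} (ht : 0 ≤ t) :
    ‖chiMain σ t‖ = (t / (2 * Real.pi)) ^ (1 / 2 - σ) := by
  rw [chiMain, norm_mul, norm_exp_ofReal_mul_I, mul_one, norm_real, Real.norm_of_nonneg]
  have := Real.two_pi_pos
  positivity

lemma exists_chi_eq {σ t : ℝ} (h0 : 0 < σ) (h1 : σ < 1) (ht : 4 ≤ t) :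
    ∃ E : ℂ, ‖E‖ ≤ 20 / t ∧ chi σ t = chiMain σ t * exp E := by
  obtain ⟨E, hE, hG⟩ := exists_Gamma_sub_mul_I (x := 1 - σ) (t := t) (by linarith) (by linarith) ht
  refine ⟨E, hE, ?_⟩
  have hpi := Real.two_pi_pos
  have ht0 : 0 < t := by linarith
  have hpc : ((2 * Real.pi : ℝ) : ℂ) ≠ 0 := by exact_mod_cast hpi.ne'
  have e1 : (1 - ((σ : ℂ) + t * I)) = ((1 - σ : ℝ) : ℂ) - t * I := by push_cast; ring
  have e2 : (Real.sqrt (2 * Real.pi) : ℂ) = exp ((Real.log (2 * Real.pi) / 2 : ℝ) : ℂ) := by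
    rw [← ofReal_exp, Real.exp_half, Real.exp_log hpi]
  have e3 : (((t / (2 * Real.pi)) ^ (1 / 2 - σ) : ℝ) : ℂ) =
      exp (((Real.log t - Real.log (2 * Real.pi)) * (1 / 2 - σ) : ℝ) : ℂ) := by
    rw [Real.rpow_def_of_pos (by positivity), ← ofReal_exp, Real.log_div ht0.ne' hpi.ne']
  rw [chi, chiMain, e1, hG, show (2 * Real.pi : ℂ) = ((2 * Real.pi : ℝ) : ℂ) by push_cast; rfl,
    cpow_def_of_ne_zero hpc, ← ofReal_log hpi.le, e2, e3, Real.log_div ht0.ne' hpi.ne',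
    ← exp_add, ← exp_add, ← exp_add, ← exp_add, ← exp_add]
  congr 1
  push_cast
  ring_nf

lemma norm_exp_sub_one_le_two_mul {E : ℂ} (hE : ‖E‖ ≤ 1) : ‖exp E - 1‖ ≤ 2 * ‖E‖ :=
  norm_exp_sub_one_le hE

lemma exists_chi_bounds {σ : ℝ} (h0 : 0 < σ) (h1 : σ < 1) :
    ∃ C : ℝ, 0 < C ∧ ∀ t : ℝ, 20 ≤ t →
      ‖chi σ t‖ ≤ C * t ^ (1 / 2 - σ) ∧
      ‖chi σ t - chiMain σ t‖ ≤ C * t ^ (-1 / 2 - σ) ∧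
      |‖chi σ t‖ ^ 2 - (t / (2 * Real.pi)) ^ (1 - 2 * σ)| ≤ C * t ^ (-2 * σ) := by
  have hpi := Real.two_pi_pos
  set P : ℝ := (2 * Real.pi)⁻¹ ^ (1 / 2 - σ) with hP
  have hP0 : 0 < P := by positivity
  refine ⟨3 * P + 40 * P + 160 * P ^ 2, by positivity, fun t ht => ?_⟩
  have ht0 : 0 < t := by linarith
  obtain ⟨E, hE, hchi⟩ := exists_chi_eq h0 h1 (by linarith : 4 ≤ t)
  have hE1 : ‖E‖ ≤ 1 := hE.trans (by rw [div_le_one ht0]; exact ht)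
  have hexp := norm_exp_sub_one_le_two_mul hE1
  have hm : ‖chiMain σ t‖ = P * t ^ (1 / 2 - σ) := by
    rw [norm_chiMain ht0.le, div_eq_inv_mul, Real.mul_rpow (by positivity) ht0.le]
  have hexp3 : ‖exp E‖ ≤ 3 := by
    have := norm_add_le (exp E - 1) 1
    rw [sub_add_cancel, norm_one] at this
    linarith
  have hpow : t ^ (1 / 2 - σ) / t = t ^ (-1 / 2 - σ) := by
    rw [← Real.rpow_sub_one ht0.ne']; congr 1; ring
  have hA : ‖chi σ t‖ ≤ 3 * P * t ^ (1 / 2 - σ) := by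
    rw [hchi, norm_mul, hm]
    have : 0 ≤ P * t ^ (1 / 2 - σ) := by positivity
    nlinarith
  have hB : ‖chi σ t - chiMain σ t‖ ≤ 40 * P * t ^ (-1 / 2 - σ) := by
    have : chi σ t - chiMain σ t = chiMain σ t * (exp E - 1) := by rw [hchi]; ring
    rw [this, norm_mul, hm, ← hpow]
    calc P * t ^ (1 / 2 - σ) * ‖exp E - 1‖ ≤ P * t ^ (1 / 2 - σ) * (2 * (20 / t)) := by
          gcongr; linarith
      _ = _ := by ring
  refine ⟨hA.trans ?_, hB.trans ?_, ?_⟩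
  · gcongr; nlinarith
  · gcongr; nlinarith
  · have hw : (t / (2 * Real.pi)) ^ (1 - 2 * σ) = ‖chiMain σ t‖ ^ 2 := by
      rw [norm_chiMain ht0.le, ← Real.rpow_mul_natCast (by positivity)]
      congr 1; push_cast; ring
    rw [hw, sq_sub_sq, abs_mul]
    have h2 : |‖chi σ t‖ - ‖chiMain σ t‖| ≤ 40 * P * t ^ (-1 / 2 - σ) :=
      (abs_norm_sub_norm_le _ _).trans hB
    have h3 : |‖chi σ t‖ + ‖chiMain σ t‖| ≤ 4 * P * t ^ (1 / 2 - σ) := by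
      rw [abs_of_nonneg (by positivity)]; linarith
    calc _ ≤ (4 * P * t ^ (1 / 2 - σ)) * (40 * P * t ^ (-1 / 2 - σ)) := by gcongr
      _ = 160 * P ^ 2 * (t ^ (1 / 2 - σ) * t ^ (-1 / 2 - σ)) := by ring
      _ = 160 * P ^ 2 * t ^ (-2 * σ) := by rw [← Real.rpow_add ht0]; congr 2; ring
      _ ≤ _ := by gcongr; nlinarith

/-- The exponentially small term of the functional equation. -/
noncomputable def chiTail (a σ t : ℝ) : ℂ :=
  chi σ t * exp (-(Real.pi * I * (1 - ((σ : ℂ) + t * I)))) *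
    (starRingEnd ℂ) (HurwitzZeta.expZeta (-(a : UnitAddCircle)) (((1 - σ : ℝ) : ℂ) + t * I))

lemma hurwitzZeta_eq_chi_mul {a : ℝ} (ha : 0 < a) (ha1 : a < 1) {σ t : ℝ} (ht : 0 < t) :
    HurwitzZeta.hurwitzZeta (a : UnitAddCircle) ((σ : ℂ) + t * I) =
      chi σ t * (starRingEnd ℂ)
        (HurwitzZeta.expZeta (a : UnitAddCircle) (((1 - σ : ℝ) : ℂ) + t * I)) +
      chiTail a σ t := by
  have hne := coe_ne_zero_unitAddCircle ha ha1
  have h := HurwitzZeta.hurwitzZeta_one_sub (a : UnitAddCircle) (s := 1 - ((σ : ℂ) + t * I))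
    (fun n hn => by
      have := congrArg Complex.im hn
      simp at this
      exact ht.ne' this) (Or.inl hne)
  have hz : 1 - ((σ : ℂ) + t * I) = (starRingEnd ℂ) (((1 - σ : ℝ) : ℂ) + t * I) := by
    simp only [map_add, conj_ofReal, map_mul, conj_I]; push_cast; ring
  rw [sub_sub_cancel] at h
  have h1 : HurwitzZeta.expZeta (-(a : UnitAddCircle)) (1 - ((σ : ℂ) + t * I)) =
      (starRingEnd ℂ) (HurwitzZeta.expZeta (a : UnitAddCircle) (((1 - σ : ℝ) : ℂ) + t * I)) := by
    rw [hz, expZeta_neg_conj ha ha1]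
  have h2 : HurwitzZeta.expZeta (a : UnitAddCircle) (1 - ((σ : ℂ) + t * I)) =
      (starRingEnd ℂ)
        (HurwitzZeta.expZeta (-(a : UnitAddCircle)) (((1 - σ : ℝ) : ℂ) + t * I)) := by
    have := expZeta_neg_conj (a := 1 - a) (by linarith) (by linarith) (((1 - σ : ℝ) : ℂ) + t * I)
    rw [coe_one_sub_unitAddCircle, neg_neg] at this
    rw [hz, this]
  rw [h, h1, h2, chiTail, chi]
  have e : exp (-Real.pi * I * (1 - ((σ : ℂ) + t * I)) / 2) =
      exp (Real.pi * I * (1 - ((σ : ℂ) + t * I)) / 2) *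
        exp (-(Real.pi * I * (1 - ((σ : ℂ) + t * I)))) := by
    rw [← exp_add]; congr 1; ring
  rw [e]
  ring

lemma exists_norm_chiTail_le {a : ℝ} (ha : 0 < a) (ha1 : a < 1) {σ : ℝ} (h0 : 0 < σ)
    (h1 : σ < 1) :
    ∃ C : ℝ, 0 < C ∧ ∀ t : ℝ, 20 ≤ t → ‖chiTail a σ t‖ ≤ C * t ^ (-1 : ℝ) := by
  obtain ⟨C, hC, hchi⟩ := exists_chi_bounds h0 h1
  obtain ⟨K, hK, hconv⟩ := exists_convexity_expZeta (a := 1 - a) (by linarith) (by linarith)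
  refine ⟨C * K * 24, by positivity, fun t ht => ?_⟩
  have ht0 : 0 < t := by linarith
  have ht1 : 1 ≤ t := by linarith
  have hpi4 := Real.pi_lt_four
  have hl := Real.log_nonneg ht1
  have hz := hconv t (1 - σ) (by linarith) (by linarith) (by
    have : 0 ≤ 1 / Real.log t := by positivity
    linarith)
  rw [coe_one_sub_unitAddCircle] at hz
  obtain ⟨hc, -, -⟩ := hchi t ht
  have hexp : ‖exp (-(Real.pi * I * (1 - ((σ : ℂ) + t * I))))‖ ≤ 24 * t ^ (-4 : ℝ) := by
    rw [norm_exp]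
    have : (-(Real.pi * I * (1 - ((σ : ℂ) + t * I)))).re = -(Real.pi * t) := by simp
    rw [this, Real.exp_neg, Real.rpow_neg ht0.le, ← div_eq_mul_inv, le_div_iff₀ (by positivity),
      inv_mul_le_iff₀ (Real.exp_pos _)]
    have h4 : t ^ (4 : ℝ) = t ^ 4 := by exact_mod_cast Real.rpow_natCast t 4
    rw [h4]
    have h5 : t ^ 4 / 24 ≤ Real.exp t := by
      have := Real.pow_div_factorial_le_exp t ht0.le 4
      norm_num [Nat.factorial] at this
      linarith
    have h6 : Real.exp t ≤ Real.exp (Real.pi * t) := by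
      apply Real.exp_le_exp.mpr; nlinarith [Real.pi_gt_three]
    linarith
  have hlog : Real.log t ≤ t := (Real.log_le_sub_one_of_pos ht0).trans (by linarith)
  rw [chiTail, norm_mul, norm_mul, RCLike.norm_conj]
  have e1 : t ^ (1 / 2 - σ) ≤ t := by
    calc t ^ (1 / 2 - σ) ≤ t ^ (1 : ℝ) := Real.rpow_le_rpow_of_exponent_le ht1 (by linarith)
      _ = t := Real.rpow_one t
  have e2 : t ^ ((1 - (1 - σ)) / 2) ≤ t := by
    calc t ^ ((1 - (1 - σ)) / 2) ≤ t ^ (1 : ℝ) :=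
          Real.rpow_le_rpow_of_exponent_le ht1 (by linarith)
      _ = t := Real.rpow_one t
  calc _ ≤ (C * t) * (24 * t ^ (-4 : ℝ)) * (K * t * t) := by
        gcongr
        · exact hc.trans (by gcongr)
        · exact hz.trans (by gcongr)
    _ = C * K * 24 * (t ^ (3 : ℕ) * t ^ (-4 : ℝ)) := by ring
    _ = _ := by
        rw [← Real.rpow_natCast, ← Real.rpow_add ht0]; norm_num

lemma hasDerivAt_unitExp_mul (n v : ℝ) :
    HasDerivAt (fun v : ℝ => unitExp (n * v)) (2 * Real.pi * n * I * unitExp (n * v)) v := by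
  have h1 : HasDerivAt (fun v : ℝ => ((2 * Real.pi * (n * v) : ℝ) : ℂ) * I)
      (((2 * Real.pi * (n * 1) : ℝ) : ℂ) * I) v :=
    ((((hasDerivAt_id v).const_mul n).const_mul (2 * Real.pi)).ofReal_comp).mul_const I
  have h2 := h1.cexp
  unfold unitExp
  convert h2 using 1
  push_cast; ring

lemma tendsto_zero_of_norm_le_rpow {f : ℝ → ℂ} {C r : ℝ} (hr : r < 0)
    (hf : ∀ v : ℝ, 0 < v → ‖f v‖ ≤ C * v ^ r) : Tendsto f atTop (nhds 0) := by
  have h : Tendsto (fun v : ℝ => C * v ^ r) atTop (nhds 0) := by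
    have := (tendsto_rpow_neg_atTop (y := -r) (by linarith)).const_mul C
    simpa using this
  refine squeeze_zero_norm' ?_ h
  filter_upwards [eventually_gt_atTop 0] with v hv using hf v hv

lemma tendsto_integral_cutPow_mul_unitExp {N : ℝ} (hN : 0 < N) {s : ℂ} (hs : 0 < s.re) {n : ℤ}
    (hn : n ≠ 0) :
    Tendsto (fun M : ℝ => ∫ v in N..M, cutPow N s v * unitExp (n * v)) atTop
      (nhds (-(emCoeff n : ℂ) * ∫ v, cutPow2 N s v * unitExp (n * v))) := by
  set c : ℂ := 2 * Real.pi * n * I with hc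
  have hpi := Real.two_pi_pos
  have hnc : (n : ℂ) ≠ 0 := by exact_mod_cast hn
  have hpc : (Real.pi : ℂ) ≠ 0 := by exact_mod_cast Real.pi_pos.ne'
  have hc0 : c ≠ 0 := by simp [hc, hnc, hpc]
  set F : ℝ → ℂ := fun v => cutPow N s v * unitExp (n * v) * c⁻¹ -
    cutPow1 N s v * unitExp (n * v) * (c⁻¹) ^ 2 with hF
  have hFd : ∀ v, HasDerivAt F (cutPow N s v * unitExp (n * v) -
      cutPow2 N s v * unitExp (n * v) * (c⁻¹) ^ 2) v := by
    intro v
    have he := hasDerivAt_unitExp_mul (n : ℝ) v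
    have h1 := ((hasDerivAt_cutPow hN s v).mul he).mul_const c⁻¹
    have h2 := ((hasDerivAt_cutPow1 hN s v).mul he).mul_const ((c⁻¹) ^ 2)
    have e : (2 * Real.pi * ((n : ℝ) : ℂ) * I : ℂ) = c := by rw [hc]; push_cast; ring
    rw [e] at h1 h2
    refine (h1.sub h2).congr_deriv ?_
    field_simp
    ring
  have hce : Continuous fun v : ℝ => unitExp (n * v) := continuous_unitExp.comp (by fun_prop)
  have hc0' : Continuous fun v => cutPow N s v * unitExp (n * v) :=
    (continuous_cutPow hN s).mul hce
  have hc2' : Continuous fun v => cutPow2 N s v * unitExp (n * v) :=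
    (continuous_cutPow2 hN s).mul hce
  have hint2 : Integrable fun v => cutPow2 N s v * unitExp (n * v) := by
    refine (integrable_cutPow2 hN (s := s) (by linarith)).norm.mono' hc2'.aestronglyMeasurable
      (ae_of_all _ fun v => ?_)
    rw [norm_mul, norm_unitExp, mul_one]
  have hFN : F N = 0 := by simp [hF, cutPow_of_le s le_rfl, cutPow1_of_le s le_rfl]
  have key : ∀ M, ∫ v in N..M, cutPow N s v * unitExp (n * v) =
      F M + (∫ v in N..M, cutPow2 N s v * unitExp (n * v)) * (c⁻¹) ^ 2 := by
    intro M
    have h := intervalIntegral.integral_eq_sub_of_hasDerivAt (a := N) (b := M)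
      (fun v _ => hFd v) ((hc0'.sub (hc2'.mul_const _)).intervalIntegrable _ _)
    rw [intervalIntegral.integral_sub (hc0'.intervalIntegrable _ _)
      ((hc2'.mul_const _).intervalIntegrable _ _), intervalIntegral.integral_mul_const, hFN] at h
    linear_combination h
  have hF0 : Tendsto F atTop (nhds 0) := by
    obtain ⟨C, hC⟩ := exists_norm_cutPow1_le N s
    have t1 : Tendsto (fun v => cutPow N s v * unitExp (n * v) * c⁻¹) atTop (nhds 0) := by
      refine tendsto_zero_of_norm_le_rpow (C := ‖c⁻¹‖) (r := -s.re) (by linarith) fun v hv => ?_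
      rw [norm_mul, norm_mul, norm_unitExp, mul_one, mul_comm]
      exact mul_le_mul_of_nonneg_left (norm_cutPow_le N s v hv) (norm_nonneg _)
    have t2 : Tendsto (fun v => cutPow1 N s v * unitExp (n * v) * (c⁻¹) ^ 2) atTop (nhds 0) := by
      refine tendsto_zero_of_norm_le_rpow (C := ‖(c⁻¹) ^ 2‖ * C) (r := -s.re - 1) (by linarith)
        fun v hv => ?_
      rw [norm_mul, norm_mul, norm_unitExp, mul_one, mul_comm, mul_assoc]
      exact mul_le_mul_of_nonneg_left (hC v hv) (norm_nonneg _)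
    have := t1.sub t2
    rwa [sub_zero] at this
  have hI : Tendsto (fun M => ∫ v in N..M, cutPow2 N s v * unitExp (n * v)) atTop
      (nhds (∫ v, cutPow2 N s v * unitExp (n * v))) := by
    have := intervalIntegral_tendsto_integral_Ioi N hint2.integrableOn tendsto_id
    rwa [setIntegral_eq_integral_of_forall_compl_eq_zero] at this
    intro v hv
    rw [cutPow2_of_le s (by simpa using hv), zero_mul]
  have := hF0.add (hI.mul_const ((c⁻¹) ^ 2))
  rw [zero_add] at this
  have e : (∫ v, cutPow2 N s v * unitExp (n * v)) * (c⁻¹) ^ 2 =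
      -(emCoeff n : ℂ) * ∫ v, cutPow2 N s v * unitExp (n * v) := by
    rw [hc, emCoeff]
    push_cast
    field_simp
    rw [I_sq]
    ring
  rw [← e]
  exact this.congr fun M => (key M).symm

lemma norm_exp_neg_mul_ofReal_le {r : ℂ} (hr : 0 ≤ r.re) {v : ℝ} (hv : 0 ≤ v) :
    ‖exp (-(r * v))‖ ≤ 1 := by
  rw [norm_exp]
  refine Real.exp_le_one_iff.2 ?_
  simp only [neg_re, mul_re, ofReal_re, ofReal_im, mul_zero, sub_zero]
  nlinarith [mul_nonneg hr hv]

lemma integrableOn_cpow_mul_exp_neg {r s : ℂ} (hr : 0 ≤ r.re) (hs : 1 < s.re) :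
    IntegrableOn (fun v : ℝ => (v : ℂ) ^ (-s) * exp (-(r * v))) (Set.Ioi 1) := by
  refine Integrable.mono' (integrableOn_Ioi_rpow_of_lt (a := -s.re) (by linarith) one_pos) ?_ ?_
  · refine ContinuousOn.aestronglyMeasurable (fun v hv => ?_) measurableSet_Ioi
    have hv0 : 0 < v := one_pos.trans hv
    exact ((hasDerivAt_ofReal_cpow_pos hv0 _).continuousAt.mul (by fun_prop)).continuousWithinAt
  · refine (ae_restrict_iff' measurableSet_Ioi).2 (ae_of_all _ fun v hv => ?_)
    have hv0 : (0 : ℝ) < v := one_pos.trans hv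
    rw [norm_mul, norm_cpow_eq_rpow_re_of_pos hv0, neg_re]
    exact mul_le_of_le_one_right (by positivity) (norm_exp_neg_mul_ofReal_le hr hv0.le)

lemma tendsto_integral_cpow_mul_exp_neg {r s : ℂ} (hr : 0 ≤ r.re) (hr0 : r ≠ 0) (hs : 0 < s.re) :
    Tendsto (fun M : ℝ => ∫ v in (1 : ℝ)..M, (v : ℂ) ^ (-s) * exp (-(r * v))) atTop
      (nhds (exp (-r) / r - s / r * ∫ v in Set.Ioi (1 : ℝ), (v : ℂ) ^ (-(s + 1)) * exp
          (-(r * v)))) := by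
  set F : ℝ → ℂ := fun v => -((v : ℂ) ^ (-s) * exp (-(r * v)) / r) with hF
  have hFd : ∀ v : ℝ, 0 < v → HasDerivAt F ((v : ℂ) ^ (-s) * exp (-(r * v)) +
      s / r * ((v : ℂ) ^ (-(s + 1)) * exp (-(r * v)))) v := by
    intro v hv
    have h1 := hasDerivAt_ofReal_cpow_pos hv (-s)
    have h2 : HasDerivAt (fun v : ℝ => exp (-(r * v))) (exp (-(r * v)) * -(r * 1)) v :=
      (((hasDerivAt_id v).ofReal_comp.const_mul r).neg).cexp
    refine (((h1.mul h2).div_const r).neg).congr_deriv ?_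
    rw [show -s - 1 = -(s + 1) by ring]
    field_simp
    ring
  have hcont : ∀ z : ℂ, ContinuousOn (fun v : ℝ => (v : ℂ) ^ z * exp (-(r * v))) (Set.Ioi 0) :=
    fun z v hv => ((hasDerivAt_ofReal_cpow_pos hv _).continuousAt.mul
      (by fun_prop)).continuousWithinAt
  have key : ∀ M : ℝ, 1 ≤ M → F M - F 1 - s / r * ∫ v in (1 : ℝ)..M,
      (v : ℂ) ^ (-(s + 1)) * exp (-(r * v)) = ∫ v in (1 : ℝ)..M,
          (v : ℂ) ^ (-s) * exp (-(r * v)) := by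
    intro M hM
    have hsub : Set.uIcc 1 M ⊆ Set.Ioi 0 := by
      rw [Set.uIcc_of_le hM]; exact fun x hx => one_pos.trans_le hx.1
    have i1 := ((hcont (-s)).mono hsub).intervalIntegrable (μ := volume)
    have i2 := (((hcont (-(s + 1))).mono hsub).intervalIntegrable (μ := volume)).const_mul (s / r)
    have h := intervalIntegral.integral_eq_sub_of_hasDerivAt (a := 1) (b := M)
      (fun v hv => hFd v (hsub hv)) (i1.add i2)
    rw [intervalIntegral.integral_add i1 i2, intervalIntegral.integral_const_mul] at h
    linear_combination -h
  have hF0 : Tendsto F atTop (nhds 0) := by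
    refine tendsto_zero_of_norm_le_rpow (C := ‖r‖⁻¹) (r := -s.re) (by linarith) fun v hv => ?_
    rw [norm_neg, norm_div, norm_mul, norm_cpow_eq_rpow_re_of_pos hv, neg_re, div_eq_inv_mul]
    exact mul_le_mul_of_nonneg_left (mul_le_of_le_one_right (by positivity)
      (norm_exp_neg_mul_ofReal_le hr hv.le)) (by positivity)
  have hI := intervalIntegral_tendsto_integral_Ioi 1
    (integrableOn_cpow_mul_exp_neg (s := s + 1) hr (by simpa using hs)) tendsto_id
  have h := (hF0.sub_const (F 1)).sub (hI.const_mul (s / r))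
  have e : (0 : ℂ) - F 1 = exp (-r) / r := by simp [hF]
  rw [e] at h
  refine h.congr' ?_
  filter_upwards [eventually_ge_atTop 1] with M hM using key M hM

/-- The regularized value of `∫ v in (0, ∞), v ^ (-s) * exp (-r v)`. -/
noncomputable def laplacePow (s r : ℂ) : ℂ :=
  (∫ v in (0 : ℝ)..1, (v : ℂ) ^ (-s) * exp (-(r * v))) +
    (exp (-r) / r - s / r * ∫ v in Set.Ioi (1 : ℝ), (v : ℂ) ^ (-(s + 1)) * exp (-(r * v)))

lemma intervalIntegrable_cpow_mul_exp_neg {s : ℂ} (hs1 : s.re < 1) (r : ℂ) (p q : ℝ) :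
    IntervalIntegrable (fun v : ℝ => (v : ℂ) ^ (-s) * exp (-(r * v))) volume p q :=
  (intervalIntegral.intervalIntegrable_cpow' (by simpa using hs1)).mul_continuousOn
    (by fun_prop)

lemma tendsto_integral_laplacePow {r s : ℂ} (hr : 0 ≤ r.re) (hr0 : r ≠ 0) (hs : 0 < s.re)
    (hs1 : s.re < 1) :
    Tendsto (fun M : ℝ => ∫ v in (0 : ℝ)..M, (v : ℂ) ^ (-s) * exp (-(r * v))) atTop
      (nhds (laplacePow s r)) := by
  refine ((tendsto_integral_cpow_mul_exp_neg hr hr0 hs).const_add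
    (∫ v in (0 : ℝ)..1, (v : ℂ) ^ (-s) * exp (-(r * v)))).congr fun M => ?_
  exact intervalIntegral.integral_add_adjacent_intervals
    (intervalIntegrable_cpow_mul_exp_neg hs1 r 0 1) (intervalIntegrable_cpow_mul_exp_neg hs1 r 1 M)

lemma integrableOn_rpow_mul_exp_neg {x c : ℝ} (hx : -1 < x) (hc : 0 < c) :
    IntegrableOn (fun v : ℝ => v ^ x * Real.exp (-c * v)) (Set.Ioi 0) := by
  simpa using integrableOn_rpow_mul_exp_neg_mul_rpow (p := 1) hx one_pos hc

lemma aestronglyMeasurable_cpow_mul_exp_neg (z w : ℂ) :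
    AEStronglyMeasurable (fun v : ℝ => (v : ℂ) ^ z * exp (-(w * v)))
      (volume.restrict (Set.Ioi 0)) :=
  ContinuousOn.aestronglyMeasurable (fun v hv => ((hasDerivAt_ofReal_cpow_pos hv
    _).continuousAt.mul (by fun_prop)).continuousWithinAt) measurableSet_Ioi

lemma integral_cpow_mul_exp_neg_of_re_pos {a r : ℂ} (ha : 0 < a.re) (hr : 0 < r.re) :
    ∫ v in Set.Ioi (0 : ℝ), (v : ℂ) ^ (a - 1) * exp (-(r * v)) = (1 / r) ^ a * Gamma a := by
  set U : Set ℂ := {w | 0 < w.re} with hU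
  have hUo : IsOpen U := isOpen_lt continuous_const continuous_re
  have hd1 : DifferentiableOn ℂ
      (fun w : ℂ => ∫ v in Set.Ioi (0 : ℝ), (v : ℂ) ^ (a - 1) * exp (-(w * v))) U := by
    intro w hw
    have hw0 : 0 < w.re := hw
    have hnb : {z : ℂ | w.re / 2 < z.re} ∈ nhds w :=
      (isOpen_lt continuous_const continuous_re).mem_nhds (by simp; linarith)
    have hbd : ∀ z : ℂ, ∀ v : ℝ, 0 < v → w.re / 2 < z.re →
        ‖exp (-(z * v))‖ ≤ Real.exp (-(w.re / 2) * v) := by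
      intro z v hv hz
      rw [norm_exp]
      refine Real.exp_le_exp.2 ?_
      simp only [neg_re, mul_re, ofReal_re, ofReal_im, mul_zero, sub_zero]
      nlinarith
    refine (hasDerivAt_integral_of_dominated_loc_of_deriv_le
      (F' := fun z v => (v : ℂ) ^ (a - 1) * (exp (-(z * v)) * -v))
      (bound := fun v : ℝ => v ^ a.re * Real.exp (-(w.re / 2) * v))
      hnb (Eventually.of_forall fun z => aestronglyMeasurable_cpow_mul_exp_neg _ z) ?_ ?_ ?_
      (integrableOn_rpow_mul_exp_neg (by linarith)
          (by linarith)) ?_).2.differentiableAt.differentiableWithinAt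
    · refine Integrable.mono' (integrableOn_rpow_mul_exp_neg (x := a.re - 1) (c := w.re / 2)
        (by linarith) (by linarith)) (aestronglyMeasurable_cpow_mul_exp_neg _ _) ?_
      refine (ae_restrict_iff' measurableSet_Ioi).2 (ae_of_all _ fun v hv => ?_)
      rw [norm_mul, norm_cpow_eq_rpow_re_of_pos hv, sub_re, one_re]
      exact mul_le_mul_of_nonneg_left (hbd w v hv (by linarith)) (Real.rpow_nonneg (le_of_lt hv) _)
    · have h := (aestronglyMeasurable_cpow_mul_exp_neg (a - 1) w).mul
        (continuous_ofReal.neg.aestronglyMeasurable (μ := volume.restrict (Set.Ioi (0 : ℝ))))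
      refine h.congr (ae_of_all _ fun v => ?_)
      simp [mul_assoc]
    · refine (ae_restrict_iff' measurableSet_Ioi).2 (ae_of_all _ fun v hv z hz => ?_)
      have hv0 : (0 : ℝ) < v := hv
      rw [norm_mul, norm_mul, norm_cpow_eq_rpow_re_of_pos hv, sub_re, one_re, norm_neg, norm_real,
        Real.norm_of_nonneg hv0.le]
      have e : v ^ a.re = v ^ (a.re - 1) * v := by
        rw [← Real.rpow_add_one hv0.ne']; ring_nf
      rw [e, mul_assoc, mul_comm v]
      have := hbd z v hv hz
      gcongr
    · refine ae_of_all _ fun v z _ => HasDerivAt.const_mul _ ?_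
      have h : HasDerivAt (fun z : ℂ => -(z * v)) (-(1 * (v : ℂ))) z :=
        ((hasDerivAt_id z).mul_const (v : ℂ)).neg
      simpa using h.cexp
  have hd2 : DifferentiableOn ℂ (fun w : ℂ => (1 / w) ^ a * Gamma a) U := by
    intro w hw
    have hw0 : 0 < w.re := hw
    have hwne : w ≠ 0 := by rintro rfl; simp at hw0
    refine DifferentiableAt.differentiableWithinAt (DifferentiableAt.mul_const
      (DifferentiableAt.cpow_const ((differentiableAt_const _).div differentiableAt_id hwne) ?_) _)
    left
    show 0 < (1 / w).re
    rw [one_div, inv_re]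
    exact div_pos hw0 (normSq_pos.2 hwne)
  have hlim : Tendsto (fun x : ℝ => (x : ℂ)) (nhdsWithin 1 {1}ᶜ) (nhdsWithin 1 {1}ᶜ) := by
    refine tendsto_nhdsWithin_iff.2 ⟨?_, ?_⟩
    · have := (continuous_ofReal.tendsto (1 : ℝ)).mono_left
        (nhdsWithin_le_nhds (s := ({1}ᶜ : Set ℝ)))
      simpa using this
    · filter_upwards [self_mem_nhdsWithin] with x hx
      simpa using hx
  have hev : ∀ᶠ x : ℝ in nhdsWithin 1 {1}ᶜ, ∫ v in Set.Ioi (0 : ℝ),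
      (v : ℂ) ^ (a - 1) * exp (-((x : ℂ) * v)) = (1 / (x : ℂ)) ^ a * Gamma a := by
    filter_upwards [nhdsWithin_le_nhds (Ioi_mem_nhds one_pos)] with x hx
    exact integral_cpow_mul_exp_neg_mul_Ioi ha hx
  exact (hd1.analyticOnNhd hUo).eqOn_of_preconnected_of_frequently_eq (hd2.analyticOnNhd hUo)
    (convex_halfSpace_re_gt 0).isPreconnected (show (1 : ℂ) ∈ U by simp [hU])
    (hlim.frequently hev.frequently) hr

lemma laplacePow_eq_of_re_pos {r s : ℂ} (hr : 0 < r.re) (hs : 0 < s.re) (hs1 : s.re < 1) :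
    laplacePow s r = (1 / r) ^ (1 - s) * Gamma (1 - s) := by
  have hr0 : r ≠ 0 := by rintro rfl; simp at hr
  have h1 := tendsto_integral_laplacePow hr.le hr0 hs hs1
  have hint : IntegrableOn (fun v : ℝ => (v : ℂ) ^ (-s) * exp (-(r * v))) (Set.Ioi 0) := by
    rw [← Set.Ioc_union_Ioi_eq_Ioi zero_le_one]
    refine IntegrableOn.union ?_ ?_
    · exact (intervalIntegrable_iff_integrableOn_Ioc_of_le zero_le_one).1
        (intervalIntegrable_cpow_mul_exp_neg hs1 r 0 1)
    · refine Integrable.mono' (exp_neg_integrableOn_Ioi 1 hr) ?_ ?_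
      · refine ContinuousOn.aestronglyMeasurable (fun v hv => ?_) measurableSet_Ioi
        have hv0 : 0 < v := one_pos.trans hv
        exact ((hasDerivAt_ofReal_cpow_pos hv0 _).continuousAt.mul
          (by fun_prop)).continuousWithinAt
      · refine (ae_restrict_iff' measurableSet_Ioi).2 (ae_of_all _ fun v hv => ?_)
        have hv1 : (1 : ℝ) < v := hv
        have hv0 : (0 : ℝ) < v := one_pos.trans hv
        rw [norm_mul, norm_cpow_eq_rpow_re_of_pos hv0, neg_re, norm_exp]
        have e : (-(r * v)).re = -r.re * v := by simp
        rw [e]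
        exact mul_le_of_le_one_left (by positivity)
          (Real.rpow_le_one_of_one_le_of_nonpos hv1.le (by linarith))
  have h2 := intervalIntegral_tendsto_integral_Ioi 0 hint tendsto_id
  rw [tendsto_nhds_unique h1 h2, ← integral_cpow_mul_exp_neg_of_re_pos (by simpa using hs1) hr]
  simp

lemma tendsto_laplacePow {s r : ℂ} (hr : r.re = 0) (hr0 : r ≠ 0) (hs : 0 < s.re)
    (hs1 : s.re < 1) :
    Tendsto (fun ε : ℝ => laplacePow s (ε + r)) (nhdsWithin 0 (Set.Ioi 0))
      (nhds (laplacePow s r)) := by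
  have hlim : Tendsto (fun ε : ℝ => (ε : ℂ) + r) (nhdsWithin 0 (Set.Ioi 0)) (nhds r) := by
    have : Continuous fun ε : ℝ => (ε : ℂ) + r := by fun_prop
    have h := this.tendsto 0
    rw [ofReal_zero, zero_add] at h
    exact h.mono_left nhdsWithin_le_nhds
  have hptw : ∀ (z : ℂ) (v : ℝ), Tendsto (fun ε : ℝ => (v : ℂ) ^ z * exp (-((ε + r) * v)))
      (nhdsWithin 0 (Set.Ioi 0)) (nhds ((v : ℂ) ^ z * exp (-(r * v)))) := fun z v =>
    ((continuous_exp.tendsto _).comp ((hlim.mul_const (v : ℂ)).neg)).const_mul _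
  have hbd : ∀ (z : ℂ) (ε v : ℝ), 0 < ε → 0 < v →
      ‖(v : ℂ) ^ z * exp (-((ε + r) * v))‖ ≤ v ^ z.re := by
    intro z ε v hε hv
    rw [norm_mul, norm_cpow_eq_rpow_re_of_pos hv]
    exact mul_le_of_le_one_right (by positivity)
      (norm_exp_neg_mul_ofReal_le (by simp [hr, hε.le]) hv.le)
  have hI1 : Tendsto (fun ε : ℝ => ∫ v in (0 : ℝ)..1, (v : ℂ) ^ (-s) * exp (-((ε + r) * v)))
      (nhdsWithin 0 (Set.Ioi 0)) (nhds (∫ v in (0 : ℝ)..1, (v : ℂ) ^ (-s) * exp (-(r * v)))) := by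
    refine intervalIntegral.tendsto_integral_filter_of_dominated_convergence
      (fun v => v ^ (-s).re) (Eventually.of_forall fun ε => ?_) ?_
      (intervalIntegral.intervalIntegrable_rpow' (by simpa using hs1))
      (ae_of_all _ fun v _ => hptw _ v)
    · rw [Set.uIoc_of_le zero_le_one]
      exact (aestronglyMeasurable_cpow_mul_exp_neg _ _).mono_measure
          (Measure.restrict_mono Set.Ioc_subset_Ioi_self le_rfl)
    · filter_upwards [self_mem_nhdsWithin] with ε hε
      refine ae_of_all _ fun v hv => hbd _ ε v hε ?_
      rw [Set.uIoc_of_le zero_le_one] at hv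
      exact hv.1
  have hI2 : Tendsto (fun ε : ℝ => ∫ v in Set.Ioi (1 : ℝ), (v : ℂ) ^ (-(s + 1)) *
      exp (-((ε + r) * v))) (nhdsWithin 0 (Set.Ioi 0))
      (nhds (∫ v in Set.Ioi (1 : ℝ), (v : ℂ) ^ (-(s + 1)) * exp (-(r * v)))) := by
    refine tendsto_integral_filter_of_dominated_convergence
      (fun v => v ^ (-(s + 1)).re) (Eventually.of_forall fun ε => ?_) ?_
      (integrableOn_Ioi_rpow_of_lt (by simp; linarith) one_pos)
      (ae_of_all _ fun v => hptw _ v)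
    · exact (aestronglyMeasurable_cpow_mul_exp_neg _ _).mono_measure
        (Measure.restrict_mono (Set.Ioi_subset_Ioi zero_le_one) le_rfl)
    · filter_upwards [self_mem_nhdsWithin] with ε hε
      refine (ae_restrict_iff' measurableSet_Ioi).2 (ae_of_all _ fun v hv => hbd _ ε v hε ?_)
      exact one_pos.trans hv
  exact hI1.add ((((continuous_exp.tendsto _).comp hlim.neg).div hlim hr0).sub
    ((tendsto_const_nhds.div hlim hr0).mul hI2))

lemma laplacePow_eq {r s : ℂ} (hr : r.re = 0) (hr0 : r ≠ 0) (hs : 0 < s.re) (hs1 : s.re < 1) :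
    laplacePow s r = (1 / r) ^ (1 - s) * Gamma (1 - s) := by
  refine tendsto_nhds_unique (tendsto_laplacePow hr hr0 hs hs1) ?_
  have hlim : Tendsto (fun ε : ℝ => (1 / ((ε : ℂ) + r)) ^ (1 - s) * Gamma (1 - s))
      (nhdsWithin 0 (Set.Ioi 0)) (nhds ((1 / r) ^ (1 - s) * Gamma (1 - s))) := by
    have him : r.im ≠ 0 := fun h => hr0 (Complex.ext hr h)
    have hsl : 1 / r ∈ slitPlane := by
      right
      rw [one_div, inv_im]
      exact div_ne_zero (neg_ne_zero.2 him) (by simpa using hr0)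
    have : ContinuousAt (fun ε : ℝ => (1 / ((ε : ℂ) + r)) ^ (1 - s) * Gamma (1 - s)) 0 := by
      refine ContinuousAt.mul (ContinuousAt.cpow ?_ continuousAt_const (by simpa using hsl))
        continuousAt_const
      exact continuousAt_const.div (by fun_prop) (by simpa using hr0)
    have h := this.tendsto
    rw [ofReal_zero, zero_add] at h
    exact h.mono_left nhdsWithin_le_nhds
  refine hlim.congr' ?_
  filter_upwards [self_mem_nhdsWithin] with ε hε
  exact (laplacePow_eq_of_re_pos (by simpa [hr] using hε) hs hs1).symm

lemma tendsto_integral_cpow_mul_unitExp {σ t : ℝ} (h0 : 0 < σ) (h1 : σ < 1) {n : ℝ} (hn : 0 < n) :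
    Tendsto (fun M : ℝ => ∫ v in (0 : ℝ)..M, (v : ℂ) ^ (-((σ : ℂ) + t * I)) * unitExp (n * v))
      atTop (nhds (chi σ t * (n : ℂ) ^ (((σ : ℂ) + t * I) - 1))) := by
  set s : ℂ := (σ : ℂ) + t * I with hs
  have hsre : s.re = σ := by simp [hs]
  set r : ℂ := -((2 * Real.pi * n : ℝ) * I) with hr
  have hpn : 0 < 2 * Real.pi * n := by have := Real.pi_pos; positivity
  have hrre : r.re = 0 := by simp [hr]
  have hr0 : r ≠ 0 := by
    rw [hr, neg_ne_zero]
    exact mul_ne_zero (ofReal_ne_zero.2 hpn.ne') I_ne_zero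
  have h := tendsto_integral_laplacePow hrre.ge hr0 (hsre ▸ h0 : 0 < s.re) (hsre ▸ h1)
  rw [laplacePow_eq hrre hr0 (hsre ▸ h0 : 0 < s.re) (hsre ▸ h1)] at h
  have e : (1 / r) ^ (1 - s) * Gamma (1 - s) = chi σ t * (n : ℂ) ^ (s - 1) := by
    have e1 : 1 / r = ((2 * Real.pi * n)⁻¹ : ℝ) * I := by
      rw [hr]; push_cast
      have : (2 * Real.pi * n : ℂ) ≠ 0 := by exact_mod_cast hpn.ne'
      field_simp
      rw [I_sq]
      ring
    have e2 : (2 * Real.pi : ℂ) = ((2 * Real.pi : ℝ) : ℂ) := by push_cast; rfl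
    rw [e1, chi, ← hs, cpow_def_of_ne_zero (by
      exact mul_ne_zero (ofReal_ne_zero.2 (inv_ne_zero hpn.ne')) I_ne_zero),
      log_ofReal_mul (inv_pos.2 hpn) I_ne_zero, log_I, Real.log_inv,
      Real.log_mul Real.two_pi_pos.ne' hn.ne', e2,
      cpow_def_of_ne_zero (ofReal_ne_zero.2 Real.two_pi_pos.ne'),
      cpow_def_of_ne_zero (ofReal_ne_zero.2 hn.ne'), ← ofReal_log Real.two_pi_pos.le,
      ← ofReal_log hn.le]
    rw [mul_right_comm, mul_right_comm (exp _), mul_right_comm, ← exp_add, ← exp_add]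
    congr 2
    push_cast
    ring
  rw [← e]
  refine h.congr fun M => intervalIntegral.integral_congr fun v _ => ?_
  simp only [unitExp, hr]
  congr 2
  push_cast
  ring

/-- Multiplication by `f` multiplies bounds of partial integrals on `[p, q]` by at most `C`. -/
def OscMul (f : ℝ → ℝ) (p q C : ℝ) : Prop :=
  ∀ (B : ℝ → ℂ) (M : ℝ), OscBound B p q M → OscBound (fun v => (f v : ℂ) * B v) p q (C * M)

lemma OscMul.of_hasDerivAt {P P' : ℝ → ℝ} {p q C : ℝ}
    (hP : ∀ v ∈ Set.Icc p q, HasDerivAt P (P' v) v) (hP' : ContinuousOn P' (Set.Icc p q))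
    (hsgn : (∀ v ∈ Set.Icc p q, 0 ≤ P' v) ∨ (∀ v ∈ Set.Icc p q, P' v ≤ 0))
    (hC : ∀ v ∈ Set.Icc p q, |P v| ≤ C) : OscMul P p q (3 * C) :=
  fun _ _ hB => hB.mul hP hP' hsgn hC

lemma OscMul.mul {f g : ℝ → ℝ} {p q C C' : ℝ} (hf : OscMul f p q C) (hg : OscMul g p q C') :
    OscMul (fun v => f v * g v) p q (C * C') := by
  intro B M hB
  have := hf _ _ (hg _ _ hB)
  rw [← mul_assoc] at this
  exact this.congr fun v _ => by push_cast; ring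

lemma OscMul.congr {f g : ℝ → ℝ} {p q C : ℝ} (hf : OscMul f p q C)
    (h : ∀ v ∈ Set.Icc p q, g v = f v) : OscMul g p q C :=
  fun B M hB => (hf B M hB).congr fun v hv => by rw [h v hv]

lemma OscMul.mono {f : ℝ → ℝ} {p q C C' : ℝ} (hf : OscMul f p q C) (hpq : p ≤ q) (hC : C ≤ C') :
    OscMul f p q C' :=
  fun B M hB => (hf B M hB).mono (mul_le_mul_of_nonneg_right hC (hB.nonneg hpq))

/-- The oscillating factor `v ^ (-it) e(nv)`. -/
noncomputable def oscFactor (t n v : ℝ) : ℂ := (v : ℂ) ^ (-((t : ℂ) * I)) * unitExp (n * v)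

/-- The derivative of `oscFactor`. -/
noncomputable def oscFactorDeriv (t n v : ℝ) : ℂ :=
  I * (((2 * Real.pi * n * v - t) / v : ℝ) : ℂ) * oscFactor t n v

lemma norm_oscFactor {t n v : ℝ} (hv : 0 < v) : ‖oscFactor t n v‖ = 1 := by
  rw [oscFactor, norm_mul, norm_unitExp, mul_one, norm_cpow_eq_rpow_re_of_pos hv]
  simp

lemma hasDerivAt_oscFactor (t n : ℝ) {v : ℝ} (hv : 0 < v) :
    HasDerivAt (oscFactor t n) (oscFactorDeriv t n v) v := by
  have h := (hasDerivAt_ofReal_cpow_pos hv (-((t : ℂ) * I))).mul (hasDerivAt_unitExp_mul n v)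
  refine h.congr_deriv ?_
  have hvc : (v : ℂ) ≠ 0 := ofReal_ne_zero.2 hv.ne'
  rw [cpow_sub _ _ hvc, cpow_one, oscFactorDeriv, oscFactor]
  push_cast
  field_simp
  ring

lemma continuousOn_oscFactor (t n : ℝ) : ContinuousOn (oscFactor t n) (Set.Ioi 0) :=
  fun _ hv => (hasDerivAt_oscFactor t n hv).continuousAt.continuousWithinAt

lemma continuousOn_oscFactorDeriv (t n : ℝ) :
    ContinuousOn (oscFactorDeriv t n) (Set.Ioi 0) := by
  refine (continuousOn_const.mul (continuous_ofReal.comp_continuousOn ?_)).mul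
    (continuousOn_oscFactor t n)
  exact ContinuousOn.div (by fun_prop) continuousOn_id fun v hv => (ne_of_gt hv)

lemma oscBound_oscFactorDeriv (t n : ℝ) {p q : ℝ} (hp : 0 < p) :
    OscBound (oscFactorDeriv t n) p q 2 := by
  have h := OscBound.of_hasDerivAt (u := oscFactor t n) (u' := oscFactorDeriv t n) (p := p) (q := q)
    (M := 1) (fun v hv => hasDerivAt_oscFactor t n (hp.trans_le hv.1))
    ((continuousOn_oscFactorDeriv t n).mono fun v hv => hp.trans_le hv.1)
    (fun v hv => (norm_oscFactor (hp.trans_le hv.1)).le)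
  simpa using h

lemma cpow_mul_unitExp_eq (σ t n : ℝ) {v : ℝ} (hv : 0 < v) :
    (v : ℂ) ^ (-((σ : ℂ) + t * I)) * unitExp (n * v) = ((v ^ (-σ) : ℝ) : ℂ) * oscFactor t n v := by
  rw [oscFactor, neg_add, cpow_add _ _ (ofReal_ne_zero.2 hv.ne'), ofReal_cpow hv.le]
  push_cast; ring

/-- Second order estimate for an oscillating integral without stationary point. -/
lemma norm_integral_osc_le {h h' : ℝ → ℝ} {p q σ t n A A₁ A₂ M : ℝ} (hp : 0 < p) (hpq : p ≤ q)
    (hσ : 0 ≤ σ) (ht : 0 ≤ t)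
    (hD : ∀ v ∈ Set.Icc p q, 2 * Real.pi * n * v - t ≠ 0)
    (hh : ∀ v ∈ Set.Icc p q, HasDerivAt h (h' v) v)
    (hmul : OscMul h p q 3)
    (hM : OscBound (fun v => (h' v : ℂ) * oscFactorDeriv t n v) p q M)
    (hA : OscMul (fun v => v ^ (1 - σ) / (2 * Real.pi * n * v - t)) p q A)
    (hA₁ : OscMul (fun v => v / (2 * Real.pi * n * v - t)) p q A₁)
    (hA₂ : OscMul (fun v => 1 / (2 * Real.pi * n * v - t)) p q A₂) :
    ‖∫ v in p..q, (h v : ℂ) * (((v ^ (-σ) : ℝ) : ℂ) * oscFactor t n v)‖ ≤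
      |h q| * (q ^ (1 - σ) / |2 * Real.pi * n * q - t|) +
      |h p| * (p ^ (1 - σ) / |2 * Real.pi * n * p - t|) +
      A * (A₁ * M) + σ * (A * (A₂ * 6)) + t * (A * (A₂ * (A₂ * 6))) := by
  set D : ℝ → ℝ := fun v => 2 * Real.pi * n * v - t with hDdef
  set E : ℝ → ℝ := fun v => v ^ (1 - σ) / D v with hE
  have hpos : ∀ v ∈ Set.Icc p q, 0 < v := fun v hv => hp.trans_le hv.1
  have hu2 := oscBound_oscFactorDeriv t n (q := q) hp
  have hT1 := hA _ _ (hA₁ _ _ hM)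
  have hT2 := hA _ _ (hA₂ _ _ (hmul _ _ hu2))
  have hT3 := hA _ _ (hA₂ _ _ (hA₂ _ _ (hmul _ _ hu2)))
  set T1 : ℝ → ℂ := fun v => (E v : ℂ) * (((v / D v : ℝ) : ℂ) *
    ((h' v : ℂ) * oscFactorDeriv t n v)) with hT1def
  set T2 : ℝ → ℂ := fun v => (E v : ℂ) * (((1 / D v : ℝ) : ℂ) *
    ((h v : ℂ) * oscFactorDeriv t n v)) with hT2def
  set T3 : ℝ → ℂ := fun v => (E v : ℂ) * (((1 / D v : ℝ) : ℂ) * (((1 / D v : ℝ) : ℂ) *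
    ((h v : ℂ) * oscFactorDeriv t n v))) with hT3def
  set f : ℝ → ℂ := fun v => (h v : ℂ) * (((v ^ (-σ) : ℝ) : ℂ) * oscFactor t n v) with hf
  set G : ℝ → ℂ := fun v => -I * ((h v : ℂ) * ((E v : ℂ) * oscFactor t n v)) with hG
  have hGd : ∀ v ∈ Set.Icc p q, HasDerivAt G (f v - T1 v + σ * T2 v + t * T3 v) v := by
    intro v hv
    have hv0 := hpos v hv
    have hDv := hD v hv
    have hDd : HasDerivAt D (2 * Real.pi * n) v := by
      have h1 := ((hasDerivAt_id v).const_mul (2 * Real.pi * n)).sub_const t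
      rw [mul_one] at h1
      exact h1
    have hEd : HasDerivAt E ((-σ * v ^ (-σ) * D v - t * v ^ (-σ)) / D v ^ 2) v := by
      have h1 := Real.hasDerivAt_rpow_const (x := v) (p := 1 - σ) (Or.inl hv0.ne')
      refine (h1.div hDd hDv).congr_deriv ?_
      congr 1
      rw [show 1 - σ - 1 = -σ by ring, show 1 - σ = -σ + 1 by ring, Real.rpow_add_one hv0.ne']
      simp only [hDdef]
      ring
    have hE' : (E v : ℂ) = ((v ^ (-σ) : ℝ) : ℂ) * v / (D v : ℂ) := by
      simp only [hE]
      rw [show 1 - σ = -σ + 1 by ring, Real.rpow_add_one hv0.ne']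
      push_cast; rfl
    have hDc : (D v : ℂ) ≠ 0 := ofReal_ne_zero.2 hDv
    have hvc : (v : ℂ) ≠ 0 := ofReal_ne_zero.2 hv0.ne'
    have hd := (((hh v hv).ofReal_comp).mul ((hEd.ofReal_comp).mul
      (hasDerivAt_oscFactor t n hv0))).const_mul (-I)
    refine hd.congr_deriv ?_
    simp only [hf, hT1def, hT2def, hT3def, Pi.mul_apply, hE', oscFactorDeriv]
    rw [show 2 * Real.pi * n * v - t = D v from rfl]
    push_cast
    field_simp
    ring_nf
    rw [show (I : ℂ) ^ 2 = -1 from I_sq]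
    ring
  have hfc : ContinuousOn f (Set.Icc p q) := by
    have h1 : ContinuousOn h (Set.Icc p q) := fun v hv =>
      (hh v hv).continuousAt.continuousWithinAt
    have h2 : ContinuousOn (fun v : ℝ => v ^ (-σ)) (Set.Icc p q) := fun v hv =>
      (Real.continuousAt_rpow_const _ _ (Or.inl (hpos v hv).ne')).continuousWithinAt
    exact (continuous_ofReal.comp_continuousOn h1).mul
      ((continuous_ofReal.comp_continuousOn h2).mul ((continuousOn_oscFactor t n).mono hpos))
  have hii : ∀ {g : ℝ → ℂ}, ContinuousOn g (Set.Icc p q) → IntervalIntegrable g volume p q :=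
    fun hg => (hg.mono (by rw [Set.uIcc_of_le hpq])).intervalIntegrable
  have if' := hii hfc
  have i1 := hii hT1.1
  have i2 := (hii hT2.1).const_mul (σ : ℂ)
  have i3 := (hii hT3.1).const_mul (t : ℂ)
  have hftc := intervalIntegral.integral_eq_sub_of_hasDerivAt (a := p) (b := q)
    (fun v hv => hGd v (by rwa [Set.uIcc_of_le hpq] at hv)) (((if'.sub i1).add i2).add i3)
  rw [intervalIntegral.integral_add ((if'.sub i1).add i2) i3,
    intervalIntegral.integral_add (if'.sub i1) i2, intervalIntegral.integral_sub if' i1,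
    intervalIntegral.integral_const_mul, intervalIntegral.integral_const_mul] at hftc
  have hGn : ∀ v, 0 < v → ‖G v‖ = |h v| * (v ^ (1 - σ) / |D v|) := by
    intro v hv
    simp only [hG, norm_mul, norm_neg, norm_I, one_mul, norm_real, Real.norm_eq_abs,
      norm_oscFactor hv, mul_one, hE, abs_div]
    rw [abs_of_nonneg (Real.rpow_nonneg hv.le _)]
  have e : ∫ v in p..q, f v = G q - G p + (∫ v in p..q, T1 v) - σ * (∫ v in p..q, T2 v) -
      t * (∫ v in p..q, T3 v) := by linear_combination hftc
  rw [e]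
  have n1 := hT1.norm_integral_le hpq
  have n2 := hT2.norm_integral_le hpq
  have n3 := hT3.norm_integral_le hpq
  refine (norm_sub_le _ _).trans (add_le_add ((norm_sub_le _ _).trans (add_le_add
    ((norm_add_le _ _).trans (add_le_add ((norm_sub_le _ _).trans (add_le_add
      (hGn q (hp.trans_le hpq)).le (hGn p hp).le)) n1)) ?_)) ?_)
  · rw [norm_mul, norm_real, Real.norm_of_nonneg hσ]
    exact mul_le_mul_of_nonneg_left (by linarith) hσ
  · rw [norm_mul, norm_real, Real.norm_of_nonneg ht]
    exact mul_le_mul_of_nonneg_left (by linarith) ht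

lemma transDeriv_nonneg (x : ℝ) : 0 ≤ transDeriv x := Real.smoothTransition.monotone.deriv_nonneg

lemma hasDerivAt_smoothTransition_sub (N v : ℝ) :
    HasDerivAt (fun v => Real.smoothTransition (v - N)) (transDeriv (v - N)) v := by
  have h := (hasDerivAt_smoothTransition (v - N)).comp v ((hasDerivAt_id v).sub_const N)
  rw [mul_one] at h
  exact h

lemma oscMul_smoothTransition (N p q : ℝ) :
    OscMul (fun v => Real.smoothTransition (v - N)) p q 3 := by
  have h := OscMul.of_hasDerivAt (C := 1) (p := p) (q := q)
    (fun v _ => hasDerivAt_smoothTransition_sub N v)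
    (continuous_transDeriv.comp (continuous_sub_right N)).continuousOn
    (Or.inl fun v _ => transDeriv_nonneg _) (fun v _ => abs_smoothTransition_le_one _)
  simpa using h

lemma oscMul_one_sub_smoothTransition (N p q : ℝ) :
    OscMul (fun v => 1 - Real.smoothTransition (v - N)) p q 3 := by
  have h := OscMul.of_hasDerivAt (C := 1) (p := p) (q := q)
    (fun v _ => (hasDerivAt_smoothTransition_sub N v).const_sub 1)
    (continuous_transDeriv.comp (continuous_sub_right N)).neg.continuousOn
    (Or.inr fun v _ => neg_nonpos.2 (transDeriv_nonneg _)) (fun v _ => by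
      rw [abs_of_nonneg (sub_nonneg.2 (Real.smoothTransition.le_one _))]
      linarith [Real.smoothTransition.nonneg (v - N)])
  simpa using h

lemma OscBound.neg {B : ℝ → ℂ} {p q M : ℝ} (h : OscBound B p q M) :
    OscBound (fun v => -B v) p q M :=
  ⟨h.1.neg, fun v hv => by rw [intervalIntegral.integral_neg, norm_neg]; exact h.2 v hv⟩

lemma oscBound_transDeriv_mul {K : ℝ} (hK : ∀ x, |transDeriv x| ≤ K) (hK' : ∀ x,
    |transDeriv2 x| ≤ K)
    (N t n : ℝ) {p q : ℝ} (hp : 0 < p) :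
    OscBound (fun v => (transDeriv (v - N) : ℂ) * oscFactorDeriv t n v) p q (3 * K) := by
  have hpos : Set.Icc p q ⊆ Set.Ioi 0 := fun v hv => hp.trans_le hv.1
  have hc1 : Continuous fun v : ℝ => (transDeriv (v - N) : ℂ) :=
    continuous_ofReal.comp (continuous_transDeriv.comp (continuous_sub_right N))
  have hc2 : Continuous fun v : ℝ => (transDeriv2 (v - N) : ℂ) :=
    continuous_ofReal.comp (continuous_transDeriv2.comp (continuous_sub_right N))
  refine ⟨hc1.continuousOn.mul ((continuousOn_oscFactorDeriv t n).mono hpos), fun w hw => ?_⟩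
  have hsub : Set.uIcc p w ⊆ Set.Ioi 0 := by
    rw [Set.uIcc_of_le hw.1]; exact fun v hv => hp.trans_le hv.1
  have hd : ∀ v ∈ Set.uIcc p w, HasDerivAt (fun v => (transDeriv (v - N) : ℂ)) (transDeriv2
      (v - N)) v :=
    fun v _ => by
      have h := (hasDerivAt_transDeriv (v - N)).comp v ((hasDerivAt_id v).sub_const N)
      rw [mul_one] at h
      exact h.ofReal_comp
  have key := intervalIntegral.integral_mul_deriv_eq_deriv_mul hd
    (fun v hv => hasDerivAt_oscFactor t n (hsub hv)) (hc2.intervalIntegrable p w)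
    ((continuousOn_oscFactorDeriv t n).mono hsub).intervalIntegrable
  rw [key]
  have hb : ∀ v, 0 < v → ‖(transDeriv (v - N) : ℂ) * oscFactor t n v‖ ≤ K := fun v hv => by
    rw [norm_mul, norm_oscFactor hv, mul_one, norm_real]; exact hK _
  have hI : ‖∫ v in p..w, (transDeriv2 (v - N) : ℂ) * oscFactor t n v‖ ≤ K := by
    have hind : Integrable (Set.indicator (Set.Icc N (N + 1)) fun _ => K) :=
      (integrable_indicator_iff measurableSet_Icc).2 (by simp)
    refine (intervalIntegral.norm_integral_le_of_norm_le hw.1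
      (g := Set.indicator (Set.Icc N (N + 1)) fun _ => K)
      (ae_of_all _ fun v hv => ?_) hind.intervalIntegrable).trans ?_
    · have hv0 : 0 < v := hp.trans hv.1
      rw [norm_mul, norm_oscFactor hv0, mul_one, norm_real, Real.norm_eq_abs]
      by_cases h : v ∈ Set.Icc N (N + 1)
      · rw [Set.indicator_of_mem h]; exact hK' _
      · rw [Set.indicator_of_notMem h]
        rw [Set.mem_Icc, not_and_or, not_le, not_le] at h
        rcases h with h | h
        · rw [transDeriv2_of_lt (by linarith), abs_zero]
        · rw [transDeriv2_of_gt (by linarith), abs_zero]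
    · have hK0 : 0 ≤ K := (abs_nonneg _).trans (hK 0)
      rw [intervalIntegral.integral_of_le hw.1]
      refine (setIntegral_le_integral hind (ae_of_all _ fun v =>
        Set.indicator_nonneg (fun _ _ => hK0) v)).trans ?_
      rw [integral_indicator measurableSet_Icc]
      simp
  calc _ ≤ K + K + K := (norm_sub_le _ _).trans (add_le_add ((norm_sub_le _ _).trans
        (add_le_add (hb w (hp.trans_le hw.1)) (hb p hp))) hI)
    _ = 3 * K := by ring

lemma hasDerivAt_linPhase (n t v : ℝ) :
    HasDerivAt (fun v => 2 * Real.pi * n * v - t) (2 * Real.pi * n) v := by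
  have h1 := ((hasDerivAt_id v).const_mul (2 * Real.pi * n)).sub_const t
  rw [mul_one] at h1
  exact h1

lemma oscMul_id_div {n t p q C : ℝ} (ht : 0 ≤ t)
    (hD : ∀ v ∈ Set.Icc p q, 2 * Real.pi * n * v - t ≠ 0)
    (hC : ∀ v ∈ Set.Icc p q, |v / (2 * Real.pi * n * v - t)| ≤ C) :
    OscMul (fun v => v / (2 * Real.pi * n * v - t)) p q (3 * C) := by
  refine OscMul.of_hasDerivAt (P' := fun v => -t / (2 * Real.pi * n * v - t) ^ 2)
    (fun v hv => ?_) ?_ (Or.inr fun v hv => ?_) hC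
  · refine ((hasDerivAt_id v).div (hasDerivAt_linPhase n t v) (hD v hv)).congr_deriv ?_
    congr 1
    simp only [id]
    ring
  · exact ContinuousOn.div (by fun_prop) (by fun_prop) fun v hv => pow_ne_zero 2 (hD v hv)
  · exact div_nonpos_of_nonpos_of_nonneg (by linarith) (sq_nonneg _)

lemma oscMul_one_div {n t p q C : ℝ}
    (hD : ∀ v ∈ Set.Icc p q, 2 * Real.pi * n * v - t ≠ 0)
    (hC : ∀ v ∈ Set.Icc p q, |1 / (2 * Real.pi * n * v - t)| ≤ C) :
    OscMul (fun v => 1 / (2 * Real.pi * n * v - t)) p q (3 * C) := by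
  refine OscMul.of_hasDerivAt (P' := fun v => -(2 * Real.pi * n) / (2 * Real.pi * n * v - t) ^ 2)
    (fun v hv => ?_) ?_ ?_ hC
  · have h := (hasDerivAt_linPhase n t v).inv (hD v hv)
    simp only [one_div]
    exact h
  · exact ContinuousOn.div (by fun_prop) (by fun_prop) fun v hv => pow_ne_zero 2 (hD v hv)
  · have hpi := Real.two_pi_pos
    rcases le_total 0 n with hn | hn
    · exact Or.inr fun v _ => div_nonpos_of_nonpos_of_nonneg
        (neg_nonpos.2 (mul_nonneg hpi.le hn)) (sq_nonneg _)
    · exact Or.inl fun v _ => div_nonneg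
        (neg_nonneg.2 (mul_nonpos_of_nonneg_of_nonpos hpi.le hn)) (sq_nonneg _)

lemma oscMul_rpow {x p q C : ℝ} (hp : 0 < p) (hC : ∀ v ∈ Set.Icc p q, v ^ x ≤ C) :
    OscMul (fun v => v ^ x) p q (3 * C) := by
  have hpos : ∀ v ∈ Set.Icc p q, 0 < v := fun v hv => hp.trans_le hv.1
  refine OscMul.of_hasDerivAt (P' := fun v => x * v ^ (x - 1))
    (fun v hv => Real.hasDerivAt_rpow_const (Or.inl (hpos v hv).ne')) ?_ ?_ fun v hv => by
      rw [abs_of_nonneg (Real.rpow_nonneg (hpos v hv).le _)]; exact hC v hv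
  · exact continuousOn_const.mul fun v hv =>
      (Real.continuousAt_rpow_const _ _ (Or.inl (hpos v hv).ne')).continuousWithinAt
  · rcases le_total 0 x with hx | hx
    · exact Or.inl fun v hv => mul_nonneg hx (Real.rpow_nonneg (hpos v hv).le _)
    · exact Or.inr fun v hv => mul_nonpos_of_nonpos_of_nonneg hx (Real.rpow_nonneg (hpos v hv).le _)

/-- Numerical collection of the error terms of the second order estimate. -/
lemma osc_bound_aux {x d X K σ t : ℝ} (hx : 0 ≤ x) (hd : 1 ≤ d) (hX : 1 ≤ X) (hK : 1 ≤ K)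
    (hσ1 : σ ≤ 1) (ht : t ≤ 26 * X ^ 2) :
    3 / 2 * x / d * (1 / (2 * d) * (3 * K)) + σ * (3 / 2 * x / d * (1 / (2 * d * X) * 6)) +
      t * (3 / 2 * x / d * (1 / (2 * d * X) * (1 / (2 * d * X) * 6))) ≤ 70 * K * x / d ^ 2 := by
  have hd0 : 0 < d := by linarith
  have hX0 : 0 < X := by linarith
  have e1 : 3 / 2 * x / d * (1 / (2 * d) * (3 * K)) = 9 / 4 * K * (x / d ^ 2) := by field_simp; ring
  have e2 : σ * (3 / 2 * x / d * (1 / (2 * d * X) * 6)) = (σ / X) * (9 / 2) * (x / d ^ 2) := by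
    field_simp; ring
  have e3 : t * (3 / 2 * x / d * (1 / (2 * d * X) * (1 / (2 * d * X) * 6))) =
      (t / X ^ 2) * (1 / d) * (9 / 4) * (x / d ^ 2) := by field_simp; ring
  have b2 : σ / X ≤ 1 := by rw [div_le_one hX0]; linarith
  have b3 : t / X ^ 2 ≤ 26 := by rw [div_le_iff₀ (by positivity)]; exact ht
  have b4 : 1 / d ≤ 1 := by rw [div_le_one hd0]; exact hd
  have b5 : (t / X ^ 2) * (1 / d) ≤ 26 := by
    have h0 : 0 ≤ 1 / d := by positivity
    nlinarith
  have hxd : 0 ≤ x / d ^ 2 := by positivity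
  rw [e1, e2, e3, show 70 * K * x / d ^ 2 = 70 * K * (x / d ^ 2) by ring, ← add_mul, ← add_mul]
  exact mul_le_mul_of_nonneg_right (by linarith) hxd

lemma norm_cutPow_le_rpow {N v : ℝ} (hv : 0 < v) (σ t : ℝ) :
    ‖cutPow N ((σ : ℂ) + t * I) v‖ ≤ v ^ (-σ) := by
  rw [cutPow, norm_mul, norm_real, Real.norm_eq_abs, norm_cpow_eq_rpow_re_of_pos hv]
  have h1 := abs_smoothTransition_le_one (v - N)
  have h2 : 0 ≤ v ^ (-σ) := Real.rpow_nonneg hv.le _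
  have e : (-((σ : ℂ) + t * I)).re = -σ := by simp
  rw [e]
  nlinarith

lemma norm_integral_cutPow_far_le {K N σ t n d M : ℝ} (hK : ∀ x, |transDeriv x| ≤ K)
    (hK' : ∀ x, |transDeriv2 x| ≤ K) (hK1 : 1 ≤ K) (hN : 1 ≤ N) (hσ : 0 ≤ σ) (hσ1 : σ ≤ 1)
    (ht0 : 0 ≤ t) (ht : t ≤ 26 * N ^ 2) (hd : 1 ≤ d)
    (hD : ∀ v, N ≤ v → 6 * d * v ≤ |2 * Real.pi * n * v - t|) (hM : N ≤ M) :
    ‖∫ v in N..M, cutPow N ((σ : ℂ) + t * I) v * unitExp (n * v)‖ ≤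
      M ^ (-σ) + 70 * K * N ^ (-σ) / d ^ 2 := by
  have hN0 : 0 < N := by linarith
  have hd0 : 0 < d := by linarith
  have hD0 : ∀ v ∈ Set.Icc N M, 2 * Real.pi * n * v - t ≠ 0 := fun v hv => by
    have h1 := hD v hv.1
    have h2 : 0 < 6 * d * v := mul_pos (by positivity) (hN0.trans_le hv.1)
    exact abs_pos.1 (h2.trans_le h1)
  have hb : ∀ v ∈ Set.Icc N M, |v / (2 * Real.pi * n * v - t)| ≤ 1 / (6 * d) := fun v hv => by
    have hv0 : 0 < v := hN0.trans_le hv.1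
    rw [abs_div, abs_of_pos hv0, div_le_div_iff₀ (abs_pos.2 (hD0 v hv)) (by positivity)]
    linarith [hD v hv.1]
  have hb2 : ∀ v ∈ Set.Icc N M, |1 / (2 * Real.pi * n * v - t)| ≤ 1 / (6 * d * N) := fun v hv => by
    rw [abs_div, abs_one]
    refine one_div_le_one_div_of_le (by positivity) (le_trans ?_ (hD v hv.1))
    exact mul_le_mul_of_nonneg_left hv.1 (by positivity)
  have hA := ((oscMul_rpow (x := -σ) hN0 (q := M) (C := N ^ (-σ)) fun v hv =>
    Real.rpow_le_rpow_of_nonpos hN0 hv.1 (by linarith)).mul (oscMul_id_div ht0 hD0 hb)).congr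
      (g := fun v => v ^ (1 - σ) / (2 * Real.pi * n * v - t)) fun v hv => by
        rw [show 1 - σ = -σ + 1 by ring, Real.rpow_add_one (hN0.trans_le hv.1).ne', mul_div_assoc]
  have h := norm_integral_osc_le (h := fun v => Real.smoothTransition (v - N))
    (h' := fun v => transDeriv (v - N)) hN0 hM hσ ht0 hD0
    (fun v _ => hasDerivAt_smoothTransition_sub N v) (oscMul_smoothTransition N N M)
    (oscBound_transDeriv_mul hK hK' N t n hN0) hA (oscMul_id_div ht0 hD0 hb)
        (oscMul_one_div hD0 hb2)
  have e : ∫ v in N..M, cutPow N ((σ : ℂ) + t * I) v * unitExp (n * v) =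
      ∫ v in N..M, (Real.smoothTransition (v - N) : ℂ) *
        (((v ^ (-σ) : ℝ) : ℂ) * oscFactor t n v) := by
    refine intervalIntegral.integral_congr fun v hv => ?_
    rw [Set.uIcc_of_le hM] at hv
    simp only [cutPow]
    rw [mul_assoc, cpow_mul_unitExp_eq σ t n (hN0.trans_le hv.1)]
  rw [e]
  refine h.trans ?_
  have hM0 : 0 < M := hN0.trans_le hM
  have hx := osc_bound_aux (x := N ^ (-σ)) (d := d) (X := N) (K := K) (σ := σ) (t := t)
    (Real.rpow_nonneg hN0.le _) hd hN hK1 hσ1 ht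
  have h0 : Real.smoothTransition (N - N) = 0 := by simp
  rw [h0, abs_zero, zero_mul, add_zero]
  have h1 : |Real.smoothTransition (M - N)| * (M ^ (1 - σ) / |2 * Real.pi * n * M - t|) ≤
      M ^ (-σ) := by
    have h2 : M ^ (1 - σ) / |2 * Real.pi * n * M - t| ≤ M ^ (-σ) := by
      rw [div_le_iff₀ (abs_pos.2 (hD0 M ⟨hM, le_rfl⟩)), show 1 - σ = -σ + 1 by ring,
        Real.rpow_add_one hM0.ne']
      refine mul_le_mul_of_nonneg_left (le_trans ?_ (hD M hM)) (Real.rpow_nonneg hM0.le _)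
      nlinarith
    have h3 : 0 ≤ M ^ (1 - σ) / |2 * Real.pi * n * M - t| := by positivity
    nlinarith [abs_smoothTransition_le_one (M - N)]
  have e1 : 3 * N ^ (-σ) * (3 * (1 / (6 * d))) = 3 / 2 * N ^ (-σ) / d := by field_simp; norm_num
  have e2 : 3 * (1 / (6 * d)) = 1 / (2 * d) := by field_simp; norm_num
  have e3 : 3 * (1 / (6 * d * N)) = 1 / (2 * d * N) := by field_simp; norm_num
  rw [e1, e2, e3]
  linarith

lemma norm_integral_one_sub_cut_le {K N X σ t n d p : ℝ} (hK : ∀ x, |transDeriv x| ≤ K)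
    (hK' : ∀ x, |transDeriv2 x| ≤ K) (hK1 : 1 ≤ K) (hN : 0 ≤ N) (hX : X = N + 1) (hσ : 0 ≤ σ)
    (hσ1 : σ ≤ 1) (ht0 : 0 ≤ t) (ht : t ≤ 26 * X ^ 2) (hd : 1 ≤ d) (hp : 0 < p) (hpX : p ≤ X)
    (hD : ∀ v, 0 ≤ v → v ≤ X → 6 * d * X ≤ |2 * Real.pi * n * v - t|) :
    ‖∫ v in p..X, ((1 - Real.smoothTransition (v - N) : ℝ) : ℂ) *
      (((v ^ (-σ) : ℝ) : ℂ) * oscFactor t n v)‖ ≤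
      p ^ (1 - σ) + 70 * K * X ^ (-σ) / d ^ 2 := by
  have hX1 : 1 ≤ X := by linarith
  have hX0 : 0 < X := by linarith
  have hd0 : 0 < d := by linarith
  have hD0 : ∀ v ∈ Set.Icc p X, 2 * Real.pi * n * v - t ≠ 0 := fun v hv => by
    have h1 := hD v (hp.le.trans hv.1) hv.2
    have h2 : 0 < 6 * d * X := by positivity
    exact abs_pos.1 (h2.trans_le h1)
  have hb2 : ∀ v ∈ Set.Icc p X, |1 / (2 * Real.pi * n * v - t)| ≤ 1 / (6 * d * X) := fun v hv => by
    rw [abs_div, abs_one]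
    exact one_div_le_one_div_of_le (by positivity) (hD v (hp.le.trans hv.1) hv.2)
  have hb : ∀ v ∈ Set.Icc p X, |v / (2 * Real.pi * n * v - t)| ≤ 1 / (6 * d) := fun v hv => by
    have hv0 : 0 < v := hp.trans_le hv.1
    rw [abs_div, abs_of_pos hv0, div_le_div_iff₀ (abs_pos.2 (hD0 v hv)) (by positivity)]
    have := hD v hv0.le hv.2
    have : 6 * d * v ≤ 6 * d * X := mul_le_mul_of_nonneg_left hv.2 (by positivity)
    linarith
  have hA := ((oscMul_rpow (x := 1 - σ) hp (q := X) (C := X ^ (1 - σ)) fun v hv =>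
    Real.rpow_le_rpow (hp.trans_le hv.1).le hv.2 (by linarith)).mul (oscMul_one_div hD0 hb2)).congr
      (g := fun v => v ^ (1 - σ) / (2 * Real.pi * n * v - t)) fun v hv => by
        rw [mul_one_div]
  have hM : OscBound (fun v => ((-transDeriv (v - N) : ℝ) : ℂ) * oscFactorDeriv t n v) p X
      (3 * K) :=
    (oscBound_transDeriv_mul hK hK' N t n hp).neg.congr fun v _ => by push_cast; ring
  have h := norm_integral_osc_le (h := fun v => 1 - Real.smoothTransition (v - N))
    (h' := fun v => -transDeriv (v - N)) hp hpX hσ ht0 hD0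
    (fun v _ => (hasDerivAt_smoothTransition_sub N v).const_sub 1)
    (oscMul_one_sub_smoothTransition N p X) hM hA
    (oscMul_id_div ht0 hD0 hb) (oscMul_one_div hD0 hb2)
  refine h.trans ?_
  have hx := osc_bound_aux (x := X ^ (-σ)) (d := d) (X := X) (K := K) (σ := σ) (t := t)
    (Real.rpow_nonneg hX0.le _) hd hX1 hK1 hσ1 ht
  have h0 : 1 - Real.smoothTransition (X - N) = 0 := by
    rw [Real.smoothTransition.one_of_one_le (by linarith), sub_self]
  rw [h0, abs_zero, zero_mul, zero_add]
  have h1 : |1 - Real.smoothTransition (p - N)| * (p ^ (1 - σ) / |2 * Real.pi * n * p - t|) ≤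
      p ^ (1 - σ) := by
    have hp1 : 0 ≤ p ^ (1 - σ) := Real.rpow_nonneg hp.le _
    have h2 : p ^ (1 - σ) / |2 * Real.pi * n * p - t| ≤ p ^ (1 - σ) := by
      refine div_le_self hp1 (le_trans ?_ (hD p hp.le hpX))
      nlinarith
    have h3 : 0 ≤ p ^ (1 - σ) / |2 * Real.pi * n * p - t| := by positivity
    have h4 : |1 - Real.smoothTransition (p - N)| ≤ 1 := by
      rw [abs_of_nonneg (sub_nonneg.2 (Real.smoothTransition.le_one _))]
      linarith [Real.smoothTransition.nonneg (p - N)]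
    nlinarith
  have e1 : 3 * X ^ (1 - σ) * (3 * (1 / (6 * d * X))) = 3 / 2 * X ^ (-σ) / d := by
    rw [show 1 - σ = -σ + 1 by ring, Real.rpow_add_one hX0.ne']
    field_simp; norm_num
  have e2 : 3 * (1 / (6 * d)) = 1 / (2 * d) := by field_simp; norm_num
  have e3 : 3 * (1 / (6 * d * X)) = 1 / (2 * d * X) := by field_simp; norm_num
  rw [e1, e2, e3]
  linarith

lemma norm_integral_cutPow_mid_le {N σ t n M : ℝ} (hN : 1 ≤ N) (hσ : 0 ≤ σ) (ht0 : 0 ≤ t)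
    (hD : ∀ v, N + 10 ≤ v → v ≤ |2 * Real.pi * n * v - t|) (hM : N + 10 ≤ M) :
    ‖∫ v in N..M, cutPow N ((σ : ℂ) + t * I) v * unitExp (n * v)‖ ≤ 28 * N ^ (-σ) := by
  have hN0 : 0 < N := by linarith
  have hQ0 : 0 < N + 10 := by linarith
  have hD0 : ∀ v ∈ Set.Icc (N + 10) M, 2 * Real.pi * n * v - t ≠ 0 := fun v hv =>
    abs_pos.1 ((hQ0.trans_le hv.1).trans_le (hD v hv.1))
  have hb : ∀ v ∈ Set.Icc (N + 10) M, |v / (2 * Real.pi * n * v - t)| ≤ 1 := fun v hv => by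
    have hv0 : 0 < v := hQ0.trans_le hv.1
    rw [abs_div, abs_of_pos hv0, div_le_one (abs_pos.2 (hD0 v hv))]
    exact hD v hv.1
  have hA := (oscMul_rpow (x := -σ) hQ0 (q := M) (C := N ^ (-σ)) fun v hv =>
    Real.rpow_le_rpow_of_nonpos hN0 (by linarith [hv.1]) (by linarith)).mul
      (oscMul_id_div ht0 hD0 hb)
  have hB : OscBound (fun v => cutPow N ((σ : ℂ) + t * I) v * unitExp (n * v)) (N + 10) M
      (18 * N ^ (-σ)) := by
    have h0 : OscBound (fun v => -I * oscFactorDeriv t n v) (N + 10) M 2 :=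
      ⟨continuousOn_const.mul (oscBound_oscFactorDeriv t n hQ0).1, fun v hv => by
        rw [intervalIntegral.integral_const_mul, norm_mul, norm_neg, norm_I, one_mul]
        exact (oscBound_oscFactorDeriv t n hQ0).2 v hv⟩
    refine ((hA _ _ h0).congr fun v hv => ?_).mono (by linarith)
    have hv0 : 0 < v := hQ0.trans_le hv.1
    have hDc : ((2 * Real.pi * n * v - t : ℝ) : ℂ) ≠ 0 := ofReal_ne_zero.2 (hD0 v hv)
    have hvc : (v : ℂ) ≠ 0 := ofReal_ne_zero.2 hv0.ne'
    rw [cutPow_of_ge _ (by linarith [hv.1]), cpow_mul_unitExp_eq σ t n hv0, oscFactorDeriv]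
    beta_reduce
    generalize 2 * Real.pi * n * v - t = D at hDc ⊢
    push_cast
    field_simp
    rw [I_sq]; ring
  have hc : Continuous fun v => cutPow N ((σ : ℂ) + t * I) v * unitExp (n * v) :=
    (continuous_cutPow hN0 _).mul (continuous_unitExp.comp (continuous_const_mul n))
  rw [← intervalIntegral.integral_add_adjacent_intervals (hc.intervalIntegrable N (N + 10))
    (hc.intervalIntegrable (N + 10) M)]
  have h1 : ‖∫ v in N..(N + 10), cutPow N ((σ : ℂ) + t * I) v * unitExp (n * v)‖ ≤
      N ^ (-σ) * |N + 10 - N| := by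
    refine intervalIntegral.norm_integral_le_of_norm_le_const fun v hv => ?_
    rw [Set.uIoc_of_le (by linarith)] at hv
    rw [norm_mul, norm_unitExp, mul_one]
    exact (norm_cutPow_le_rpow (hN0.trans hv.1) σ t).trans
      (Real.rpow_le_rpow_of_nonpos hN0 hv.1.le (by linarith))
  have h2 := hB.norm_integral_le hM
  rw [add_sub_cancel_left, abs_of_pos (by norm_num : (0 : ℝ) < 10)] at h1
  exact (norm_add_le _ _).trans (by linarith)

/-- The Fourier coefficient of the smoothly truncated power `cutPow`. -/
noncomputable def cutCoeff (N : ℝ) (s : ℂ) (n : ℤ) : ℂ :=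
  -(emCoeff n : ℂ) * ∫ v, cutPow2 N s v * unitExp (n * v)

lemma tendsto_rpow_neg_add {σ : ℝ} (hσ : 0 < σ) (B : ℝ) :
    Tendsto (fun M : ℝ => M ^ (-σ) + B) atTop (nhds B) := by
  have h := (tendsto_rpow_neg_atTop hσ).add_const B
  rwa [zero_add] at h

lemma norm_cutCoeff_le {N σ t B : ℝ} (hN : 0 < N) (hσ : 0 < σ) {n : ℤ} (hn : n ≠ 0)
    (h : ∀ᶠ M in atTop, ‖∫ v in N..M, cutPow N ((σ : ℂ) + t * I) v * unitExp ((n : ℝ) * v)‖ ≤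
      M ^ (-σ) + B) : ‖cutCoeff N ((σ : ℂ) + t * I) n‖ ≤ B :=
  le_of_tendsto_of_tendsto
    (tendsto_integral_cutPow_mul_unitExp hN (s := (σ : ℂ) + t * I) (by simpa using hσ) hn).norm
    (tendsto_rpow_neg_add hσ B) h

lemma cutCoeff_sub_eq {N X σ t : ℝ} (hN : 0 < N) (hX : X = N + 1) (hσ : 0 < σ) (hσ1 : σ < 1)
    {n : ℤ} (hn : 0 < n) :
    cutCoeff N ((σ : ℂ) + t * I) n - chi σ t * ((n : ℝ) : ℂ) ^ (((σ : ℂ) + t * I) - 1) =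
      -∫ v in (0 : ℝ)..X, ((1 - Real.smoothTransition (v - N) : ℝ) : ℂ) *
        ((v : ℂ) ^ (-((σ : ℂ) + t * I)) * unitExp (n * v)) := by
  set s : ℂ := (σ : ℂ) + t * I with hs
  have hsr : s.re = σ := by simp [hs]
  have hnR : (0 : ℝ) < n := Int.cast_pos.2 hn
  have hi : ∀ p q : ℝ, IntervalIntegrable (fun v : ℝ => (v : ℂ) ^ (-s) * unitExp (n * v))
      volume p q := fun p q =>
    (intervalIntegral.intervalIntegrable_cpow' (by rw [neg_re, hsr]; linarith)).mul_continuousOn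
      (continuous_unitExp.comp (continuous_const_mul _)).continuousOn
  have hWc : Continuous fun v : ℝ => ((1 - Real.smoothTransition (v - N) : ℝ) : ℂ) :=
    continuous_ofReal.comp (continuous_const.sub
      (Real.smoothTransition.continuous.comp (continuous_sub_right N)))
  have hF : ∀ p q : ℝ, IntervalIntegrable (fun v : ℝ =>
      ((1 - Real.smoothTransition (v - N) : ℝ) : ℂ) * ((v : ℂ) ^ (-s) * unitExp (n * v)))
      volume p q := fun p q => (hi p q).continuousOn_mul hWc.continuousOn
  have hc : Continuous fun v : ℝ => cutPow N s v * unitExp (n * v) :=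
    (continuous_cutPow hN _).mul (continuous_unitExp.comp (continuous_const_mul _))
  have h1 := tendsto_integral_cutPow_mul_unitExp hN (s := s) (by rw [hsr]; exact hσ) hn.ne'
  have h2 := tendsto_integral_cpow_mul_unitExp hσ hσ1 (t := t) hnR
  refine tendsto_nhds_unique (h1.sub h2) (tendsto_const_nhds.congr' ?_)
  filter_upwards [eventually_ge_atTop X] with M hM
  have e1 : ∫ v in N..M, cutPow N s v * unitExp (n * v) =
      ∫ v in (0 : ℝ)..M, cutPow N s v * unitExp (n * v) := by
    rw [← intervalIntegral.integral_add_adjacent_intervals (hc.intervalIntegrable 0 N)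
      (hc.intervalIntegrable N M), intervalIntegral.integral_congr (g := fun _ => (0 : ℂ)) (b := N)]
    · simp
    · intro v hv
      rw [Set.uIcc_of_le hN.le] at hv
      simp [cutPow_of_le s hv.2]
  have e2 : ∫ v in X..M, ((1 - Real.smoothTransition (v - N) : ℝ) : ℂ) *
      ((v : ℂ) ^ (-s) * unitExp (n * v)) = 0 := by
    rw [intervalIntegral.integral_congr (g := fun _ => (0 : ℂ))]
    · simp
    · intro v hv
      rw [Set.uIcc_of_le hM] at hv
      simp [Real.smoothTransition.one_of_one_le (show 1 ≤ v - N by linarith [hv.1])]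
  rw [e1, ← intervalIntegral.integral_sub (hc.intervalIntegrable 0 M) (hi 0 M),
    ← add_zero (∫ v in (0 : ℝ)..X, _), ← e2,
    intervalIntegral.integral_add_adjacent_intervals (hF 0 X) (hF X M),
    ← intervalIntegral.integral_neg]
  refine intervalIntegral.integral_congr fun v _ => ?_
  simp only [cutPow]
  push_cast; ring

lemma norm_cutCoeff_sub_le {N X σ t B : ℝ} (hN : 0 < N) (hX : X = N + 1) (hσ : 0 < σ)
    (hσ1 : σ < 1) {n : ℤ} (hn : 0 < n)
    (h : ∀ p, 0 < p → p ≤ X → ‖∫ v in p..X, ((1 - Real.smoothTransition (v - N) : ℝ) : ℂ) *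
      (((v ^ (-σ) : ℝ) : ℂ) * oscFactor t n v)‖ ≤ p ^ (1 - σ) + B) :
    ‖cutCoeff N ((σ : ℂ) + t * I) n - chi σ t * ((n : ℝ) : ℂ) ^ (((σ : ℂ) + t * I) - 1)‖ ≤ B := by
  rw [cutCoeff_sub_eq hN hX hσ hσ1 hn, norm_neg]
  have hX0 : 0 < X := by linarith
  set f : ℝ → ℂ := fun v => ((1 - Real.smoothTransition (v - N) : ℝ) : ℂ) *
        ((v : ℂ) ^ (-((σ : ℂ) + t * I)) * unitExp (n * v)) with hf
  have hsr : (-((σ : ℂ) + t * I)).re = -σ := by simp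
  have hWc : Continuous fun v : ℝ => ((1 - Real.smoothTransition (v - N) : ℝ) : ℂ) :=
    continuous_ofReal.comp (continuous_const.sub
      (Real.smoothTransition.continuous.comp (continuous_sub_right N)))
  have hF : IntervalIntegrable f volume 0 X :=
    ((intervalIntegral.intervalIntegrable_cpow' (by rw [hsr]; linarith)).mul_continuousOn
      (continuous_unitExp.comp (continuous_const_mul _)).continuousOn).continuousOn_mul
      hWc.continuousOn
  have hcont := intervalIntegral.continuousOn_primitive_interval_left
    ((intervalIntegrable_iff' (by simp)).1 hF)
  have hlim : Tendsto (fun p => ∫ v in p..X, f v) (nhdsWithin 0 (Set.Ioc 0 X))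
      (nhds (∫ v in (0 : ℝ)..X, f v)) :=
    (hcont 0 Set.left_mem_uIcc).mono_left (nhdsWithin_mono _ (by
      rw [Set.uIcc_of_le hX0.le]; exact Set.Ioc_subset_Icc_self))
  have : (nhdsWithin (0 : ℝ) (Set.Ioc 0 X)).NeBot := by
    rw [nhdsWithin_Ioc_eq_nhdsGT hX0]; infer_instance
  have hlim2 : Tendsto (fun p : ℝ => p ^ (1 - σ) + B) (nhdsWithin 0 (Set.Ioc 0 X)) (nhds B) := by
    have h1 := (Real.continuousAt_rpow_const 0 (1 - σ) (Or.inr (by linarith))).tendsto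
    rw [Real.zero_rpow (by linarith)] at h1
    have h2 := (h1.mono_left (nhdsWithin_le_nhds (s := Set.Ioc 0 X))).add_const B
    rwa [zero_add] at h2
  refine le_of_tendsto_of_tendsto hlim.norm hlim2 ?_
  filter_upwards [self_mem_nhdsWithin] with p hp
  refine le_trans (le_of_eq ?_) (h p hp.1 hp.2)
  congr 1
  refine intervalIntegral.integral_congr fun v hv => ?_
  rw [Set.uIcc_of_le hp.2] at hv
  simp only [hf]
  rw [cpow_mul_unitExp_eq σ t n (hp.1.trans_le hv.1)]

/-- The main part of the Fourier coefficient of the truncated power. -/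
noncomputable def cutMain (N : ℕ) (σ t : ℝ) (n : ℤ) : ℂ :=
  if 0 < n ∧ n ≤ N then chi σ t * ((n : ℝ) : ℂ) ^ (((σ : ℂ) + t * I) - 1) else 0

lemma le_div_one_add_sq {C c x y B : ℝ} (hy : 0 < y) (hB : 0 ≤ B) (h : C * (1 + x ^ 2) ≤ c * y) :
    C * B / y ≤ c * (B * (1 / (1 + x ^ 2))) := by
  have hx : 0 < 1 + x ^ 2 := by positivity
  rw [mul_one_div, ← mul_div_assoc, div_le_div_iff₀ hy hx]
  nlinarith

lemma norm_cutCoeff_le_of_neg {K σ t : ℝ} {N : ℕ} (hK : ∀ x, |transDeriv x| ≤ K)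
    (hK' : ∀ x, |transDeriv2 x| ≤ K) (hK1 : 1 ≤ K) (hN : 2 ≤ N) (hσ : 0 < σ) (hσ1 : σ < 1)
    (ht0 : 0 ≤ t) (ht : t ≤ 26 * (N : ℝ) ^ 2) {n : ℤ} (hn : n < 0) :
    ‖cutCoeff N ((σ : ℂ) + t * I) n‖ ≤ 140 * K * ((N : ℝ) ^ (-σ) * (1 / (1 + (n : ℝ) ^ 2))) := by
  have hNR : (2 : ℝ) ≤ N := by exact_mod_cast hN
  have hnR : (n : ℝ) ≤ -1 := by exact_mod_cast Int.le_sub_one_of_lt hn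
  have h6 := six_lt_two_pi
  have h := norm_cutCoeff_le (N := N) (t := t) (by linarith) hσ hn.ne
    (B := 70 * K * (N : ℝ) ^ (-σ) / (-(n : ℝ)) ^ 2) (by
      filter_upwards [eventually_ge_atTop (N : ℝ)] with M hM
      refine norm_integral_cutPow_far_le hK hK' hK1 (by linarith) hσ.le hσ1.le ht0 ht (by linarith)
        (fun v hv => ?_) hM
      have hv0 : 0 < -(n : ℝ) * v := mul_pos (by linarith) (by linarith)
      rw [le_abs]
      right
      nlinarith)
  refine h.trans (le_div_one_add_sq (by nlinarith) (by positivity) ?_)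
  rw [neg_sq]
  have : 1 ≤ (n : ℝ) ^ 2 := by nlinarith
  nlinarith

lemma norm_cutCoeff_le_of_large {K σ t : ℝ} {N : ℕ} (hK : ∀ x, |transDeriv x| ≤ K)
    (hK' : ∀ x, |transDeriv2 x| ≤ K) (hK1 : 1 ≤ K) (hN : 2 ≤ N) (hσ : 0 < σ) (hσ1 : σ < 1)
    (ht0 : 0 ≤ t) (ht : t ≤ 26 * (N : ℝ) ^ 2) (ht2 : t ≤ 2 * Real.pi * ((N : ℝ) + 1) ^ 2) {n : ℤ}
    (hn : N + 5 ≤ n) :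
    ‖cutCoeff N ((σ : ℂ) + t * I) n‖ ≤
      490 * K * ((N : ℝ) ^ (-σ) * (1 / (1 + ((n - N : ℤ) : ℝ) ^ 2))) := by
  have hNR : (2 : ℝ) ≤ N := by exact_mod_cast hN
  have hnR : (N : ℝ) + 5 ≤ n := by exact_mod_cast hn
  have h6 := six_lt_two_pi
  set d : ℝ := n - N - 3 with hd
  have hd2 : 2 ≤ d := by linarith
  have hn' : (n : ℝ) = d + (N + 3) := by linarith
  have h := norm_cutCoeff_le (N := N) (t := t) (n := n) (by linarith) hσ (by omega)
    (B := 70 * K * (N : ℝ) ^ (-σ) / d ^ 2) (by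
      filter_upwards [eventually_ge_atTop (N : ℝ)] with M hM
      refine norm_integral_cutPow_far_le hK hK' hK1 (by linarith) hσ.le hσ1.le ht0 ht (by linarith)
        (fun v hv => ?_) hM
      rw [le_abs, hn']
      left
      have h1 : ((N : ℝ) + 1) ^ 2 ≤ (N + 3) * v := by nlinarith
      have h2 : 2 * Real.pi * ((N : ℝ) + 1) ^ 2 ≤ 2 * Real.pi * ((N + 3) * v) :=
        mul_le_mul_of_nonneg_left h1 (by linarith)
      have h3 : 6 * (d * v) ≤ 2 * Real.pi * (d * v) :=
        mul_le_mul_of_nonneg_right h6.le (mul_nonneg (by linarith) (by linarith))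
      linarith)
  refine h.trans (le_div_one_add_sq (by positivity) (by positivity) ?_)
  push_cast
  rw [show (n : ℝ) - N = d + 3 by linarith]
  have : 1 + (d + 3) ^ 2 ≤ 7 * d ^ 2 := by nlinarith
  nlinarith

lemma norm_cutCoeff_sub_le_of_small {K σ t : ℝ} {N : ℕ} (hK : ∀ x, |transDeriv x| ≤ K)
    (hK' : ∀ x, |transDeriv2 x| ≤ K) (hK1 : 1 ≤ K) (hN : 2 ≤ N) (hσ : 0 < σ) (hσ1 : σ < 1)
    (ht : t ≤ 26 * (N : ℝ) ^ 2) (ht1 : 2 * Real.pi * (N : ℝ) ^ 2 ≤ t) {n : ℤ}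
    (hn : 0 < n) (hn' : n + 2 ≤ N) :
    ‖cutCoeff N ((σ : ℂ) + t * I) n - chi σ t * ((n : ℝ) : ℂ) ^ (((σ : ℂ) + t * I) - 1)‖ ≤
      350 * K * ((N : ℝ) ^ (-σ) * (1 / (1 + ((n - N : ℤ) : ℝ) ^ 2))) := by
  have hNR : (2 : ℝ) ≤ N := by exact_mod_cast hN
  have hn0 : (1 : ℝ) ≤ n := by exact_mod_cast hn
  have hnR : (n : ℝ) + 2 ≤ N := by exact_mod_cast hn'
  have h6 := six_lt_two_pi
  set d : ℝ := N - 1 - n with hd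
  have hd2 : 1 ≤ d := by linarith
  have hn' : (n : ℝ) = N - 1 - d := by linarith
  have ht0 : 0 ≤ t := le_trans (by positivity) ht1
  have h := norm_cutCoeff_sub_le (N := N) (t := t) (X := N + 1) (n := n) (by linarith) rfl hσ hσ1 hn
    (B := 70 * K * ((N : ℝ) + 1) ^ (-σ) / d ^ 2) (fun p hp hpX => by
      refine norm_integral_one_sub_cut_le hK hK' hK1 (by linarith) rfl hσ.le hσ1.le ht0
        (ht.trans (by nlinarith)) hd2 hp hpX (fun v hv hvX => ?_)
      rw [le_abs]
      right
      have h1 : (n : ℝ) * v ≤ n * (N + 1) := mul_le_mul_of_nonneg_left hvX (by linarith)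
      have h2 : d * (N + 1) + n * v ≤ (N : ℝ) ^ 2 := by
        rw [hn'] at h1 ⊢; nlinarith
      have h3 : 2 * Real.pi * (d * (N + 1) + n * v) ≤ 2 * Real.pi * (N : ℝ) ^ 2 :=
        mul_le_mul_of_nonneg_left h2 (by linarith)
      have h4 : 6 * (d * (N + 1)) ≤ 2 * Real.pi * (d * (N + 1)) :=
        mul_le_mul_of_nonneg_right h6.le (mul_nonneg (by linarith) (by linarith))
      linarith)
  have hX : ((N : ℝ) + 1) ^ (-σ) ≤ (N : ℝ) ^ (-σ) :=
    Real.rpow_le_rpow_of_nonpos (by linarith) (by linarith) (by linarith)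
  have hB : 70 * K * ((N : ℝ) + 1) ^ (-σ) / d ^ 2 ≤ 70 * K * (N : ℝ) ^ (-σ) / d ^ 2 := by
    gcongr
  refine h.trans (hB.trans (le_div_one_add_sq (by positivity) (by positivity) ?_))
  push_cast
  rw [show (n : ℝ) - N = -(d + 1) by linarith]
  have : 1 + (-(d + 1)) ^ 2 ≤ 5 * d ^ 2 := by nlinarith
  nlinarith

lemma norm_cutCoeff_le_of_mid {σ t : ℝ} {N : ℕ} (hN : 2 ≤ N) (hσ : 0 < σ)
    (ht0 : 0 ≤ t) (ht2 : t ≤ 2 * Real.pi * ((N : ℝ) + 1) ^ 2) {n : ℤ}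
    (hn : N - 1 ≤ n) :
    ‖cutCoeff N ((σ : ℂ) + t * I) n‖ ≤ 28 * (N : ℝ) ^ (-σ) := by
  have hNR : (2 : ℝ) ≤ N := by exact_mod_cast hN
  have hnR : (N : ℝ) - 1 ≤ n := by exact_mod_cast hn
  have h6 := six_lt_two_pi
  refine norm_cutCoeff_le (N := N) (t := t) (n := n) (by linarith) hσ (by omega) ?_
  filter_upwards [eventually_ge_atTop ((N : ℝ) + 10)] with M hM
  have hM0 : 0 ≤ M ^ (-σ) := Real.rpow_nonneg (by linarith) _
  refine (norm_integral_cutPow_mid_le (by linarith) hσ.le ht0 (fun v hv => ?_) hM).trans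
    (by linarith)
  rw [le_abs]
  left
  have h1 : ((N : ℝ) - 1) * v ≤ n * v := mul_le_mul_of_nonneg_right hnR (by linarith)
  have h3 : (1 : ℝ) / 6 * v ≤ n * v - ((N : ℝ) + 1) ^ 2 := by nlinarith
  have h4 : 2 * Real.pi * (1 / 6 * v) ≤ 2 * Real.pi * (n * v - ((N : ℝ) + 1) ^ 2) :=
    mul_le_mul_of_nonneg_left h3 (by linarith)
  have h5 : 6 * (1 / 6 * v) ≤ 2 * Real.pi * (1 / 6 * v) :=
    mul_le_mul_of_nonneg_right h6.le (by linarith)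
  linarith

lemma tau_cutN_bounds {t : ℝ} (ht : 26 ≤ t) : 2 ≤ cutN t ∧ 2 * Real.pi * (cutN t : ℝ) ^ 2 ≤ t ∧
    t ≤ 2 * Real.pi * ((cutN t : ℝ) + 1) ^ 2 ∧ t ≤ 26 * (cutN t : ℝ) ^ 2 := by
  have hpi := Real.pi_lt_d2
  have hpi0 := Real.pi_pos
  have h2 : 2 ≤ cutN t := by
    refine Nat.succ_le_of_lt (lt_cutN_iff.2 ?_)
    unfold tau; push_cast; linarith
  have hlo : 2 * Real.pi * (cutN t : ℝ) ^ 2 ≤ t := by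
    have h := lt_cutN_iff.1 (show cutN t - 1 < cutN t by omega)
    unfold tau at h
    rwa [Nat.cast_sub (by omega), Nat.cast_one, sub_add_cancel] at h
  have hhi : t ≤ 2 * Real.pi * ((cutN t : ℝ) + 1) ^ 2 := by
    have h := (not_congr lt_cutN_iff).1 (lt_irrefl (cutN t))
    unfold tau at h
    linarith
  refine ⟨h2, hlo, hhi, hhi.trans ?_⟩
  have hN : (2 : ℝ) ≤ cutN t := by exact_mod_cast h2
  nlinarith

lemma exists_norm_cutCoeff_sub_cutMain_le {σ : ℝ} (hσ : 0 < σ) (hσ1 : σ < 1 / 2) :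
    ∃ C : ℝ, 0 < C ∧ ∀ t : ℝ, 26 ≤ t → ∀ n : ℤ,
      ‖cutCoeff (cutN t) ((σ : ℂ) + t * I) n - cutMain (cutN t) σ t n‖ ≤
        C * ((cutN t : ℝ) ^ (-σ) *
          (1 / (1 + (n : ℝ) ^ 2) + 1 / (1 + ((n - cutN t : ℤ) : ℝ) ^ 2))) := by
  obtain ⟨K, hK1, hK, hK'⟩ := exists_bound_transDeriv
  obtain ⟨L, hL, hchi⟩ := exists_chi_bounds hσ (by linarith)
  refine ⟨490 * K + 17 * (28 + 52 * L), by positivity, fun t ht n => ?_⟩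
  obtain ⟨hN, ht1, ht2, ht3⟩ := tau_cutN_bounds ht
  set N := cutN t with hNdef
  have hNR : (2 : ℝ) ≤ N := by exact_mod_cast hN
  have hN0 : (0 : ℝ) < N := by linarith
  have ht0 : 0 ≤ t := by linarith
  have hg1 : 0 ≤ 1 / (1 + (n : ℝ) ^ 2) := by positivity
  have hg2 : 0 ≤ 1 / (1 + ((n - N : ℤ) : ℝ) ^ 2) := by positivity
  have hx : 0 ≤ (N : ℝ) ^ (-σ) := by positivity
  have hw1 : ∀ c : ℝ, 0 ≤ c → c ≤ 490 * K + 17 * (28 + 52 * L) → ∀ y : ℝ,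
      y ≤ 1 / (1 + (n : ℝ) ^ 2) + 1 / (1 + ((n - N : ℤ) : ℝ) ^ 2) → 
      c * ((N : ℝ) ^ (-σ) * y) ≤ (490 * K + 17 * (28 + 52 * L)) * ((N : ℝ) ^ (-σ) *
          (1 / (1 + (n : ℝ) ^ 2) + 1 / (1 + ((n - N : ℤ) : ℝ) ^ 2))) := fun c hc hc' y hy =>
    (mul_le_mul_of_nonneg_left (mul_le_mul_of_nonneg_left hy hx) hc).trans
      (mul_le_mul_of_nonneg_right hc' (mul_nonneg hx (add_nonneg hg1 hg2)))
  rcases lt_trichotomy n 0 with hn | hn | hn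
  · rw [cutMain, if_neg (by omega), sub_zero]
    exact (norm_cutCoeff_le_of_neg hK hK' hK1 hN hσ (by linarith) ht0 ht3 hn).trans
      (hw1 _ (by positivity) (by nlinarith) _ (by linarith))
  · subst hn
    rw [cutMain, if_neg (by omega), sub_zero, cutCoeff, show emCoeff 0 = 0 by simp [emCoeff]]
    simp only [ofReal_zero, neg_zero, zero_mul, norm_zero]
    exact mul_nonneg (by positivity) (mul_nonneg hx (add_nonneg hg1 hg2))
  · rcases le_or_gt (n + 2) N with h1 | h1
    · rw [cutMain, if_pos ⟨hn, by omega⟩]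
      exact (norm_cutCoeff_sub_le_of_small hK hK' hK1 hN hσ (by linarith) ht3 ht1 hn h1).trans
        (hw1 _ (by positivity) (by nlinarith) _ (by linarith))
    rcases le_or_gt ((N : ℤ) + 5) n with h2 | h2
    · rw [cutMain, if_neg (by omega), sub_zero]
      exact (norm_cutCoeff_le_of_large hK hK' hK1 hN hσ (by linarith) ht0 ht3 ht2 h2).trans
        (hw1 _ (by positivity) (by nlinarith) _ (by linarith))
    have hmid := norm_cutCoeff_le_of_mid hN hσ ht0 ht2 (show (N : ℤ) - 1 ≤ n by omega)
    have hmain : ‖cutMain N σ t n‖ ≤ 52 * L * (N : ℝ) ^ (-σ) := by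
      rw [cutMain]
      split_ifs with h
      · have hnR : (N : ℝ) / 2 ≤ n := by
          have : (N : ℝ) - 1 ≤ n := by exact_mod_cast (show (N : ℤ) - 1 ≤ n by omega)
          linarith
        have hn0 : (0 : ℝ) < n := by linarith
        rw [norm_mul, norm_cpow_eq_rpow_re_of_pos hn0,
          show (((σ : ℂ) + t * I) - 1).re = σ - 1 by simp]
        have b1 : t ^ (1 / 2 - σ) ≤ 26 * (N : ℝ) ^ (1 - 2 * σ) := by
          refine (Real.rpow_le_rpow ht0 ht3 (by linarith)).trans ?_
          rw [Real.mul_rpow (by norm_num) (by positivity), ← Real.rpow_natCast,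
              ← Real.rpow_mul hN0.le,
            show ((2 : ℕ) : ℝ) * (1 / 2 - σ) = 1 - 2 * σ by push_cast; ring]
          refine mul_le_mul_of_nonneg_right ?_ (by positivity)
          exact Real.rpow_le_self_of_one_le (by norm_num) (by linarith)
        have b2 : (n : ℝ) ^ (σ - 1) ≤ 2 * (N : ℝ) ^ (σ - 1) := by
          refine (Real.rpow_le_rpow_of_nonpos (by linarith) hnR (by linarith)).trans ?_
          rw [Real.div_rpow hN0.le (by norm_num), div_eq_mul_inv, ← Real.rpow_neg (by norm_num),
            mul_comm]
          refine mul_le_mul_of_nonneg_right ?_ (by positivity)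
          exact Real.rpow_le_self_of_one_le (by norm_num) (by linarith)
        calc _ ≤ (L * (26 * (N : ℝ) ^ (1 - 2 * σ))) * (2 * (N : ℝ) ^ (σ - 1)) := by
              refine mul_le_mul ((hchi t (by linarith)).1.trans ?_) b2 (by positivity)
                  (by positivity)
              exact mul_le_mul_of_nonneg_left b1 hL.le
          _ = 52 * L * ((N : ℝ) ^ (1 - 2 * σ) * (N : ℝ) ^ (σ - 1)) := by ring
          _ = 52 * L * (N : ℝ) ^ (-σ) := by
              rw [← Real.rpow_add hN0]; congr 2; ring
      · rw [norm_zero]; positivity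
    have hg : (1 : ℝ) / 17 ≤ 1 / (1 + ((n - N : ℤ) : ℝ) ^ 2) := by
      refine one_div_le_one_div_of_le (by positivity) ?_
      have u1 : ((n - N : ℤ) : ℝ) ≤ 4 := by exact_mod_cast (show n - N ≤ 4 by omega)
      have u2 : (-1 : ℝ) ≤ ((n - N : ℤ) : ℝ) := by exact_mod_cast (show -1 ≤ n - N by omega)
      nlinarith
    calc _ ≤ 28 * (N : ℝ) ^ (-σ) + 52 * L * (N : ℝ) ^ (-σ) :=
          (norm_sub_le _ _).trans (add_le_add hmid hmain)
      _ = 17 * (28 + 52 * L) * ((N : ℝ) ^ (-σ) * (1 / 17)) := by ring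
      _ ≤ _ := hw1 _ (by positivity) (by nlinarith) _ (by linarith)

/-- The coefficients `e(a(k+1))` of the dual Dirichlet series. -/
noncomputable def dualCoeff (a : ℝ) (k : ℕ) : ℂ := unitExp (a * ((k : ℝ) + 1))

/-- The remainder in the approximate functional equation of the Hurwitz zeta function. -/
noncomputable def afeRem (a σ t : ℝ) : ℂ :=
  HurwitzZeta.hurwitzZeta (a : UnitAddCircle) (σ + t * I) - dSum a (fun _ => 1) σ t -
    chi σ t * (starRingEnd ℂ) (dSum 1 (dualCoeff a) (1 - σ) t)

lemma summable_one_div_one_add_sq : Summable fun n : ℤ => 1 / (1 + (n : ℝ) ^ 2) := by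
  refine Summable.of_norm_bounded_eventually (Real.summable_one_div_int_pow.2 one_lt_two) ?_
  rw [Filter.eventually_cofinite]
  refine (Set.finite_singleton (0 : ℤ)).subset fun n hn => ?_
  by_contra h0
  refine hn ?_
  have hn0 : (n : ℝ) ≠ 0 := by exact_mod_cast h0
  rw [Real.norm_of_nonneg (by positivity)]
  exact one_div_le_one_div_of_le (by positivity) (by linarith)

lemma hasSum_cutMain (a σ t : ℝ) :
    HasSum (fun n : ℤ => cutMain (cutN t) σ t n * unitExp (-(n * a)))
      (chi σ t * (starRingEnd ℂ) (dSum 1 (dualCoeff a) (1 - σ) t)) := by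
  obtain ⟨ι, hι⟩ : ∃ ι : ℕ ↪ ℤ, ∀ k : ℕ, ι k = (k : ℤ) + 1 :=
    ⟨⟨fun k => (k : ℤ) + 1, fun i j h => by simpa using h⟩, fun _ => rfl⟩
  have h0 : ∀ n ∉ (range (cutN t)).map ι, cutMain (cutN t) σ t n * unitExp (-(n * a)) = 0 := by
    intro n hn
    rw [cutMain, if_neg, zero_mul]
    rintro ⟨h1, h2⟩
    refine hn (mem_map.2 ⟨(n - 1).toNat, mem_range.2 (by omega), ?_⟩)
    rw [hι]
    omega
  have h := hasSum_sum_of_ne_finset_zero (L := SummationFilter.unconditional ℤ) h0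
  rw [sum_map] at h
  convert h using 1
  rw [dSum, map_sum, mul_sum]
  refine sum_congr rfl fun k hk => ?_
  rw [mem_range] at hk
  rw [hι, cutMain, if_pos ⟨by omega, by omega⟩, dTerm, map_mul, conj_ofReal_cpow (by positivity),
      dualCoeff,
    conj_unitExp]
  have e1 : (starRingEnd ℂ) (-(((1 - σ : ℝ) : ℂ) + t * I)) = ((σ : ℂ) + t * I) - 1 := by
    simp only [map_neg, map_add, map_mul, conj_ofReal, conj_I]
    push_cast; ring
  rw [e1]
  push_cast
  rw [show -(a * ((k : ℝ) + 1)) = -(((k : ℝ) + 1) * a) by ring]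
  ring

lemma hasSum_neg_emRemainder {N σ : ℝ} (hN : 0 < N) (hσ : 0 < σ) (a t : ℝ) :
    HasSum (fun n : ℤ => cutCoeff N ((σ : ℂ) + t * I) n * unitExp (-(n * a)))
      (-emRemainder a N ((σ : ℂ) + t * I)) := by
  have h := (hasSum_integral_emKernel (integrable_cutPow2 hN (s := (σ : ℂ) + t * I)
    (by simp; linarith)) a).neg
  refine h.congr_fun fun n => ?_
  have e : ∀ v : ℝ, cutPow2 N ((σ : ℂ) + t * I) v * unitExp (n * (v - a)) =
      cutPow2 N ((σ : ℂ) + t * I) v * unitExp (n * v) * unitExp (-(n * a)) := fun v => by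
    rw [show (n : ℝ) * (v - a) = n * v + -(n * a) by ring, unitExp_add, mul_assoc]
  simp only [e]
  rw [integral_mul_const, cutCoeff]
  ring

lemma norm_inv_mul_cutMass_le {K σ t : ℝ} {N : ℕ} (hK : ∀ x, |transDeriv x| ≤ K) (hN : 1 ≤ N)
    (hσ : 0 < σ) (hσ1 : σ < 1) (ht : 2 * Real.pi * (N : ℝ) ^ 2 ≤ t) :
    ‖((σ : ℂ) + t * I - 1)⁻¹ * cutMass N ((σ : ℂ) + t * I)‖ ≤ K * (N : ℝ) ^ (-σ) := by
  have hNR : (1 : ℝ) ≤ N := by exact_mod_cast hN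
  have hN0 : (0 : ℝ) < N := by linarith
  have h6 := six_lt_two_pi
  have hK0 : 0 ≤ K := (abs_nonneg _).trans (hK 0)
  have ht6 : 6 * (N : ℝ) ^ 2 ≤ t := le_trans (by gcongr) ht
  have ht0 : 0 < t := lt_of_lt_of_le (by positivity) ht6
  have h1 : t ≤ ‖(σ : ℂ) + t * I - 1‖ := by
    have := abs_im_le_norm ((σ : ℂ) + t * I - 1)
    simp at this
    exact (le_abs_self t).trans this
  have h2 : ‖cutMass N ((σ : ℂ) + t * I)‖ ≤ K * (2 * (N : ℝ) ^ (1 - σ)) * |(N : ℝ) + 1 - N| := by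
    rw [cutMass_eq hN0]
    refine intervalIntegral.norm_integral_le_of_norm_le_const fun v hv => ?_
    rw [Set.uIoc_of_le (by linarith)] at hv
    have hv0 : 0 < v := hN0.trans hv.1
    rw [norm_mul, norm_real, Real.norm_eq_abs, norm_cpow_eq_rpow_re_of_pos hv0,
      show (1 - ((σ : ℂ) + t * I)).re = 1 - σ by simp]
    refine mul_le_mul (hK _) ?_ (by positivity) hK0
    calc v ^ (1 - σ) ≤ (2 * (N : ℝ)) ^ (1 - σ) :=
          Real.rpow_le_rpow hv0.le (by linarith [hv.2]) (by linarith)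
      _ = 2 ^ (1 - σ) * (N : ℝ) ^ (1 - σ) := Real.mul_rpow (by norm_num) hN0.le
      _ ≤ 2 * (N : ℝ) ^ (1 - σ) := by
          gcongr
          exact Real.rpow_le_self_of_one_le (by norm_num) (by linarith)
  rw [add_sub_cancel_left, abs_one, mul_one] at h2
  rw [norm_mul, norm_inv]
  calc _ ≤ t⁻¹ * (K * (2 * (N : ℝ) ^ (1 - σ))) := by gcongr
    _ ≤ (6 * (N : ℝ) ^ 2)⁻¹ * (K * (2 * (N : ℝ) ^ (1 - σ))) := by gcongr
    _ = K * (N : ℝ) ^ (-σ) * (1 / (3 * N)) := by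
        rw [show 1 - σ = -σ + 1 by ring, Real.rpow_add_one hN0.ne']
        field_simp; ring
    _ ≤ K * (N : ℝ) ^ (-σ) * 1 := by
        refine mul_le_mul_of_nonneg_left ?_ (by positivity)
        rw [div_le_one (by positivity)]; linarith
    _ = _ := mul_one _

/-- The approximate functional equation of the Hurwitz zeta function. -/
theorem exists_norm_afeRem_le {a σ : ℝ} (ha : 0 < a) (ha1 : a < 1) (hσ : 0 < σ)
    (hσ1 : σ < 1 / 2) :
    ∃ C : ℝ, 0 < C ∧ ∀ t : ℝ, 26 ≤ t → ‖afeRem a σ t‖ ≤ C * t ^ (-σ / 2) := by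
  obtain ⟨K, hK1, hK, hK'⟩ := exists_bound_transDeriv
  obtain ⟨C, hC, hcoef⟩ := exists_norm_cutCoeff_sub_cutMain_le hσ hσ1
  set G : ℝ := ∑' n : ℤ, 1 / (1 + (n : ℝ) ^ 2) with hG
  have hGs : HasSum (fun n : ℤ => 1 / (1 + (n : ℝ) ^ 2)) G := summable_one_div_one_add_sq.hasSum
  have hG0 : 0 ≤ G := tsum_nonneg fun n => by positivity
  refine ⟨26 * (1 + K + C * (G + G)), by positivity, fun t ht => ?_⟩
  obtain ⟨hN, ht1, ht2, ht3⟩ := tau_cutN_bounds ht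
  set N := cutN t with hNdef
  have hNR : (2 : ℝ) ≤ N := by exact_mod_cast hN
  have hN0 : (0 : ℝ) < N := by linarith
  have ht0 : 0 < t := by linarith
  have hx : 0 ≤ (N : ℝ) ^ (-σ) := by positivity
  have hs1 : (σ : ℂ) + t * I ≠ 1 := fun h => by
    have := congrArg im h
    simp at this
    linarith
  have hGN : HasSum (fun n : ℤ => 1 / (1 + ((n - N : ℤ) : ℝ) ^ 2)) G :=
    (Equiv.subRight (N : ℤ)).hasSum_iff.2 hGs
  have hdiff := (hasSum_neg_emRemainder hN0 hσ a t).sub (hasSum_cutMain a σ t)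
  have hD : ‖-emRemainder a N ((σ : ℂ) + t * I) -
      chi σ t * (starRingEnd ℂ) (dSum 1 (dualCoeff a) (1 - σ) t)‖ ≤
      C * ((N : ℝ) ^ (-σ) * (G + G)) := by
    rw [← hdiff.tsum_eq]
    refine tsum_of_norm_bounded (((hGs.add hGN).mul_left _).mul_left C) fun n => ?_
    rw [← sub_mul, norm_mul, norm_unitExp, mul_one]
    exact hcoef t ht n
  have hW : ‖((1 : ℂ) - Real.smoothTransition a) * ((N + a : ℝ) : ℂ) ^ (-((σ : ℂ) + t * I))‖ ≤
      (N : ℝ) ^ (-σ) := by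
    rw [norm_mul, norm_cpow_eq_rpow_re_of_pos (by positivity),
      show (-((σ : ℂ) + t * I)).re = -σ by simp, ← ofReal_one, ← ofReal_sub, norm_real,
      Real.norm_of_nonneg (sub_nonneg.2 (Real.smoothTransition.le_one _))]
    have h1 : ((N : ℝ) + a) ^ (-σ) ≤ (N : ℝ) ^ (-σ) :=
      Real.rpow_le_rpow_of_nonpos hN0 (by linarith) (by linarith)
    have h2 : 0 ≤ ((N : ℝ) + a) ^ (-σ) := by positivity
    nlinarith [Real.smoothTransition.nonneg a]
  have hM := norm_inv_mul_cutMass_le hK (by omega : 1 ≤ N) hσ (by linarith) ht1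
  have e : afeRem a σ t =
      ((1 : ℂ) - Real.smoothTransition a) * ((N + a : ℝ) : ℂ) ^ (-((σ : ℂ) + t * I)) +
      ((σ : ℂ) + t * I - 1)⁻¹ * cutMass N ((σ : ℂ) + t * I) +
      (-emRemainder a N ((σ : ℂ) + t * I) -
        chi σ t * (starRingEnd ℂ) (dSum 1 (dualCoeff a) (1 - σ) t)) := by
    rw [afeRem, hurwitzZeta_eq ha ha1.le (by omega : 0 < N) (by simp; linarith) hs1, dSum]
    simp only [dTerm, one_mul]
    ring
  have hfin : (N : ℝ) ^ (-σ) ≤ 26 * t ^ (-σ / 2) := by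
    have h1 : (26 * (N : ℝ) ^ 2) ^ (-σ / 2) ≤ t ^ (-σ / 2) :=
      Real.rpow_le_rpow_of_nonpos ht0 ht3 (by linarith)
    rw [Real.mul_rpow (by norm_num) (by positivity), ← Real.rpow_natCast (N : ℝ) 2,
      ← Real.rpow_mul hN0.le, show ((2 : ℕ) : ℝ) * (-σ / 2) = -σ by push_cast; ring] at h1
    have h2 : (26 : ℝ)⁻¹ ≤ 26 ^ (-σ / 2) := by
      rw [← Real.rpow_neg_one]
      exact Real.rpow_le_rpow_of_exponent_le (by norm_num) (by linarith)
    have h3 : (26 : ℝ)⁻¹ * (N : ℝ) ^ (-σ) ≤ 26 ^ (-σ / 2) * (N : ℝ) ^ (-σ) :=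
      mul_le_mul_of_nonneg_right h2 hx
    linarith
  rw [e]
  calc _ ≤ (N : ℝ) ^ (-σ) + K * (N : ℝ) ^ (-σ) + C * ((N : ℝ) ^ (-σ) * (G + G)) :=
        norm_add₃_le.trans (add_le_add (add_le_add hW hM) hD)
    _ = (1 + K + C * (G + G)) * (N : ℝ) ^ (-σ) := by ring
    _ ≤ (1 + K + C * (G + G)) * (26 * t ^ (-σ / 2)) := by gcongr
    _ = _ := by ring

lemma dirichletData_hurwitzZeta {a : ℝ} (ha : 0 < a) (ha1 : a ≤ 1) :
    DirichletData a (fun _ => 1) (HurwitzZeta.hurwitzZeta (a : UnitAddCircle)) where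
  pos := ha
  le_one := ha1
  norm_coeff _ := norm_one
  differentiableAt _ hs := HurwitzZeta.differentiableAt_hurwitzZeta _ fun h => by
    rw [h] at hs; simp at hs
  hasSum s hs := hasSum_hurwitzZeta ha ha1 hs
  convexity := exists_convexity_hurwitz ha ha1

lemma norm_dualCoeff (a : ℝ) (k : ℕ) : ‖dualCoeff a k‖ = 1 := norm_unitExp _

lemma dirichletData_expZeta {a : ℝ} (ha : 0 < a) (ha1 : a < 1) :
    DirichletData 1 (dualCoeff a) (HurwitzZeta.expZeta (a : UnitAddCircle)) where
  pos := one_pos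
  le_one := le_rfl
  norm_coeff := norm_dualCoeff a
  differentiableAt s _ :=
    HurwitzZeta.differentiable_expZeta_of_ne_zero (coe_ne_zero_unitAddCircle ha ha1) s
  hasSum _ hs := hasSum_expZeta a hs
  convexity := exists_convexity_expZeta ha ha1

/-- Integration by parts against a power, for an integrable function with bounded primitive. -/
lemma abs_integral_rpow_mul_le {f : ℝ → ℝ} {p T M : ℝ} (hp : 0 ≤ p) (hT : 1 ≤ T)
    (hf : IntervalIntegrable f volume 1 T) (hM : ∀ t ∈ Set.Icc 1 T, |∫ v in (1 : ℝ)..t, f v| ≤ M) :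
    |∫ t in (1 : ℝ)..T, t ^ p * f t| ≤ 2 * T ^ p * M := by
  have hM0 : 0 ≤ M := (abs_nonneg _).trans (hM 1 ⟨le_rfl, hT⟩)
  have hu : Set.uIcc 1 T = Set.Icc 1 T := Set.uIcc_of_le hT
  have hd : ∀ t ∈ Set.uIcc 1 T, HasDerivAt (fun t : ℝ => t ^ p) (p * t ^ (p - 1)) t := by
    intro t ht
    rw [hu] at ht
    exact Real.hasDerivAt_rpow_const (Or.inl (by linarith [ht.1]))
  have hdi : IntervalIntegrable (fun t : ℝ => p * t ^ (p - 1)) volume 1 T := by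
    refine ContinuousOn.intervalIntegrable fun t ht => ?_
    rw [hu] at ht
    exact (continuousAt_const.mul (Real.continuousAt_rpow_const _ _
      (Or.inl (by linarith [ht.1])))).continuousWithinAt
  have hpow : AbsolutelyContinuousOnInterval (fun t : ℝ => t ^ p) 1 T := by
    refine ContDiffOn.absolutelyContinuousOnInterval fun t ht => ?_
    rw [hu] at ht
    exact (Real.contDiffAt_rpow_const_of_ne (by linarith [ht.1])).contDiffWithinAt
  have hF := hf.absolutelyContinuousOnInterval_intervalIntegral (c := 1) (by simp)
  have key := hpow.integral_mul_deriv_eq_deriv_mul hF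
  have e1 : ∫ t in (1 : ℝ)..T, t ^ p * f t =
      ∫ t in (1 : ℝ)..T, t ^ p * deriv (fun x => ∫ v in (1 : ℝ)..x, f v) t := by
    refine intervalIntegral.integral_congr_ae ?_
    filter_upwards [hf.ae_hasDerivAt_integral] with t ht ht'
    rw [(ht (Set.uIoc_subset_uIcc ht') 1 (by simp)).deriv]
  have e2 : ∫ t in (1 : ℝ)..T, p * t ^ (p - 1) = T ^ p - 1 := by
    rw [intervalIntegral.integral_eq_sub_of_hasDerivAt hd hdi, Real.one_rpow]
  have b1 : ‖∫ t in (1 : ℝ)..T, deriv (fun t : ℝ => t ^ p) t * ∫ v in (1 : ℝ)..t, f v‖ ≤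
      ∫ t in (1 : ℝ)..T, p * t ^ (p - 1) * M := by
    refine intervalIntegral.norm_integral_le_of_norm_le hT ?_ (hdi.mul_const M)
    refine Eventually.of_forall fun t ht => ?_
    have ht1 : t ∈ Set.Icc 1 T := Set.Ioc_subset_Icc_self ht
    have ht0 : 0 ≤ t := by linarith [ht1.1]
    rw [(hd t (hu ▸ ht1)).deriv, norm_mul, Real.norm_eq_abs, Real.norm_eq_abs,
      abs_of_nonneg (by positivity)]
    exact mul_le_mul_of_nonneg_left (hM t ht1) (by positivity)
  rw [intervalIntegral.integral_mul_const, e2, Real.norm_eq_abs] at b1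
  have hTp : 1 ≤ T ^ p := Real.one_le_rpow hT hp
  rw [e1, key, intervalIntegral.integral_same, mul_zero, sub_zero]
  refine (abs_sub _ _).trans ?_
  rw [abs_mul, abs_of_pos (by positivity : 0 < T ^ p)]
  have b2 := mul_le_mul_of_nonneg_left (hM T ⟨hT, le_rfl⟩) (by positivity : 0 ≤ T ^ p)
  nlinarith

lemma cutN_eq_zero {t : ℝ} (ht : t < 2 * Real.pi) : cutN t = 0 := by
  by_contra h
  have h1 := lt_cutN_iff.mp (Nat.pos_of_ne_zero h)
  have := two_pi_le_tau 0
  linarith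

lemma meanDefect_eq_zero {b : ℝ} {β : ℕ → ℂ} {D : ℂ → ℂ} {α t : ℝ} (ht : t < 2 * Real.pi) :
    meanDefect b β D α t = 0 := by
  simp [meanDefect, dSum, dDiag, cutN_eq_zero ht]

/-- The mean defect integrated against a power. -/
lemma DirichletData.exists_weighted_meanDefect_le {b : ℝ} {β : ℕ → ℂ} {D : ℂ → ℂ} {α : ℝ}
    (h : DirichletData b β D) (hα0 : 0 < α) (hα1 : α < 1) {p : ℝ} (hp : 0 ≤ p) :
    ∃ C : ℝ, 0 < C ∧ ∀ T : ℝ, 2 * Real.pi ≤ T →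
      IntervalIntegrable (fun t => t ^ p * meanDefect b β D α t) volume 1 T ∧
      |∫ t in (1 : ℝ)..T, t ^ p * meanDefect b β D α t| ≤
        C * T ^ (1 - α + p) * Real.log T := by
  obtain ⟨C, hC, hb⟩ := h.exists_meanDefect_le hα0 hα1
  refine ⟨2 * C, by positivity, fun T hT => ?_⟩
  have h6 := six_lt_two_pi
  have hl := one_le_log_of_two_pi_le hT
  have hT0 : 0 < T := by linarith
  have hi := (hb T hT).1
  refine ⟨hi.continuousOn_mul fun t ht => ?_, ?_⟩
  · exact (Real.continuousAt_rpow_const _ _ (Or.inr hp)).continuousWithinAt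
  · refine (abs_integral_rpow_mul_le (M := C * T ^ (1 - α) * Real.log T) hp (by linarith) hi
      fun t ht => ?_).trans_eq ?_
    · rcases lt_or_ge t (2 * Real.pi) with h2 | h2
      · rw [intervalIntegral.integral_congr (g := fun _ => (0 : ℝ)),
          intervalIntegral.integral_zero, abs_zero]
        · positivity
        · intro v hv
          rw [Set.uIcc_of_le ht.1] at hv
          exact meanDefect_eq_zero (by linarith [hv.2])
      · refine (hb t h2).2.trans ?_
        have h3 : t ^ (1 - α) ≤ T ^ (1 - α) :=
          Real.rpow_le_rpow (by linarith) ht.2 (by linarith)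
        have h4 : Real.log t ≤ Real.log T := Real.log_le_log (by linarith) ht.2
        have h5 := one_le_log_of_two_pi_le h2
        gcongr
    · rw [Real.rpow_add hT0]; ring

lemma exists_norm_cutMass_sub_le {r : ℝ} (hr : 0 < r) :
    ∃ C : ℝ, 0 < C ∧ ∀ N : ℝ, 1 ≤ N →
      ‖cutMass N (r : ℂ) - ((N ^ (1 - r) : ℝ) : ℂ)‖ ≤ C * N ^ (-r) := by
  obtain ⟨K, hK1, hK, -⟩ := exists_bound_transDeriv
  refine ⟨K * (|1 - r| + 1), by positivity, fun N hN => ?_⟩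
  have hN0 : 0 < N := by linarith
  have hpos : ∀ v ∈ Set.uIcc N (N + 1), 0 < v := fun v hv => by
    rw [Set.uIcc_of_le (by linarith)] at hv; linarith [hv.1]
  have hc : Continuous fun v : ℝ => transDeriv (v - N) :=
    continuous_transDeriv.comp (continuous_sub_right N)
  have e1 : cutMass N (r : ℂ) = ((∫ v in N..(N + 1), transDeriv (v - N) * v ^
      (1 - r) : ℝ) : ℂ) := by
    rw [cutMass_eq hN0, ← intervalIntegral.integral_ofReal]
    refine intervalIntegral.integral_congr fun v hv => ?_
    rw [ofReal_mul, ofReal_cpow (hpos v hv).le]; push_cast; rfl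
  have e2 : ∫ v in N..(N + 1), transDeriv (v - N) = 1 := by
    rw [intervalIntegral.integral_eq_sub_of_hasDerivAt (f := fun v => Real.smoothTransition (v - N))
      (fun v _ => by
        have h := (hasDerivAt_smoothTransition (v - N)).comp v ((hasDerivAt_id v).sub_const N)
        rw [mul_one] at h; exact h) (hc.intervalIntegrable _ _)]
    simp
  have hi1 : IntervalIntegrable (fun v : ℝ => transDeriv (v - N) * v ^ (1 - r)) volume N
      (N + 1) := by
    refine ContinuousOn.intervalIntegrable fun v hv => ?_
    exact (hc.continuousAt.mul (Real.continuousAt_rpow_const _ _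
      (Or.inl (hpos v hv).ne'))).continuousWithinAt
  have e3 : (∫ v in N..(N + 1), transDeriv (v - N) * v ^ (1 - r)) - N ^ (1 - r) =
      ∫ v in N..(N + 1), transDeriv (v - N) * (v ^ (1 - r) - N ^ (1 - r)) := by
    have h := intervalIntegral.integral_sub hi1 ((hc.intervalIntegrable N (N + 1)).mul_const
      (N ^ (1 - r)))
    rw [intervalIntegral.integral_mul_const, e2, one_mul] at h
    rw [← h]
    refine intervalIntegral.integral_congr fun v _ => ?_
    ring
  rw [e1, ← ofReal_sub, e3, norm_real]
  have h := intervalIntegral.norm_integral_le_of_norm_le_const (a := N) (b := N + 1)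
    (f := fun v => transDeriv (v - N) * (v ^ (1 - r) - N ^ (1 - r)))
    (C := K * ((|1 - r| + 1) * N ^ (-r))) fun v hv => by
      rw [Set.uIoc_of_le (by linarith)] at hv
      rw [norm_mul]
      refine mul_le_mul (hK _) ?_ (norm_nonneg _) (by linarith)
      have hm := Convex.norm_image_sub_le_of_norm_hasDerivWithin_le (f := fun x : ℝ => x ^ (1 - r))
        (f' := fun x => (1 - r) * x ^ (1 - r - 1)) (s := Set.Icc N (N + 1))
        (C := |1 - r| * N ^ (-r)) (x := N) (y := v)
        (fun x hx => (Real.hasDerivAt_rpow_const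
          (Or.inl (by linarith [hx.1]))).hasDerivWithinAt) (fun x hx => by
          have hx0 : 0 < x := by linarith [hx.1]
          rw [norm_mul, Real.norm_eq_abs, Real.norm_eq_abs, abs_of_pos (Real.rpow_pos_of_pos hx0 _),
            show 1 - r - 1 = -r by ring]
          exact mul_le_mul_of_nonneg_left (Real.rpow_le_rpow_of_nonpos hN0 hx.1 (by linarith))
            (abs_nonneg _)) (convex_Icc _ _) ⟨le_rfl, by linarith⟩ ⟨hv.1.le, hv.2⟩
      refine hm.trans ?_
      have h1 : ‖v - N‖ ≤ 1 := by
        rw [Real.norm_eq_abs, abs_of_pos (by linarith [hv.1])]; linarith [hv.2]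
      calc |1 - r| * N ^ (-r) * ‖v - N‖ ≤ |1 - r| * N ^ (-r) * 1 := by gcongr
        _ ≤ (|1 - r| + 1) * N ^ (-r) := by
          rw [mul_one]; gcongr; linarith
  refine h.trans_eq ?_
  rw [add_sub_cancel_left, abs_one]; ring

lemma exists_norm_emRemainder_le {r : ℝ} (hr : 0 < r) (a : ℝ) :
    ∃ C : ℝ, 0 < C ∧ ∀ N : ℝ, 1 ≤ N → ‖emRemainder a N (r : ℂ)‖ ≤ C * N ^ (-r) := by
  obtain ⟨K, hK1, hK, hK'⟩ := exists_bound_transDeriv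
  set M := ∑' n, emCoeff n with hM
  have hM0 : 0 ≤ M := tsum_nonneg emCoeff_nonneg
  refine ⟨(K * (1 + 2 * r) + r) * (M + 1), by positivity, fun N hN => ?_⟩
  have hN0 : 0 < N := by linarith
  set c : ℝ := K * (1 + 2 * r) * N ^ (-r) with hc
  set g : ℝ → ℝ := fun v => (Set.Ioc N (N + 1)).indicator (fun _ => c) v +
    (Set.Ioi N).indicator (fun v => r * (r + 1) * v ^ (-r - 2)) v with hg
  have hgi1 : Integrable ((Set.Ioc N (N + 1)).indicator (fun _ => c)) :=
    (integrable_indicator_iff measurableSet_Ioc).2 (integrableOn_const (by simp))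
  have hgi2 : Integrable ((Set.Ioi N).indicator (fun v => r * (r + 1) * v ^ (-r - 2))) :=
    (integrable_indicator_iff measurableSet_Ioi).2
      ((integrableOn_Ioi_rpow_of_lt (by linarith) hN0).const_mul _)
  have hgint : ∫ v, g v = c + r * (r + 1) * (N ^ (-r - 1) / (r + 1)) := by
    rw [hg, integral_add hgi1 hgi2, integral_indicator measurableSet_Ioc,
      integral_indicator measurableSet_Ioi, setIntegral_const, integral_const_mul,
      integral_Ioi_rpow_of_lt (by linarith) hN0]
    simp only [Measure.real, Real.volume_Ioc, add_sub_cancel_left, ENNReal.ofReal_one,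
      ENNReal.toReal_one, one_smul]
    rw [show -r - 2 + 1 = -r - 1 by ring, show -r - 1 = -(r + 1) by ring, neg_div_neg_eq]
  have hbound : ∀ v, ‖cutPow2 N (r : ℂ) v‖ ≤ g v := by
    intro v
    rcases le_or_gt v N with hv | hv
    · rw [cutPow2_of_le _ hv, norm_zero]
      simp [hg, hv]
    have hv0 : 0 < v := hN0.trans hv
    have t3 : ‖(r : ℂ) * (r + 1) * (Real.smoothTransition (v - N) : ℂ) * (v : ℂ) ^ (-(r : ℂ) - 2)‖ ≤
        r * (r + 1) * v ^ (-r - 2) := by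
      rw [show (r : ℂ) * (r + 1) = ((r * (r + 1) : ℝ) : ℂ) by push_cast; ring, norm_mul, norm_mul,
        norm_real, norm_real, norm_cpow_eq_rpow_re_of_pos hv0, Real.norm_eq_abs, Real.norm_eq_abs,
        abs_of_pos (by positivity), show (-(r : ℂ) - 2).re = -r - 2 by simp]
      refine mul_le_mul_of_nonneg_right ?_ (by positivity)
      exact mul_le_of_le_one_right (by positivity) (abs_smoothTransition_le_one _)
    rw [cutPow2]
    refine (norm_add_le _ _).trans ?_
    have hgv : g v = (Set.Ioc N (N + 1)).indicator (fun _ => c) v + r * (r + 1) * v ^ (-r - 2) := by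
      simp [hg, hv]
    rw [hgv]
    refine add_le_add ?_ t3
    rcases le_or_gt v (N + 1) with hv1 | hv1
    · rw [Set.indicator_of_mem (Set.mem_Ioc.2 ⟨hv, hv1⟩)]
      refine (norm_sub_le _ _).trans ?_
      simp only [norm_mul, norm_real, norm_cpow_eq_rpow_re_of_pos hv0, Real.norm_eq_abs,
        show (-(r : ℂ)).re = -r by simp, show (-(r : ℂ) - 1).re = -r - 1 by simp]
      rw [norm_ofNat, abs_of_pos hr]
      have p1 : v ^ (-r) ≤ N ^ (-r) := Real.rpow_le_rpow_of_nonpos hN0 hv.le (by linarith)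
      have p2 : v ^ (-r - 1) ≤ N ^ (-r) :=
        (Real.rpow_le_rpow_of_exponent_le (by linarith) (by linarith)).trans p1
      calc |transDeriv2 (v - N)| * v ^ (-r) + 2 * r * |transDeriv (v - N)| * v ^ (-r - 1)
          ≤ K * N ^ (-r) + 2 * r * K * N ^ (-r) := by
            have := hK (v - N)
            have := hK' (v - N)
            gcongr
        _ = c := by rw [hc]; ring
    · rw [Set.indicator_of_notMem (fun h => by linarith [h.2]),
        transDeriv2_of_gt (by linarith), transDeriv_of_gt (by linarith)]
      simp
  calc ‖emRemainder a N (r : ℂ)‖ ≤ ∫ v, g v * M := by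
        refine norm_integral_le_of_norm_le ((hgi1.add hgi2).mul_const M)
          (Eventually.of_forall fun v => ?_)
        rw [norm_mul]
        exact mul_le_mul (hbound v) (norm_emKernel_le a v) (norm_nonneg _)
          ((norm_nonneg _).trans (hbound v))
    _ = (c + r * N ^ (-r - 1)) * M := by
        rw [integral_mul_const, hgint]; field_simp
    _ ≤ (c + r * N ^ (-r)) * (M + 1) := by
        have : N ^ (-r - 1) ≤ N ^ (-r) := Real.rpow_le_rpow_of_exponent_le hN (by linarith)
        gcongr
        linarith
    _ = _ := by rw [hc]; ring

/-- Partial sums of the Hurwitz zeta function at positive real arguments. -/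
lemma exists_norm_sum_rpow_sub_le {a r : ℝ} (ha : 0 < a) (ha1 : a ≤ 1) (hr : 0 < r) (hr1 : r ≠ 1) :
    ∃ C : ℝ, 0 < C ∧ ∀ N : ℕ, 1 ≤ N →
      ‖((∑ k ∈ range N, ((k : ℝ) + a) ^ (-r) - (N : ℝ) ^ (1 - r) / (1 - r) : ℝ) : ℂ) -
        HurwitzZeta.hurwitzZeta (a : UnitAddCircle) (r : ℂ)‖ ≤ C * (N : ℝ) ^ (-r) := by
  obtain ⟨C1, hC1, h1⟩ := exists_norm_cutMass_sub_le hr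
  obtain ⟨C2, hC2, h2⟩ := exists_norm_emRemainder_le hr a
  have hr1' : (r : ℂ) - 1 ≠ 0 := sub_ne_zero.2 (by exact_mod_cast hr1)
  refine ⟨‖((r : ℂ) - 1)⁻¹‖ * C1 + C2 + 2, by positivity, fun N hN => ?_⟩
  have hNR : (1 : ℝ) ≤ N := by exact_mod_cast hN
  have hN0 : (0 : ℝ) < N := by linarith
  have e := hurwitzZeta_eq ha ha1 hN (s := (r : ℂ)) (by simp; linarith) (by exact_mod_cast hr1)
  have es : ∑ k ∈ range N, ((k + a : ℝ) : ℂ) ^ (-(r : ℂ)) =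
      ((∑ k ∈ range N, ((k : ℝ) + a) ^ (-r) : ℝ) : ℂ) := by
    rw [ofReal_sum]
    refine sum_congr rfl fun k _ => ?_
    rw [ofReal_cpow (by positivity)]; push_cast; rfl
  rw [es] at e
  have key : ((∑ k ∈ range N, ((k : ℝ) + a) ^ (-r) - (N : ℝ) ^ (1 - r) / (1 - r) : ℝ) : ℂ) -
      HurwitzZeta.hurwitzZeta (a : UnitAddCircle) (r : ℂ) =
      -(((r : ℂ) - 1)⁻¹ * (cutMass N (r : ℂ) - (((N : ℝ) ^ (1 - r) : ℝ) : ℂ))) +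
        emRemainder a N (r : ℂ) -
        (1 - Real.smoothTransition a) * ((N + a : ℝ) : ℂ) ^ (-(r : ℂ)) := by
    rw [e]
    have h3 : (1 : ℂ) - r ≠ 0 := fun h => hr1' (by linear_combination -h)
    push_cast
    field_simp
    ring
  rw [key]
  have b3 : ‖(1 - (Real.smoothTransition a : ℂ)) * ((N + a : ℝ) : ℂ) ^ (-(r : ℂ))‖ ≤
      2 * (N : ℝ) ^ (-r) := by
    rw [norm_mul, norm_cpow_eq_rpow_re_of_pos (by positivity), neg_re, ofReal_re]
    refine mul_le_mul ?_ (Real.rpow_le_rpow_of_nonpos hN0 (by linarith) (by linarith))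
      (by positivity) (by norm_num)
    refine (norm_sub_le _ _).trans ?_
    rw [norm_one, norm_real, Real.norm_eq_abs]
    linarith [abs_smoothTransition_le_one a]
  have b1 := h1 N hNR
  have b2 := h2 N hNR
  refine (norm_sub_le _ _).trans ((add_le_add (norm_add_le _ _) b3).trans ?_)
  rw [norm_neg, norm_mul]
  have b1' := mul_le_mul_of_nonneg_left b1 (norm_nonneg ((r : ℂ) - 1)⁻¹)
  linarith

/-- The Hurwitz zeta function is real at positive real arguments. -/
lemma hurwitzZeta_ofReal_im {a r : ℝ} (ha : 0 < a) (ha1 : a ≤ 1) (hr : 0 < r) (hr1 : r ≠ 1) :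
    (HurwitzZeta.hurwitzZeta (a : UnitAddCircle) (r : ℂ)).im = 0 := by
  obtain ⟨C, -, h⟩ := exists_norm_sum_rpow_sub_le ha ha1 hr hr1
  have ht : Tendsto (fun N : ℕ => C * (N : ℝ) ^ (-r)) atTop (nhds 0) := by
    have := ((tendsto_rpow_neg_atTop hr).comp tendsto_natCast_atTop_atTop).const_mul C
    rwa [mul_zero] at this
  have h2 : |(HurwitzZeta.hurwitzZeta (a : UnitAddCircle) (r : ℂ)).im| ≤ 0 := by
    refine ge_of_tendsto ht ?_
    filter_upwards [eventually_ge_atTop 1] with N hN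
    have h3 := (abs_im_le_norm _).trans (h N hN)
    rwa [sub_im, ofReal_im, zero_sub, abs_neg] at h3
  exact abs_eq_zero.1 (le_antisymm h2 (abs_nonneg _))

lemma cutN_rpow_neg_le {t r : ℝ} (ht : 26 ≤ t) (hr : 0 ≤ r) (hr2 : r ≤ 2) :
    (cutN t : ℝ) ^ (-r) ≤ 26 * t ^ (-r / 2) := by
  obtain ⟨h2, -, -, h4⟩ := tau_cutN_bounds ht
  have hN : (2 : ℝ) ≤ cutN t := by exact_mod_cast h2
  have h5 : ((cutN t : ℝ) ^ 2) ^ (-r / 2) ≤ (t / 26) ^ (-r / 2) :=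
    Real.rpow_le_rpow_of_nonpos (by linarith) (by linarith) (by linarith)
  rw [← Real.rpow_natCast_mul (by linarith), Real.div_rpow (by linarith) (by norm_num)] at h5
  rw [show ((2 : ℕ) : ℝ) * (-r / 2) = -r by push_cast; ring] at h5
  refine h5.trans ?_
  rw [div_eq_mul_inv, ← Real.rpow_neg (by norm_num), mul_comm]
  gcongr
  calc (26 : ℝ) ^ (-(-r / 2)) ≤ 26 ^ (1 : ℝ) :=
        Real.rpow_le_rpow_of_exponent_le (by norm_num) (by linarith)
    _ = 26 := Real.rpow_one _

lemma exists_dDiag_bounds {a σ : ℝ} (ha : 0 < a) (ha1 : a ≤ 1) (h0 : 0 < σ)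
    (h2 : σ ≠ 1 / 2) :
    ∃ C : ℝ, 0 < C ∧ ∀ t : ℝ, 26 ≤ t →
      |dDiag a σ t - (cutN t : ℝ) ^ (1 - 2 * σ) / (1 - 2 * σ) -
        (HurwitzZeta.hurwitzZeta (a : UnitAddCircle) ((2 * σ : ℝ) : ℂ)).re| ≤
        C * (cutN t : ℝ) ^ (-(2 * σ)) := by
  obtain ⟨C, hC, h⟩ := exists_norm_sum_rpow_sub_le (r := 2 * σ) ha ha1 (by linarith)
    (fun h => h2 (by linarith))
  refine ⟨C, hC, fun t ht => ?_⟩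
  obtain ⟨h2, -⟩ := tau_cutN_bounds ht
  have h3 := (abs_re_le_norm _).trans (h (cutN t) (by omega))
  rw [sub_re, ofReal_re] at h3
  rw [dDiag, neg_mul]
  exact h3

lemma abs_rpow_sub_mul_rpow_neg_le {p x n : ℝ} (hp : 0 < p) (hp1 : p < 1) (hn : 1 ≤ n)
    (hnx : n ≤ x) (hxn : x ≤ n + 1) : |n ^ p - x ^ (2 * p) * n ^ (-p)| ≤ 3 * p * n ^ (p - 1) := by
  have hn0 : 0 < n := by linarith
  have hx0 : 0 < x := by linarith
  have hm := Convex.norm_image_sub_le_of_norm_hasDerivWithin_le (f := fun x : ℝ => x ^ p)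
    (f' := fun x => p * x ^ (p - 1)) (s := Set.Icc n x) (C := p * n ^ (p - 1)) (x := n) (y := x)
    (fun y hy => (Real.hasDerivAt_rpow_const (Or.inl (by linarith [hy.1]))).hasDerivWithinAt)
    (fun y hy => by
      have hy0 : 0 < y := by linarith [hy.1]
      rw [Real.norm_eq_abs, abs_of_pos (by positivity)]
      exact mul_le_mul_of_nonneg_left (Real.rpow_le_rpow_of_nonpos hn0 hy.1 (by linarith)) hp.le)
    (convex_Icc _ _) ⟨le_rfl, hnx⟩ ⟨hnx, le_rfl⟩
  simp only [Real.norm_eq_abs] at hm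
  have hm' : |x ^ p - n ^ p| ≤ p * n ^ (p - 1) := by
    refine hm.trans (mul_le_of_le_one_right (by positivity) ?_)
    rw [abs_of_nonneg (by linarith)]; linarith
  have hxp : x ^ p ≤ 2 * n ^ p := by
    calc x ^ p ≤ (2 * n) ^ p := Real.rpow_le_rpow hx0.le (by linarith) hp.le
      _ = 2 ^ p * n ^ p := Real.mul_rpow (by norm_num) hn0.le
      _ ≤ 2 * n ^ p := by
        gcongr
        exact Real.rpow_le_self_of_one_le (by norm_num) hp1.le
  have hinv : n ^ p * n ^ (-p) = 1 := by rw [← Real.rpow_add hn0, add_neg_cancel, Real.rpow_zero]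
  have hpos : 0 < n ^ (-p) := by positivity
  have hnp : 0 < n ^ p := by positivity
  have hxp0 : 0 < x ^ p := by positivity
  have e : n ^ p - x ^ (2 * p) * n ^ (-p) = -((x ^ p - n ^ p) * ((x ^ p + n ^ p) * n ^ (-p))) := by
    rw [show 2 * p = p + p by ring, Real.rpow_add hx0]
    linear_combination (-n ^ p) * hinv
  rw [e, abs_neg, abs_mul, abs_of_pos (by positivity : 0 < (x ^ p + n ^ p) * n ^ (-p))]
  have h3 : (x ^ p + n ^ p) * n ^ (-p) ≤ 3 := by
    calc _ ≤ (3 * n ^ p) * n ^ (-p) := by gcongr; linarith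
      _ = 3 := by rw [mul_assoc, hinv, mul_one]
  calc _ ≤ p * n ^ (p - 1) * 3 := by gcongr
    _ = _ := by ring

/-- The diagonal contributions of the two sums in the approximate functional equation. -/
lemma exists_abs_diag_sub_le {a σ : ℝ} (ha : 0 < a) (ha1 : a ≤ 1) (h0 : 0 < σ) (h1 : σ < 1 / 2) :
    ∃ C : ℝ, 0 < C ∧ ∀ t : ℝ, 26 ≤ t →
      |dDiag a σ t + (t / (2 * Real.pi)) ^ (1 - 2 * σ) * dDiag 1 (1 - σ) t -
        (HurwitzZeta.hurwitzZeta (a : UnitAddCircle) ((2 * σ : ℝ) : ℂ)).re -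
        (t / (2 * Real.pi)) ^ (1 - 2 * σ) *
          (HurwitzZeta.hurwitzZeta ((1 : ℝ) : UnitAddCircle) ((2 * (1 - σ) : ℝ) : ℂ)).re| ≤
        C * t ^ (-σ) := by
  obtain ⟨C1, hC1, b1⟩ := exists_dDiag_bounds ha ha1 h0 h1.ne
  obtain ⟨C2, hC2, b2⟩ := exists_dDiag_bounds (a := 1) (σ := 1 - σ) one_pos le_rfl (by linarith)
    (fun h => by linarith)
  refine ⟨26 * (C1 + 4 * C2 + 3), by positivity, fun t ht => ?_⟩
  obtain ⟨h2, h3, h4, -⟩ := tau_cutN_bounds ht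
  have hb1 := b1 t ht
  have hb2 := b2 t ht
  have hdec := cutN_rpow_neg_le (r := 2 * σ) ht (by linarith) (by linarith)
  rw [show -(2 * σ) / 2 = -σ by ring] at hdec
  set Z1 := (HurwitzZeta.hurwitzZeta (a : UnitAddCircle) ((2 * σ : ℝ) : ℂ)).re
  set Z2 := (HurwitzZeta.hurwitzZeta ((1 : ℝ) : UnitAddCircle) ((2 * (1 - σ) : ℝ) : ℂ)).re
  have hN : (1 : ℝ) ≤ cutN t := by exact_mod_cast (by omega : 1 ≤ cutN t)
  set n : ℝ := (cutN t : ℝ) with hn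
  have hn0 : 0 < n := by linarith
  have hpi := Real.two_pi_pos
  have hxt : 0 ≤ t / (2 * Real.pi) := div_nonneg (by linarith) hpi.le
  set x := Real.sqrt (t / (2 * Real.pi)) with hx
  have hxx : x ^ 2 = t / (2 * Real.pi) := Real.sq_sqrt hxt
  have hnx : n ≤ x := Real.le_sqrt_of_sq_le (by rw [le_div_iff₀ hpi]; linarith)
  have hxn : x ≤ n + 1 := Real.sqrt_le_iff.2 ⟨by linarith, by rw [div_le_iff₀ hpi]; linarith⟩
  have hx0 : 0 < x := by linarith
  set p := 1 - 2 * σ with hp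
  have hp0 : 0 < p := by linarith
  have hp1 : p < 1 := by linarith
  have hw : (t / (2 * Real.pi)) ^ p = x ^ (2 * p) := by
    rw [← hxx, ← Real.rpow_natCast_mul hx0.le]; norm_num
  rw [hw]
  rw [show 1 - 2 * (1 - σ) = -p by rw [hp]; ring] at hb2
  have hb3 := abs_rpow_sub_mul_rpow_neg_le hp0 hp1 hN hnx hxn
  rw [show p - 1 = -(2 * σ) by rw [hp]; ring] at hb3
  have hb4 : |(n ^ p - x ^ (2 * p) * n ^ (-p)) / p| ≤ 3 * n ^ (-(2 * σ)) := by
    rw [abs_div, abs_of_pos hp0, div_le_iff₀ hp0]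
    linarith
  have hw4 : x ^ (2 * p) * n ^ (-(2 * (1 - σ))) ≤ 4 * n ^ (-(2 * σ)) := by
    have h5 : x ^ (2 * p) ≤ 4 * n ^ (2 * p) := by
      calc x ^ (2 * p) ≤ (2 * n) ^ (2 * p) := Real.rpow_le_rpow hx0.le (by linarith) (by linarith)
        _ = 2 ^ (2 * p) * n ^ (2 * p) := Real.mul_rpow (by norm_num) hn0.le
        _ ≤ 2 ^ (2 : ℝ) * n ^ (2 * p) := by
          gcongr
          · norm_num
          · linarith
        _ = 4 * n ^ (2 * p) := by norm_num
    calc _ ≤ 4 * n ^ (2 * p) * n ^ (-(2 * (1 - σ))) := by gcongr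
      _ = 4 * n ^ (-(2 * σ)) := by
        rw [mul_assoc, ← Real.rpow_add hn0]; congr 2; rw [hp]; ring
  have hx2 : 0 < x ^ (2 * p) := by positivity
  have hb5 : |x ^ (2 * p) * (dDiag 1 (1 - σ) t - n ^ (-p) / (-p) - Z2)| ≤
      C2 * (4 * n ^ (-(2 * σ))) := by
    rw [abs_mul, abs_of_pos hx2]
    calc _ ≤ x ^ (2 * p) * (C2 * n ^ (-(2 * (1 - σ)))) := by gcongr
      _ = C2 * (x ^ (2 * p) * n ^ (-(2 * (1 - σ)))) := by ring
      _ ≤ _ := by gcongr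
  have h8 := abs_add_three (dDiag a σ t - n ^ p / p - Z1)
    (x ^ (2 * p) * (dDiag 1 (1 - σ) t - n ^ (-p) / (-p) - Z2)) ((n ^ p - x ^ (2 * p) * n ^
        (-p)) / p)
  have e : dDiag a σ t + x ^ (2 * p) * dDiag 1 (1 - σ) t - Z1 - x ^ (2 * p) * Z2 =
      dDiag a σ t - n ^ p / p - Z1 + x ^ (2 * p) * (dDiag 1 (1 - σ) t - n ^ (-p) / (-p) - Z2) +
        (n ^ p - x ^ (2 * p) * n ^ (-p)) / p := by
    field_simp; ring
  rw [← e] at h8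
  calc _ ≤ (C1 + 4 * C2 + 3) * n ^ (-(2 * σ)) := by linarith
    _ ≤ (C1 + 4 * C2 + 3) * (26 * t ^ (-σ)) := by gcongr
    _ = _ := by ring

/-- First derivative test for `t ^ r · exp (i t (log (t / c) - 1))`. -/
lemma norm_integral_rpow_mul_exp_le {p q c r δ θ : ℝ} (hp : 0 < p) (hpq : p ≤ q) (hc : 0 < c)
    (hr : 0 ≤ r) (hδ : 0 < δ) (hδp : δ ≤ Real.log (p / c)) :
    ‖∫ t in p..q, ((t ^ r : ℝ) : ℂ) * exp ((t * Real.log (t / c) - t - θ : ℝ) * I)‖ ≤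
      18 * q ^ r / δ := by
  have hpos : ∀ v ∈ Set.Icc p q, 0 < v := fun v hv => hp.trans_le hv.1
  have hL : ∀ v ∈ Set.Icc p q, δ ≤ Real.log (v / c) := fun v hv =>
    hδp.trans (Real.log_le_log (by positivity) (by gcongr; exact hv.1))
  have hLd : ∀ v ∈ Set.Icc p q, HasDerivAt (fun v => Real.log (v / c)) (1 / v) v := by
    intro v hv
    have hv0 := hpos v hv
    have h := ((hasDerivAt_id v).div_const c).log (by simp only [id]; positivity)
    refine h.congr_deriv ?_
    simp only [id]; field_simp
  have hLc : ContinuousOn (fun v => Real.log (v / c)) (Set.Icc p q) :=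
    fun v hv => (hLd v hv).continuousAt.continuousWithinAt
  have hu : ∀ v ∈ Set.Icc p q, HasDerivAt
      (fun v : ℝ => exp ((v * Real.log (v / c) - v - θ : ℝ) * I))
      ((Real.log (v / c) : ℂ) * (I * exp ((v * Real.log (v / c) - v - θ : ℝ) * I))) v := by
    intro v hv
    have hv0 := hpos v hv
    have h1 : HasDerivAt (fun v => v * Real.log (v / c) - v - θ) (Real.log (v / c)) v := by
      refine ((((hasDerivAt_id v).mul (hLd v hv)).sub (hasDerivAt_id v)).sub_const θ).congr_deriv ?_
      simp only [id]; field_simp; ring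
    refine ((h1.ofReal_comp.mul_const I).cexp).congr_deriv ?_
    ring
  have huc : ContinuousOn (fun v : ℝ => exp ((v * Real.log (v / c) - v - θ : ℝ) * I))
      (Set.Icc p q) := fun v hv => (hu v hv).continuousAt.continuousWithinAt
  have o1 := OscBound.of_hasDerivAt (M := 1) hu
    ((continuous_ofReal.comp_continuousOn hLc).mul (continuousOn_const.mul huc))
    (fun v _ => (norm_exp_ofReal_mul_I _).le)
  have hLne : ∀ v ∈ Set.Icc p q, Real.log (v / c) ≠ 0 := fun v hv =>
    (hδ.trans_le (hL v hv)).ne'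
  have o2 := o1.mul (P := fun v => (Real.log (v / c))⁻¹)
    (P' := fun v => -(1 / v) / (Real.log (v / c)) ^ 2) (C := 1 / δ)
    (fun v hv => (hLd v hv).inv (hLne v hv))
    (((continuousOn_const.div continuousOn_id (fun v hv => (hpos v hv).ne')).neg).div
      (hLc.pow 2) (fun v hv => pow_ne_zero 2 (hLne v hv)))
    (Or.inr fun v hv => div_nonpos_of_nonpos_of_nonneg
      (neg_nonpos.2 (one_div_nonneg.2 (hpos v hv).le)) (sq_nonneg _))
    (fun v hv => by
      rw [abs_of_pos (inv_pos.2 (hδ.trans_le (hL v hv))), one_div]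
      exact inv_anti₀ hδ (hL v hv))
  have o3 := o2.mul (P := fun v => v ^ r) (P' := fun v => r * v ^ (r - 1)) (C := q ^ r)
    (fun v hv => Real.hasDerivAt_rpow_const (Or.inl (hpos v hv).ne'))
    (continuousOn_const.mul (continuousOn_id.rpow_const fun v hv => Or.inl (hpos v hv).ne'))
    (Or.inl fun v hv => mul_nonneg hr (Real.rpow_nonneg (hpos v hv).le _))
    (fun v hv => by
      rw [abs_of_nonneg (Real.rpow_nonneg (hpos v hv).le _)]
      exact Real.rpow_le_rpow (hpos v hv).le hv.2 hr)
  have h := o3.norm_integral_le hpq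
  have e : ∫ t in p..q, ((t ^ r : ℝ) : ℂ) * exp ((t * Real.log (t / c) - t - θ : ℝ) * I) =
      (-I) * ∫ t in p..q, ((t ^ r : ℝ) : ℂ) * ((((Real.log (t / c))⁻¹ : ℝ) : ℂ) *
        ((Real.log (t / c) : ℂ) * (I * exp ((t * Real.log (t / c) - t - θ : ℝ) * I)))) := by
    rw [← intervalIntegral.integral_const_mul]
    refine intervalIntegral.integral_congr fun t ht => ?_
    rw [Set.uIcc_of_le hpq] at ht
    have hne : (Real.log (t / c) : ℂ) ≠ 0 := ofReal_ne_zero.2 (hLne t ht)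
    simp only [ofReal_inv]
    rw [inv_mul_cancel_left₀ hne]
    linear_combination (((t ^ r : ℝ) : ℂ) * exp ((t * Real.log (t / c) - t - θ : ℝ) * I)) * I_sq
  rw [e, norm_mul, norm_neg, norm_I, one_mul]
  refine h.trans (le_of_eq ?_)
  field_simp; ring

lemma rpow_mul_rpow_le_one_div_min {x y σ : ℝ} (hx : 0 < x) (hy : 0 < y) (h0 : 0 ≤ σ)
    (h1 : σ ≤ 1) : x ^ (-σ) * y ^ (σ - 1) ≤ 1 / min x y := by
  have hm : 0 < min x y := lt_min hx hy
  calc x ^ (-σ) * y ^ (σ - 1) ≤ (min x y) ^ (-σ) * (min x y) ^ (σ - 1) :=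
        mul_le_mul (Real.rpow_le_rpow_of_nonpos hm (min_le_left _ _) (by linarith))
          (Real.rpow_le_rpow_of_nonpos hm (min_le_right _ _) (by linarith)) (by positivity)
          (by positivity)
    _ = 1 / min x y := by
        rw [← Real.rpow_add hm, show -σ + (σ - 1) = -1 by ring, Real.rpow_neg_one, one_div]

lemma add_rpow_neg_le {a σ : ℝ} (ha : 0 < a) (ha1 : a ≤ 1) (h0 : 0 ≤ σ) (h1 : σ ≤ 1) (m : ℕ) :
    ((m : ℝ) + a) ^ (-σ) ≤ 1 / a * ((m : ℝ) + 1) ^ (-σ) := by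
  have hm : (0 : ℝ) ≤ m := m.cast_nonneg
  calc ((m : ℝ) + a) ^ (-σ) ≤ (a * ((m : ℝ) + 1)) ^ (-σ) :=
        Real.rpow_le_rpow_of_nonpos (by positivity) (by nlinarith) (by linarith)
    _ = a ^ (-σ) * ((m : ℝ) + 1) ^ (-σ) := Real.mul_rpow ha.le (by positivity)
    _ ≤ 1 / a * ((m : ℝ) + 1) ^ (-σ) := by
        gcongr
        rw [one_div, ← Real.rpow_neg_one]
        exact Real.rpow_le_rpow_of_exponent_ge ha ha1 (by linarith)

lemma ofReal_cpow_neg_add_mul_I {x : ℝ} (hx : 0 < x) (α t : ℝ) :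
    (x : ℂ) ^ (-((α : ℂ) + t * I)) =
      ((x ^ (-α) : ℝ) : ℂ) * exp ((-(t * Real.log x) : ℝ) * I) := by
  have hx' : (x : ℂ) ≠ 0 := ofReal_ne_zero.2 hx.ne'
  rw [neg_add, cpow_add _ _ hx', ofReal_cpow hx.le, ofReal_neg, cpow_def_of_ne_zero hx' (-(t * I)),
    ← ofReal_log hx.le]
  congr 2; push_cast; ring

lemma dTerm_mul_conj_chiMain_mul_dTerm {a σ t : ℝ} {β : ℕ → ℂ} (ha : 0 < a) (ht : 0 < t)
    (m n : ℕ) :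
    dTerm a (fun _ => 1) σ m t * ((starRingEnd ℂ) (chiMain σ t) * dTerm 1 β (1 - σ) n t) =
      (β n * (((2 * Real.pi) ^ (-(1 / 2 - σ)) * (((m : ℝ) + a) ^ (-σ) *
        ((n : ℝ) + 1) ^ (σ - 1)) : ℝ) : ℂ)) * (((t ^ (1 / 2 - σ) : ℝ) : ℂ) *
      exp ((t * Real.log (t / (2 * Real.pi * (((m : ℝ) + a) * ((n : ℝ) + 1)))) - t -
        Real.pi / 4 : ℝ) * I)) := by
  have hpi := Real.two_pi_pos
  have hm : (0 : ℝ) < (m : ℝ) + a := by positivity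
  have hn : (0 : ℝ) < (n : ℝ) + 1 := by positivity
  have hlog : Real.log (t / (2 * Real.pi * (((m : ℝ) + a) * ((n : ℝ) + 1)))) =
      Real.log (t / (2 * Real.pi)) - Real.log ((m : ℝ) + a) - Real.log ((n : ℝ) + 1) := by
    rw [← div_div, Real.log_div (by positivity) (by positivity), Real.log_mul hm.ne' hn.ne']
    ring
  rw [hlog, dTerm, dTerm, chiMain, map_mul, conj_ofReal, ← exp_conj, map_mul, conj_ofReal, conj_I,
    ofReal_cpow_neg_add_mul_I hm, ofReal_cpow_neg_add_mul_I hn, Real.div_rpow ht.le hpi.le,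
    Real.rpow_neg hpi.le, show -(1 - σ) = σ - 1 by ring]
  have e : exp (((t * (Real.log (t / (2 * Real.pi)) - Real.log ((m : ℝ) + a) -
      Real.log ((n : ℝ) + 1)) - t - Real.pi / 4 : ℝ) : ℂ) * I) =
      exp (((Real.pi / 4 + t - t * Real.log (t / (2 * Real.pi)) : ℝ) : ℂ) * -I) *
      exp ((-(t * Real.log ((m : ℝ) + a)) : ℝ) * I) *
      exp ((-(t * Real.log ((n : ℝ) + 1)) : ℝ) * I) := by
    rw [← Complex.exp_add, ← Complex.exp_add]
    congr 1; push_cast; ring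
  rw [e]
  push_cast
  ring

/-- The pair `(m, n)` of the cross term, with a lower bound `δ` for the phase derivative. -/
lemma norm_integral_crossTerm_le {a σ p q δ : ℝ} {β : ℕ → ℂ} (hβ : ∀ k, ‖β k‖ = 1) (ha : 0 < a)
    (ha1 : a ≤ 1) (h0 : 0 ≤ σ) (h1 : σ ≤ 1 / 2) (hp : 0 < p) (hpq : p ≤ q) (m n : ℕ) (hδ : 0 < δ)
    (hδp : δ ≤ Real.log (p / (2 * Real.pi * (((m : ℝ) + a) * ((n : ℝ) + 1))))) :
    ‖∫ t in p..q, dTerm a (fun _ => 1) σ m t *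
      ((starRingEnd ℂ) (chiMain σ t) * dTerm 1 β (1 - σ) n t)‖ ≤
      18 / a * q ^ (1 / 2 - σ) * (1 / (δ * min ((m : ℝ) + 1) ((n : ℝ) + 1))) := by
  have hpi := six_lt_two_pi
  have hm : (0 : ℝ) < (m : ℝ) + a := by positivity
  have hn : (0 : ℝ) < (n : ℝ) + 1 := by positivity
  have hm1 : (0 : ℝ) < (m : ℝ) + 1 := by positivity
  have hq : 0 < q := hp.trans_le hpq
  have hcong : Set.EqOn (fun t => dTerm a (fun _ => 1) σ m t *
      ((starRingEnd ℂ) (chiMain σ t) * dTerm 1 β (1 - σ) n t)) (fun t =>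
      (β n * (((2 * Real.pi) ^ (-(1 / 2 - σ)) * (((m : ℝ) + a) ^ (-σ) *
        ((n : ℝ) + 1) ^ (σ - 1)) : ℝ) : ℂ)) * (((t ^ (1 / 2 - σ) : ℝ) : ℂ) *
      exp ((t * Real.log (t / (2 * Real.pi * (((m : ℝ) + a) * ((n : ℝ) + 1)))) - t -
        Real.pi / 4 : ℝ) * I))) (Set.uIcc p q) := fun t ht => by
    rw [Set.uIcc_of_le hpq] at ht
    exact dTerm_mul_conj_chiMain_mul_dTerm ha (hp.trans_le ht.1) m n
  have h := norm_integral_rpow_mul_exp_le (r := 1 / 2 - σ) (θ := Real.pi / 4) hp hpq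
    (show 0 < 2 * Real.pi * (((m : ℝ) + a) * ((n : ℝ) + 1)) by positivity) (by linarith) hδ hδp
  rw [intervalIntegral.integral_congr hcong, intervalIntegral.integral_const_mul, norm_mul,
      norm_mul, hβ, one_mul, norm_real,
    Real.norm_of_nonneg (by positivity)]
  have hw : (2 * Real.pi) ^ (-(1 / 2 - σ)) * (((m : ℝ) + a) ^ (-σ) * ((n : ℝ) + 1) ^ (σ - 1)) ≤
      1 / a * (1 / min ((m : ℝ) + 1) ((n : ℝ) + 1)) := by
    calc _ ≤ 1 * ((1 / a * ((m : ℝ) + 1) ^ (-σ)) * ((n : ℝ) + 1) ^ (σ - 1)) := by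
          gcongr
          · exact Real.rpow_le_one_of_one_le_of_nonpos (by linarith) (by linarith)
          · exact add_rpow_neg_le ha ha1 h0 (by linarith) m
      _ = 1 / a * (((m : ℝ) + 1) ^ (-σ) * ((n : ℝ) + 1) ^ (σ - 1)) := by ring
      _ ≤ _ := by
          gcongr
          exact rpow_mul_rpow_le_one_div_min hm1 hn h0 (by linarith)
  have hmin : 0 < min ((m : ℝ) + 1) ((n : ℝ) + 1) := lt_min hm1 hn
  calc _ ≤ 1 / a * (1 / min ((m : ℝ) + 1) ((n : ℝ) + 1)) * (18 * q ^ (1 / 2 - σ) / δ) := by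
        gcongr
    _ = _ := by field_simp

lemma norm_integral_crossTerm_diag_le {a σ T : ℝ} {β : ℕ → ℂ} (hβ : ∀ k, ‖β k‖ = 1) (ha : 0 < a)
    (ha1 : a < 1) (h0 : 0 ≤ σ) (h1 : σ ≤ 1 / 2) (n : ℕ) (hT : tau n ≤ T) :
    ‖∫ t in (max (tau n) (tau n))..T, dTerm a (fun _ => 1) σ n t *
      ((starRingEnd ℂ) (chiMain σ t) * dTerm 1 β (1 - σ) n t)‖ ≤
      18 / a * T ^ (1 / 2 - σ) * (1 / (1 - a)) := by
  have h6 := six_lt_two_pi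
  have hn : (0 : ℝ) < (n : ℝ) + 1 := by positivity
  have ha' : 0 < 1 - a := by linarith
  have hna : (0 : ℝ) < (n : ℝ) + a := by positivity
  rw [max_self]
  have hτ : (0 : ℝ) < tau n := by unfold tau; positivity
  have h := norm_integral_crossTerm_le hβ ha ha1.le h0 h1 hτ hT n n
    (δ := (1 - a) / ((n : ℝ) + 1)) (by positivity) (by
      have e : tau n / (2 * Real.pi * (((n : ℝ) + a) * ((n : ℝ) + 1))) =
          ((n : ℝ) + 1) / ((n : ℝ) + a) := by
        unfold tau; field_simp
      rw [e]
      have := sub_div_le_log_div hna hn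
      rwa [show (n : ℝ) + 1 - (n + a) = 1 - a by ring] at this)
  refine h.trans (le_of_eq ?_)
  rw [min_self]
  field_simp

lemma norm_integral_crossTerm_offDiag_le {a σ T : ℝ} {β : ℕ → ℂ} (hβ : ∀ k, ‖β k‖ = 1)
    (ha : 0 < a) (ha1 : a < 1) (h0 : 0 ≤ σ) (h1 : σ ≤ 1 / 2) {m n j k : ℕ} (hjk : j < k)
    (hmn : m = j ∧ n = k ∨ m = k ∧ n = j) (hT : tau k ≤ T) :
    ‖∫ t in (max (tau m) (tau n))..T, dTerm a (fun _ => 1) σ m t *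
      ((starRingEnd ℂ) (chiMain σ t) * dTerm 1 β (1 - σ) n t)‖ ≤
      18 / a * T ^ (1 / 2 - σ) * (1 / ((j : ℝ) + 1) + 1 / ((k : ℝ) - j)) := by
  have h6 := six_lt_two_pi
  have hj : (0 : ℝ) < (j : ℝ) + 1 := by positivity
  have hk : (0 : ℝ) < (k : ℝ) + 1 := by positivity
  have hjk' : (0 : ℝ) < (k : ℝ) - j := sub_pos.2 (by exact_mod_cast hjk)
  have hτ : (0 : ℝ) < tau k := by unfold tau; positivity
  have hmax : max (tau m) (tau n) = tau k := by
    rcases hmn with ⟨rfl, rfl⟩ | ⟨rfl, rfl⟩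
    · exact max_eq_right (tau_mono hjk.le)
    · exact max_eq_left (tau_mono hjk.le)
  have hmin : min ((m : ℝ) + 1) ((n : ℝ) + 1) = (j : ℝ) + 1 := by
    rcases hmn with ⟨rfl, rfl⟩ | ⟨rfl, rfl⟩
    · exact min_eq_left (by linarith)
    · exact min_eq_right (by linarith)
  have hprod : ((m : ℝ) + a) * ((n : ℝ) + 1) ≤ ((j : ℝ) + 1) * ((k : ℝ) + 1) := by
    rcases hmn with ⟨rfl, rfl⟩ | ⟨rfl, rfl⟩
    · gcongr
    · rw [mul_comm]; gcongr
  have hpos : 0 < ((m : ℝ) + a) * ((n : ℝ) + 1) := by positivity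
  have h := norm_integral_crossTerm_le hβ ha ha1.le h0 h1 hτ hT m n
    (δ := ((k : ℝ) - j) / ((k : ℝ) + 1)) (by positivity) (by
      calc ((k : ℝ) - j) / ((k : ℝ) + 1) = (((k : ℝ) + 1) - ((j : ℝ) + 1)) / ((k : ℝ) + 1) := by
            ring
        _ ≤ Real.log (((k : ℝ) + 1) / ((j : ℝ) + 1)) := sub_div_le_log_div hj hk
        _ = Real.log (tau k / (2 * Real.pi * (((j : ℝ) + 1) * ((k : ℝ) + 1)))) := by
            congr 1; unfold tau; field_simp
        _ ≤ _ := by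
            refine Real.log_le_log (by positivity) ?_
            gcongr)
  rw [hmax]
  refine h.trans (le_of_eq ?_)
  rw [hmin]
  field_simp
  ring

/-- The cross term of the two sums of the approximate functional equation. -/
theorem exists_norm_integral_dSum_mul_dSum_le {a σ : ℝ} {β : ℕ → ℂ} (hβ : ∀ k, ‖β k‖ = 1)
    (ha : 0 < a) (ha1 : a < 1) (h0 : 0 ≤ σ) (h1 : σ ≤ 1 / 2) :
    ∃ C : ℝ, 0 < C ∧ ∀ T : ℝ, 2 * Real.pi ≤ T →
      IntervalIntegrable (fun t : ℝ => dSum a (fun _ => 1) σ t *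
        ((starRingEnd ℂ) (chiMain σ t) * dSum 1 β (1 - σ) t)) volume 1 T ∧
      ‖∫ t in (1 : ℝ)..T, dSum a (fun _ => 1) σ t *
        ((starRingEnd ℂ) (chiMain σ t) * dSum 1 β (1 - σ) t)‖ ≤
        C * T ^ (1 - σ) * Real.log T := by
  have ha' : 0 < 1 - a := by linarith
  refine ⟨18 / a * (1 / (1 - a) + 10), by positivity, fun T hT => ?_⟩
  have h6 := six_lt_two_pi
  have hl := one_le_log_of_two_pi_le hT
  have hT1 : 1 ≤ T := by linarith
  have hT0 : 0 < T := by linarith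
  have hchi : ContinuousOn (fun t => (starRingEnd ℂ) (chiMain σ t)) (Set.Icc 1 T) := by
    refine continuous_conj.comp_continuousOn ?_
    unfold chiMain
    have hp : ∀ t ∈ Set.Icc (1 : ℝ) T, t / (2 * Real.pi) ≠ 0 := fun t ht => by
      have : 0 < t := by linarith [ht.1]
      positivity
    have hd : ContinuousOn (fun t : ℝ => t / (2 * Real.pi)) (Set.Icc 1 T) :=
      (continuous_id.div_const _).continuousOn
    refine (continuous_ofReal.comp_continuousOn (hd.rpow_const fun t ht => Or.inl (hp t ht))).mul
      (Complex.continuous_exp.comp_continuousOn ((continuous_ofReal.comp_continuousOn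
        ((continuousOn_const.add continuousOn_id).sub
          (continuousOn_id.mul (hd.log hp)))).mul continuousOn_const))
  obtain ⟨i1, i2⟩ := integral_sum_cutN_mul_sum_cutN (T := T)
    (f := dTerm a (fun _ => 1) σ)
    (g := fun k t => (starRingEnd ℂ) (chiMain σ t) * dTerm 1 β (1 - σ) k t) hT1
    (fun k => (continuous_dTerm ha k).continuousOn)
    (fun k => hchi.mul (continuous_dTerm one_pos k).continuousOn)
  simp only [← mul_sum] at i1 i2
  refine ⟨i1, ?_⟩
  change ‖∫ t in (1 : ℝ)..T, (∑ k ∈ range (cutN t), dTerm a (fun _ => 1) σ k t) *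
    ((starRingEnd ℂ) (chiMain σ t) * ∑ k ∈ range (cutN t), dTerm 1 β (1 - σ) k t)‖ ≤ _
  rw [i2]
  set F : ℕ → ℕ → ℂ := fun m n => ∫ t in (max (tau m) (tau n))..T,
    dTerm a (fun _ => 1) σ m t * ((starRingEnd ℂ) (chiMain σ t) * dTerm 1 β (1 - σ) n t) with hF
  set W : ℝ := 18 / a * T ^ (1 / 2 - σ) with hW
  have hW0 : 0 ≤ W := by positivity
  have hτ : ∀ k ∈ range (cutN T), tau k ≤ T := fun k hk => lt_cutN_iff.mp (mem_range.mp hk)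
  have hN := cutN_le_sqrt (T := T)
  have hdiag : ‖∑ k ∈ range (cutN T), F k k‖ ≤ √T * (W * (1 / (1 - a))) := by
    calc _ ≤ ∑ k ∈ range (cutN T), W * (1 / (1 - a)) := norm_sum_le_of_le _ fun k hk =>
          norm_integral_crossTerm_diag_le hβ ha ha1 h0 h1 k (hτ k hk)
      _ = cutN T * (W * (1 / (1 - a))) := by rw [sum_const, card_range, nsmul_eq_mul]
      _ ≤ _ := by gcongr
  have hoff : ‖∑ j ∈ range (cutN T), ∑ k ∈ range (cutN T), F j k -
      ∑ k ∈ range (cutN T), F k k‖ ≤ √T * (W * (10 * Real.log T)) := by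
    refine (norm_sum_sum_sub_diag_le F _).trans ?_
    calc _ ≤ ∑ k ∈ range (cutN T), ∑ j ∈ range k,
          2 * W * (1 / ((j : ℝ) + 1) + 1 / ((k : ℝ) - j)) := by
          refine sum_le_sum fun k hk => sum_le_sum fun j hj => ?_
          have hjk := mem_range.mp hj
          have b1 := norm_integral_crossTerm_offDiag_le hβ ha ha1 h0 h1 hjk
            (Or.inl ⟨rfl, rfl⟩) (hτ k hk)
          have b2 := norm_integral_crossTerm_offDiag_le hβ ha ha1 h0 h1 hjk
            (Or.inr ⟨rfl, rfl⟩) (hτ k hk)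
          simp only [hF]
          linarith
      _ ≤ ∑ k ∈ range (cutN T), W * (10 * Real.log T) := by
          refine sum_le_sum fun k hk => ?_
          rw [← mul_sum]
          have hkT : (k : ℝ) ≤ T := by
            have h1 := succ_le_sqrt_of_tau_le (hτ k hk)
            have h2 := sqrt_le_self_of_two_pi_le hT
            linarith
          have := sum_offDiag_le one_pos hT hkT
          calc _ ≤ 2 * W * ((1 / 1 + 4) * Real.log T) := by gcongr
            _ = _ := by ring
      _ = cutN T * (W * (10 * Real.log T)) := by rw [sum_const, card_range, nsmul_eq_mul]
      _ ≤ _ := by gcongr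
  have hsq : √T * W = 18 / a * T ^ (1 - σ) := by
    rw [hW, Real.sqrt_eq_rpow, mul_left_comm, ← Real.rpow_add hT0,
      show 1 / 2 + (1 / 2 - σ) = 1 - σ by ring]
  have htri := norm_add_le (∑ j ∈ range (cutN T), ∑ k ∈ range (cutN T), F j k -
      ∑ k ∈ range (cutN T), F k k) (∑ k ∈ range (cutN T), F k k)
  rw [sub_add_cancel] at htri
  calc _ ≤ √T * (W * (10 * Real.log T)) + √T * (W * (1 / (1 - a))) :=
        htri.trans (add_le_add hoff hdiag)
    _ = √T * W * (10 * Real.log T + 1 / (1 - a) * 1) := by ring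
    _ ≤ √T * W * (10 * Real.log T + 1 / (1 - a) * Real.log T) := by gcongr
    _ = _ := by rw [hsq]; ring

lemma exists_norm_dSum_le {b α : ℝ} {β : ℕ → ℂ} (hb : 0 < b) (hb1 : b ≤ 1) (hβ : ∀ k, ‖β k‖ = 1)
    (hα : α < 1) :
    ∃ C : ℝ, 0 < C ∧ ∀ t : ℝ, 0 ≤ t → ‖dSum b β α t‖ ≤ C * t ^ ((1 - α) / 2) := by
  obtain ⟨C, hC, h⟩ := sum_cutN_rpow_le hb hb1 (r := -α) (by linarith)
  refine ⟨C, hC, fun t ht => ?_⟩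
  refine (norm_sum_le _ _).trans ?_
  simp only [norm_dTerm hb hβ]
  rw [show (1 - α) / 2 = (-α + 1) / 2 by ring]
  exact h t ht

lemma norm_sq_eq_of_functional (z S₁ X S₂ D η : ℂ) (hz : z = X * (starRingEnd ℂ) D + η) :
    ‖z‖ ^ 2 = ‖z - S₁ - X * (starRingEnd ℂ) S₂‖ ^ 2 +
      (2 * (z * (starRingEnd ℂ) S₁).re - ‖S₁‖ ^ 2) +
      ‖X‖ ^ 2 * (2 * (D * (starRingEnd ℂ) S₂).re - ‖S₂‖ ^ 2) +
      2 * (η * (starRingEnd ℂ) X * S₂).re - 2 * (S₁ * ((starRingEnd ℂ) X * S₂)).re := by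
  subst hz
  simp only [Complex.sq_norm, normSq_apply, mul_re, mul_im, add_re, add_im, sub_re, sub_im,
    conj_re, conj_im]
  ring

/-- The difference between `|ζ|²` and its main terms, after removing the terms which are small
only on average. -/
noncomputable def meanError (a σ t : ℝ) : ℝ :=
  ‖HurwitzZeta.hurwitzZeta (a : UnitAddCircle) ((σ : ℂ) + t * I)‖ ^ 2 -
    (HurwitzZeta.hurwitzZeta (a : UnitAddCircle) ((2 * σ : ℝ) : ℂ)).re -
    (t / (2 * Real.pi)) ^ (1 - 2 * σ) *
      (HurwitzZeta.hurwitzZeta ((1 : ℝ) : UnitAddCircle) ((2 * (1 - σ) : ℝ) : ℂ)).re -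
    meanDefect a (fun _ => 1) (HurwitzZeta.hurwitzZeta (a : UnitAddCircle)) σ t -
    (t / (2 * Real.pi)) ^ (1 - 2 * σ) *
      meanDefect 1 (dualCoeff a) (HurwitzZeta.expZeta (a : UnitAddCircle)) (1 - σ) t +
    2 * (dSum a (fun _ => 1) σ t *
      ((starRingEnd ℂ) (chiMain σ t) * dSum 1 (dualCoeff a) (1 - σ) t)).re

theorem exists_abs_meanError_le {a σ : ℝ} (ha : 0 < a) (ha1 : a < 1) (h0 : 0 < σ)
    (h1 : σ < 1 / 2) :
    ∃ C : ℝ, 0 < C ∧ ∀ t : ℝ, 26 ≤ t → |meanError a σ t| ≤ C * t ^ (-σ) * Real.log t := by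
  obtain ⟨CR, hCR, hR⟩ := exists_norm_afeRem_le ha ha1 h0 h1
  obtain ⟨CX, hCX, hX⟩ := exists_chi_bounds h0 (by linarith : σ < 1)
  obtain ⟨Cη, hCη, hη⟩ := exists_norm_chiTail_le ha ha1 h0 (by linarith : σ < 1)
  obtain ⟨CA, hCA, hA⟩ := exists_abs_diag_sub_le ha ha1.le h0 h1
  obtain ⟨K, hK, hD⟩ := exists_convexity_expZeta ha ha1
  obtain ⟨C1, hC1, hS1⟩ := exists_norm_dSum_le (α := σ) (β := fun _ => 1) ha ha1.le
    (fun _ => norm_one) (by linarith)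
  obtain ⟨C2, hC2, hS2⟩ := exists_norm_dSum_le (b := 1) (α := 1 - σ) (β := dualCoeff a) one_pos
    le_rfl (norm_dualCoeff a) (by linarith)
  refine ⟨CR ^ 2 + CA + CX * (2 * (K * C2) + C2 ^ 2) + 2 * (Cη * CX * C2) + 2 * (C1 * CX * C2),
    by positivity, fun t ht => ?_⟩
  have ht0 : 0 < t := by linarith
  have hpi4 := Real.pi_le_four
  have hpi6 := six_lt_two_pi
  have ht2 : 2 * Real.pi ≤ t := by linarith
  have hl := one_le_log_of_two_pi_le ht2
  have hl0 : 0 < Real.log t := by linarith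
  obtain ⟨hX1, hX2, hX3⟩ := hX t (by linarith)
  have hR := hR t ht
  have hη := hη t (by linarith)
  have hA := hA t ht
  have hD := hD t (1 - σ) ht2 (by linarith) (by
    have : 0 < 1 / Real.log t := by positivity
    linarith)
  have hS1 := hS1 t ht0.le
  have hS2 := hS2 t ht0.le
  rw [show (1 - (1 - σ)) / 2 = σ / 2 by ring] at hD hS2
  have key := norm_sq_eq_of_functional _ (dSum a (fun _ => 1) σ t) _
    (dSum 1 (dualCoeff a) (1 - σ) t) _ _ (hurwitzZeta_eq_chi_mul (σ := σ) ha ha1 ht0)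
  set z := HurwitzZeta.hurwitzZeta (a : UnitAddCircle) ((σ : ℂ) + t * I) with hz
  set S₁ := dSum a (fun _ => 1) σ t with hS₁
  set S₂ := dSum 1 (dualCoeff a) (1 - σ) t with hS₂
  set X := chi σ t with hXd
  set D := HurwitzZeta.expZeta (a : UnitAddCircle) (((1 - σ : ℝ) : ℂ) + t * I) with hDd
  set η := chiTail a σ t with hηd
  have hRd : z - S₁ - X * (starRingEnd ℂ) S₂ = afeRem a σ t := rfl
  rw [hRd] at key
  set R := afeRem a σ t with hRd'
  have hm1 : meanDefect a (fun _ => 1) (HurwitzZeta.hurwitzZeta (a : UnitAddCircle)) σ t =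
    2 * (z * (starRingEnd ℂ) S₁).re - ‖S₁‖ ^ 2 - dDiag a σ t := rfl
  have hm2 : meanDefect 1 (dualCoeff a) (HurwitzZeta.expZeta (a : UnitAddCircle)) (1 - σ) t =
    2 * (D * (starRingEnd ℂ) S₂).re - ‖S₂‖ ^ 2 - dDiag 1 (1 - σ) t := rfl
  set w := (t / (2 * Real.pi)) ^ (1 - 2 * σ) with hw
  set Q := 2 * (D * (starRingEnd ℂ) S₂).re - ‖S₂‖ ^ 2 with hQ
  set Z₁ := (HurwitzZeta.hurwitzZeta (a : UnitAddCircle) ((2 * σ : ℝ) : ℂ)).re with hZ₁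
  set Z₂ := (HurwitzZeta.hurwitzZeta ((1 : ℝ) : UnitAddCircle) ((2 * (1 - σ) : ℝ) : ℂ)).re with hZ₂
  have e : meanError a σ t = ‖R‖ ^ 2 +
      (dDiag a σ t + w * dDiag 1 (1 - σ) t - Z₁ - w * Z₂) +
      (‖X‖ ^ 2 - w) * Q + 2 * (η * (starRingEnd ℂ) X * S₂).re -
      2 * (S₁ * ((starRingEnd ℂ) (X - chiMain σ t) * S₂)).re := by
    have e1 : (S₁ * ((starRingEnd ℂ) (X - chiMain σ t) * S₂)).re =
        (S₁ * ((starRingEnd ℂ) X * S₂)).re -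
          (S₁ * ((starRingEnd ℂ) (chiMain σ t) * S₂)).re := by
      rw [← sub_re, map_sub]; congr 1; ring
    have e2 : meanError a σ t = ‖z‖ ^ 2 - Z₁ - w * Z₂ -
      (2 * (z * (starRingEnd ℂ) S₁).re - ‖S₁‖ ^ 2 - dDiag a σ t) -
      w * (Q - dDiag 1 (1 - σ) t) +
      2 * (S₁ * ((starRingEnd ℂ) (chiMain σ t) * S₂)).re := rfl
    rw [e2, e1, key]
    ring
  have b1 : |‖R‖ ^ 2| ≤ CR ^ 2 * t ^ (-σ) := by
    rw [abs_of_nonneg (sq_nonneg _)]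
    calc ‖R‖ ^ 2 ≤ (CR * t ^ (-σ / 2)) ^ 2 := by gcongr
      _ = _ := by
          rw [mul_pow, ← Real.rpow_mul_natCast ht0.le]
          rw [show -σ / 2 * ((2 : ℕ) : ℝ) = -σ by push_cast; ring]
  have b3 : |(‖X‖ ^ 2 - w) * Q| ≤ CX * (2 * (K * C2) + C2 ^ 2) * t ^ (-σ) * Real.log t := by
    have hre : |(D * (starRingEnd ℂ) S₂).re| ≤
        (K * t ^ (σ / 2) * Real.log t) * (C2 * t ^ (σ / 2)) := by
      refine (abs_re_le_norm _).trans ?_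
      rw [norm_mul, RCLike.norm_conj]
      gcongr
    have hsq : |‖S₂‖ ^ 2| ≤ (C2 * t ^ (σ / 2)) ^ 2 * Real.log t := by
      rw [abs_of_nonneg (sq_nonneg _)]
      calc ‖S₂‖ ^ 2 ≤ (C2 * t ^ (σ / 2)) ^ 2 := by gcongr
        _ ≤ _ := le_mul_of_one_le_right (sq_nonneg _) hl
    have hQb : |Q| ≤ (2 * (K * C2) + C2 ^ 2) * (t ^ (σ / 2) * t ^ (σ / 2)) * Real.log t := by
      refine (abs_sub _ _).trans ?_
      rw [abs_mul, abs_two]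
      linarith
    rw [abs_mul]
    calc _ ≤ (CX * t ^ (-2 * σ)) *
          ((2 * (K * C2) + C2 ^ 2) * (t ^ (σ / 2) * t ^ (σ / 2)) * Real.log t) := by gcongr
      _ = CX * (2 * (K * C2) + C2 ^ 2) * (t ^ (-2 * σ) * (t ^ (σ / 2) * t ^ (σ / 2))) *
          Real.log t := by ring
      _ = _ := by
          rw [← Real.rpow_add ht0, ← Real.rpow_add ht0,
            show -2 * σ + (σ / 2 + σ / 2) = -σ by ring]
  have b4 : |2 * (η * (starRingEnd ℂ) X * S₂).re| ≤ 2 * (Cη * CX * C2) * t ^ (-σ) := by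
    rw [abs_mul, abs_two, mul_assoc 2]
    refine mul_le_mul_of_nonneg_left ((abs_re_le_norm _).trans ?_) zero_le_two
    rw [norm_mul, norm_mul, RCLike.norm_conj]
    calc _ ≤ (Cη * t ^ (-1 : ℝ)) * (CX * t ^ (1 / 2 - σ)) * (C2 * t ^ (σ / 2)) := by gcongr
      _ = Cη * CX * C2 * (t ^ (-1 : ℝ) * t ^ (1 / 2 - σ) * t ^ (σ / 2)) := by ring
      _ ≤ _ := by
          rw [← Real.rpow_add ht0, ← Real.rpow_add ht0]
          gcongr
          · linarith
          · linarith
  have b5 : |2 * (S₁ * ((starRingEnd ℂ) (X - chiMain σ t) * S₂)).re| ≤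
      2 * (C1 * CX * C2) * t ^ (-σ) := by
    rw [abs_mul, abs_two, mul_assoc 2]
    refine mul_le_mul_of_nonneg_left ((abs_re_le_norm _).trans ?_) zero_le_two
    rw [norm_mul, norm_mul, RCLike.norm_conj]
    calc _ ≤ (C1 * t ^ ((1 - σ) / 2)) * ((CX * t ^ (-1 / 2 - σ)) * (C2 * t ^ (σ / 2))) := by gcongr
      _ = C1 * CX * C2 * (t ^ ((1 - σ) / 2) * t ^ (-1 / 2 - σ) * t ^ (σ / 2)) := by ring
      _ = _ := by
          rw [← Real.rpow_add ht0, ← Real.rpow_add ht0]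
          rw [show (1 - σ) / 2 + (-1 / 2 - σ) + σ / 2 = -σ by ring]
  rw [e]
  have hsum : ∀ u v x y s : ℝ, |u + v + x + y - s| ≤ |u| + |v| + |x| + |y| + |s| := by
    intro u v x y s
    refine (abs_sub _ _).trans ?_
    have i1 := abs_add_le (u + v + x) y
    have i2 := abs_add_three u v x
    linarith
  refine (hsum _ _ _ _ _).trans ?_
  have hp : 0 < t ^ (-σ) := by positivity
  have hlog : ∀ c : ℝ, 0 ≤ c → c * t ^ (-σ) ≤ c * t ^ (-σ) * Real.log t := fun c hc =>
    le_mul_of_one_le_right (by positivity) hl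
  have l1 := hlog (CR ^ 2) (by positivity)
  have l2 := hlog CA hCA.le
  have l4 := hlog (2 * (Cη * CX * C2)) (by positivity)
  have l5 := hlog (2 * (C1 * CX * C2)) (by positivity)
  calc _ ≤ CR ^ 2 * t ^ (-σ) * Real.log t + CA * t ^ (-σ) * Real.log t +
        CX * (2 * (K * C2) + C2 ^ 2) * t ^ (-σ) * Real.log t +
        2 * (Cη * CX * C2) * t ^ (-σ) * Real.log t +
        2 * (C1 * CX * C2) * t ^ (-σ) * Real.log t := by
        gcongr
        · exact b1.trans l1
        · exact hA.trans l2
        · exact b4.trans l4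
        · exact b5.trans l5
    _ = _ := by ring

lemma intervalIntegrable_norm_hurwitzZeta_sq (a σ T : ℝ) (hT : 1 ≤ T) :
    IntervalIntegrable
      (fun t : ℝ => ‖HurwitzZeta.hurwitzZeta (a : UnitAddCircle) ((σ : ℂ) + t * I)‖ ^ 2)
      volume 1 T := by
  refine ContinuousOn.intervalIntegrable fun t ht => ?_
  rw [Set.uIcc_of_le hT] at ht
  have hne : (σ : ℂ) + t * I ≠ 1 := fun h => by
    have h1 := congrArg im h
    simp at h1
    linarith [ht.1]
  have h1 := (HurwitzZeta.differentiableAt_hurwitzZeta (a : UnitAddCircle) hne).continuousAt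
  have h2 : ContinuousAt (fun t : ℝ => (σ : ℂ) + t * I) t := by fun_prop
  exact ((ContinuousAt.comp (f := fun t : ℝ =>
      (σ : ℂ) + t * I) h1 h2).norm.pow 2).continuousWithinAt

lemma integral_div_rpow {c r T : ℝ} (hc : 0 < c) (hr : 0 ≤ r) (hT : 1 ≤ T) :
    ∫ t in (1 : ℝ)..T, (t / c) ^ r = c ^ (-r) * ((T ^ (r + 1) - 1) / (r + 1)) := by
  have h : Set.EqOn (fun t : ℝ => (t / c) ^ r) (fun t => c ^ (-r) * t ^ r) (Set.uIcc 1 T) := by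
    intro t ht
    rw [Set.uIcc_of_le hT] at ht
    have : 0 ≤ t := by linarith [ht.1]
    simp only [Real.div_rpow this hc.le, Real.rpow_neg hc.le]
    ring
  rw [intervalIntegral.integral_congr h, intervalIntegral.integral_const_mul,
    integral_rpow (Or.inl (by linarith)), Real.one_rpow]

/-- A function which is `O(t ^ (-σ) log t)` has integral `O(T ^ (1 - σ) log T)`. -/
lemma exists_abs_integral_le_of_abs_le {f : ℝ → ℝ} {σ C : ℝ} (hC : 0 < C)
    (h1 : σ < 1) (hf : ∀ T : ℝ, 26 ≤ T → IntervalIntegrable f volume 1 T)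
    (hb : ∀ t : ℝ, 26 ≤ t → |f t| ≤ C * t ^ (-σ) * Real.log t) :
    ∃ C' : ℝ, 0 < C' ∧ ∀ T : ℝ, 26 ≤ T →
      |∫ t in (1 : ℝ)..T, f t| ≤ C' * T ^ (1 - σ) * Real.log T := by
  have hσ : 0 < 1 - σ := by linarith
  refine ⟨|∫ t in (1 : ℝ)..26, f t| + C / (1 - σ), by positivity, fun T hT => ?_⟩
  have hpi4 := Real.pi_le_four
  have hl := one_le_log_of_two_pi_le (T := T) (by linarith)
  have hT0 : 0 < T := by linarith
  have hTp : 1 ≤ T ^ (1 - σ) := Real.one_le_rpow (by linarith) hσ.le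
  have hi := hf T hT
  have hi26 := hf 26 le_rfl
  have hi' : IntervalIntegrable f volume 26 T := hi26.symm.trans hi
  have hr : IntervalIntegrable (fun t : ℝ => C * Real.log T * t ^ (-σ)) volume 26 T :=
    (intervalIntegral.intervalIntegrable_rpow' (by linarith)).const_mul _
  have h2 : |∫ t in (26 : ℝ)..T, f t| ≤ C / (1 - σ) * T ^ (1 - σ) * Real.log T := by
    rw [← Real.norm_eq_abs]
    refine (intervalIntegral.norm_integral_le_of_norm_le hT (ae_of_all _ fun t ht
        => ?_) hr).trans ?_
    · rw [Real.norm_eq_abs]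
      have ht0 : 0 < t := by linarith [ht.1]
      calc |f t| ≤ C * t ^ (-σ) * Real.log t := hb t ht.1.le
        _ ≤ C * t ^ (-σ) * Real.log T := by gcongr; exact ht.2
        _ = _ := by ring
    · rw [intervalIntegral.integral_const_mul, integral_rpow (Or.inl (by linarith)),
        show -σ + 1 = 1 - σ by ring]
      calc C * Real.log T * ((T ^ (1 - σ) - 26 ^ (1 - σ)) / (1 - σ)) ≤
            C * Real.log T * (T ^ (1 - σ) / (1 - σ)) := by
            have : (0 : ℝ) ≤ 26 ^ (1 - σ) := by positivity
            gcongr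
            linarith
        _ = _ := by ring
  rw [← intervalIntegral.integral_add_adjacent_intervals hi26 hi']
  refine (abs_add_le _ _).trans ?_
  have h3 : |∫ t in (1 : ℝ)..26, f t| ≤
      |∫ t in (1 : ℝ)..26, f t| * (T ^ (1 - σ) * Real.log T) :=
    le_mul_of_one_le_right (abs_nonneg _) (one_le_mul_of_one_le_of_one_le hTp hl)
  linarith

theorem exists_abs_meanSquare_sub_le {a σ : ℝ} (ha : 0 < a) (ha1 : a < 1) (h0 : 0 < σ)
    (h1 : σ < 1 / 2) :
    ∃ C : ℝ, 0 < C ∧ ∀ T : ℝ, 26 ≤ T →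
      |(∫ t in (1 : ℝ)..T,
          ‖HurwitzZeta.hurwitzZeta (a : UnitAddCircle) ((σ : ℂ) + t * I)‖ ^ 2) -
        (2 * Real.pi) ^ (2 * σ - 1) / (2 - 2 * σ) *
          (HurwitzZeta.hurwitzZeta ((1 : ℝ) : UnitAddCircle) ((2 * (1 - σ) : ℝ) : ℂ)).re *
          T ^ (2 - 2 * σ) -
        (HurwitzZeta.hurwitzZeta (a : UnitAddCircle) ((2 * σ : ℝ) : ℂ)).re * T| ≤
        C * T ^ (1 - σ) * Real.log T := by
  have hpi4 := Real.pi_le_four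
  have hpi := Real.two_pi_pos
  obtain ⟨CE, hCE, hE⟩ := exists_abs_meanError_le ha ha1 h0 h1
  obtain ⟨C1, hC1, hM1⟩ := (dirichletData_hurwitzZeta ha ha1.le).exists_meanDefect_le h0
    (by linarith : σ < 1)
  obtain ⟨C2, hC2, hM2⟩ := (dirichletData_expZeta ha ha1).exists_weighted_meanDefect_le
    (α := 1 - σ) (p := 1 - 2 * σ) (by linarith) (by linarith) (by linarith)
  obtain ⟨C3, hC3, hM3⟩ := exists_norm_integral_dSum_mul_dSum_le (norm_dualCoeff a) ha ha1 h0.le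
    h1.le
  set Z₁ := (HurwitzZeta.hurwitzZeta (a : UnitAddCircle) ((2 * σ : ℝ) : ℂ)).re with hZ₁
  set Z₂ := (HurwitzZeta.hurwitzZeta ((1 : ℝ) : UnitAddCircle) ((2 * (1 - σ) : ℝ) : ℂ)).re with hZ₂
  set z : ℝ → ℝ := fun t =>
    ‖HurwitzZeta.hurwitzZeta (a : UnitAddCircle) ((σ : ℂ) + t * I)‖ ^ 2 with hz
  set M₁ := meanDefect a (fun _ => 1) (HurwitzZeta.hurwitzZeta (a : UnitAddCircle)) σ with hM₁
  set M₂ := meanDefect 1 (dualCoeff a) (HurwitzZeta.expZeta (a : UnitAddCircle)) (1 - σ) with hM₂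
  set X : ℝ → ℂ := fun t => dSum a (fun _ => 1) σ t *
    ((starRingEnd ℂ) (chiMain σ t) * dSum 1 (dualCoeff a) (1 - σ) t) with hX
  set w : ℝ → ℝ := fun t => (t / (2 * Real.pi)) ^ (1 - 2 * σ) with hw
  set P : ℝ := (2 * Real.pi) ^ (2 * σ - 1) with hP
  have hP0 : 0 < P := by positivity
  have hwe : ∀ t : ℝ, 0 ≤ t → w t = P * t ^ (1 - 2 * σ) := fun t ht => by
    simp only [hw, hP]
    rw [Real.div_rpow ht hpi.le, show 2 * σ - 1 = -(1 - 2 * σ) by ring, Real.rpow_neg hpi.le]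
    ring
  have hpos : ∀ T : ℝ, 26 ≤ T → ∀ t ∈ Set.uIcc 1 T, 0 ≤ t := fun T hT t ht => by
    rw [Set.uIcc_of_le (by linarith)] at ht
    linarith [ht.1]
  have iz : ∀ T : ℝ, 26 ≤ T → IntervalIntegrable z volume 1 T := fun T hT =>
    intervalIntegrable_norm_hurwitzZeta_sq a σ T (by linarith)
  have iw : ∀ T : ℝ, 26 ≤ T → IntervalIntegrable w volume 1 T := fun T hT => by
    refine ContinuousOn.intervalIntegrable (Continuous.continuousOn ?_)
    exact (continuous_id.div_const _).rpow_const fun t => Or.inr (by linarith)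
  have i1 : ∀ T : ℝ, 26 ≤ T → IntervalIntegrable M₁ volume 1 T := fun T hT =>
    (hM1 T (by linarith)).1
  have e2 : ∀ T : ℝ, 26 ≤ T → Set.EqOn (fun t => P * (t ^ (1 - 2 * σ) * M₂ t))
      (fun t => w t * M₂ t) (Set.uIcc 1 T) := fun T hT t ht => by
    simp only [hwe t (hpos T hT t ht)]; ring
  have i2 : ∀ T : ℝ, 26 ≤ T → IntervalIntegrable (fun t => w t * M₂ t) volume 1 T := fun T hT =>
    ((hM2 T (by linarith)).1.const_mul P).congr fun t ht => e2 T hT (Set.uIoc_subset_uIcc ht)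
  have i3 : ∀ T : ℝ, 26 ≤ T → IntervalIntegrable (fun t => (X t).re) volume 1 T := fun T hT => by
    have := (hM3 T (by linarith)).1
    rw [intervalIntegrable_iff] at this ⊢
    exact this.re
  have hdef : meanError a σ = fun t => z t - Z₁ - w t * Z₂ - M₁ t - w t * M₂ t + 2 * (X t).re := rfl
  have iE : ∀ T : ℝ, 26 ≤ T → IntervalIntegrable (meanError a σ) volume 1 T := fun T hT => by
    rw [hdef]
    exact (((((iz T hT).sub intervalIntegrable_const).sub ((iw T hT).mul_const _)).sub
      (i1 T hT)).sub (i2 T hT)).add ((i3 T hT).const_mul 2)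
  obtain ⟨C4, hC4, h4⟩ := exists_abs_integral_le_of_abs_le hCE (by linarith) iE hE
  have h22 : 0 < 2 - 2 * σ := by linarith
  refine ⟨C4 + |Z₁| + P / (2 - 2 * σ) * |Z₂| + C1 + P * C2 + 2 * C3, by positivity,
    fun T hT => ?_⟩
  have hT0 : 0 < T := by linarith
  have hl := one_le_log_of_two_pi_le (T := T) (by linarith)
  have hTp : 1 ≤ T ^ (1 - σ) := Real.one_le_rpow (by linarith) (by linarith)
  have b4 := h4 T hT
  have b1 := (hM1 T (by linarith)).2
  have b2 := (hM2 T (by linarith)).2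
  have b3 := (abs_re_le_norm _).trans (hM3 T (by linarith)).2
  rw [show 1 - (1 - σ) + (1 - 2 * σ) = 1 - σ by ring] at b2
  have r3 := reCLM.intervalIntegral_comp_comm (hM3 T (by linarith)).1
  simp only [reCLM_apply] at r3
  rw [← r3] at b3
  have hIw : ∫ t in (1 : ℝ)..T, w t = P * ((T ^ (2 - 2 * σ) - 1) / (2 - 2 * σ)) := by
    rw [hw, integral_div_rpow hpi (by linarith) (by linarith), hP,
      show -(1 - 2 * σ) = 2 * σ - 1 by ring, show 1 - 2 * σ + 1 = 2 - 2 * σ by ring]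
  have hI2 : ∫ t in (1 : ℝ)..T, w t * M₂ t = P * ∫ t in (1 : ℝ)..T, t ^ (1 - 2 * σ) * M₂ t := by
    rw [← intervalIntegral.integral_congr (e2 T hT), intervalIntegral.integral_const_mul]
  have hIE : ∫ t in (1 : ℝ)..T, meanError a σ t = (∫ t in (1 : ℝ)..T, z t) - Z₁ * (T - 1) -
      P * ((T ^ (2 - 2 * σ) - 1) / (2 - 2 * σ)) * Z₂ - (∫ t in (1 : ℝ)..T, M₁ t) -
      P * (∫ t in (1 : ℝ)..T, t ^ (1 - 2 * σ) * M₂ t) + 2 * ∫ t in (1 : ℝ)..T, (X t).re := by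
    rw [hdef]
    have j1 := (iz T hT).sub (intervalIntegrable_const (c := Z₁))
    have j2 := j1.sub ((iw T hT).mul_const Z₂)
    have j3 := j2.sub (i1 T hT)
    have j4 := j3.sub (i2 T hT)
    rw [intervalIntegral.integral_add j4 ((i3 T hT).const_mul 2),
      intervalIntegral.integral_sub j3 (i2 T hT), intervalIntegral.integral_sub j2 (i1 T hT),
      intervalIntegral.integral_sub j1 ((iw T hT).mul_const Z₂),
      intervalIntegral.integral_sub (iz T hT) intervalIntegrable_const,
      intervalIntegral.integral_const_mul, intervalIntegral.integral_mul_const, hIw, hI2,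
      intervalIntegral.integral_const, smul_eq_mul]
    ring
  set E := T ^ (1 - σ) * Real.log T with hEd
  have hE1 : 1 ≤ E := one_le_mul_of_one_le_of_one_le hTp hl
  have hsum : (∫ t in (1 : ℝ)..T, z t) - P / (2 - 2 * σ) * Z₂ * T ^ (2 - 2 * σ) - Z₁ * T =
      (∫ t in (1 : ℝ)..T, meanError a σ t) - Z₁ - P / (2 - 2 * σ) * Z₂ +
      (∫ t in (1 : ℝ)..T, M₁ t) + P * (∫ t in (1 : ℝ)..T, t ^ (1 - 2 * σ) * M₂ t) -
      2 * ∫ t in (1 : ℝ)..T, (X t).re := by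
    rw [hIE]; ring
  rw [hsum]
  have habs : ∀ u v x y s r : ℝ, |u - v - x + y + s - r| ≤ |u| + |v| + |x| + |y| + |s| + |r| := by
    intro u v x y s r
    have k1 := abs_sub (u - v - x + y + s) r
    have k2 := abs_add_three (u - v - x) y s
    have k3 := abs_sub (u - v) x
    have k4 := abs_sub u v
    linarith
  refine (habs _ _ _ _ _ _).trans ?_
  rw [abs_mul (P / (2 - 2 * σ)), abs_of_pos (show 0 < P / (2 - 2 * σ) by positivity), abs_mul P,
    abs_of_pos hP0, abs_mul 2, abs_two]
  have hle : ∀ c : ℝ, 0 ≤ c → c ≤ c * E := fun c hc => le_mul_of_one_le_right hc hE1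
  have l1 := hle |Z₁| (abs_nonneg _)
  have l2 := hle (P / (2 - 2 * σ) * |Z₂|) (by positivity)
  have l3 := mul_le_mul_of_nonneg_left b2 hP0.le
  calc _ ≤ C4 * T ^ (1 - σ) * Real.log T + |Z₁| * E + P / (2 - 2 * σ) * |Z₂| * E +
        C1 * T ^ (1 - σ) * Real.log T + P * (C2 * T ^ (1 - σ) * Real.log T) +
        2 * (C3 * T ^ (1 - σ) * Real.log T) := by gcongr
    _ = _ := by rw [hEd]; ring

theorem stmt6 (a : ℝ) (ha : 0 < a) (ha1 : a < 1) (σ : ℝ) (h1 : 0 < σ) (h2 : σ < 1 / 2) :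
    (fun T : ℝ =>
        ((∫ t in (1 : ℝ)..T, ‖hzeta a (σ + t * I)‖ ^ 2 : ℝ) : ℂ)
        - ((2 * Real.pi : ℝ) : ℂ) ^ ((2 * σ - 1 : ℝ) : ℂ) / ((2 - 2 * σ : ℝ) : ℂ) *
            riemannZeta ((2 - 2 * σ : ℝ) : ℂ) * (T : ℂ) ^ ((2 - 2 * σ : ℝ) : ℂ)
        - hzeta a ((2 * σ : ℝ) : ℂ) * (T : ℂ))
      =O[atTop] fun T : ℝ => T ^ (1 - σ) * Real.log T := by
  obtain ⟨C, _, hC⟩ := exists_abs_meanSquare_sub_le ha ha1 h1 h2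
  have hpi := Real.two_pi_pos
  have hZ₁ : hzeta a ((2 * σ : ℝ) : ℂ) =
      ((HurwitzZeta.hurwitzZeta (a : UnitAddCircle) ((2 * σ : ℝ) : ℂ)).re : ℂ) := by
    rw [hzeta]
    exact Complex.ext rfl
      (by rw [ofReal_im, hurwitzZeta_ofReal_im ha ha1.le (by linarith) (by linarith)])
  have hZ₂ : riemannZeta ((2 - 2 * σ : ℝ) : ℂ) =
      ((HurwitzZeta.hurwitzZeta ((1 : ℝ) : UnitAddCircle) ((2 * (1 - σ) : ℝ) : ℂ)).re : ℂ) := by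
    have h0 : ((1 : ℝ) : UnitAddCircle) = 0 := AddCircle.coe_period 1
    have him := hurwitzZeta_ofReal_im (a := 1) (r := 2 * (1 - σ)) one_pos le_rfl (by linarith)
      (by linarith)
    rw [h0, HurwitzZeta.hurwitzZeta_zero] at him ⊢
    rw [show 2 - 2 * σ = 2 * (1 - σ) by ring]
    exact Complex.ext rfl (by rw [ofReal_im, him])
  refine Asymptotics.IsBigO.of_bound C ?_
  filter_upwards [eventually_ge_atTop 26] with T hT
  have hT0 : 0 < T := by linarith
  have hlog : 0 ≤ Real.log T := Real.log_nonneg (by linarith)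
  rw [hZ₁, hZ₂, ← ofReal_cpow hpi.le, ← ofReal_cpow hT0.le, ← ofReal_div, ← ofReal_mul,
    ← ofReal_mul, ← ofReal_mul, ← ofReal_sub, ← ofReal_sub, norm_real, Real.norm_eq_abs,
    Real.norm_of_nonneg (by positivity), ← mul_assoc]
  exact hC T hT
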